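/- Every graph whose crossing number is at most two is 5-choosable. -/

import Mathlib

open Set

noncomputable section

/-- A drawing of a simple graph in the plane: vertices are mapped to distinct points,
each edge is realized by a simple arc joining the images of its endpoints, arcs do not
pass through vertex points, any two arcs realizing distinct edges meet in at most one
point, and no point of the plane that is not a vertex point lies on three or more arcs. -/
structure Drawing {V : Type} (G : SimpleGraph V) where
  pos : V → ℝ × ℝ
  pos_inj : Function.Injective pos
  arc : ∀ ⦃u v : V⦄, G.Adj u v → Path (pos u) (pos v)
  arc_symm : ∀ ⦃u v : V⦄ (h : G.Adj u v), arc h.symm = (arc h).symm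
  arc_inj : ∀ ⦃u v : V⦄ (h : G.Adj u v), Function.Injective ⇑(arc h)
  arc_vertex : ∀ ⦃u v : V⦄ (h : G.Adj u v) (t : unitInterval) (w : V),
    arc h t = pos w → t = 0 ∨ t = 1
  arc_meet_once : ∀ ⦃u v x y : V⦄ (h₁ : G.Adj u v) (h₂ : G.Adj x y),
    s(u, v) ≠ s(x, y) → (Set.range ⇑(arc h₁) ∩ Set.range ⇑(arc h₂)).Subsingleton
  arc_no_triple : ∀ ⦃u₁ v₁ u₂ v₂ u₃ v₃ : V⦄ (h₁ : G.Adj u₁ v₁) (h₂ : G.Adj u₂ v₂)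
    (h₃ : G.Adj u₃ v₃), s(u₁, v₁) ≠ s(u₂, v₂) → s(u₁, v₁) ≠ s(u₃, v₃) →
    s(u₂, v₂) ≠ s(u₃, v₃) →
    ∀ p ∈ Set.range ⇑(arc h₁) ∩ Set.range ⇑(arc h₂) ∩ Set.range ⇑(arc h₃),
      ∃ w : V, p = pos w

namespace Drawing

variable {V : Type} {G : SimpleGraph V} (D : Drawing G)

/-- The set of points used by the arc of an edge. -/
def arcSet ⦃u v : V⦄ (h : G.Adj u v) : Set (ℝ × ℝ) :=
  Set.range ⇑(D.arc h)

/-- The set of interior points of the arc of an edge. -/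
def arcInterior ⦃u v : V⦄ (h : G.Adj u v) : Set (ℝ × ℝ) :=
  ⇑(D.arc h) '' {t : unitInterval | t ≠ 0 ∧ t ≠ 1}

/-- All points of the plane used by the drawing. -/
def graphSet : Set (ℝ × ℝ) :=
  Set.range D.pos ∪ ⋃ (u : V) (v : V) (h : G.Adj u v), D.arcSet h

/-- A crossing of a drawing: a point interior to the arcs of two distinct edges. -/
def IsCrossing (p : ℝ × ℝ) : Prop :=
  ∃ (u v x y : V) (h₁ : G.Adj u v) (h₂ : G.Adj x y),
    s(u, v) ≠ s(x, y) ∧ p ∈ D.arcInterior h₁ ∧ p ∈ D.arcInterior h₂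

/-- A drawing is plane if it has no crossings. -/
def IsPlane : Prop := ∀ p : ℝ × ℝ, ¬ D.IsCrossing p

/-- The faces of a drawing are the connected components of the complement
of the drawing. -/
def IsFace (f : Set (ℝ × ℝ)) : Prop :=
  ∃ q : ℝ × ℝ, q ∉ D.graphSet ∧ f = connectedComponentIn D.graphSetᶜ q

/-- The outer (unbounded) face of a drawing. -/
def outerFace : Set (ℝ × ℝ) :=
  {p : ℝ × ℝ | p ∉ D.graphSet ∧
    ¬ Bornology.IsBounded (connectedComponentIn D.graphSetᶜ p)}

/-- A vertex lies on the outer face if its point is on the boundary of the outer face. -/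
def OnOuter (v : V) : Prop := D.pos v ∈ frontier D.outerFace

/-- The set of points of the plane used by the drawing of a walk. -/
def walkSet {a b : V} (W : G.Walk a b) : Set (ℝ × ℝ) :=
  D.pos '' {v : V | v ∈ W.support} ∪ ⋃ d ∈ W.darts, D.arcSet d.adj

/-- A closed walk bounds the outer face if the boundary of the outer face is exactly
the drawing of the walk. -/
def BoundsOuter {a : V} (W : G.Walk a a) : Prop :=
  frontier D.outerFace = D.walkSet W

end Drawing

/-- The open region enclosed by a set `S` (typically the drawing of a cycle):
all points outside `S` whose connected component in the complement of `S` is bounded. -/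
def enclosed (S : Set (ℝ × ℝ)) : Set (ℝ × ℝ) :=
  {p : ℝ × ℝ | p ∉ S ∧ Bornology.IsBounded (connectedComponentIn Sᶜ p)}

namespace Drawing

variable {V : Type} {G : SimpleGraph V} (D : Drawing G)

/-- The closed disc bounded by (the drawing of) a closed walk. -/
def closedDisc {a : V} (W : G.Walk a a) : Set (ℝ × ℝ) :=
  D.walkSet W ∪ enclosed (D.walkSet W)

/-- The endpoints of the (two) edges incident with a crossing point `p`. -/
def crossingEnds (p : ℝ × ℝ) : Set V :=
  {w : V | ∃ (z : V) (h : G.Adj w z), p ∈ D.arcInterior h}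

end Drawing

/-- A proper colouring of `G` from the lists `L`. -/
def IsListColoring {V : Type} (G : SimpleGraph V) (L : V → Finset ℕ) (c : V → ℕ) : Prop :=
  (∀ v, c v ∈ L v) ∧ ∀ ⦃u v : V⦄, G.Adj u v → c u ≠ c v

/-- `G` is colourable from the lists `L`. -/
def ListColorable {V : Type} (G : SimpleGraph V) (L : V → Finset ℕ) : Prop :=
  ∃ c : V → ℕ, IsListColoring G L c


open Set
noncomputable section PartA
namespace CN
variable {W : Type} {H : SimpleGraph W}

/-- `S` is nonempty and connected in `H`. -/
def Conn (H : SimpleGraph W) (S : Set W) : Prop :=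
  S.Nonempty ∧ ∀ T ⊆ S, T.Nonempty → (∀ x ∈ T, ∀ y ∈ S, H.Adj x y → y ∈ T) → T = S

/-- `v` has a neighbour in `S`. -/
def Nb (H : SimpleGraph W) (S : Set W) (v : W) : Prop := ∃ s ∈ S, H.Adj v s

/-- Some edge joins `A` and `B`. -/
def Tch (H : SimpleGraph W) (A B : Set W) : Prop := ∃ a ∈ A, Nb H B a

theorem Tch.symm {A B : Set W} (h : Tch H A B) : Tch H B A := by
  obtain ⟨a, ha, b, hb, hab⟩ := h
  exact ⟨b, hb, a, ha, hab.symm⟩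

theorem Conn.singleton (v : W) : Conn H {v} := by
  refine ⟨⟨v, rfl⟩, fun T hT hne _ => ?_⟩
  exact (Set.subset_singleton_iff_eq.1 hT).resolve_left hne.ne_empty

theorem Conn.union {A B : Set W} (hA : Conn H A) (hB : Conn H B) (h : Tch H A B) :
    Conn H (A ∪ B) := by
  refine ⟨hA.1.mono subset_union_left, fun T hT hne hc => ?_⟩
  obtain ⟨a, ha, b, hb, hab⟩ := h
  have key1 : (T ∩ A).Nonempty → A ⊆ T := by
    intro hn
    have := hA.2 (T ∩ A) inter_subset_right hn
      (fun x hx y hy hxy => ⟨hc x hx.1 y (Or.inl hy) hxy, hy⟩)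
    intro z hz
    rw [← this] at hz
    exact hz.1
  have key2 : (T ∩ B).Nonempty → B ⊆ T := by
    intro hn
    have := hB.2 (T ∩ B) inter_subset_right hn
      (fun x hx y hy hxy => ⟨hc x hx.1 y (Or.inr hy) hxy, hy⟩)
    intro z hz
    rw [← this] at hz
    exact hz.1
  have : A ⊆ T ∧ B ⊆ T := by
    obtain ⟨x, hx⟩ := hne
    rcases hT hx with h | h
    · have h1 := key1 ⟨x, hx, h⟩
      exact ⟨h1, key2 ⟨b, hc a (h1 ha) b (Or.inr hb) hab, hb⟩⟩
    · have h1 := key2 ⟨x, hx, h⟩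
      exact ⟨key1 ⟨a, hc b (h1 hb) a (Or.inl ha) hab.symm, ha⟩, h1⟩
  exact subset_antisymm hT (union_subset this.1 this.2)

theorem Conn.union' {A B : Set W} (hA : Conn H A) (hB : Conn H B) (h : (A ∩ B).Nonempty) :
    Conn H (A ∪ B) := by
  refine ⟨hA.1.mono subset_union_left, fun T hT hne hc => ?_⟩
  obtain ⟨a, ha, hb⟩ := h
  have key1 : (T ∩ A).Nonempty → A ⊆ T := by
    intro hn
    have := hA.2 (T ∩ A) inter_subset_right hn
      (fun x hx y hy hxy => ⟨hc x hx.1 y (Or.inl hy) hxy, hy⟩)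
    intro z hz
    rw [← this] at hz
    exact hz.1
  have key2 : (T ∩ B).Nonempty → B ⊆ T := by
    intro hn
    have := hB.2 (T ∩ B) inter_subset_right hn
      (fun x hx y hy hxy => ⟨hc x hx.1 y (Or.inr hy) hxy, hy⟩)
    intro z hz
    rw [← this] at hz
    exact hz.1
  have : A ⊆ T ∧ B ⊆ T := by
    obtain ⟨x, hx⟩ := hne
    rcases hT hx with h | h
    · have h1 := key1 ⟨x, hx, h⟩
      exact ⟨h1, key2 ⟨a, h1 ha, hb⟩⟩
    · have h1 := key2 ⟨x, hx, h⟩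
      exact ⟨key1 ⟨a, h1 hb, ha⟩, h1⟩
  exact subset_antisymm hT (union_subset this.1 this.2)

theorem Conn.insert {A : Set W} {v : W} (hA : Conn H A) (h : Nb H A v) :
    Conn H (insert v A) := by
  rw [Set.insert_eq]
  exact (Conn.singleton v).union hA ⟨v, rfl, h⟩

theorem Conn.mono {H' : SimpleGraph W} {A : Set W} (hA : Conn H A)
    (h : ∀ x ∈ A, ∀ y ∈ A, H.Adj x y → H'.Adj x y) : Conn H' A :=
  ⟨hA.1, fun T hT hne hc => hA.2 T hT hne
    (fun x hx y hy hxy => hc x hx y hy (h x (hT hx) y hy hxy))⟩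

/-- component of `x` in `S` (for `x ∈ S`). -/
def comp (H : SimpleGraph W) (S : Set W) (x : W) : Set W :=
  {y | Relation.ReflTransGen (fun a b => H.Adj a b ∧ b ∈ S) x y}

theorem self_mem_comp (S : Set W) (x : W) : x ∈ comp H S x := Relation.ReflTransGen.refl

theorem comp_sub {S : Set W} {x : W} (hx : x ∈ S) : comp H S x ⊆ S := by
  intro y hy
  induction hy with
  | refl => exact hx
  | tail _ h _ => exact h.2

theorem comp_closed {S : Set W} {x a b : W} (ha : a ∈ comp H S x) (hb : b ∈ S)
    (hab : H.Adj a b) : b ∈ comp H S x := Relation.ReflTransGen.tail ha ⟨hab, hb⟩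

theorem comp_conn (S : Set W) (x : W) : Conn H (comp H S x) := by
  classical
  refine ⟨⟨x, self_mem_comp S x⟩, fun T hT hne hc => subset_antisymm hT ?_⟩
  have hx : ∀ y ∈ comp H S x, y ∈ T → x ∈ T := by
    intro y hy
    induction hy with
    | refl => exact id
    | @tail b c hb h ih =>
      exact fun hc' => ih (hc _ hc' _ hb h.1.symm)
  obtain ⟨y, hy⟩ := hne
  have hxT := hx y (hT hy) hy
  intro z hz
  induction hz with
  | refl => exact hxT
  | @tail b c hb h ih =>
    exact hc _ ih _ (Relation.ReflTransGen.tail hb h) h.1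

theorem Conn.sub_comp {S A : Set W} {x : W} (hA : Conn H A) (hAS : A ⊆ S) {a : W}
    (ha : a ∈ A) (hax : a ∈ comp H S x) : A ⊆ comp H S x := by
  have := hA.2 (A ∩ comp H S x) inter_subset_left ⟨a, ha, hax⟩
    (fun u hu v hv huv => ⟨hv, comp_closed hu.2 (hAS hv) huv⟩)
  intro z hz
  rw [← this] at hz
  exact hz.2

theorem not_conn {S : Set W} (hS : S.Nonempty) (h : ¬ Conn H S) :
    ∃ A ⊆ S, A.Nonempty ∧ (∀ x ∈ A, ∀ y ∈ S, H.Adj x y → y ∈ A) ∧ ∃ z ∈ S, z ∉ A := by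
  by_contra hcon
  push Not at hcon
  exact h ⟨hS, fun T hT hne hc => subset_antisymm hT (fun z hz => hcon T hT hne hc z hz)⟩

/-- combinatorial planarity: no `K₅` or `K₃,₃` minor model. -/
structure Planar (H : SimpleGraph W) : Prop where
  k5 : ∀ B : Fin 5 → Set W, (∀ i, Conn H (B i)) → (∀ i j, i ≠ j → Disjoint (B i) (B j)) →
    ¬ (∀ i j, i ≠ j → Tch H (B i) (B j))
  k33 : ∀ A B : Fin 3 → Set W, (∀ i, Conn H (A i)) → (∀ i, Conn H (B i)) →
    (∀ i j, i ≠ j → Disjoint (A i) (A j)) → (∀ i j, i ≠ j → Disjoint (B i) (B j)) →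
    (∀ i j, Disjoint (A i) (B j)) → ¬ (∀ i j, Tch H (A i) (B j))

theorem Planar.k33' (hP : Planar H) {A1 A2 A3 B1 B2 B3 : Set W}
    (c1 : Conn H A1) (c2 : Conn H A2) (c3 : Conn H A3)
    (e1 : Conn H B1) (e2 : Conn H B2) (e3 : Conn H B3)
    (d12 : Disjoint A1 A2) (d13 : Disjoint A1 A3) (d23 : Disjoint A2 A3)
    (f12 : Disjoint B1 B2) (f13 : Disjoint B1 B3) (f23 : Disjoint B2 B3)
    (g : Disjoint (A1 ∪ A2 ∪ A3) (B1 ∪ B2 ∪ B3))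
    (t11 : Tch H A1 B1) (t12 : Tch H A1 B2) (t13 : Tch H A1 B3)
    (t21 : Tch H A2 B1) (t22 : Tch H A2 B2) (t23 : Tch H A2 B3)
    (t31 : Tch H A3 B1) (t32 : Tch H A3 B2) (t33 : Tch H A3 B3) : False := by
  simp only [Set.disjoint_union_left, Set.disjoint_union_right] at g
  refine hP.k33 ![A1, A2, A3] ![B1, B2, B3] ?_ ?_ ?_ ?_ ?_ ?_
  · intro i; fin_cases i <;> assumption
  · intro i; fin_cases i <;> assumption
  · intro i j hij; fin_cases i <;> fin_cases j <;>
      first | exact absurd rfl hij | assumption | (apply Disjoint.symm; assumption)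
  · intro i j hij; fin_cases i <;> fin_cases j <;>
      first | exact absurd rfl hij | assumption | (apply Disjoint.symm; assumption)
  · intro i j; fin_cases i <;> fin_cases j <;> simp [g]
  · intro i j; fin_cases i <;> fin_cases j <;> assumption

/-- `K₃,₃` with three vertices against three connected sets. -/
theorem Planar.k33v (hP : Planar H) {x y z : W} {A B C : Set W}
    (hA : Conn H A) (hB : Conn H B) (hC : Conn H C)
    (hxy : x ≠ y) (hxz : x ≠ z) (hyz : y ≠ z)
    (hAB : ∀ w ∈ A, w ∉ B) (hAC : ∀ w ∈ A, w ∉ C) (hBC : ∀ w ∈ B, w ∉ C)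
    (xA : x ∉ A) (xB : x ∉ B) (xC : x ∉ C)
    (yA : y ∉ A) (yB : y ∉ B) (yC : y ∉ C)
    (zA : z ∉ A) (zB : z ∉ B) (zC : z ∉ C)
    (xA' : Nb H A x) (xB' : Nb H B x) (xC' : Nb H C x)
    (yA' : Nb H A y) (yB' : Nb H B y) (yC' : Nb H C y)
    (zA' : Nb H A z) (zB' : Nb H B z) (zC' : Nb H C z) : False := by
  refine hP.k33' (Conn.singleton x) (Conn.singleton y) (Conn.singleton z) hA hB hC
    (by simpa using hxy) (by simpa using hxz) (by simpa using hyz)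
    (Set.disjoint_left.2 hAB) (Set.disjoint_left.2 hAC) (Set.disjoint_left.2 hBC) ?_
    ⟨x, rfl, xA'⟩ ⟨x, rfl, xB'⟩ ⟨x, rfl, xC'⟩ ⟨y, rfl, yA'⟩ ⟨y, rfl, yB'⟩ ⟨y, rfl, yC'⟩
    ⟨z, rfl, zA'⟩ ⟨z, rfl, zB'⟩ ⟨z, rfl, zC'⟩
  rw [Set.disjoint_left]
  simp
  grind

/-- `K₃,₃` with three vertices against two vertices and a connected set. -/
theorem Planar.k33u (hP : Planar H) {x y z u v : W} {C : Set W} (hC : Conn H C)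
    (hxy : x ≠ y) (hxz : x ≠ z) (hyz : y ≠ z) (huv : u ≠ v)
    (xu : H.Adj x u) (yu : H.Adj y u) (zu : H.Adj z u)
    (xv : H.Adj x v) (yv : H.Adj y v) (zv : H.Adj z v)
    (xC : x ∉ C) (yC : y ∉ C) (zC : z ∉ C) (uC : u ∉ C) (vC : v ∉ C)
    (xC' : Nb H C x) (yC' : Nb H C y) (zC' : Nb H C z) : False := by
  refine hP.k33v (Conn.singleton u) (Conn.singleton v) hC hxy hxz hyz (by simpa using huv)
    (by simpa using uC) (by simpa using vC) (by simpa using xu.ne) (by simpa using xv.ne) xC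
    (by simpa using yu.ne) (by simpa using yv.ne) yC
    (by simpa using zu.ne) (by simpa using zv.ne) zC
    ⟨u, rfl, xu⟩ ⟨v, rfl, xv⟩ xC' ⟨u, rfl, yu⟩ ⟨v, rfl, yv⟩ yC' ⟨u, rfl, zu⟩ ⟨v, rfl, zv⟩ zC'

theorem Planar.k5' (hP : Planar H) {A B C D E : Set W}
    (cA : Conn H A) (cB : Conn H B) (cC : Conn H C) (cD : Conn H D) (cE : Conn H E)
    (AB : Disjoint A B) (AC : Disjoint A C) (AD : Disjoint A D) (AE : Disjoint A E)
    (BC : Disjoint B C) (BD : Disjoint B D) (BE : Disjoint B E)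
    (CD : Disjoint C D) (CE : Disjoint C E) (DE : Disjoint D E)
    (AB' : Tch H A B) (AC' : Tch H A C) (AD' : Tch H A D) (AE' : Tch H A E)
    (BC' : Tch H B C) (BD' : Tch H B D) (BE' : Tch H B E)
    (CD' : Tch H C D) (CE' : Tch H C E) (DE' : Tch H D E) : False := by
  refine hP.k5 ![A, B, C, D, E] ?_ ?_ ?_
  · intro i; fin_cases i <;> assumption
  · intro i j hij; fin_cases i <;> fin_cases j <;>
      first | exact absurd rfl hij | assumption | (apply Disjoint.symm; assumption)
  · intro i j hij; fin_cases i <;> fin_cases j <;>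
      first | exact absurd rfl hij | assumption | (apply Tch.symm; assumption)

end CN
end PartA

open Set
noncomputable section PartB
namespace CN
variable {W : Type} {H : SimpleGraph W}

/-- If no clique of size two at `v` separates, three neighbours of `v` on the boundary are
impossible. -/
theorem deg_lemma (hP : Planar H) {S U : Set W} (hS : Conn H S) (hUS : ∀ u ∈ U, u ∉ S)
    {v w1 w2 w3 : W} (hv : v ∈ U) (h1 : w1 ∈ U) (h2 : w2 ∈ U) (h3 : w3 ∈ U)
    (h12 : w1 ≠ w2) (h13 : w1 ≠ w3) (h23 : w2 ≠ w3)
    (a1 : H.Adj v w1) (a2 : H.Adj v w2) (a3 : H.Adj v w3)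
    (nv : Nb H S v) (n1 : Nb H S w1) (n2 : Nb H S w2) (n3 : Nb H S w3)
    (c1 : Conn H (U \ {v, w1})) (c2 : Conn H (U \ {v, w2})) (c3 : Conn H (U \ {v, w3})) :
    False := by
  have link : ∀ x y z : W, x ∈ U → y ∈ U → x ≠ y → x ≠ z → y ≠ z → H.Adj v x → H.Adj v y →
      Conn H (U \ {v, z}) → Nb H (comp H (U \ {v, y, z}) x) y := by
    intro x y z hx hy hxy hxz hyz ax ay hc
    by_contra hn
    have hxm : x ∈ U \ {v, y, z} := ⟨hx, by simp [hxy, hxz, ax.ne']⟩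
    have hsub := comp_sub (H := H) hxm
    have := hc.2 (comp H (U \ {v, y, z}) x)
      (fun t ht => ⟨(hsub ht).1, by have := (hsub ht).2; simp at this ⊢; tauto⟩)
      ⟨x, self_mem_comp _ _⟩ (fun s hs t ht hst => by
        by_cases hty : t = y
        · exact absurd ⟨s, hs, hty ▸ hst.symm⟩ hn
        · exact comp_closed hs ⟨ht.1, by have := ht.2; simp at this ⊢; tauto⟩ hst)
    have hy' : y ∈ comp H (U \ {v, y, z}) x := by
      rw [this]; exact ⟨hy, by simp [hyz, ay.ne']⟩
    have := (hsub hy').2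
    simp at this
  set R : Set W := U \ {v, w1, w2, w3} with hR
  set D := comp H (U \ {v, w2, w3}) w1 with hD
  have hDsub : D ⊆ U \ {v, w2, w3} := comp_sub ⟨h1, by simp [h12, h13, a1.ne']⟩
  have hDc : Conn H D := comp_conn _ _
  have hw1D : w1 ∈ D := self_mem_comp _ _
  have D2 : Nb H D w2 := link w1 w2 w3 h1 h2 h12 h13 h23 a1 a2 c3
  have D3 : Nb H D w3 := by
    have := link w1 w3 w2 h1 h3 h13 h12 h23.symm a1 a3 c2
    rwa [Set.pair_comm w3 w2] at this
  -- final K5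
  have fin : ∀ C : Set W, Conn H C → C ⊆ U → v ∉ C → w2 ∈ C → w3 ∉ C → (∀ x ∈ C, x ∉ D) →
      Nb H C w3 → False := by
    intro C hC hCU hvC h2C h3C hCD hn3
    refine hP.k5' hS (Conn.singleton v) hDc hC (Conn.singleton w3) ?_ ?_ ?_ ?_ ?_ ?_ ?_ ?_ ?_ ?_
      (Tch.symm ⟨v, rfl, nv⟩) (Tch.symm ⟨w1, hw1D, n1⟩) (Tch.symm ⟨w2, h2C, n2⟩)
      (Tch.symm ⟨w3, rfl, n3⟩) ⟨v, rfl, w1, hw1D, a1⟩ ⟨v, rfl, w2, h2C, a2⟩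
      ⟨v, rfl, w3, rfl, a3⟩ (Tch.symm ⟨w2, h2C, D2⟩) (Tch.symm ⟨w3, rfl, D3⟩)
      (Tch.symm ⟨w3, rfl, hn3⟩)
    · simpa using hUS v hv
    · exact Set.disjoint_right.2 fun x hx => hUS x (hDsub hx).1
    · exact Set.disjoint_right.2 fun x hx => hUS x (hCU hx)
    · simpa using hUS w3 h3
    · simp; intro h; have := (hDsub h).2; simp at this
    · simpa using hvC
    · simpa using a3.ne
    · exact Set.disjoint_right.2 hCD
    · simp; intro h; have := (hDsub h).2; simp at this
    · simpa using h3C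
  by_cases h23' : H.Adj w2 w3
  · refine fin {w2} (Conn.singleton _) (by simpa using h2) (by simpa using a2.ne) rfl
      (by simpa using h23.symm) ?_ ⟨w2, rfl, h23'.symm⟩
    rintro x rfl h; have := (hDsub h).2; simp at this
  set E := comp H (U \ {v, w3, w1}) w2 with hE
  have hEsub : E ⊆ U \ {v, w3, w1} := comp_sub ⟨h2, by simp [h12.symm, h23, a2.ne']⟩
  obtain ⟨x, hxE, hx⟩ := link w2 w3 w1 h2 h3 h23 h12.symm h13.symm a2 a3 c1
  have hx2 : x ≠ w2 := by rintro rfl; exact h23' hx.symm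
  have hxR : x ∈ R := by
    have := hEsub hxE
    simp [hR] at this ⊢; tauto
  set C := comp H R x with hC
  have hCsub : C ⊆ R := comp_sub hxR
  have hCE : C ⊆ E := by
    refine (comp_conn R x).sub_comp (fun t ht => ?_) (self_mem_comp _ _) hxE
    have := hCsub ht
    simp [hR] at this ⊢; tauto
  have hC3 : Nb H C w3 := ⟨x, self_mem_comp _ _, hx⟩
  have hC2 : Nb H C w2 := by
    by_contra hn
    have := (comp_conn (H := H) (U \ {v, w3, w1}) w2).2 C hCE ⟨x, self_mem_comp _ _⟩
      (fun s hs t ht hst => by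
        by_cases ht2 : t = w2
        · exact absurd ⟨s, hs, ht2 ▸ hst.symm⟩ hn
        · refine comp_closed hs ?_ hst
          have := hEsub ht
          simp [hR] at this ⊢; tauto)
    have h2C : w2 ∈ C := by rw [this]; exact self_mem_comp _ _
    have := hCsub h2C
    simp [hR] at this
  have hvC : v ∉ C := fun h => by have := hCsub h; simp [hR] at this
  have hw1C : w1 ∉ C := fun h => by have := hCsub h; simp [hR] at this
  have hw2C : w2 ∉ C := fun h => by have := hCsub h; simp [hR] at this
  have hw3C : w3 ∉ C := fun h => by have := hCsub h; simp [hR] at this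
  by_cases hC1 : Nb H C w1
  · refine hP.k33v hS (Conn.singleton v) (comp_conn R x) h12 h13 h23 ?_ ?_ ?_ (hUS _ h1)
      (by simpa using a1.ne') hw1C (hUS _ h2) (by simpa using a2.ne') hw2C (hUS _ h3)
      (by simpa using a3.ne') hw3C n1 ⟨v, rfl, a1.symm⟩ hC1 n2 ⟨v, rfl, a2.symm⟩ hC2
      n3 ⟨v, rfl, a3.symm⟩ hC3
    · intro w hw hwv
      rw [Set.mem_singleton_iff] at hwv
      exact hUS v hv (hwv ▸ hw)
    · intro w hw hwC; exact hUS w (hCsub hwC).1 hw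
    · rintro w rfl; exact hvC
  · refine fin (insert w2 C) ((comp_conn R x).insert hC2) ?_ ?_ (Set.mem_insert _ _) ?_ ?_ ?_
    · rintro t (rfl | ht)
      · exact h2
      · exact (hCsub ht).1
    · simp [a2.ne, hvC]
    · simp [h23.symm, hw3C]
    · rintro t (rfl | ht) htD
      · have := (hDsub htD).2; simp at this
      · have := hDc.2 (D ∩ C) inter_subset_left ⟨t, htD, ht⟩ (fun a ha b hb hab => by
          refine ⟨hb, ?_⟩
          by_cases hb1 : b = w1
          · exact absurd ⟨a, ha.2, hb1 ▸ hab.symm⟩ hC1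
          · refine comp_closed ha.2 ?_ hab
            have := hDsub hb
            simp [hR] at this ⊢; tauto)
        have h' : w1 ∈ D ∩ C := by rw [this]; exact hw1D
        exact hw1C h'.2
    · exact ⟨x, Or.inr (self_mem_comp _ _), hx⟩
end CN
end PartB

open Set
noncomputable section PartC
namespace CN
variable {W : Type} {H : SimpleGraph W}

/-- a colouring of `U` extending `φ` on `T`, from the lists `L` off `T`. -/
def ThGoal (H : SimpleGraph W) (U T : Finset W) (φ : W → ℕ) (L : W → Finset ℕ) : Prop :=
  ∃ c : W → ℕ, (∀ t ∈ T, c t = φ t) ∧ (∀ v ∈ U, v ∉ T → c v ∈ L v) ∧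
    ∀ u ∈ U, ∀ v ∈ U, H.Adj u v → ¬ (u ∈ T ∧ v ∈ T) → c u ≠ c v

theorem pick1 {A B : Finset ℕ} (h : B.card < A.card) : ∃ a ∈ A, a ∉ B :=
  Finset.exists_mem_notMem_of_card_lt_card h

theorem card2 (a b : ℕ) : ({a, b} : Finset ℕ).card ≤ 2 := Finset.card_le_two
theorem card3 (a b c : ℕ) : ({a, b, c} : Finset ℕ).card ≤ 3 := Finset.card_le_three
theorem card4 (a b c d : ℕ) : ({a, b, c, d} : Finset ℕ).card ≤ 4 := Finset.card_le_four

open Classical in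
set_option maxHeartbeats 4000000 in
theorem thomassen (hP : Planar H) : ∀ n : ℕ, ∀ (U : Finset W), U.card = n →
    ∀ (S : Set W), Conn H S → (∀ v ∈ U, v ∉ S) → ∀ (T : Finset W) (φ : W → ℕ) (L : W → Finset ℕ),
    T ⊆ U → T.card ≤ 2 → (∀ t ∈ T, Nb H S t) → (∀ s ∈ T, ∀ t ∈ T, s ≠ t → H.Adj s t) →
    (∀ v ∈ U, v ∉ T → Nb H S v → 3 ≤ (L v).card) →
    (∀ v ∈ U, ¬ Nb H S v → 5 ≤ (L v).card) → ThGoal H U T φ L := by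
  intro n
  induction n using Nat.strong_induction_on with
  | _ n ih =>
  intro U hn S hS hUS T φ L hTU hT2 hTN hTcl hL3 hL5
  -- version with `T` nonempty
  have main : ∀ (S : Set W), Conn H S → (∀ v ∈ U, v ∉ S) → ∀ (T : Finset W) (φ : W → ℕ),
    T ⊆ U → T.card ≤ 2 → T.Nonempty → (∀ t ∈ T, Nb H S t) →
    (∀ s ∈ T, ∀ t ∈ T, s ≠ t → H.Adj s t) →
    (∀ v ∈ U, v ∉ T → Nb H S v → 3 ≤ (L v).card) →
    (∀ v ∈ U, ¬ Nb H S v → 5 ≤ (L v).card) → ThGoal H U T φ L := by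
    clear hS hUS hTU hT2 hTN hTcl hL3 hL5
    clear S T φ
    intro S hS hUS T φ hTU hT2 hTne hTN hTcl hL3 hL5
    -- splitting
    by_cases hsplit : ∃ sep : Finset W, sep ⊆ U ∧ sep.card ≤ 2 ∧ (∀ t ∈ sep, Nb H S t) ∧
        (∀ s ∈ sep, ∀ t ∈ sep, s ≠ t → H.Adj s t) ∧ (∃ x ∈ U, x ∉ sep) ∧
        ¬ Conn H ((U : Set W) \ sep)
    · obtain ⟨sep, hsU, hs2, hsN, hscl, ⟨x0, hx0, hx0s⟩, hnc⟩ := hsplit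
      obtain ⟨A0, hA0, ⟨a0, ha0⟩, hA0c, z0, hz0, hz0A⟩ := not_conn ⟨x0, by simpa using ⟨hx0, hx0s⟩⟩ hnc
      -- two sides
      obtain ⟨A, B, hAB, hAne, hBne, hdisj, hnoAB, hTA⟩ : ∃ A B : Finset W,
          (∀ x, x ∈ U ↔ x ∈ A ∨ x ∈ B ∨ x ∈ sep) ∧ A.Nonempty ∧ B.Nonempty ∧
          (∀ x, (x ∈ A → x ∉ B ∧ x ∉ sep) ∧ (x ∈ B → x ∉ sep)) ∧
          (∀ a ∈ A, ∀ b ∈ B, ¬ H.Adj a b) ∧ (∀ t ∈ T, t ∈ A ∨ t ∈ sep) := by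
        have hA0' : ∀ x ∈ A0, x ∈ U ∧ x ∉ sep := fun x hx => by simpa using hA0 hx
        have hz0' : z0 ∈ U ∧ z0 ∉ sep := by simpa using hz0
        by_cases hT : ∃ t ∈ T, t ∈ A0
        · obtain ⟨t, ht, htA⟩ := hT
          refine ⟨U.filter (· ∈ A0), U.filter (fun x => x ∉ A0 ∧ x ∉ sep), ?_, ⟨a0, ?_⟩, ⟨z0, ?_⟩,
            ?_, ?_, ?_⟩
          · intro x; simp only [Finset.mem_filter]; have := @hsU x; tauto
          · simp only [Finset.mem_filter]; exact ⟨(hA0' _ ha0).1, ha0⟩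
          · simp only [Finset.mem_filter]; tauto
          · intro x; simp only [Finset.mem_filter]; have := hA0' x; tauto
          · intro a ha b hb hab
            simp only [Finset.mem_filter] at ha hb
            exact hb.2.1 (hA0c a ha.2 b (by simpa using ⟨hb.1, hb.2.2⟩) hab)
          · intro t' ht'
            simp only [Finset.mem_filter]
            by_contra hcon
            have h1 : t' ∉ A0 := fun h => hcon (Or.inl ⟨hTU ht', h⟩)
            have h2 : t' ∉ sep := fun h => hcon (Or.inr h)
            have hne : t ≠ t' := fun h => h1 (h ▸ htA)
            exact h1 (hA0c t htA t' (by simpa using ⟨hTU ht', h2⟩) (hTcl t ht t' ht' hne))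
        · push Not at hT
          refine ⟨U.filter (fun x => x ∉ A0 ∧ x ∉ sep), U.filter (· ∈ A0), ?_, ⟨z0, ?_⟩, ⟨a0, ?_⟩,
            ?_, ?_, ?_⟩
          · intro x; simp only [Finset.mem_filter]; have := @hsU x; tauto
          · simp only [Finset.mem_filter]; tauto
          · simp only [Finset.mem_filter]; exact ⟨(hA0' _ ha0).1, ha0⟩
          · intro x; simp only [Finset.mem_filter]; have := hA0' x; tauto
          · intro a ha b hb hab
            simp only [Finset.mem_filter] at ha hb
            exact ha.2.1 (hA0c b hb.2 a (by simpa using ⟨ha.1, ha.2.2⟩) hab.symm)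
          · intro t ht
            have := hT t ht
            have := hTU ht
            simp only [Finset.mem_filter]; tauto
      have hsub1 : A ∪ sep ⊆ U := fun x hx => by
        rw [hAB]; simp only [Finset.mem_union] at hx; tauto
      have hsub2 : B ∪ sep ⊆ U := fun x hx => by
        rw [hAB]; simp only [Finset.mem_union] at hx; tauto
      have hc1 : (A ∪ sep).card < n := by
        rw [← hn]; apply Finset.card_lt_card
        refine ⟨hsub1, fun h => ?_⟩
        obtain ⟨b, hb⟩ := hBne
        have := h (hsub2 (Finset.mem_union_left _ hb))
        simp only [Finset.mem_union] at this
        have := hdisj b; tauto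
      have hc2 : (B ∪ sep).card < n := by
        rw [← hn]; apply Finset.card_lt_card
        refine ⟨hsub2, fun h => ?_⟩
        obtain ⟨b, hb⟩ := hAne
        have := h (hsub1 (Finset.mem_union_left _ hb))
        simp only [Finset.mem_union] at this
        have := hdisj b; tauto
      obtain ⟨c, hc, hcL, hcp⟩ := ih _ hc1 (A ∪ sep) rfl S hS (fun v hv => hUS v (hsub1 hv)) T φ L
        (fun t ht => by simp only [Finset.mem_union]; exact hTA t ht) hT2 hTN hTcl
        (fun v hv => hL3 v (hsub1 hv)) (fun v hv => hL5 v (hsub1 hv))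
      obtain ⟨c', hc', hcL', hcp'⟩ := ih _ hc2 (B ∪ sep) rfl S hS (fun v hv => hUS v (hsub2 hv))
        sep c L (fun t ht => Finset.mem_union_right _ ht) hs2 hsN hscl
        (fun v hv hvs => hL3 v (hsub2 hv) (fun hvT => by
          simp only [Finset.mem_union] at hv
          have := hTA v hvT; have := hdisj v; tauto)) (fun v hv => hL5 v (hsub2 hv))
      refine ⟨fun v => if v ∈ B then c' v else c v, ?_, ?_, ?_⟩
      · intro t ht
        have : t ∉ B := by have := hTA t ht; have := hdisj t; tauto
        simp only [this, if_false]; exact hc t ht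
      · intro v hv hvT
        by_cases hvB : v ∈ B
        · simp only [hvB, if_true]
          exact hcL' v (Finset.mem_union_left _ hvB) ((hdisj v).2 hvB)
        · simp only [hvB, if_false]
          refine hcL v ?_ hvT
          have := (hAB v).1 hv
          simp only [Finset.mem_union]; tauto
      · intro u hu v hv huv hT'
        have hu' := (hAB u).1 hu
        have hv' := (hAB v).1 hv
        by_cases huB : u ∈ B <;> by_cases hvB : v ∈ B <;> simp only [huB, hvB, if_true, if_false]
        · exact hcp' u (Finset.mem_union_left _ huB) v (Finset.mem_union_left _ hvB) huv
            (fun h => (hdisj u).2 huB h.1)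
        · have hvs : v ∈ sep := by
            rcases hv' with h | h | h
            · exact absurd huv.symm (hnoAB v h u huB)
            · exact absurd h hvB
            · exact h
          rw [← hc' v hvs]
          exact hcp' u (Finset.mem_union_left _ huB) v (Finset.mem_union_right _ hvs) huv
            (fun h => (hdisj u).2 huB h.1)
        · have hus : u ∈ sep := by
            rcases hu' with h | h | h
            · exact absurd huv (hnoAB u h v hvB)
            · exact absurd h huB
            · exact h
          rw [← hc' u hus]
          exact hcp' u (Finset.mem_union_right _ hus) v (Finset.mem_union_left _ hvB) huv
            (fun h => (hdisj v).2 hvB h.2)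
        · refine hcp u ?_ v ?_ huv hT' <;> simp only [Finset.mem_union] <;> tauto
    have hNS : ∀ sep : Finset W, sep ⊆ U → sep.card ≤ 2 → (∀ t ∈ sep, Nb H S t) →
        (∀ s ∈ sep, ∀ t ∈ sep, s ≠ t → H.Adj s t) → (∃ x ∈ U, x ∉ sep) →
        Conn H ((U : Set W) \ sep) := by
      intro sep h1 h2 h3 h4 h5
      by_contra h6
      exact hsplit ⟨sep, h1, h2, h3, h4, h5, h6⟩
    clear hsplit
    have hdeg : ∀ v ∈ U, Nb H S v → ∀ w1 ∈ U, ∀ w2 ∈ U, ∀ w3 ∈ U, Nb H S w1 → Nb H S w2 →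
        Nb H S w3 → H.Adj v w1 → H.Adj v w2 → H.Adj v w3 →
        w1 = w2 ∨ w1 = w3 ∨ w2 = w3 := by
      intro v hv nv w1 h1 w2 h2 w3 h3 n1 n2 n3 a1 a2 a3
      by_contra hcon
      push Not at hcon
      obtain ⟨h12, h13, h23⟩ := hcon
      have key : ∀ w x, w ∈ U → Nb H S w → H.Adj v w → x ∈ U → x ≠ v → x ≠ w →
          Conn H ((U : Set W) \ {v, w}) := by
        intro w x hw nw aw hx hxv hxw
        have := hNS {v, w} (by intro t; simp; rintro (rfl | rfl) <;> assumption)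
          Finset.card_le_two (by intro t; simp; rintro (rfl | rfl) <;> assumption)
          (by intro s hs t ht hst
              simp at hs ht
              rcases hs with rfl | rfl <;> rcases ht with rfl | rfl <;>
                first | exact absurd rfl hst | exact aw | exact aw.symm)
          ⟨x, hx, by simp [hxv, hxw]⟩
        simpa using this
      exact deg_lemma hP hS (U := (U : Set W)) hUS hv h1 h2 h3 h12 h13 h23 a1 a2 a3 nv n1 n2 n3
        (key w1 w2 h1 n1 a1 h2 a2.ne' h12.symm) (key w2 w3 h2 n2 a2 h3 a3.ne' h23.symm)
        (key w3 w1 h3 n3 a3 h1 a1.ne' h13)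
    by_cases ha : ∃ v ∈ U, v ∉ T ∧ Nb H S v ∧ ∃ t ∈ T, H.Adj v t
    · by_cases hb : ∃ v ∈ U, v ∉ T ∧ Nb H S v ∧ ∃ y ∈ T, ∃ z ∈ T, y ≠ z ∧ H.Adj v y ∧ H.Adj v z
      · -- case (b-ii)
        obtain ⟨v, hvU, hvT, nv, y, hy, z, hz, hyz, vy, vz⟩ := hb
        have hyzA : H.Adj y z := hTcl y hy z hz hyz
        have hTeq : T = {y, z} := by
          symm; apply Finset.eq_of_subset_of_card_le
          · intro t; simp; rintro (rfl | rfl) <;> assumption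
          · rw [Finset.card_pair hyz]; exact hT2
        obtain ⟨α, hα, hα'⟩ := pick1 (lt_of_le_of_lt (card2 (φ y) (φ z)) (hL3 v hvU hvT nv))
        have hyU := hTU hy
        have hzU := hTU hz
        have ny := hTN y hy
        have nz := hTN z hz
        set ψ : W → ℕ := fun w => if w = v then α else φ w with hψ
        have ψv : ψ v = α := by simp [hψ]
        have ψy : ψ y = φ y := by simp [hψ, vy.ne']
        have ψz : ψ z = φ z := by simp [hψ, vz.ne']
        have hSc : Conn H (insert v (insert y (insert z S))) := by
          refine Conn.insert (Conn.insert (hS.insert nz) ?_) ?_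
          · exact ⟨z, Or.inl rfl, hyzA⟩
          · exact ⟨y, Or.inl rfl, vy⟩
        set S' := insert v (insert y (insert z S)) with hS'
        have hU'U : ∀ u, u ∈ U \ {v, y, z} ↔ u ∈ U ∧ u ≠ v ∧ u ≠ y ∧ u ≠ z := by
          intro u; simp
        have hNold : ∀ u ∈ U \ {v, y, z}, Nb H S u → ¬ H.Adj u v ∧ ¬ H.Adj u y ∧ ¬ H.Adj u z := by
          intro u hu nu
          obtain ⟨huU, h1, h2, h3⟩ := (hU'U u).1 hu
          refine ⟨fun h => ?_, fun h => ?_, fun h => ?_⟩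
          · have := hdeg v hvU nv u huU y hyU z hzU nu ny nz h.symm vy vz; tauto
          · have := hdeg y hyU ny u huU v hvU z hzU nu nv nz h.symm vy.symm hyzA
            have := vz.ne; tauto
          · have := hdeg z hzU nz u huU v hvU y hyU nu nv ny h.symm vz.symm hyzA.symm
            have := vy.ne; tauto
        have huniq : ∀ u ∈ U \ {v, y, z}, ∀ u' ∈ U \ {v, y, z},
            H.Adj u v ∧ H.Adj u y ∧ H.Adj u z → H.Adj u' v ∧ H.Adj u' y ∧ H.Adj u' z → u = u' := by
          intro u hu u' hu' h h'
          by_contra hne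
          refine hP.k33u hS vy.ne vz.ne hyz hne h.1.symm h.2.1.symm h.2.2.symm h'.1.symm h'.2.1.symm
            h'.2.2.symm (hUS _ hvU) (hUS _ hyU) (hUS _ hzU) (hUS _ ((hU'U _).1 hu).1)
            (hUS _ ((hU'U _).1 hu').1) nv ny nz
        set T' : Finset W := (U \ {v, y, z}).filter
          (fun u => H.Adj u v ∧ H.Adj u y ∧ H.Adj u z) with hT'
        have hT'm : ∀ u, u ∈ T' ↔ u ∈ U \ {v, y, z} ∧ H.Adj u v ∧ H.Adj u y ∧ H.Adj u z := by
          intro u; rw [hT', Finset.mem_filter]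
        have hT'1 : ∀ u ∈ T', ∀ u' ∈ T', u = u' := fun u hu u' hu' =>
          huniq u ((hT'm u).1 hu).1 u' ((hT'm u').1 hu').1 ((hT'm u).1 hu).2 ((hT'm u').1 hu').2
        have hex : ∀ u ∈ U, ¬ Nb H S u → ∃ a ∈ L u, a ∉ ({α, φ y, φ z} : Finset ℕ) := fun u hu nu =>
          pick1 (lt_of_le_of_lt (card3 _ _ _) (lt_of_lt_of_le (by norm_num) (hL5 u hu nu)))
        choose! χ hχ1 hχ2 using hex
        have hT'N : ∀ u ∈ T', u ∈ U ∧ ¬ Nb H S u := by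
          intro u hu
          have hu' := (hT'm u).1 hu
          exact ⟨((hU'U u).1 hu'.1).1, fun nu => (hNold u hu'.1 nu).1 hu'.2.1⟩
        have hcard : (U \ {v, y, z}).card < n := by
          rw [← hn]; apply Finset.card_lt_card
          exact ⟨Finset.sdiff_subset, fun h => by simpa using h hvU⟩
        set L' : W → Finset ℕ := fun u => L u \ Finset.image ψ (({v, y, z} : Finset W).filter
          (fun s => H.Adj u s)) with hL'
        obtain ⟨c, hc, hcL, hcp⟩ := ih _ hcard (U \ {v, y, z}) rfl S' hSc
          (fun u hu => by
            have := (hU'U u).1 hu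
            have := hUS u this.1
            simp [hS']; tauto) T' χ L'
          (fun u hu => ((hT'm u).1 hu).1)
          (le_trans (Finset.card_le_one.2 hT'1) (by norm_num))
          (fun u hu => ⟨v, Or.inl rfl, ((hT'm u).1 hu).2.1⟩)
          (fun s hs t ht hst => absurd (hT'1 s hs t ht) hst)
          (fun u hu huT nu => by
            by_cases hnu : Nb H S u
            · have hno := hNold u hu hnu
              have : L' u = L u := by
                simp only [hL']
                rw [Finset.sdiff_eq_self_iff_disjoint, Finset.disjoint_right]
                intro a ha
                simp only [Finset.mem_image, Finset.mem_filter, Finset.mem_insert,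
                  Finset.mem_singleton] at ha
                obtain ⟨n1, n2, n3⟩ := hno
                obtain ⟨s, ⟨rfl | rfl | rfl, h⟩, -⟩ := ha <;> contradiction
              rw [this]
              refine hL3 u ((hU'U u).1 hu).1 (fun h => ?_) hnu
              rw [hTeq] at h
              have := (hU'U u).1 hu
              simp at h; tauto
            · have h5 := hL5 u ((hU'U u).1 hu).1 hnu
              have hf : (({v, y, z} : Finset W).filter (fun s => H.Adj u s)).card ≤ 2 := by
                by_contra hcon
                have hle := Finset.card_filter_le ({v, y, z} : Finset W) (fun s => H.Adj u s)
                have h3 : ({v, y, z} : Finset W).card ≤ 3 := Finset.card_le_three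
                have heq : ({v, y, z} : Finset W).filter (fun s => H.Adj u s) = {v, y, z} :=
                  Finset.eq_of_subset_of_card_le (Finset.filter_subset _ _) (by omega)
                rw [Finset.filter_eq_self] at heq
                exact huT ((hT'm u).2 ⟨hu, heq v (by simp), heq y (by simp), heq z (by simp)⟩)
              have := Finset.le_card_sdiff (Finset.image ψ (({v, y, z} : Finset W).filter
                (fun s => H.Adj u s))) (L u)
              have h7 := Finset.card_image_le (s := ({v, y, z} : Finset W).filter
                (fun s => H.Adj u s)) (f := ψ)
              simp only [hL']; omega)
          (fun u hu nu => by
            have hno : ∀ s ∈ S', ¬ H.Adj u s := fun s hs h => nu ⟨s, hs, h⟩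
            have h1 := hno v (by simp [hS'])
            have h2 := hno y (by simp [hS'])
            have h3 := hno z (by simp [hS'])
            have : L' u = L u := by
              simp only [hL']
              rw [Finset.sdiff_eq_self_iff_disjoint, Finset.disjoint_right]
              intro a ha
              simp only [Finset.mem_image, Finset.mem_filter, Finset.mem_insert,
                Finset.mem_singleton] at ha
              obtain ⟨s, ⟨rfl | rfl | rfl, h⟩, -⟩ := ha <;> contradiction
            rw [this]
            exact hL5 u ((hU'U u).1 hu).1 (fun ⟨s, hs, h⟩ => hno s (by simp [hS', hs]) h))
        have hout : ∀ u ∈ U \ {v, y, z}, ∀ s ∈ ({v, y, z} : Finset W), H.Adj u s → c u ≠ ψ s := by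
          intro u hu s hs hus
          by_cases huT : u ∈ T'
          · rw [hc u huT]
            have := hχ2 u (hT'N u huT).1 (hT'N u huT).2
            simp at this hs
            rcases hs with rfl | rfl | rfl
            · rw [ψv]; tauto
            · rw [ψy]; tauto
            · rw [ψz]; tauto
          · have := hcL u hu huT
            simp only [hL', Finset.mem_sdiff, Finset.mem_image, Finset.mem_filter] at this
            exact fun h => this.2 ⟨s, ⟨hs, hus⟩, h.symm⟩
        refine ⟨fun u => if u ∈ U \ {v, y, z} then c u else ψ u, ?_, ?_, ?_⟩
        · intro t ht
          rw [hTeq] at ht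
          simp at ht
          rcases ht with rfl | rfl
          · simp [ψy]
          · simp [ψz]
        · intro u hu huT
          by_cases hu' : u ∈ U \ {v, y, z}
          · simp only [hu', if_true]
            by_cases huT' : u ∈ T'
            · rw [hc u huT']; exact hχ1 u (hT'N u huT').1 (hT'N u huT').2
            · exact (Finset.mem_sdiff.1 (hcL u hu' huT')).1
          · simp only [hu', if_false]
            rw [hU'U] at hu'
            have : u = v := by
              rw [hTeq] at huT; simp at huT; tauto
            rw [this, ψv]; exact hα
        · intro a ha b hb hab hT''
          have hmem : ∀ u ∈ U, u ∉ U \ {v, y, z} → u ∈ ({v, y, z} : Finset W) := by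
            intro u hu h; simp at h ⊢; tauto
          by_cases ha' : a ∈ U \ {v, y, z} <;> by_cases hb' : b ∈ U \ {v, y, z} <;>
            simp only [ha', hb', if_true, if_false]
          · exact hcp a ha' b hb' hab (fun h => hab.ne (hT'1 a h.1 b h.2))
          · exact hout a ha' b (hmem b hb hb') hab
          · exact (hout b hb' a (hmem a ha ha') hab.symm).symm
          · have h1 := hmem a ha ha'
            have h2 := hmem b hb hb'
            have hmT : ∀ w ∈ ({v, y, z} : Finset W), w ≠ v → w ∈ T ∧ ψ w ≠ α := by
              intro w hw hwv
              simp only [Finset.mem_insert, Finset.mem_singleton, not_or] at hw hα'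
              rcases hw with h | h | h
              · exact absurd h hwv
              · rw [h, ψy]; exact ⟨hy, Ne.symm hα'.1⟩
              · rw [h, ψz]; exact ⟨hz, Ne.symm hα'.2⟩
            by_cases hav : a = v
            · rw [hav, ψv]
              exact (hmT b h2 (fun h => hab.ne (hav.trans h.symm))).2.symm
            · by_cases hbv : b = v
              · rw [hbv, ψv]; exact (hmT a h1 hav).2
              · exact absurd ⟨(hmT a h1 hav).1, (hmT b h2 hbv).1⟩ hT''
      · -- case (b-good)
        obtain ⟨v, hvU, hvT, nv, t, ht, vt⟩ := ha
        have hvonly : ∀ t' ∈ T, H.Adj v t' → t' = t := by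
          intro t' ht' h
          by_contra hne
          exact hb ⟨v, hvU, hvT, nv, t', ht', t, ht, hne, h, vt⟩
        obtain ⟨α, hα, hα'⟩ := pick1 (A := L v) (B := {φ t}) (by
          have := hL3 v hvU hvT nv; simp; omega)
        obtain ⟨β, hβ, hβ'⟩ := pick1 (lt_of_le_of_lt (card2 (φ t) α) (hL3 v hvU hvT nv))
        have hcard : (U.erase v).card < n := by
          rw [← hn]; exact Finset.card_erase_lt_of_mem hvU
        set L' : W → Finset ℕ := fun u => if Nb H S u ∨ ¬ H.Adj u v then L u else L u \ {α, β}
          with hL'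
        obtain ⟨c, hc, hcL, hcp⟩ := ih _ hcard (U.erase v) rfl (insert v S) (hS.insert nv)
          (fun u hu => by
            rw [Finset.mem_erase] at hu
            have := hUS u hu.2
            simp; tauto) T φ L'
          (fun u hu => by
            rw [Finset.mem_erase]; exact ⟨fun h => hvT (h ▸ hu), hTU hu⟩)
          hT2 (fun u hu => by
            obtain ⟨s, hs, h⟩ := hTN u hu; exact ⟨s, Or.inr hs, h⟩) hTcl
          (fun u hu huT nu => by
            rw [Finset.mem_erase] at hu
            simp only [hL']
            split_ifs with h
            · by_cases hnu : Nb H S u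
              · exact hL3 u hu.2 huT hnu
              · exact le_trans (by norm_num) (hL5 u hu.2 hnu)
            · have h5 := hL5 u hu.2 (fun h' => h (Or.inl h'))
              have h6 := Finset.le_card_sdiff ({α, β} : Finset ℕ) (L u)
              have := card2 α β
              omega)
          (fun u hu nu => by
            rw [Finset.mem_erase] at hu
            have h1 : ¬ H.Adj u v := fun h => nu ⟨v, Or.inl rfl, h⟩
            have h2 : ¬ Nb H S u := fun ⟨s, hs, h⟩ => nu ⟨s, Or.inr hs, h⟩
            simp only [hL', h1]
            simpa using hL5 u hu.2 h2)
        -- pick the colour of v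
        obtain ⟨γ, hγ, hγw⟩ : ∃ γ, (γ = α ∨ γ = β) ∧
            ∀ w ∈ U, Nb H S w → H.Adj v w → w ≠ t → c w ≠ γ := by
          by_cases h : ∃ w ∈ U, Nb H S w ∧ H.Adj v w ∧ w ≠ t ∧ c w = α
          · obtain ⟨w, hw, nw, vw, hwt, hcw⟩ := h
            refine ⟨β, Or.inr rfl, fun w' hw' nw' vw' hwt' => ?_⟩
            have : w = w' := by
              have := hdeg v hvU nv t (hTU ht) w hw w' hw' (hTN t ht) nw nw' vt vw vw'
              grind
            rw [← this, hcw]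
            simp at hβ'; tauto
          · push Not at h
            exact ⟨α, Or.inl rfl, fun w hw nw vw hwt => h w hw nw vw hwt⟩
        have hγL : γ ∈ L v := by rcases hγ with rfl | rfl <;> assumption
        have hγt : γ ≠ φ t := by
          simp at hα' hβ'
          rcases hγ with rfl | rfl <;> tauto
        have hvn : ∀ u ∈ U.erase v, H.Adj v u → c u ≠ γ := by
          intro u hu hvu
          have hu' := Finset.mem_erase.1 hu
          by_cases hut : u = t
          · rw [hut, hc t ht]; exact hγt.symm
          by_cases hnu : Nb H S u
          · exact hγw u hu'.2 hnu hvu hut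
          · have huT : u ∉ T := fun h => hnu (hTN u h)
            have := hcL u hu huT
            simp only [hL', hnu, hvu.symm] at this
            simp at this
            rcases hγ with rfl | rfl <;> tauto
        refine ⟨fun u => if u = v then γ else c u, ?_, ?_, ?_⟩
        · intro s hs
          have : s ≠ v := fun h => hvT (h ▸ hs)
          simp only [this, if_false]; exact hc s hs
        · intro u hu huT
          by_cases huv : u = v
          · simp only [huv, if_true]; exact hγL
          · simp only [huv, if_false]
            have := hcL u (Finset.mem_erase.2 ⟨huv, hu⟩) huT
            simp only [hL'] at this
            split_ifs at this
            · exact this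
            · exact (Finset.mem_sdiff.1 this).1
        · intro a ha b hb hab hT'
          by_cases hav : a = v <;> by_cases hbv : b = v
          · exact absurd (hav.trans hbv.symm) hab.ne
          · simp only [hav, hbv, if_true, if_false]
            exact (hvn b (Finset.mem_erase.2 ⟨hbv, hb⟩) (hav ▸ hab)).symm
          · simp only [hav, hbv, if_true, if_false]
            exact hvn a (Finset.mem_erase.2 ⟨hav, ha⟩) (hbv ▸ hab.symm)
          · simp only [hav, hbv, if_false]
            exact hcp a (Finset.mem_erase.2 ⟨hav, ha⟩) b (Finset.mem_erase.2 ⟨hbv, hb⟩) hab hT'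
    · -- case (a)
      push Not at ha
      have hSc : Conn H (S ∪ T) := by
        have : ∀ T' : Finset W, T' ⊆ T → Conn H (S ∪ T') := by
          intro T'
          induction T' using Finset.induction_on with
          | empty => intro _; simpa using hS
          | insert a s _ ihs =>
            intro h
            have := (ihs (fun x hx => h (Finset.mem_insert_of_mem hx))).insert (v := a) (by
              obtain ⟨s', hs', h'⟩ := hTN a (h (Finset.mem_insert_self _ _))
              exact ⟨s', Or.inl hs', h'⟩)
            rw [Finset.coe_insert, Set.union_insert]; exact this
        exact this T subset_rfl
      have hcard : (U \ T).card < n := by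
        rw [← hn]; apply Finset.card_lt_card
        obtain ⟨t, ht⟩ := hTne
        exact ⟨Finset.sdiff_subset, fun h => by simpa [ht] using h (hTU ht)⟩
      set L' : W → Finset ℕ := fun u => L u \ Finset.image φ (T.filter (fun s => H.Adj u s)) with hL'
      have hsame : ∀ u, (∀ t ∈ T, ¬ H.Adj u t) → L' u = L u := by
        intro u h
        simp only [hL']
        rw [Finset.sdiff_eq_self_iff_disjoint, Finset.disjoint_right]
        intro a ha
        simp at ha
        obtain ⟨s, hs, _⟩ := ha
        exact absurd hs.2 (h s hs.1)
      obtain ⟨c, -, hcL, hcp⟩ := ih _ hcard (U \ T) rfl (S ∪ T) hSc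
        (fun u hu => by
          rw [Finset.mem_sdiff] at hu
          have := hUS u hu.1
          simp; tauto) ∅ φ L' (by simp) (by simp) (by simp) (by simp)
        (fun u hu _ nu => by
          rw [Finset.mem_sdiff] at hu
          by_cases hnu : Nb H S u
          · rw [hsame u (ha u hu.1 hu.2 hnu)]
            exact hL3 u hu.1 hu.2 hnu
          · have h5 := hL5 u hu.1 hnu
            have h6 := Finset.le_card_sdiff (Finset.image φ (T.filter (fun s => H.Adj u s))) (L u)
            have h7 := Finset.card_image_le (s := T.filter (fun s => H.Adj u s)) (f := φ)
            have h8 := Finset.card_filter_le T (fun s => H.Adj u s)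
            simp only [hL']; omega)
        (fun u hu nu => by
          rw [Finset.mem_sdiff] at hu
          rw [hsame u (fun t ht h => nu ⟨t, Or.inr ht, h⟩)]
          exact hL5 u hu.1 (fun ⟨s, hs, h⟩ => nu ⟨s, Or.inl hs, h⟩))
      have hout : ∀ u ∈ U \ T, ∀ t ∈ T, H.Adj u t → c u ≠ φ t := by
        intro u hu t ht hut h
        have := hcL u hu (by simp)
        simp only [hL', Finset.mem_sdiff, Finset.mem_image, Finset.mem_filter] at this
        exact this.2 ⟨t, ⟨ht, hut⟩, h.symm⟩
      refine ⟨fun u => if u ∈ T then φ u else c u, ?_, ?_, ?_⟩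
      · intro t ht; simp [ht]
      · intro u hu huT
        simp only [huT, if_false]
        exact (Finset.mem_sdiff.1 (hcL u (Finset.mem_sdiff.2 ⟨hu, huT⟩) (by simp))).1
      · intro a ha b hb hab hT'
        by_cases haT : a ∈ T <;> by_cases hbT : b ∈ T <;> simp only [haT, hbT, if_true, if_false]
        · tauto
        · exact (hout b (Finset.mem_sdiff.2 ⟨hb, hbT⟩) a haT hab.symm).symm
        · exact hout a (Finset.mem_sdiff.2 ⟨ha, haT⟩) b hbT hab
        · exact hcp a (Finset.mem_sdiff.2 ⟨ha, haT⟩) b (Finset.mem_sdiff.2 ⟨hb, hbT⟩) hab (by simp)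
  rcases T.eq_empty_or_nonempty with hT | hT
  · subst hT
    by_cases hN : ∃ v ∈ U, Nb H S v
    · obtain ⟨v, hv, nv⟩ := hN
      obtain ⟨α, hα, -⟩ := pick1 (A := L v) (B := ∅) (by
        have := hL3 v hv (by simp) nv; rw [Finset.card_empty]; omega)
      obtain ⟨c, hc, hcL, hcp⟩ := main S hS hUS {v} (fun _ => α) (by simpa using hv) (by simp)
        (by simp) (by simpa using nv) (by simp)
        (fun u hu _ nu => hL3 u hu (by simp) nu) hL5
      refine ⟨c, by simp, fun u hu _ => ?_, fun a ha b hb hab _ => hcp a ha b hb hab ?_⟩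
      · by_cases huv : u = v
        · rw [huv, hc v (by simp)]; exact hα
        · exact hcL u hu (by simpa using huv)
      · simp; rintro rfl h; exact hab.ne h.symm
    · push Not at hN
      rcases U.eq_empty_or_nonempty with rfl | ⟨v, hv⟩
      · exact ⟨φ, by simp, by simp, by simp⟩
      obtain ⟨α, hα, -⟩ := pick1 (A := L v) (B := ∅) (by
        have := hL5 v hv (hN v hv); rw [Finset.card_empty]; omega)
      have hcard : (U.erase v).card < n := by
        rw [← hn]; exact Finset.card_erase_lt_of_mem hv
      obtain ⟨c, hc, hcL, hcp⟩ := ih _ hcard (U.erase v) rfl {v} (Conn.singleton v)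
        (fun u hu => by simpa using (Finset.mem_erase.1 hu).1) ∅ φ (fun u => if H.Adj u v then L u \ {α} else L u)
        (by simp) (by simp) (by simp) (by simp)
        (fun u hu _ _ => by
          have := hL5 u (Finset.mem_erase.1 hu).2 (hN u (Finset.mem_erase.1 hu).2)
          have h6 := Finset.le_card_sdiff ({α} : Finset ℕ) (L u)
          rw [Finset.card_singleton] at h6
          split_ifs <;> omega)
        (fun u hu nu => by
          have h1 : ¬ H.Adj u v := fun h => nu ⟨v, rfl, h⟩
          simp only [h1, if_false]
          exact hL5 u (Finset.mem_erase.1 hu).2 (hN u (Finset.mem_erase.1 hu).2))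
      have hvn : ∀ u ∈ U.erase v, H.Adj u v → c u ≠ α := by
        intro u hu huv h
        have := hcL u hu (by simp)
        simp [huv, h] at this
      refine ⟨fun u => if u = v then α else c u, by simp, fun u hu _ => ?_,
        fun a ha b hb hab _ => ?_⟩
      · by_cases huv : u = v
        · simp only [huv, if_true]; exact hα
        · simp only [huv, if_false]
          have := hcL u (Finset.mem_erase.2 ⟨huv, hu⟩) (by simp)
          beta_reduce at this
          split_ifs at this
          · exact (Finset.mem_sdiff.1 this).1
          · exact this
      · by_cases hav : a = v <;> by_cases hbv : b = v
        · exact absurd (hav.trans hbv.symm) hab.ne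
        · simp only [hav, hbv, if_true, if_false]
          exact (hvn b (Finset.mem_erase.2 ⟨hbv, hb⟩) (hav ▸ hab.symm)).symm
        · simp only [hav, hbv, if_true, if_false]
          exact hvn a (Finset.mem_erase.2 ⟨hav, ha⟩) (hbv ▸ hab)
        · simp only [hav, hbv, if_false]
          exact hcp a (Finset.mem_erase.2 ⟨hav, ha⟩) b (Finset.mem_erase.2 ⟨hbv, hb⟩) hab (by simp)
  · exact main S hS hUS T φ hTU hT2 hT hTN hTcl hL3 hL5
end CN
end PartC

open Set
noncomputable section PartD
namespace CN
variable {W : Type} {H : SimpleGraph W}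

/-- `H` restricted to `P`, with a clique added on `Y`. -/
def cut (H : SimpleGraph W) (P Y : Set W) : SimpleGraph W where
  Adj u v := u ≠ v ∧ ((H.Adj u v ∧ u ∈ P ∧ v ∈ P) ∨ (u ∈ Y ∧ v ∈ Y))
  symm := ⟨by rintro u v ⟨h, h'⟩; exact ⟨h.symm, h'.imp (fun h => ⟨h.1.symm, h.2.2, h.2.1⟩) And.symm⟩⟩
  loopless := ⟨fun u h => h.1 rfl⟩

theorem cut_adj {P Y : Set W} {u v : W} : (cut H P Y).Adj u v ↔
    u ≠ v ∧ ((H.Adj u v ∧ u ∈ P ∧ v ∈ P) ∨ (u ∈ Y ∧ v ∈ Y)) := Iff.rfl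

/-- a minor model of pattern `E`. -/
structure Model (H : SimpleGraph W) {ι : Type} (E : ι → ι → Prop) (B : ι → Set W) : Prop where
  conn : ∀ i, Conn H (B i)
  disj : ∀ i j, i ≠ j → Disjoint (B i) (B j)
  tch : ∀ i j, E i j → Tch H (B i) (B j)

/-- pattern of `K₃,₃`. -/
def E33 : Fin 3 ⊕ Fin 3 → Fin 3 ⊕ Fin 3 → Prop
  | .inl _, .inr _ => True
  | .inr _, .inl _ => True
  | _, _ => False

theorem planar_iff : Planar H ↔ (∀ B : Fin 5 → Set W, ¬ Model H (· ≠ ·) B) ∧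
    (∀ B : Fin 3 ⊕ Fin 3 → Set W, ¬ Model H E33 B) := by
  constructor
  · intro h
    refine ⟨fun B hB => h.k5 B hB.conn hB.disj hB.tch, fun B hB => ?_⟩
    refine h.k33 (fun i => B (.inl i)) (fun i => B (.inr i)) (fun i => hB.conn _)
      (fun i => hB.conn _) (fun i j hij => hB.disj _ _ (by simpa using hij))
      (fun i j hij => hB.disj _ _ (by simpa using hij))
      (fun i j => hB.disj _ _ (by simp)) (fun i j => hB.tch _ _ trivial)
  · rintro ⟨h1, h2⟩
    refine ⟨fun B a b c => h1 B ⟨a, b, c⟩, fun A B a b c d e f => h2 (Sum.elim A B) ⟨?_, ?_, ?_⟩⟩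
    · rintro (i | i)
      · exact a i
      · exact b i
    · rintro (i | i) (j | j) hij
      · exact c i j (by simpa using hij)
      · exact e i j
      · exact (e j i).symm
      · exact d i j (by simpa using hij)
    · rintro (i | i) (j | j) hij
      · exact hij.elim
      · exact f i j
      · exact (f j i).symm
      · exact hij.elim

theorem delta_aux {ι : Type} {E : ι → ι → Prop} (hEs : ∀ i j, E i j → E j i)
    (hEir : ∀ i, ¬ E i i) (hEd : ∀ i, ∃ j, E i j)
    {A P : Set W} (hA : Conn H A) (hAP : ∀ a ∈ A, a ∉ P) {x y z : W}
    (hx : x ∈ P) (hy : y ∈ P) (hz : z ∈ P) (nx : Nb H A x) (ny : Nb H A y) (nz : Nb H A z)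
    {B : ι → Set W} (hB : Model (cut H P {x, y, z}) E B) :
    (∃ B' : ι → Set W, Model H E B') ∨
    ∃ i j k, E i j ∧ E i k ∧ E j k ∧ x ∈ B i ∧ y ∈ B j ∧ z ∈ B k ∧
      (∀ l, B l ⊆ P) ∧ (∀ l, Conn H (B l)) ∧
      (∀ l m, E l m → l ≠ i → l ≠ j → l ≠ k → Tch H (B l) (B m)) := by
  classical
  have hX : ∀ u ∈ ({x, y, z} : Set W), u ∈ P ∧ Nb H A u := by
    rintro u (rfl | rfl | rfl) <;> constructor <;> assumption
  set X : Set W := {x, y, z} with hXdef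
  have huniq : ∀ u i j, u ∈ B i → u ∈ B j → i = j := by
    intro u i j hi hj
    by_contra hij
    exact Set.disjoint_left.1 (hB.disj i j hij) hi hj
  have hPB : ∀ l, B l ⊆ P := by
    intro l
    obtain ⟨m, hm⟩ := hEd l
    obtain ⟨a, ha, b, hb, hab⟩ := hB.tch l m hm
    have hcl : ∀ u v, (cut H P X).Adj u v → v ∈ P := by
      rintro u v ⟨_, h | h⟩
      · exact h.2.2
      · exact (hX v h.2).1
    have := (hB.conn l).2 (B l ∩ P) inter_subset_left ⟨a, ha, hcl _ _ hab.symm⟩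
      (fun u hu v hv huv => ⟨hv, hcl _ _ huv⟩)
    rw [← this]; exact inter_subset_right
  have hconn1 : ∀ l, (∀ u ∈ X, ∀ v ∈ X, u ∈ B l → v ∈ B l → u = v) → Conn H (B l) := by
    intro l hl
    refine (hB.conn l).mono ?_
    rintro u hu v hv ⟨hne, h | h⟩
    · exact h.1
    · exact absurd (hl u h.1 v h.2 hu hv) hne
  have htch1 : ∀ l m, E l m → ((∀ u ∈ X, u ∉ B l) ∨ (∀ u ∈ X, u ∉ B m)) → Tch H (B l) (B m) := by
    intro l m hlm h
    obtain ⟨a, ha, b, hb, hne, h' | h'⟩ := hB.tch l m hlm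
    · exact ⟨a, ha, b, hb, h'.1⟩
    · rcases h with h | h
      · exact absurd ha (h a h'.1)
      · exact absurd hb (h b h'.2)
  have hBA : ∀ l, Disjoint (B l) A := fun l =>
    Set.disjoint_right.2 fun a ha hal => hAP a ha (hPB l hal)
  have hX3 : ∀ u, u ∈ X ↔ u = x ∨ u = y ∨ u = z := fun u => Iff.rfl
  have tri : (∀ j, ∀ u ∈ X, u ∉ B j) ∨ (∃ i0, (∃ u ∈ X, u ∈ B i0) ∧
      (∀ j, j ≠ i0 → ∀ u ∈ X, ∀ v ∈ X, u ∈ B j → v ∈ B j → u = v) ∧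
      (∀ j k, j ≠ i0 → k ≠ i0 → E j k → (∀ u ∈ X, u ∉ B j) ∨ (∀ u ∈ X, u ∉ B k))) ∨
      (∃ i j k, E i j ∧ E i k ∧ E j k ∧ x ∈ B i ∧ y ∈ B j ∧ z ∈ B k) := by
    have hxx : x ∈ X := (hX3 x).2 (Or.inl rfl)
    have hyy : y ∈ X := (hX3 y).2 (Or.inr (Or.inl rfl))
    have hzz : z ∈ X := (hX3 z).2 (Or.inr (Or.inr rfl))
    have ux := huniq x
    have uy := huniq y
    have uz := huniq z
    clear_value X
    clear hXdef hB hA nx ny nz hX hPB hconn1 htch1 hBA hEd huniq hx hy hz hAP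
    by_cases h1 : ∃ i, x ∈ B i
    · obtain ⟨i, hi⟩ := h1
      by_cases h2 : ∃ j, y ∈ B j
      · obtain ⟨j, hj⟩ := h2
        by_cases h3 : ∃ k, z ∈ B k
        · obtain ⟨k, hk⟩ := h3
          by_cases hjk : j = k
          · right; left; exact ⟨j, ⟨y, hyy, hj⟩, by grind, by grind⟩
          by_cases hik : i = k
          · right; left; exact ⟨i, ⟨x, hxx, hi⟩, by grind, by grind⟩
          by_cases hij : i = j
          · right; left; exact ⟨i, ⟨x, hxx, hi⟩, by grind, by grind⟩
          by_cases e1 : E j k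
          · by_cases e2 : E i k
            · by_cases e3 : E i j
              · exact Or.inr (Or.inr ⟨i, j, k, e3, e2, e1, hi, hj, hk⟩)
              · right; left; exact ⟨k, ⟨z, hzz, hk⟩, by grind, by grind⟩
            · right; left; exact ⟨j, ⟨y, hyy, hj⟩, by grind, by grind⟩
          · right; left; exact ⟨i, ⟨x, hxx, hi⟩, by grind, by grind⟩
        · right; left; exact ⟨i, ⟨x, hxx, hi⟩, by grind, by grind⟩
      · right; left; exact ⟨i, ⟨x, hxx, hi⟩, by grind, by grind⟩
    · by_cases h2 : ∃ j, y ∈ B j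
      · obtain ⟨j, hj⟩ := h2
        right; left; exact ⟨j, ⟨y, hyy, hj⟩, by grind, by grind⟩
      · by_cases h3 : ∃ k, z ∈ B k
        · obtain ⟨k, hk⟩ := h3
          right; left; exact ⟨k, ⟨z, hzz, hk⟩, by grind, by grind⟩
        · left; grind
  rcases tri with h | ⟨i0, ⟨w, hwX, hw⟩, h1, h2⟩ | ⟨i, j, k, eij, eik, ejk, hi, hj, hk⟩
  · left
    exact ⟨B, fun l => hconn1 l (fun u hu v _ hul => absurd hul (h l u hu)), hB.disj,
      fun l m hlm => htch1 l m hlm (Or.inl (h l))⟩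
  · left
    have hc0 : Conn H (B i0 ∪ A) := by
      refine ⟨⟨w, Or.inl hw⟩, fun T hT hne hcl => ?_⟩
      have s1 : (T ∩ A).Nonempty → T = B i0 ∪ A := by
        rintro ⟨a, haT, haA⟩
        have hAT : A ⊆ T := by
          have := hA.2 (T ∩ A) inter_subset_right ⟨a, haT, haA⟩
            (fun u hu v hv huv => ⟨hcl u hu.1 v (Or.inr hv) huv, hv⟩)
          rw [← this]; exact inter_subset_left
        have hXT : ∀ u ∈ X, u ∈ B i0 → u ∈ T := by
          intro u hu hu0
          obtain ⟨s, hs, hus⟩ := (hX u hu).2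
          exact hcl s (hAT hs) u (Or.inl hu0) hus.symm
        have hBT : B i0 ⊆ T := by
          have := (hB.conn i0).2 (T ∩ B i0) inter_subset_right ⟨w, hXT w hwX hw, hw⟩
            (by
              rintro u hu v hv ⟨hne, h | h⟩
              · exact ⟨hcl u hu.1 v (Or.inl hv) h.1, hv⟩
              · exact ⟨hXT v h.2 hv, hv⟩)
          rw [← this]; exact inter_subset_left
        exact subset_antisymm hT (union_subset hBT hAT)
      obtain ⟨t, ht⟩ := hne
      rcases hT ht with htB | htA
      · have hXT : ∃ u ∈ X, u ∈ B i0 ∧ u ∈ T := by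
          by_contra hcon
          push Not at hcon
          have := (hB.conn i0).2 (T ∩ B i0) inter_subset_right ⟨t, ht, htB⟩
            (by
              rintro u hu v hv ⟨hne, h | h⟩
              · exact ⟨hcl u hu.1 v (Or.inl hv) h.1, hv⟩
              · exact absurd hu.1 (hcon u h.1 hu.2))
          have hwT : w ∈ T ∩ B i0 := by rw [this]; exact hw
          exact hcon w hwX hw hwT.1
        obtain ⟨u, huX, hu0, huT⟩ := hXT
        obtain ⟨s, hs, hus⟩ := (hX u huX).2
        exact s1 ⟨s, hcl u huT s (Or.inr hs) hus, hs⟩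
      · exact s1 ⟨t, ht, htA⟩
    have key : ∀ m, E i0 m → Tch H (B i0 ∪ A) (B m) := by
      intro m hm
      obtain ⟨a, ha, b, hb, hne, h' | h'⟩ := hB.tch i0 m hm
      · exact ⟨a, Or.inl ha, b, hb, h'.1⟩
      · obtain ⟨s, hs, hbs⟩ := (hX b h'.2).2
        exact ⟨s, Or.inr hs, b, hb, hbs.symm⟩
    refine ⟨fun l => if l = i0 then B i0 ∪ A else B l, ?_, ?_, ?_⟩
    · intro l
      by_cases hl : l = i0
      · simp only [hl, if_true]; exact hc0
      · simp only [hl, if_false]; exact hconn1 l (h1 l hl)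
    · intro l m hlm
      by_cases hl : l = i0 <;> by_cases hm : m = i0
      · exact absurd (hl.trans hm.symm) hlm
      · simp only [hl, hm, if_true, if_false, Set.disjoint_union_left]
        exact ⟨hB.disj _ _ (Ne.symm hm), (hBA m).symm⟩
      · simp only [hl, hm, if_true, if_false, Set.disjoint_union_right]
        exact ⟨hB.disj _ _ hl, (hBA l)⟩
      · simp only [hl, hm, if_false]; exact hB.disj _ _ hlm
    · intro l m hlm
      by_cases hl : l = i0 <;> by_cases hm : m = i0
      · rw [hl, hm] at hlm; exact absurd hlm (hEir _)
      · simp only [hl, hm, if_true, if_false]; exact key m (hl ▸ hlm)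
      · simp only [hl, hm, if_true, if_false]
        exact (key l (hm ▸ hEs _ _ hlm)).symm
      · simp only [hl, hm, if_false]; exact htch1 l m hlm (h2 l m hl hm hlm)
  · right
    have nij : i ≠ j := fun h => hEir j (h ▸ eij)
    have nik : i ≠ k := fun h => hEir k (h ▸ eik)
    have njk : j ≠ k := fun h => hEir k (h ▸ ejk)
    have hnx : ∀ l, x ∈ B l → l = i := fun l h => huniq x l i h hi
    have hny : ∀ l, y ∈ B l → l = j := fun l h => huniq y l j h hj
    have hnz : ∀ l, z ∈ B l → l = k := fun l h => huniq z l k h hk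
    refine ⟨i, j, k, eij, eik, ejk, hi, hj, hk, hPB, fun l => hconn1 l ?_, fun l m hlm h1 h2 h3 =>
      htch1 l m hlm (Or.inl ?_)⟩
    · rintro u (rfl | rfl | rfl) v (rfl | rfl | rfl) hu hv <;> grind
    · rintro u (rfl | rfl | rfl) hu
      · exact h1 (hnx l hu)
      · exact h2 (hny l hu)
      · exact h3 (hnz l hu)

theorem Planar.delta (hP : Planar H) {A P : Set W} (hA : Conn H A) (hAP : ∀ a ∈ A, a ∉ P)
    {x y z : W} (hx : x ∈ P) (hy : y ∈ P) (hz : z ∈ P)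
    (nx : Nb H A x) (ny : Nb H A y) (nz : Nb H A z) : Planar (cut H P {x, y, z}) := by
  rw [planar_iff]
  refine ⟨fun B hB => ?_, fun B hB => ?_⟩
  · rcases delta_aux (fun i j h => Ne.symm h) (fun i h => h rfl)
      (fun i => ⟨i + 1, by fin_cases i <;> decide⟩) hA hAP hx hy hz nx ny nz hB with
      ⟨B', hB'⟩ | ⟨i, j, k, hij, hik, hjk, hi, hj, hk, hBP, hBc, ht⟩
    · exact (planar_iff.1 hP).1 B' hB'
    · obtain ⟨l, m, hlm, l1, l2, l3, m1, m2, m3⟩ : ∃ l m : Fin 5, l ≠ m ∧ l ≠ i ∧ l ≠ j ∧ l ≠ k ∧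
          m ≠ i ∧ m ≠ j ∧ m ≠ k := by
        clear hi hj hk ht
        revert i j k; decide
      have hd := hB.disj
      have hAB : ∀ n, Disjoint (B n) A := fun n =>
        Set.disjoint_right.2 fun a ha h => hAP a ha (hBP n h)
      refine hP.k33' (hBc i) (hBc j) (hBc k) hA (hBc l) (hBc m) (hd _ _ hij) (hd _ _ hik)
        (hd _ _ hjk) (hAB l).symm (hAB m).symm (hd _ _ hlm) ?_ ⟨x, hi, nx⟩
        (ht l i l1 l1 l2 l3).symm (ht m i m1 m1 m2 m3).symm
        ⟨y, hj, ny⟩ (ht l j l2 l1 l2 l3).symm (ht m j m2 m1 m2 m3).symm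
        ⟨z, hk, nz⟩ (ht l k l3 l1 l2 l3).symm (ht m k m3 m1 m2 m3).symm
      simp only [Set.disjoint_union_left, Set.disjoint_union_right]
      refine ⟨⟨⟨⟨hAB i, hAB j⟩, hAB k⟩, ⟨hd _ _ l1.symm, hd _ _ l2.symm⟩, hd _ _ l3.symm⟩,
        ⟨hd _ _ m1.symm, hd _ _ m2.symm⟩, hd _ _ m3.symm⟩
  · have hEs : ∀ i j, E33 i j → E33 j i := by rintro (i | i) (j | j) h <;> exact h
    have hEd : ∀ i, ∃ j, E33 i j := by
      rintro (i | i)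
      · exact ⟨.inr 0, trivial⟩
      · exact ⟨.inl 0, trivial⟩
    rcases delta_aux hEs (by rintro (i | i) h <;> exact h)
      hEd hA hAP hx hy hz nx ny nz hB with
      ⟨B', hB'⟩ | ⟨i, j, k, hij, hik, hjk, -⟩
    · exact (planar_iff.1 hP).2 B' hB'
    · rcases i with i | i <;> rcases j with j | j <;> rcases k with k | k <;>
        first | exact hij.elim | exact hik.elim | exact hjk.elim

theorem Conn.sub_nb {S : Set W} (hS : Conn H S) {a : W} (ha : a ∈ S) (h : S ≠ {a}) :
    ∃ b ∈ S, H.Adj a b := by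
  by_contra hcon
  push Not at hcon
  exact h (hS.2 {a} (by simpa using ha) ⟨a, rfl⟩
    (fun x hx y hy hxy => absurd (hx ▸ hxy) (hcon y hy))).symm

/-- Planarity is monotone. -/
theorem Planar.mono {H' : SimpleGraph W} (hP : Planar H) (h : ∀ u v, H'.Adj u v → H.Adj u v) :
    Planar H' := by
  rw [planar_iff] at hP ⊢
  have key : ∀ {ι : Type} (E : ι → ι → Prop) (B : ι → Set W), Model H' E B → Model H E B := by
    intro ι E B hB
    refine ⟨fun i => (hB.conn i).mono (fun x _ y _ => h x y), hB.disj, fun i j hij => ?_⟩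
    obtain ⟨a, ha, b, hb, hab⟩ := hB.tch i j hij
    exact ⟨a, ha, b, hb, h _ _ hab⟩
  exact ⟨fun B hB => hP.1 B (key _ _ hB), fun B hB => hP.2 B (key _ _ hB)⟩

open Classical in
/-- Finishing lemma: a connected coloured part `S` (with coloured real vertices `Sr`). -/
theorem finish (hP : Planar H) {K : W → W → Prop} (hK : ∀ u v, K u v → K v u)
    (U Sr T : Finset W) (S : Set W) (hS : Conn H S) (hUS : ∀ u ∈ U, u ∈ S → u ∈ Sr)
    (hTU : T ⊆ U) (hTS : ∀ t ∈ T, t ∉ Sr) (hT2 : T.card ≤ 2) (hTN : ∀ t ∈ T, Nb H S t)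
    (hTcl : ∀ s ∈ T, ∀ t ∈ T, s ≠ t → H.Adj s t) (ψ : W → ℕ) (L : W → Finset ℕ)
    (hL : ∀ u ∈ U, u ∉ Sr → u ∉ T → 5 ≤ (L u).card)
    (h1 : ∀ u ∈ U, u ∉ Sr → u ∉ T → ∀ v ∈ U, v ∉ Sr → v ∉ T → K u v → H.Adj u v)
    (h2 : ∀ u ∈ U, u ∉ Sr → u ∉ T → ∀ p, (p ∈ Sr ∨ p ∈ T) → K u p →
      Nb H S u ∨ (p ∈ T ∧ H.Adj u p))
    (h3 : ∀ u ∈ U, u ∉ Sr → u ∉ T → ∃ a b, ∀ p, (p ∈ Sr ∨ p ∈ T) → K u p →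
      ¬ (p ∈ T ∧ H.Adj u p) → ψ p ∈ L u → ψ p = a ∨ ψ p = b) :
    ∃ f : W → ℕ, (∀ p ∈ Sr, f p = ψ p) ∧ (∀ p ∈ T, f p = ψ p) ∧
      (∀ u ∈ U, u ∉ Sr → u ∉ T → f u ∈ L u) ∧
      ∀ u ∈ U, u ∉ Sr → u ∉ T → ∀ v ∈ U, K u v → f u ≠ f v := by
  set L' : W → Finset ℕ := fun u => L u \ Finset.image ψ ((Sr ∪ T).filter
    (fun p => K u p ∧ ¬ (p ∈ T ∧ H.Adj u p))) with hL'
  have hmL : ∀ u a, a ∈ L' u ↔ a ∈ L u ∧ ∀ p, (p ∈ Sr ∨ p ∈ T) → K u p →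
      ¬ (p ∈ T ∧ H.Adj u p) → ψ p ≠ a := by
    intro u a
    simp only [hL', Finset.mem_sdiff, Finset.mem_image, Finset.mem_filter, Finset.mem_union,
      not_exists, not_and]
    constructor
    · rintro ⟨h, h'⟩
      exact ⟨h, fun p hp hk hn => h' p ⟨hp, hk, fun h => by simpa [h] using hn⟩⟩
    · rintro ⟨h, h'⟩
      exact ⟨h, fun p hp => h' p hp.1 hp.2.1 hp.2.2⟩
  obtain ⟨c, hc, hcL, hcp⟩ := thomassen hP _ (U \ Sr) rfl S hS
    (fun v hv hvS => (Finset.mem_sdiff.1 hv).2 (hUS v (Finset.mem_sdiff.1 hv).1 hvS)) T ψ L'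
    (fun t ht => Finset.mem_sdiff.2 ⟨hTU ht, hTS t ht⟩) hT2 hTN hTcl
    (fun v hv hvT _ => by
      obtain ⟨hvU, hvS⟩ := Finset.mem_sdiff.1 hv
      obtain ⟨a, b, hab⟩ := h3 v hvU hvS hvT
      have hsub : L v \ {a, b} ⊆ L' v := by
        intro x hx
        rw [hmL]
        simp only [Finset.mem_sdiff, Finset.mem_insert, Finset.mem_singleton] at hx
        refine ⟨hx.1, fun p hp hk hn hpx => ?_⟩
        have := hab p hp hk hn (hpx ▸ hx.1)
        rw [hpx] at this
        exact hx.2 this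
      have h5 := hL v hvU hvS hvT
      have h6 := Finset.le_card_sdiff ({a, b} : Finset ℕ) (L v)
      have h7 := Finset.card_le_card hsub
      have := card2 a b
      omega)
    (fun v hv nv => by
      obtain ⟨hvU, hvS⟩ := Finset.mem_sdiff.1 hv
      have hvT : v ∉ T := fun h => nv (hTN v h)
      have hsub : L v ⊆ L' v := by
        intro x hx
        rw [hmL]
        exact ⟨hx, fun p hp hk hn _ => (h2 v hvU hvS hvT p hp hk).elim nv hn⟩
      exact le_trans (hL v hvU hvS hvT) (Finset.card_le_card hsub))
  refine ⟨fun u => if u ∈ Sr then ψ u else c u, fun p hp => by simp [hp], fun p hp => ?_,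
    fun u hu huS huT => ?_, fun u hu huS huT v hv huv => ?_⟩
  · simp only [hTS p hp, if_false]; exact hc p hp
  · simp only [huS, if_false]
    exact ((hmL u _).1 (hcL u (Finset.mem_sdiff.2 ⟨hu, huS⟩) huT)).1
  · have hu' := ((hmL u _).1 (hcL u (Finset.mem_sdiff.2 ⟨hu, huS⟩) huT)).2
    simp only [huS, if_false]
    by_cases hvS : v ∈ Sr
    · simp only [hvS, if_true]
      exact (hu' v (Or.inl hvS) huv (fun h => hTS v h.1 hvS)).symm
    · simp only [hvS, if_false]
      by_cases hvT : v ∈ T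
      · by_cases hA : H.Adj u v
        · exact hcp u (Finset.mem_sdiff.2 ⟨hu, huS⟩) v (Finset.mem_sdiff.2 ⟨hv, hvS⟩) hA
            (fun h => huT h.1)
        · rw [hc v hvT]
          exact (hu' v (Or.inr hvT) huv (fun h => hA h.2)).symm
      · exact hcp u (Finset.mem_sdiff.2 ⟨hu, huS⟩) v (Finset.mem_sdiff.2 ⟨hv, hvS⟩)
          (h1 u hu huS huT v hv hvS hvT huv) (fun h => huT h.1)

open Classical in
/-- A precoloured clique with at most three vertices extends. -/
theorem R2 (hP : Planar H) (U X : Finset W) (φ : W → ℕ) (L : W → Finset ℕ) (hX : X ⊆ U)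
    (hX3 : X.card ≤ 3) (hcl : ∀ s ∈ X, ∀ t ∈ X, s ≠ t → H.Adj s t)
    (hL : ∀ u ∈ U, u ∉ X → 5 ≤ (L u).card) : ThGoal H U X φ L := by
  have main : ∀ (X : Finset W) (φ : W → ℕ), X ⊆ U → X.card ≤ 3 → X.Nonempty →
      (∀ s ∈ X, ∀ t ∈ X, s ≠ t → H.Adj s t) →
      (∀ u ∈ U, u ∉ X → 5 ≤ (L u).card) → ThGoal H U X φ L := by
    clear hX hX3 hcl hL
    clear X φ
    rintro X φ hX hX3 ⟨x, hx⟩ hcl hL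
    have hm : ∀ u, u ∉ ({x} : Finset W) → u ∉ X.erase x → u ∉ X := by
      intro u h1 h2; simp at h1 h2; exact h2 h1
    obtain ⟨f, f1, f2, f3, f4⟩ := finish hP (K := H.Adj) (fun u v h => h.symm) U {x} (X.erase x) {x}
      (Conn.singleton x) (by simp) ((Finset.erase_subset _ _).trans hX)
      (fun t ht => by simpa using (Finset.ne_of_mem_erase ht))
      (by rw [Finset.card_erase_of_mem hx]; omega)
      (fun t ht => ⟨x, rfl, hcl t (Finset.mem_of_mem_erase ht) x hx (Finset.ne_of_mem_erase ht)⟩)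
      (fun s hs t ht => hcl s (Finset.mem_of_mem_erase hs) t (Finset.mem_of_mem_erase ht))
      φ L (fun u hu h1 h2 => hL u hu (hm u h1 h2)) (fun u _ _ _ v _ _ _ h => h)
      (fun u hu h1 h2 p hp h => hp.imp (fun h' => ⟨x, rfl, by simp at h'; exact h' ▸ h⟩)
        (fun h' => ⟨h', h⟩))
      (fun u hu h1 h2 => ⟨φ x, φ x, fun p hp hk hn _ => by
        rcases hp with hp | hp
        · simp at hp; simp [hp]
        · exact absurd ⟨hp, hk⟩ hn⟩)
    refine ⟨f, fun t ht => ?_, fun v hv hvX => ?_, fun u hu v hv huv hn => ?_⟩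
    · by_cases h : t = x
      · exact f1 t (by simp [h])
      · exact f2 t (Finset.mem_erase.2 ⟨h, ht⟩)
    · exact f3 v hv (by simp; rintro rfl; exact hvX hx) (fun h => hvX (Finset.mem_of_mem_erase h))
    · by_cases huX : u ∈ X
      · have hvX : v ∉ X := fun h => hn ⟨huX, h⟩
        exact (f4 v hv (by simp; rintro rfl; exact hvX hx)
          (fun h => hvX (Finset.mem_of_mem_erase h)) u hu huv.symm).symm
      · exact f4 u hu (by simp; rintro rfl; exact huX hx)
          (fun h => huX (Finset.mem_of_mem_erase h)) v hv huv
  rcases X.eq_empty_or_nonempty with rfl | hne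
  · rcases U.eq_empty_or_nonempty with rfl | ⟨v, hv⟩
    · exact ⟨φ, by simp, by simp, by simp⟩
    obtain ⟨α, hα, -⟩ := pick1 (A := L v) (B := ∅) (by
      have := hL v hv (by simp); rw [Finset.card_empty]; omega)
    obtain ⟨c, hc, hcL, hcp⟩ := main {v} (fun _ => α) (by simpa using hv) (by simp) (by simp)
      (by simp) (fun u hu _ => hL u hu (by simp))
    refine ⟨c, by simp, fun u hu _ => ?_, fun a ha b hb hab _ => hcp a ha b hb hab ?_⟩
    · by_cases huv : u = v
      · rw [huv, hc v (by simp)]; exact hα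
      · exact hcL u hu (by simpa using huv)
    · simp; rintro rfl h; exact hab.ne h.symm
  · exact main X φ hX hX3 hne hcl hL

end CN
end PartD

open Set
noncomputable section PartE
namespace CN
variable {W : Type} {H : SimpleGraph W}

/-- crossing vertex `q` with cyclic neighbours `c d c' d'` and the ring edges. -/
structure Cross (H : SimpleGraph W) (q c d c' d' : W) : Prop where
  nq : ∀ v, H.Adj q v ↔ v = c ∨ v = d ∨ v = c' ∨ v = d'
  n1 : c ≠ d
  n2 : c ≠ c'
  n3 : c ≠ d'
  n4 : d ≠ c'
  n5 : d ≠ d'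
  n6 : c' ≠ d'
  r1 : H.Adj c d
  r2 : H.Adj d c'
  r3 : H.Adj c' d'
  r4 : H.Adj d' c

theorem Cross.rot {q c d c' d' : W} (h : Cross H q c d c' d') : Cross H q d c' d' c :=
  ⟨fun v => by rw [h.nq]; tauto, h.n4, h.n5, h.n1.symm, h.n6, h.n2.symm, h.n3.symm,
    h.r2, h.r3, h.r4, h.r1⟩

theorem Cross.refl {q c d c' d' : W} (h : Cross H q c d c' d') : Cross H q c d' c' d :=
  ⟨fun v => by rw [h.nq]; tauto, h.n3, h.n2, h.n1, h.n6.symm, h.n5.symm, h.n4.symm,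
    h.r4.symm, h.r3.symm, h.r2.symm, h.r1.symm⟩

theorem comp_cl {M B : Set W} {y u v : W} (hM : ∀ u v, H.Adj u v → v ∈ M)
    (hu : u ∈ comp H (M \ B) y) (huv : H.Adj u v) : v ∈ comp H (M \ B) y ∨ v ∈ B := by
  by_cases h : v ∈ B
  · exact Or.inr h
  · exact Or.inl (comp_closed hu ⟨hM _ _ huv, h⟩ huv)

/-- no vertex cut of size at most three inside `U`. -/
structure Star (H : SimpleGraph W) (M : Set W) (U : Finset W) : Prop where
  hP : Planar H
  inM : ∀ u v, H.Adj u v → v ∈ M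
  UM : ∀ u ∈ U, u ∈ M
  conn : ∀ x ∈ U, ∀ y ∈ U, ∀ z ∈ U, Conn H (M \ {x, y, z})

theorem Star.cut3 {M : Set W} {U : Finset W} (h : Star H M U) {x y z : W} (hx : x ∈ U)
    (hy : y ∈ U) (hz : z ∈ U) {A : Set W} {a w : W} (ha : a ∈ A) (haM : a ∈ M)
    (hxA : x ∉ A) (hyA : y ∉ A) (hzA : z ∉ A)
    (hcl : ∀ u ∈ A, ∀ v, H.Adj u v → v ∈ A ∨ v = x ∨ v = y ∨ v = z)
    (hw : w ∈ M) (hwx : w ≠ x) (hwy : w ≠ y) (hwz : w ≠ z) : w ∈ A := by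
  have h1 := (h.conn x hx y hy z hz).2 (A ∩ (M \ {x, y, z})) inter_subset_right
    ⟨a, ha, haM, by
      rintro (rfl | rfl | rfl)
      · exact hxA ha
      · exact hyA ha
      · exact hzA ha⟩
    (fun u hu v hv huv => ⟨(hcl u hu.1 v huv).resolve_right hv.2, hv⟩)
  have h2 : w ∈ M \ {x, y, z} := ⟨hw, by rintro (h | h | h) <;> contradiction⟩
  rw [← h1] at h2
  exact h2.1

/-- A wheel with four spokes, hub `b`, rim `a v c v'`, hub having one more neighbour. -/
theorem Star.w4 {M : Set W} {U : Finset W} (h : Star H M U) {b a v c v' y : W}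
    (hb : b ∈ U) (ha : a ∈ U) (hv : v ∈ U) (hc : c ∈ U)
    (hv' : v' ∈ U ∨ ∃ e, (∀ y, H.Adj v' y → y = a ∨ y = c ∨ y = b ∨ y = e) ∧ H.Adj e a ∧ H.Adj e c)
    (ba : H.Adj b a) (bv : H.Adj b v) (bc : H.Adj b c) (bv' : H.Adj b v') (by' : H.Adj b y)
    (av : H.Adj a v) (vc : H.Adj v c) (cv' : H.Adj c v') (v'a : H.Adj v' a)
    (hac : a ≠ c) (hvv : v ≠ v') (ya : y ≠ a) (yv : y ≠ v) (yc : y ≠ c) (yv' : y ≠ v') : False := by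
  set B : Set W := {b, a, v, c, v'} with hB
  have hyM : y ∈ M \ B := ⟨h.inM _ _ by', by
    rintro (h | h | h | h | h)
    · exact by'.ne h.symm
    all_goals contradiction⟩
  set C := comp H (M \ B) y with hC
  have hsub : ∀ u ∈ C, u ∉ B := fun u hu => (comp_sub hyM hu).2
  have hCc : Conn H C := comp_conn _ _
  have hcl : ∀ u ∈ C, ∀ w, H.Adj u w → w ∈ C ∨ w ∈ B := fun u hu w huw =>
    comp_cl h.inM hu huw
  have bC : b ∉ C := fun h => hsub _ h (by simp [hB])
  have aC : a ∉ C := fun h => hsub _ h (by simp [hB])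
  have vC : v ∉ C := fun h => hsub _ h (by simp [hB])
  have cC : c ∉ C := fun h => hsub _ h (by simp [hB])
  have v'C : v' ∉ C := fun h => hsub _ h (by simp [hB])
  have hyC : y ∈ C := self_mem_comp _ _
  have nb : Nb H C b := ⟨y, hyC, by'⟩
  have k1 : Nb H C a → Nb H C c → False := fun na nc =>
    h.hP.k33u hCc ba.ne bc.ne hac hvv bv av vc.symm bv' v'a.symm cv' bC aC cC vC v'C nb na nc
  have k2 : Nb H C v → Nb H C v' → False := fun nv nv' =>
    h.hP.k33u hCc bv.ne bv'.ne hvv hac ba av.symm v'a bc vc cv'.symm bC vC v'C aC cC nb nv nv'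
  have hcl2 : ∀ u ∈ C, ∀ w, H.Adj u w → w ∈ C ∨ w = b ∨ (w = a ∧ Nb H C a) ∨ (w = v ∧ Nb H C v)
      ∨ (w = c ∧ Nb H C c) ∨ (w = v' ∧ Nb H C v') := by
    intro u hu w huw
    rcases hcl u hu w huw with h | h | h | h | h | h
    · exact Or.inl h
    · exact Or.inr (Or.inl h)
    · exact Or.inr (Or.inr (Or.inl ⟨h, u, hu, h ▸ huw.symm⟩))
    · exact Or.inr (Or.inr (Or.inr (Or.inl ⟨h, u, hu, h ▸ huw.symm⟩)))
    · exact Or.inr (Or.inr (Or.inr (Or.inr (Or.inl ⟨h, u, hu, h ▸ huw.symm⟩))))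
    · exact Or.inr (Or.inr (Or.inr (Or.inr (Or.inr ⟨h, u, hu, h ▸ huw.symm⟩))))
  have hv'' : Nb H C v' → v' ∈ U := by
    rintro ⟨e', he', hve⟩
    rcases hv' with hv' | ⟨e, he, ea, ec⟩
    · exact hv'
    · exfalso
      rcases he e' hve with rfl | rfl | rfl | rfl
      · exact aC he'
      · exact cC he'
      · exact bC he'
      · exact k1 ⟨_, he', ea.symm⟩ ⟨_, he', ec.symm⟩
  have fin : ∀ x x' z, x ∈ U → x' ∈ U → z ∈ U → x ∉ C → x' ∉ C → z ∉ C → z ≠ b → z ≠ x → z ≠ x' →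
      (∀ w, ((w = a ∧ Nb H C a) ∨ (w = v ∧ Nb H C v) ∨ (w = c ∧ Nb H C c) ∨ (w = v' ∧ Nb H C v')) →
        w = x ∨ w = x') → False := by
    intro x x' z hx hx' hz xC x'C zC zb zx zx' hh
    refine zC (h.cut3 hb hx hx' hyC hyM.1 bC xC x'C (fun u hu w huw => ?_) (h.UM _ hz) zb zx zx')
    rcases hcl2 u hu w huw with h1 | h1 | h1
    · exact Or.inl h1
    · exact Or.inr (Or.inl h1)
    · exact Or.inr (Or.inr (hh w h1))
  by_cases na : Nb H C a
  · by_cases nv' : Nb H C v'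
    · refine fin a v' c ha (hv'' nv') hc aC v'C cC bc.ne' hac.symm cv'.ne ?_
      rintro w (⟨h, n⟩ | ⟨h, n⟩ | ⟨h, n⟩ | ⟨h, n⟩)
      exacts [Or.inl h, (k2 n nv').elim, (k1 na n).elim, Or.inr h]
    · refine fin a v c ha hv hc aC vC cC bc.ne' hac.symm vc.ne' ?_
      rintro w (⟨h, n⟩ | ⟨h, n⟩ | ⟨h, n⟩ | ⟨h, n⟩)
      exacts [Or.inl h, Or.inr h, (k1 na n).elim, (nv' n).elim]
  · by_cases nv' : Nb H C v'
    · refine fin c v' a hc (hv'' nv') ha cC v'C aC ba.ne' hac v'a.ne' ?_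
      rintro w (⟨h, n⟩ | ⟨h, n⟩ | ⟨h, n⟩ | ⟨h, n⟩)
      exacts [(na n).elim, (k2 n nv').elim, Or.inl h, Or.inr h]
    · refine fin c v a hc hv ha cC vC aC ba.ne' hac av.ne ?_
      rintro w (⟨h, n⟩ | ⟨h, n⟩ | ⟨h, n⟩ | ⟨h, n⟩)
      exacts [(na n).elim, Or.inr h, Or.inl h, (nv' n).elim]

/-- A wheel with five spokes: the hub has no other neighbour. -/
theorem Star.w5 {M : Set W} {U : Finset W} (h : Star H M U) {b x1 x2 x3 x4 x5 y : W}
    (hb : b ∈ U) (u1 : x1 ∈ U) (u2 : x2 ∈ U) (u3 : x3 ∈ U) (u4 : x4 ∈ U) (u5 : x5 ∈ U)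
    (b1 : H.Adj b x1) (b2 : H.Adj b x2) (b3 : H.Adj b x3) (b4 : H.Adj b x4) (b5 : H.Adj b x5)
    (by' : H.Adj b y)
    (e1 : H.Adj x1 x2) (e2 : H.Adj x2 x3) (e3 : H.Adj x3 x4) (e4 : H.Adj x4 x5) (e5 : H.Adj x5 x1)
    (n13 : x1 ≠ x3) (n14 : x1 ≠ x4) (n24 : x2 ≠ x4) (n25 : x2 ≠ x5) (n35 : x3 ≠ x5)
    (y1 : y ≠ x1) (y2 : y ≠ x2) (y3 : y ≠ x3) (y4 : y ≠ x4) (y5 : y ≠ x5) : False := by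
  set B : Set W := {b, x1, x2, x3, x4, x5} with hB
  have hyM : y ∈ M \ B := ⟨h.inM _ _ by', by
    rintro (h | h | h | h | h | h)
    · exact by'.ne h.symm
    all_goals contradiction⟩
  set C := comp H (M \ B) y with hC
  have hsub : ∀ u ∈ C, u ∉ B := fun u hu => (comp_sub hyM hu).2
  have hCc : Conn H C := comp_conn _ _
  have hcl : ∀ u ∈ C, ∀ w, H.Adj u w → w ∈ C ∨ w ∈ B := fun u hu w huw =>
    comp_cl h.inM hu huw
  have bC : b ∉ C := fun h => hsub _ h (by simp [hB])
  have C1 : x1 ∉ C := fun h => hsub _ h (by simp [hB])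
  have C2 : x2 ∉ C := fun h => hsub _ h (by simp [hB])
  have C3 : x3 ∉ C := fun h => hsub _ h (by simp [hB])
  have C4 : x4 ∉ C := fun h => hsub _ h (by simp [hB])
  have C5 : x5 ∉ C := fun h => hsub _ h (by simp [hB])
  have hyC : y ∈ C := self_mem_comp _ _
  have nb : Nb H C b := ⟨y, hyC, by'⟩
  have key : ∀ x1 x2 x3 x4 x5, H.Adj b x1 → H.Adj b x2 → H.Adj b x3 → H.Adj b x4 → H.Adj b x5 →
      H.Adj x1 x2 → H.Adj x2 x3 → H.Adj x3 x4 → H.Adj x4 x5 → H.Adj x5 x1 →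
      x1 ≠ x3 → x1 ≠ x4 → x2 ≠ x4 → x2 ≠ x5 → x3 ≠ x5 → x1 ∉ C → x2 ∉ C → x3 ∉ C → x4 ∉ C →
      x5 ∉ C → Nb H C x1 → Nb H C x3 → False := by
    intro x1 x2 x3 x4 x5 b1 b2 b3 b4 b5 e1 e2 e3 e4 e5 n13 n14 n24 n25 n35 C1 C2 C3 C4 C5 N1 N3
    exact h.hP.k33v (x := b) (y := x1) (z := x3) (A := C) (B := {x2}) (C := {x4, x5}) hCc
      (Conn.singleton _) ((Conn.singleton x5).insert ⟨x5, rfl, e4⟩) b1.ne b3.ne n13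
      (by rintro w hw rfl; exact C2 hw) (by rintro w hw (rfl | rfl); exacts [C4 hw, C5 hw])
      (by rintro w rfl (h | h); exacts [n24 h, n25 h]) bC (by simpa using b2.ne)
      (by rintro (h | h); exacts [b4.ne h, b5.ne h]) C1 (by simpa using e1.ne)
      (by rintro (h | h); exacts [n14 h, e5.ne h.symm]) C3 (by simpa using e2.ne')
      (by rintro (h | h); exacts [e3.ne h, n35 h])
      nb ⟨x2, rfl, b2⟩ ⟨x4, by simp, b4⟩ N1 ⟨x2, rfl, e1⟩ ⟨x5, by simp, e5.symm⟩
      N3 ⟨x2, rfl, e2.symm⟩ ⟨x4, by simp, e3⟩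
  have k13 := key x1 x2 x3 x4 x5 b1 b2 b3 b4 b5 e1 e2 e3 e4 e5 n13 n14 n24 n25 n35 C1 C2 C3 C4 C5
  have k24 := key x2 x3 x4 x5 x1 b2 b3 b4 b5 b1 e2 e3 e4 e5 e1 n24 n25 n35 n13.symm n14.symm
    C2 C3 C4 C5 C1
  have k35 := key x3 x4 x5 x1 x2 b3 b4 b5 b1 b2 e3 e4 e5 e1 e2 n35 n13.symm n14.symm n24.symm n25.symm
    C3 C4 C5 C1 C2
  have k41 := key x4 x5 x1 x2 x3 b4 b5 b1 b2 b3 e4 e5 e1 e2 e3 n14.symm n24.symm n25.symm n35.symm n13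
    C4 C5 C1 C2 C3
  have k52 := key x5 x1 x2 x3 x4 b5 b1 b2 b3 b4 e5 e1 e2 e3 e4 n25.symm n35.symm n13 n14 n24
    C5 C1 C2 C3 C4
  have hcl2 : ∀ u ∈ C, ∀ w, H.Adj u w → w ∈ C ∨ w = b ∨ (w = x1 ∧ Nb H C x1) ∨
      (w = x2 ∧ Nb H C x2) ∨ (w = x3 ∧ Nb H C x3) ∨ (w = x4 ∧ Nb H C x4) ∨ (w = x5 ∧ Nb H C x5) := by
    intro u hu w huw
    rcases hcl u hu w huw with h | h | h | h | h | h | h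
    · exact Or.inl h
    · exact Or.inr (Or.inl h)
    · exact Or.inr (Or.inr (Or.inl ⟨h, u, hu, h ▸ huw.symm⟩))
    · exact Or.inr (Or.inr (Or.inr (Or.inl ⟨h, u, hu, h ▸ huw.symm⟩)))
    · exact Or.inr (Or.inr (Or.inr (Or.inr (Or.inl ⟨h, u, hu, h ▸ huw.symm⟩))))
    · exact Or.inr (Or.inr (Or.inr (Or.inr (Or.inr (Or.inl ⟨h, u, hu, h ▸ huw.symm⟩)))))
    · exact Or.inr (Or.inr (Or.inr (Or.inr (Or.inr (Or.inr ⟨h, u, hu, h ▸ huw.symm⟩)))))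
  have fin : ∀ x x' z, x ∈ U → x' ∈ U → z ∈ U → x ∉ C → x' ∉ C → z ∉ C → z ≠ b → z ≠ x → z ≠ x' →
      (∀ w, ((w = x1 ∧ Nb H C x1) ∨
      (w = x2 ∧ Nb H C x2) ∨ (w = x3 ∧ Nb H C x3) ∨ (w = x4 ∧ Nb H C x4) ∨ (w = x5 ∧ Nb H C x5)) →
        w = x ∨ w = x') → False := by
    intro x x' z hx hx' hz xC x'C zC zb zx zx' hh
    refine zC (h.cut3 hb hx hx' hyC hyM.1 bC xC x'C (fun u hu w huw => ?_) (h.UM _ hz) zb zx zx')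
    rcases hcl2 u hu w huw with h1 | h1 | h1
    · exact Or.inl h1
    · exact Or.inr (Or.inl h1)
    · exact Or.inr (Or.inr (hh w h1))
  by_cases N1 : Nb H C x1
  · by_cases N2 : Nb H C x2
    · refine fin x1 x2 x3 u1 u2 u3 C1 C2 C3 b3.ne' n13.symm e2.ne' ?_
      rintro w (⟨h, n⟩ | ⟨h, n⟩ | ⟨h, n⟩ | ⟨h, n⟩ | ⟨h, n⟩)
      exacts [Or.inl h, Or.inr h, (k13 N1 n).elim, (k41 n N1).elim, (k52 n N2).elim]
    · refine fin x1 x5 x3 u1 u5 u3 C1 C5 C3 b3.ne' n13.symm n35 ?_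
      rintro w (⟨h, n⟩ | ⟨h, n⟩ | ⟨h, n⟩ | ⟨h, n⟩ | ⟨h, n⟩)
      exacts [Or.inl h, (N2 n).elim, (k13 N1 n).elim, (k41 n N1).elim, Or.inr h]
  · by_cases N2 : Nb H C x2
    · refine fin x2 x3 x1 u2 u3 u1 C2 C3 C1 b1.ne' e1.ne n13 ?_
      rintro w (⟨h, n⟩ | ⟨h, n⟩ | ⟨h, n⟩ | ⟨h, n⟩ | ⟨h, n⟩)
      exacts [(N1 n).elim, Or.inl h, Or.inr h, (k24 N2 n).elim, (k52 n N2).elim]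
    · by_cases N3 : Nb H C x3
      · refine fin x3 x4 x1 u3 u4 u1 C3 C4 C1 b1.ne' n13 n14 ?_
        rintro w (⟨h, n⟩ | ⟨h, n⟩ | ⟨h, n⟩ | ⟨h, n⟩ | ⟨h, n⟩)
        exacts [(N1 n).elim, (N2 n).elim, Or.inl h, Or.inr h, (k35 N3 n).elim]
      · refine fin x4 x5 x1 u4 u5 u1 C4 C5 C1 b1.ne' n14 e5.ne' ?_
        rintro w (⟨h, n⟩ | ⟨h, n⟩ | ⟨h, n⟩ | ⟨h, n⟩ | ⟨h, n⟩)
        exacts [(N1 n).elim, (N2 n).elim, (N3 n).elim, Or.inl h, Or.inr h]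

/-- environment: a crossing, no small cuts, large degrees at the crossing, lists of size five. -/
structure Env (H : SimpleGraph W) (M : Set W) (U : Finset W) (L : W → Finset ℕ)
    (q c d c' d' : W) : Prop extends Star H M U, Cross H q c d c' d' where
  qU : q ∉ U
  nU : ∀ x, H.Adj q x → ∀ v, H.Adj x v → v ∈ U ∨ v = q
  deg : ∀ x, H.Adj q x → ∀ a b e f, ∃ y, H.Adj x y ∧ y ≠ a ∧ y ≠ b ∧ y ≠ e ∧ y ≠ f
  L5 : ∀ u ∈ U, (L u).card = 5

variable {M : Set W} {U : Finset W} {L : W → Finset ℕ} {q c d c' d' : W}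

theorem Env.rot (h : Env H M U L q c d c' d') : Env H M U L q d c' d' c :=
  { h.toStar, h.toCross.rot with qU := h.qU, nU := h.nU, deg := h.deg, L5 := h.L5 }

theorem Env.refl (h : Env H M U L q c d c' d') : Env H M U L q c d' c' d :=
  { h.toStar, h.toCross.refl with qU := h.qU, nU := h.nU, deg := h.deg, L5 := h.L5 }

theorem Cross.qc (h : Cross H q c d c' d') : H.Adj q c := (h.nq c).2 (by simp)
theorem Cross.qd (h : Cross H q c d c' d') : H.Adj q d := (h.nq d).2 (by simp)
theorem Cross.qc' (h : Cross H q c d c' d') : H.Adj q c' := (h.nq c').2 (by simp)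
theorem Cross.qd' (h : Cross H q c d c' d') : H.Adj q d' := (h.nq d').2 (by simp)

theorem Env.cU (h : Env H M U L q c d c' d') : c ∈ U :=
  (h.nU d h.qd c h.r1.symm).resolve_right h.qc.ne'
theorem Env.dU (h : Env H M U L q c d c' d') : d ∈ U := h.rot.cU
theorem Env.c'U (h : Env H M U L q c d c' d') : c' ∈ U := h.rot.rot.cU
theorem Env.d'U (h : Env H M U L q c d c' d') : d' ∈ U := h.rot.rot.rot.cU

theorem Env.qM (h : Env H M U L q c d c' d') : q ∈ M := h.inM _ _ h.qc.symm

theorem Env.F0 (h : Env H M U L q c d c' d') {v : W} (hv : v ≠ q) (vc : H.Adj v c)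
    (vd : H.Adj v d) (vc' : H.Adj v c') : False := by
  have vU : v ∈ U := (h.nU c h.qc v vc.symm).resolve_right hv
  obtain ⟨y, hy, y1, y2, y3, y4⟩ := h.deg d h.qd c v c' q
  refine h.toStar.w4 h.dU h.cU vU h.c'U (v' := q) (Or.inr ⟨d', fun y hy => ?_, h.r4, h.r3.symm⟩)
    h.r1.symm vd.symm h.r2 h.qd.symm hy vc.symm vc' h.qc'.symm h.qc h.n2 hv y1 y2 y3 y4
  have := (h.nq y).1 hy; tauto

theorem dsj {x y : W} (h : x ≠ y) : Disjoint ({x} : Set W) {y} := by simpa using h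

theorem Env.ncc (h : Env H M U L q c d c' d') : ¬ H.Adj c c' := by
  intro hcc
  obtain ⟨y, hy, y1, y2, y3, -⟩ := h.deg d h.qd c c' q q
  set B : Set W := {c, c', d, q} with hB
  have hyM : y ∈ M \ B := ⟨h.inM _ _ hy, by
    rintro (h | h | h | h)
    · exact y1 h
    · exact y2 h
    · exact hy.ne h.symm
    · exact y3 h⟩
  set C := comp H (M \ B) y with hC
  have hsub : ∀ u ∈ C, u ∉ B := fun u hu => (comp_sub hyM hu).2
  have hCc : Conn H C := comp_conn _ _
  have hcl : ∀ u ∈ C, ∀ w, H.Adj u w → w ∈ C ∨ w ∈ B := fun u hu w huw =>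
    comp_cl h.inM hu huw
  have cC : c ∉ C := fun h => hsub _ h (by simp [hB])
  have c'C : c' ∉ C := fun h => hsub _ h (by simp [hB])
  have dC : d ∉ C := fun h => hsub _ h (by simp [hB])
  have qC : q ∉ C := fun h => hsub _ h (by simp [hB])
  have hyC : y ∈ C := self_mem_comp _ _
  have hdC : d' ∈ C := by
    by_contra hd
    refine hd (h.cut3 h.cU h.c'U h.dU hyC hyM.1 cC c'C dC (fun u hu w huw => ?_) (h.UM _ h.d'U)
      h.n3.symm h.n6.symm h.n5.symm)
    rcases hcl u hu w huw with h1 | h1 | h1 | h1 | h1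
    · exact Or.inl h1
    · exact Or.inr (Or.inl h1)
    · exact Or.inr (Or.inr (Or.inl h1))
    · exact Or.inr (Or.inr (Or.inr h1))
    · exfalso
      rw [h1] at huw
      rcases (h.nq u).1 huw.symm with rfl | rfl | rfl | rfl <;> contradiction
  refine h.hP.k5' (Conn.singleton c) (Conn.singleton c') (Conn.singleton d) (Conn.singleton q) hCc
    (dsj h.n2) (dsj h.n1) (dsj h.qc.ne') (by simpa using cC) (dsj h.n4.symm) (dsj h.qc'.ne')
    (by simpa using c'C) (dsj h.qd.ne') (by simpa using dC) (by simpa using qC)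
    ⟨c, rfl, c', rfl, hcc⟩ ⟨c, rfl, d, rfl, h.r1⟩ ⟨c, rfl, q, rfl, h.qc.symm⟩
    ⟨c, rfl, d', hdC, h.r4.symm⟩ ⟨c', rfl, d, rfl, h.r2.symm⟩ ⟨c', rfl, q, rfl, h.qc'.symm⟩
    ⟨c', rfl, d', hdC, h.r3⟩ ⟨d, rfl, q, rfl, h.qd.symm⟩ ⟨d, rfl, y, hyC, hy⟩
    ⟨q, rfl, d', hdC, h.qd'⟩

/-- common neighbours of two consecutive crossing vertices. -/
theorem Env.notQ (h : Env H M U L q c d c' d') {v : W} (vc : H.Adj v c) (vd : H.Adj v d) :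
    v ≠ c ∧ v ≠ d ∧ v ≠ c' ∧ v ≠ d' :=
  ⟨vc.ne, vd.ne, fun h' => h.ncc (h' ▸ vc.symm), fun h' => h.rot.ncc (h' ▸ vd.symm)⟩

theorem Env.F1 (h : Env H M U L q c d c' d') {v v' : W} (hv : v ≠ q) (hv' : v' ≠ q) (vc : H.Adj v c)
    (vd : H.Adj v d) (vc' : H.Adj v' c) (vd' : H.Adj v' d) : v = v' := by
  by_contra hne
  have vU : v ∈ U := (h.nU c h.qc v vc.symm).resolve_right hv
  have vU' : v' ∈ U := (h.nU c h.qc v' vc'.symm).resolve_right hv'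
  obtain ⟨-, -, v3, v4⟩ := h.notQ vc vd
  obtain ⟨-, -, w3, w4⟩ := h.notQ vc' vd'
  set B : Set W := {v, v', q, c, d} with hB
  have hyM : c' ∈ M \ B := ⟨h.UM _ h.c'U, by
    rintro (h1 | h1 | h1 | h1 | h1)
    · exact v3 h1.symm
    · exact w3 h1.symm
    · exact h.qc'.ne h1.symm
    · exact h.n2 h1.symm
    · exact h.n4 h1.symm⟩
  have hyM' : d' ∈ M \ B := ⟨h.UM _ h.d'U, by
    rintro (h1 | h1 | h1 | h1 | h1)
    · exact v4 h1.symm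
    · exact w4 h1.symm
    · exact h.qd'.ne h1.symm
    · exact h.n3 h1.symm
    · exact h.n5 h1.symm⟩
  set C := comp H (M \ B) c' with hC
  have hsub : ∀ u ∈ C, u ∉ B := fun u hu => (comp_sub hyM hu).2
  have hCc : Conn H C := comp_conn _ _
  have hcl : ∀ u ∈ C, ∀ w, H.Adj u w → w ∈ C ∨ w ∈ B := fun u hu w huw =>
    comp_cl h.inM hu huw
  have cC : c ∉ C := fun h => hsub _ h (by simp [hB])
  have dC : d ∉ C := fun h => hsub _ h (by simp [hB])
  have qC : q ∉ C := fun h => hsub _ h (by simp [hB])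
  have vC : v ∉ C := fun h => hsub _ h (by simp [hB])
  have v'C : v' ∉ C := fun h => hsub _ h (by simp [hB])
  have hc'C : c' ∈ C := self_mem_comp _ _
  have hd'C : d' ∈ C := comp_closed hc'C hyM' h.r3
  have key : ∀ x x', x ∈ U → x ∉ C → x' ∈ U → x' ∉ C → x' ≠ c → x' ≠ d → x' ≠ x → x ≠ q → x' ≠ q →
      (∀ w, w = v ∨ w = v' → w = x ∨ w = x') → ¬ Nb H C x' → False := by
    intro x x' hx xC hx' x'C x'c x'd x'x xq x'q hh hn
    have : x' ∈ C ∪ {q} := by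
      refine h.cut3 hx h.cU h.dU (Or.inl hc'C) hyM.1 (fun h => h.elim xC xq)
        (fun h1 => h1.elim cC h.qc.ne') (fun h1 => h1.elim dC h.qd.ne') (fun u hu w huw => ?_)
        (h.UM _ hx') x'x x'c x'd
      rcases hu with hu | rfl
      · have aux : w = v ∨ w = v' → w ∈ C ∪ {q} ∨ w = x ∨ w = c ∨ w = d := by
          intro hw
          rcases hh w hw with h1 | h1
          · exact Or.inr (Or.inl h1)
          · exact (hn ⟨u, hu, h1 ▸ huw.symm⟩).elim
        rcases hcl u hu w huw with h1 | h1 | h1 | h1 | h1 | h1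
        · exact Or.inl (Or.inl h1)
        · exact aux (Or.inl h1)
        · exact aux (Or.inr h1)
        · exact Or.inl (Or.inr h1)
        · exact Or.inr (Or.inr (Or.inl h1))
        · exact Or.inr (Or.inr (Or.inr h1))
      · rcases (h.nq w).1 huw with rfl | rfl | rfl | rfl
        · exact Or.inr (Or.inr (Or.inl rfl))
        · exact Or.inr (Or.inr (Or.inr rfl))
        · exact Or.inl (Or.inl hc'C)
        · exact Or.inl (Or.inl hd'C)
    exact this.elim x'C x'q
  by_cases nv : Nb H C v
  · by_cases nv' : Nb H C v'
    · exact h.hP.k33u hCc hne hv hv' h.n1 vc vc' h.qc vd vd' h.qd vC v'C qC cC dC nv nv'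
        ⟨c', hc'C, h.qc'⟩
    · exact key v v' vU vC vU' v'C vc'.ne vd'.ne (Ne.symm hne) hv hv' (fun w hw => hw) nv'
  · exact key v' v vU' v'C vU vC vc.ne vd.ne hne hv' hv (fun w hw => hw.symm) nv

/-- case five a -/
theorem Env.five (h : Env H M U L q c d c' d') {r : W} (hr : r ≠ d) (hr' : r ≠ d')
    (rc : H.Adj r c) (rc' : H.Adj r c') {Z : Set W} (hZ : Conn H Z) (cZ : c ∉ Z) (c'Z : c' ∉ Z)
    (dZ : d ∉ Z) (d'Z : d' ∉ Z) (rZ : r ∉ Z) (nr : Nb H Z r) (nd : Nb H Z d) (nd' : Nb H Z d') :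
    False :=
  h.hP.k33u hZ h.n5 hr.symm hr'.symm h.n2 h.r1.symm h.r4 rc h.r2 h.r3.symm rc' dZ d'Z rZ cZ c'Z
    nd nd' nr

theorem Env.F6 (h : Env H M U L q c d c' d') {r w s : W} (hr : r ≠ q) (hw : w ≠ q) (hs : s ≠ q)
    (hsU : s ∈ U) (sc : s ≠ c) (sc' : s ≠ c')
    (rw' : H.Adj r w) (rc : H.Adj r c) (rc' : H.Adj r c') (wc : H.Adj w c) (wc' : H.Adj w c')
    (sr : H.Adj s r) (sw : H.Adj s w) : False := by
  have rU : r ∈ U := (h.nU c h.qc r rc.symm).resolve_right hr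
  have wU : w ∈ U := (h.nU c h.qc w wc.symm).resolve_right hw
  set B : Set W := {r, w, c, c', s} with hB
  have hqM : q ∈ M \ B := ⟨h.qM, by
    rintro (h1 | h1 | h1 | h1 | h1)
    exacts [hr h1.symm, hw h1.symm, h.qc.ne h1, h.qc'.ne h1, hs h1.symm]⟩
  set C := comp H (M \ B) q with hC
  have hsub : ∀ u ∈ C, u ∉ B := fun u hu => (comp_sub hqM hu).2
  have hCc : Conn H C := comp_conn _ _
  have hcl : ∀ u ∈ C, ∀ w, H.Adj u w → w ∈ C ∨ w ∈ B := fun u hu w huw =>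
    comp_cl h.inM hu huw
  have cC : c ∉ C := fun h => hsub _ h (by simp [hB])
  have c'C : c' ∉ C := fun h => hsub _ h (by simp [hB])
  have rC : r ∉ C := fun h => hsub _ h (by simp [hB])
  have wC : w ∉ C := fun h => hsub _ h (by simp [hB])
  have sC : s ∉ C := fun h => hsub _ h (by simp [hB])
  have hqC : q ∈ C := self_mem_comp _ _
  have nc : Nb H C c := ⟨q, hqC, h.qc.symm⟩
  have nc' : Nb H C c' := ⟨q, hqC, h.qc'.symm⟩
  by_cases ns : Nb H C s
  · exact h.hP.k33u hCc h.n2 sc.symm sc'.symm rw'.ne rc.symm rc'.symm sr wc.symm wc'.symm sw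
      cC c'C sC rC wC nc nc' ns
  set B' : Set W := {r, w, c, c'} with hB'
  have hsM : s ∈ M \ B' := ⟨h.UM _ hsU, by
    rintro (h1 | h1 | h1 | h1)
    exacts [sr.ne h1, sw.ne h1, sc h1, sc' h1]⟩
  set D := comp H (M \ B') s with hD
  have hsub' : ∀ u ∈ D, u ∉ B' := fun u hu => (comp_sub hsM hu).2
  have hDc : Conn H D := comp_conn _ _
  have hcl' : ∀ u ∈ D, ∀ w, H.Adj u w → w ∈ D ∨ w ∈ B' := fun u hu w huw =>
    comp_cl h.inM hu huw
  have cD : c ∉ D := fun h => hsub' _ h (by simp [hB'])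
  have c'D : c' ∉ D := fun h => hsub' _ h (by simp [hB'])
  have rD : r ∉ D := fun h => hsub' _ h (by simp [hB'])
  have wD : w ∉ D := fun h => hsub' _ h (by simp [hB'])
  have hsD : s ∈ D := self_mem_comp _ _
  have hclC : ∀ u ∈ C, ∀ w', H.Adj u w' → w' ∈ C ∨ w' = r ∨ w' = w ∨ w' = c ∨ w' = c' := by
    intro u hu x hux
    rcases hcl u hu x hux with h1 | h1 | h1 | h1 | h1 | h1
    · exact Or.inl h1
    · exact Or.inr (Or.inl h1)
    · exact Or.inr (Or.inr (Or.inl h1))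
    · exact Or.inr (Or.inr (Or.inr (Or.inl h1)))
    · exact Or.inr (Or.inr (Or.inr (Or.inr h1)))
    · exact (ns ⟨u, hu, h1 ▸ hux.symm⟩).elim
  have hCD : ∀ x ∈ C, x ∉ D := by
    intro x hxC hxD
    have := hDc.2 (D ∩ C) inter_subset_left ⟨x, hxD, hxC⟩ (fun u hu v hv huv => ⟨hv, by
      rcases hclC u hu.2 v huv with h1 | rfl | rfl | rfl | rfl
      · exact h1
      all_goals contradiction⟩)
    have h2 : s ∈ D ∩ C := by rw [this]; exact hsD
    exact sC h2.2
  have nDc : Nb H D c := by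
    by_contra hn
    refine hCD q hqC (h.cut3 rU wU h.c'U hsD hsM.1 rD wD c'D (fun u hu x hux => ?_) h.qM hr.symm
      hw.symm h.qc'.ne)
    rcases hcl' u hu x hux with h1 | h1 | h1 | h1 | h1
    · exact Or.inl h1
    · exact Or.inr (Or.inl h1)
    · exact Or.inr (Or.inr (Or.inl h1))
    · exact (hn ⟨u, hu, h1 ▸ hux.symm⟩).elim
    · exact Or.inr (Or.inr (Or.inr h1))
  have nDc' : Nb H D c' := by
    by_contra hn
    refine hCD q hqC (h.cut3 rU wU h.cU hsD hsM.1 rD wD cD (fun u hu x hux => ?_) h.qM hr.symm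
      hw.symm h.qc.ne)
    rcases hcl' u hu x hux with h1 | h1 | h1 | h1 | h1
    · exact Or.inl h1
    · exact Or.inr (Or.inl h1)
    · exact Or.inr (Or.inr (Or.inl h1))
    · exact Or.inr (Or.inr (Or.inr h1))
    · exact (hn ⟨u, hu, h1 ▸ hux.symm⟩).elim
  have fin : ∀ r w, r ≠ w → H.Adj r w → H.Adj r c → H.Adj r c' → H.Adj w c → H.Adj w c' →
      H.Adj s r → r ∉ C → w ∉ C → r ∉ D → w ∉ D → Nb H C r → False := by
    intro r w hrw rw' rc rc' wc wc' sr rC wC rD wD nr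
    exact h.hP.k33v (x := c) (y := c') (z := r) (A := {w}) (B := D) (C := C) (Conn.singleton w)
      hDc hCc h.n2 rc.ne' rc'.ne' (by simpa using wD) (by simpa using wC)
      (fun x hx hx' => hCD x hx' hx) (by simpa using wc.ne') cD cC (by simpa using wc'.ne') c'D c'C
      (by simpa using hrw) rD rC ⟨w, rfl, wc.symm⟩ nDc nc ⟨w, rfl, wc'.symm⟩ nDc' nc'
      ⟨w, rfl, rw'⟩ ⟨s, hsD, sr.symm⟩ nr
  by_cases nr : Nb H C r
  · exact fin r w rw'.ne rw' rc rc' wc wc' sr rC wC rD wD nr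
  by_cases nw : Nb H C w
  · exact fin w r rw'.ne' rw'.symm wc wc' rc rc' sw wC rC wD rD nw
  refine sC (h.cut3 h.cU h.c'U h.c'U hqC h.qM cC c'C c'C (fun u hu x hux => ?_) (h.UM _ hsU)
    sc sc' sc')
  rcases hclC u hu x hux with h1 | h1 | h1 | h1 | h1
  · exact Or.inl h1
  · exact (nr ⟨u, hu, h1 ▸ hux.symm⟩).elim
  · exact (nw ⟨u, hu, h1 ▸ hux.symm⟩).elim
  · exact Or.inr (Or.inl h1)
  · exact Or.inr (Or.inr (Or.inl h1))

end CN
end PartE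

open Set
noncomputable section PartF
namespace CN
variable {W : Type} {H : SimpleGraph W}
variable {M : Set W} {U : Finset W} {L : W → Finset ℕ} {q c d c' d' : W}

/-- adjacency together with the two mate pairs of the crossing. -/
def KQ (H : SimpleGraph W) (c d c' d' u v : W) : Prop :=
  H.Adj u v ∨ (u = c ∧ v = c') ∨ (u = c' ∧ v = c) ∨ (u = d ∧ v = d') ∨ (u = d' ∧ v = d)

theorem KQ.symm {u v : W} (h : KQ H c d c' d' u v) : KQ H c d c' d' v u := by
  rcases h with h | h | h | h | h
  · exact Or.inl h.symm
  · exact Or.inr (Or.inr (Or.inl h.symm))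
  · exact Or.inr (Or.inl h.symm)
  · exact Or.inr (Or.inr (Or.inr (Or.inr h.symm)))
  · exact Or.inr (Or.inr (Or.inr (Or.inl h.symm)))

theorem KQ.rot : KQ H d c' d' c = KQ H c d c' d' := by
  funext u v; unfold KQ; apply propext; tauto

theorem KQ.refl : KQ H c d' c' d = KQ H c d c' d' := by
  funext u v; unfold KQ; apply propext; tauto

/-- distance levels from `q`. -/
structure Lev (H : SimpleGraph W) (M : Set W) (q : W) (lev : W → ℕ) : Prop where
  zero : lev q = 0
  le : ∀ u v, H.Adj u v → lev u ≤ lev v + 1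
  down : ∀ v ∈ M, v ≠ q → ∃ u, H.Adj v u ∧ lev v = lev u + 1

variable {lev : W → ℕ}

/-- A good coloured connector. -/
structure FFw (H : SimpleGraph W) (U : Finset W) (L : W → Finset ℕ) (lev : W → ℕ)
    (q c d c' d' s r : W) (σ ρ : ℕ) (Sr : Finset W) (ψ : W → ℕ) : Prop where
  sub : Sr ⊆ U
  hs : s ∈ Sr
  hr : r ∈ Sr
  conn : Conn H (insert q (Sr : Set W))
  cs : ψ s = σ
  cr : ψ r = ρ
  inL : ∀ x ∈ Sr, x ≠ s → ψ x ∈ L x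
  prop : ∀ x ∈ Sr, ∀ y ∈ Sr, KQ H c d c' d' x y → ψ x ≠ ψ y
  low : ∀ x ∈ Sr, x ≠ s → x ≠ r → lev x < lev r
  p1 : c ∈ Sr ∨ c' ∈ Sr
  p2 : d ∈ Sr ∨ d' ∈ Sr
  ok : ∀ u ∈ U, u ∉ Sr → ∃ a b, ∀ p ∈ Sr, KQ H c d c' d' u p → ψ p ∈ L u → ψ p = a ∨ ψ p = b

def FF (H : SimpleGraph W) (U : Finset W) (L : W → Finset ℕ) (lev : W → ℕ)
    (q c d c' d' s r : W) : Prop :=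
  ∀ σ ρ, σ ≠ ρ → ρ ∈ L r → ∃ Sr ψ, FFw H U L lev q c d c' d' s r σ ρ Sr ψ

theorem FF.rot {s r : W} (h : FF H U L lev q d c' d' c s r) : FF H U L lev q c d c' d' s r := by
  intro σ ρ h1 h2
  obtain ⟨Sr, ψ, h3⟩ := h σ ρ h1 h2
  refine ⟨Sr, ψ, { h3 with prop := ?_, ok := ?_, p1 := h3.p2.symm, p2 := h3.p1 }⟩
  · have := h3.prop; rwa [KQ.rot] at this
  · have := h3.ok; rwa [KQ.rot] at this

theorem FF.refl {s r : W} (h : FF H U L lev q c d' c' d s r) : FF H U L lev q c d c' d' s r := by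
  intro σ ρ h1 h2
  obtain ⟨Sr, ψ, h3⟩ := h σ ρ h1 h2
  refine ⟨Sr, ψ, { h3 with prop := ?_, ok := ?_, p2 := h3.p2.symm }⟩
  · have := h3.prop; rwa [KQ.refl] at this
  · have := h3.ok; rwa [KQ.refl] at this

/-- colours that would make a list lose three. -/
def bad (A : Finset ℕ) (x y : ℕ) : Finset ℕ := if x ∈ A ∧ y ∈ A ∧ x ≠ y then A \ {x, y} else ∅

theorem bad_card {A : Finset ℕ} (hA : A.card = 5) (x y : ℕ) : (bad A x y).card ≤ 3 := by
  unfold bad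
  split_ifs with h
  · rw [Finset.card_sdiff_of_subset (by
      intro z hz; simp only [Finset.mem_insert, Finset.mem_singleton] at hz
      rcases hz with rfl | rfl
      exacts [h.1, h.2.1]), Finset.card_pair h.2.2]
    omega
  · simp

theorem ok3 {A : Finset ℕ} {x y z : ℕ} (h : z ∉ bad A x y) :
    ∃ a b, (x ∈ A → x = a ∨ x = b) ∧ (y ∈ A → y = a ∨ y = b) ∧ (z ∈ A → z = a ∨ z = b) := by
  unfold bad at h
  split_ifs at h with h1
  · simp only [Finset.mem_sdiff, Finset.mem_insert, Finset.mem_singleton] at h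
    exact ⟨x, y, by tauto, by tauto, by tauto⟩
  · by_cases hx : x ∈ A
    · by_cases hy : y ∈ A
      · have : x = y := by tauto
        exact ⟨x, z, by tauto, fun _ => Or.inl this.symm, by tauto⟩
      · exact ⟨x, z, by tauto, by tauto, by tauto⟩
    · exact ⟨y, z, by tauto, by tauto, by tauto⟩

theorem ok4 {A : Finset ℕ} {σ ρ γ κ : ℕ} {p1 p2 p3 p4 : Prop} (h0 : p1 → p2 → p3 → p4 → False)
    (h123 : p1 → p2 → p3 → γ ∉ bad A σ ρ) (h124 : p1 → p2 → p4 → κ ∉ bad A σ ρ)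
    (h134 : p1 → p3 → p4 → κ ∉ bad A σ γ) (h234 : p2 → p3 → p4 → κ ∉ bad A ρ γ) :
    ∃ a b, (p1 → σ ∈ A → σ = a ∨ σ = b) ∧ (p2 → ρ ∈ A → ρ = a ∨ ρ = b) ∧
      (p3 → γ ∈ A → γ = a ∨ γ = b) ∧ (p4 → κ ∈ A → κ = a ∨ κ = b) := by
  by_cases a1 : p1
  · by_cases a2 : p2
    · by_cases a3 : p3
      · obtain ⟨a, b, i, j, k⟩ := ok3 (h123 a1 a2 a3)
        exact ⟨a, b, fun _ => i, fun _ => j, fun _ => k, fun h => (h0 a1 a2 a3 h).elim⟩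
      · by_cases a4 : p4
        · obtain ⟨a, b, i, j, k⟩ := ok3 (h124 a1 a2 a4)
          exact ⟨a, b, fun _ => i, fun _ => j, fun h => (a3 h).elim, fun _ => k⟩
        · exact ⟨σ, ρ, fun _ _ => Or.inl rfl, fun _ _ => Or.inr rfl, fun h => (a3 h).elim,
            fun h => (a4 h).elim⟩
    · by_cases a3 : p3
      · by_cases a4 : p4
        · obtain ⟨a, b, i, j, k⟩ := ok3 (h134 a1 a3 a4)
          exact ⟨a, b, fun _ => i, fun h => (a2 h).elim, fun _ => j, fun _ => k⟩
        · exact ⟨σ, γ, fun _ _ => Or.inl rfl, fun h => (a2 h).elim, fun _ _ => Or.inr rfl,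
            fun h => (a4 h).elim⟩
      · exact ⟨σ, κ, fun _ _ => Or.inl rfl, fun h => (a2 h).elim, fun h => (a3 h).elim,
          fun _ _ => Or.inr rfl⟩
  · by_cases a2 : p2
    · by_cases a3 : p3
      · by_cases a4 : p4
        · obtain ⟨a, b, i, j, k⟩ := ok3 (h234 a2 a3 a4)
          exact ⟨a, b, fun h => (a1 h).elim, fun _ => i, fun _ => j, fun _ => k⟩
        · exact ⟨ρ, γ, fun h => (a1 h).elim, fun _ _ => Or.inl rfl, fun _ _ => Or.inr rfl,
            fun h => (a4 h).elim⟩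
      · exact ⟨ρ, κ, fun h => (a1 h).elim, fun _ _ => Or.inl rfl, fun h => (a3 h).elim,
          fun _ _ => Or.inr rfl⟩
    · exact ⟨γ, κ, fun h => (a1 h).elim, fun h => (a2 h).elim, fun _ _ => Or.inl rfl,
        fun _ _ => Or.inr rfl⟩

/-- choose a colour avoiding one colour and the bad set of a unique vertex. -/
theorem pickU {A : Finset ℕ} (hA : A.card = 5) (hL : ∀ u ∈ U, (L u).card = 5) (P : W → Prop)
    (hP : ∀ u ∈ U, ∀ u' ∈ U, P u → P u' → u = u') (ρ x y : ℕ) :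
    ∃ γ ∈ A, γ ≠ ρ ∧ ∀ u ∈ U, P u → γ ∉ bad (L u) x y := by
  classical
  by_cases h : ∃ u ∈ U, P u
  · obtain ⟨u, hu, hPu⟩ := h
    obtain ⟨γ, h1, h2⟩ := pick1 (A := A) (B := insert ρ (bad (L u) x y)) (by
      have := Finset.card_insert_le ρ (bad (L u) x y)
      have := bad_card (hL u hu) x y
      omega)
    rw [Finset.mem_insert, not_or] at h2
    refine ⟨γ, h1, h2.1, fun v hv hPv => ?_⟩
    rw [hP v hv u hu hPv hPu]; exact h2.2
  · obtain ⟨γ, h1, h2⟩ := pick1 (A := A) (B := {ρ}) (by rw [Finset.card_singleton]; omega)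
    exact ⟨γ, h1, by simpa using h2, fun u hu hPu => (h ⟨u, hu, hPu⟩).elim⟩

theorem Lev.eq_q (hl : Lev H M q lev) {v : W} (hv : v ∈ M) (h : lev v = 0) : v = q := by
  by_contra hn
  obtain ⟨u, -, hu⟩ := hl.down v hv hn
  omega

theorem Lev.one (hl : Lev H M q lev) (hM : ∀ u v, H.Adj u v → v ∈ M) {v : W} (hv : H.Adj q v) :
    lev v = 1 := by
  have h1 := hl.le v q hv.symm
  have h2 : lev v ≠ 0 := fun h => hv.ne (hl.eq_q (hM _ _ hv) h).symm
  have := hl.zero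
  omega

/-- `K` is adjacency away from level one. -/
theorem Env.kadj (h : Env H M U L q c d c' d') (hl : Lev H M q lev) {u v : W} (hu : 2 ≤ lev u)
    (hk : KQ H c d c' d' u v) : H.Adj u v := by
  have a := hl.one h.inM h.qc
  have b := hl.one h.inM h.qd
  have e := hl.one h.inM h.qc'
  have f := hl.one h.inM h.qd'
  rcases hk with hk | ⟨rfl, _⟩ | ⟨rfl, _⟩ | ⟨rfl, _⟩ | ⟨rfl, _⟩
  · exact hk
  all_goals omega

open Classical in
theorem FF.ext (h : Env H M U L q c d c' d') (hl : Lev H M q lev) {t s r : W}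
    (hF : FF H U L lev q c d c' d' s r) (hsr : lev s = lev r + 1) (hs3 : 3 ≤ lev s)
    (sr : H.Adj s r) (ts : H.Adj t s) (hts : lev t = lev s + 1) (tU : t ∈ U) (sU : s ∈ U)
    (rU : r ∈ U)
    (dg : ∀ a b e f, ∃ y, H.Adj s y ∧ y ≠ a ∧ y ≠ b ∧ y ≠ e ∧ y ≠ f) :
    FF H U L lev q c d c' d' t s := by
  intro τ σ hne hσ
  have hun : ∀ u ∈ U, ∀ u' ∈ U, (H.Adj u t ∧ H.Adj u s ∧ H.Adj u r) →
      (H.Adj u' t ∧ H.Adj u' s ∧ H.Adj u' r) → u = u' := by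
    rintro u hu u' hu' ⟨a1, a2, a3⟩ ⟨b1, b2, b3⟩
    by_contra hn
    obtain ⟨y, hy, y1, y2, y3, y4⟩ := dg t u r u'
    exact h.toStar.w4 sU tU hu rU (Or.inl hu') ts.symm a2.symm sr b2.symm hy a1.symm a3 b3.symm b1
      (fun h => by rw [h] at hts; omega) hn y1 y2 y3 y4
  obtain ⟨ρ, hρ, hρσ, hρb⟩ := pickU (h.L5 r rU) h.L5 _ hun σ τ σ
  obtain ⟨Sr, ψ, w⟩ := hF σ ρ hρσ.symm hρ
  have hlow : ∀ x ∈ Sr, lev x + 1 ≤ lev t ∧ (x ≠ s → lev x + 2 ≤ lev t) ∧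
      (x ≠ s → x ≠ r → lev x + 3 ≤ lev t) := by
    intro x hx
    by_cases h1 : x = s
    · subst h1; exact ⟨by omega, fun h => (h rfl).elim, fun h => (h rfl).elim⟩
    · by_cases h2 : x = r
      · subst h2; exact ⟨by omega, fun _ => by omega, fun _ h => (h rfl).elim⟩
      · have := w.low x hx h1 h2
        exact ⟨by omega, fun _ => by omega, fun _ _ => by omega⟩
  have htS : t ∉ Sr := fun h => by have := (hlow t h).1; omega
  have hnt : ∀ x ∈ Sr, x ≠ t := fun x hx hxt => htS (hxt ▸ hx)
  have htk : ∀ x ∈ Sr, KQ H c d c' d' t x → x = s := by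
    intro x hx hk
    have h1 := h.kadj hl (by omega) hk
    have h2 := hl.le t x h1
    by_contra h3
    have := (hlow x hx).2.1 h3
    omega
  refine ⟨insert t Sr, Function.update ψ t τ, ?_⟩
  have hψ : ∀ x ∈ Sr, Function.update ψ t τ x = ψ x := fun x hx =>
    Function.update_of_ne (hnt x hx) _ _
  have hψt : Function.update ψ t τ t = τ := Function.update_self _ _ _
  refine ⟨?_, Finset.mem_insert_self _ _, Finset.mem_insert_of_mem w.hs, ?_, hψt,
    (hψ s w.hs).trans w.cs, ?_, ?_, ?_, w.p1.imp Finset.mem_insert_of_mem Finset.mem_insert_of_mem,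
    w.p2.imp Finset.mem_insert_of_mem Finset.mem_insert_of_mem, ?_⟩
  · exact Finset.insert_subset tU w.sub
  · rw [Finset.coe_insert, Set.insert_comm]
    exact w.conn.insert ⟨s, Or.inr w.hs, ts⟩
  · intro x hx hxt
    have hx := (Finset.mem_insert.1 hx).resolve_left hxt
    rw [hψ x hx]
    by_cases hxs : x = s
    · rw [hxs, w.cs]; exact hσ
    · exact w.inL x hx hxs
  · intro x hx y hy hk
    rcases Finset.mem_insert.1 hx with hxt | hx'
    · rcases Finset.mem_insert.1 hy with hyt | hy'
      · rw [hxt, hyt] at hk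
        exact ((h.kadj hl (by omega) hk).ne rfl).elim
      · rw [hxt] at hk ⊢
        rw [hψt, hψ y hy', htk y hy' hk, w.cs]; exact hne
    · rcases Finset.mem_insert.1 hy with hyt | hy'
      · rw [hyt] at hk ⊢
        rw [hψt, hψ x hx', htk x hx' hk.symm, w.cs]; exact hne.symm
      · rw [hψ x hx', hψ y hy']; exact w.prop x hx' y hy' hk
  · intro x hx h1 h2
    have hx := (Finset.mem_insert.1 hx).resolve_left h1
    have := (hlow x hx).2.1 h2
    omega
  · intro u hu huS
    rw [Finset.mem_insert, not_or] at huS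
    by_cases hkt : KQ H c d c' d' u t
    · have hut := (h.kadj hl (by omega) hkt.symm).symm
      have hlu : lev t ≤ lev u + 1 := hl.le t u hut.symm
      have hp : ∀ p ∈ Sr, KQ H c d c' d' u p → H.Adj u p ∧ (p = s ∨ p = r) := by
        intro p hp hk
        have h1 := h.kadj hl (by omega) hk
        refine ⟨h1, ?_⟩
        by_contra hn
        rw [not_or] at hn
        have := (hlow p hp).2.2 hn.1 hn.2
        have := hl.le u p h1
        omega
      by_cases h3 : H.Adj u s ∧ H.Adj u r
      · obtain ⟨a, b, i, j, k⟩ := ok3 (hρb u hu ⟨hut, h3.1, h3.2⟩)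
        refine ⟨a, b, fun p hpS hk => ?_⟩
        rcases Finset.mem_insert.1 hpS with rfl | hpS
        · rw [hψt]; exact i
        · rw [hψ p hpS]
          rcases (hp p hpS hk).2 with rfl | rfl
          · rw [w.cs]; exact j
          · rw [w.cr]; exact k
      · by_cases h4 : H.Adj u s
        · refine ⟨τ, σ, fun p hpS hk _ => ?_⟩
          rcases Finset.mem_insert.1 hpS with rfl | hpS
          · rw [hψt]; exact Or.inl rfl
          · rw [hψ p hpS]
            rcases (hp p hpS hk).2 with rfl | rfl
            · rw [w.cs]; exact Or.inr rfl
            · exact (h3 ⟨h4, (hp _ hpS hk).1⟩).elim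
        · refine ⟨τ, ρ, fun p hpS hk _ => ?_⟩
          rcases Finset.mem_insert.1 hpS with rfl | hpS
          · rw [hψt]; exact Or.inl rfl
          · rw [hψ p hpS]
            rcases (hp p hpS hk).2 with rfl | rfl
            · exact (h4 (hp _ hpS hk).1).elim
            · rw [w.cr]; exact Or.inr rfl
    · obtain ⟨a, b, hab⟩ := w.ok u hu huS.2
      refine ⟨a, b, fun p hpS hk => ?_⟩
      rcases Finset.mem_insert.1 hpS with rfl | hpS
      · exact (hkt hk).elim
      · rw [hψ p hpS]; exact hab p hpS hk

end CN
end PartF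

open Set
noncomputable section PartG
namespace CN
variable {W : Type} {H : SimpleGraph W}
variable {M : Set W} {U : Finset W} {L : W → Finset ℕ} {q c d c' d' : W} {lev : W → ℕ}

/-- Situation of the end lemma (for contradiction). -/
structure EndS (H : SimpleGraph W) (M : Set W) (U : Finset W) (L : W → Finset ℕ) (lev : W → ℕ)
    (s q c d c' d' : W) : Prop extends Env H M U L q c d c' d' where
  lv : Lev H M q lev
  sU : s ∈ U
  s3 : lev s = 3
  dg : ∀ r ∈ U, lev r = 2 → ∀ a b e f, ∃ y, H.Adj r y ∧ y ≠ a ∧ y ≠ b ∧ y ≠ e ∧ y ≠ f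
  hy : ∃ y, H.Adj s y ∧ 3 ≤ lev y
  no : ∀ r ∈ U, H.Adj s r → lev r = 2 → ¬ FF H U L lev q c d c' d' s r

variable {s : W}

theorem EndS.rot (h : EndS H M U L lev s q c d c' d') : EndS H M U L lev s q d c' d' c :=
  { h.toEnv.rot with
    lv := h.lv, sU := h.sU, s3 := h.s3, dg := h.dg, hy := h.hy,
    no := fun r h1 h2 h3 hF => h.no r h1 h2 h3 hF.rot }

theorem EndS.refl (h : EndS H M U L lev s q c d c' d') : EndS H M U L lev s q c d' c' d :=
  { h.toEnv.refl with
    lv := h.lv, sU := h.sU, s3 := h.s3, dg := h.dg, hy := h.hy,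
    no := fun r h1 h2 h3 hF => h.no r h1 h2 h3 hF.refl }

theorem EndS.swap (h : EndS H M U L lev s q c d c' d') : EndS H M U L lev s q d c d' c' :=
  h.rot.refl

theorem EndS.l2 (h : EndS H M U L lev s q c d c' d') {r x : W} (sr : H.Adj s r) (rx : H.Adj r x)
    (qx : H.Adj q x) : lev r = 2 := by
  have h1 := h.lv.one h.inM qx
  have h2 := h.lv.le r x rx
  have h3 := h.lv.le s r sr
  have := h.s3
  omega

theorem EndS.rU (h : EndS H M U L lev s q c d c' d') {r x : W} (sr : H.Adj s r) (rx : H.Adj r x)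
    (qx : H.Adj q x) : r ∈ U := by
  refine (h.nU x qx r rx.symm).resolve_right ?_
  rintro rfl
  have := h.lv.zero
  have := h.l2 sr rx qx
  omega

theorem EndS.rq (h : EndS H M U L lev s q c d c' d') {r x : W} (sr : H.Adj s r) (rx : H.Adj r x)
    (qx : H.Adj q x) : r ≠ q := fun hq => h.qU (hq ▸ h.rU sr rx qx)

theorem EndS.sx (h : EndS H M U L lev s q c d c' d') {x : W} (qx : H.Adj q x) : ¬ H.Adj s x := by
  intro hs
  have h1 := h.lv.one h.inM qx
  have h3 := h.lv.le s x hs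
  have := h.s3
  omega

theorem EndS.sne (h : EndS H M U L lev s q c d c' d') {x : W} (qx : H.Adj q x) : s ≠ x := by
  rintro rfl
  have h1 := h.lv.one h.inM qx
  have := h.s3
  omega

theorem EndS.rne (h : EndS H M U L lev s q c d c' d') {r x z : W} (sr : H.Adj s r) (rx : H.Adj r x)
    (qx : H.Adj q x) (qz : H.Adj q z) : r ≠ z := by
  rintro rfl
  have h1 := h.lv.one h.inM qz
  have := h.l2 sr rx qx
  omega

open Classical in
theorem EndS.four (h : EndS H M U L lev s q c d c' d') {r : W} (sr : H.Adj s r) (rc : H.Adj r c)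
    (hh : ∀ σ ρ, σ ≠ ρ → ρ ∈ L r → ∃ γ ∈ L c, ∃ κ ∈ L d, ρ ≠ γ ∧ γ ≠ κ ∧ (H.Adj r d → ρ ≠ κ) ∧
      ∀ u ∈ U, u ≠ s → u ≠ r → u ≠ c → u ≠ d → ∃ a b, (H.Adj u s → σ ∈ L u → σ = a ∨ σ = b) ∧
        (H.Adj u r → ρ ∈ L u → ρ = a ∨ ρ = b) ∧ (KQ H c d c' d' u c → γ ∈ L u → γ = a ∨ γ = b) ∧
        (KQ H c d c' d' u d → κ ∈ L u → κ = a ∨ κ = b)) : False := by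
  have r2 := h.l2 sr rc h.qc
  have rU := h.rU sr rc h.qc
  refine h.no r rU sr r2 (fun σ ρ hne hρ => ?_)
  obtain ⟨γ, hγ, κ, hκ, h1, h2, h3, h4⟩ := hh σ ρ hne hρ
  have lc := h.lv.one h.inM h.qc
  have ld := h.lv.one h.inM h.qd
  have hs3 := h.s3
  have nsc : s ≠ c := h.sne h.qc
  have nsd : s ≠ d := h.sne h.qd
  have nrc : r ≠ c := rc.ne
  have nrd : r ≠ d := h.rne sr rc h.qc h.qd
  have nsr : s ≠ r := sr.ne
  have ncd := h.n1
  set ψ : W → ℕ := fun x => if x = s then σ else if x = r then ρ else if x = c then γ else κ with hψ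
  have ps : ψ s = σ := by simp [hψ]
  have pr : ψ r = ρ := by simp [hψ, nsr.symm]
  have pc : ψ c = γ := by simp [hψ, nsc.symm, nrc.symm]
  have pd : ψ d = κ := by simp [hψ, nsd.symm, nrd.symm, ncd.symm]
  clear_value ψ
  have hm : ∀ x, x ∈ ({s, r, c, d} : Finset W) ↔ x = s ∨ x = r ∨ x = c ∨ x = d := by simp
  refine ⟨{s, r, c, d}, ψ, ?_, by simp, by simp, ?_, ps, pr, ?_, ?_, ?_, by simp, by simp, ?_⟩
  · intro x hx
    rcases (hm x).1 hx with rfl | rfl | rfl | rfl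
    exacts [h.sU, rU, h.cU, h.dU]
  · have e : (insert q (({s, r, c, d} : Finset W) : Set W)) = insert s (insert r (insert c {q, d})) := by
      ext x; simp; tauto
    rw [e]
    refine Conn.insert (Conn.insert (Conn.insert (Conn.insert (Conn.singleton d) ⟨d, rfl, h.qd⟩)
      ⟨d, by simp, h.r1⟩) ⟨c, by simp, rc⟩) ⟨r, by simp, sr⟩
  · intro x hx hxs
    rcases (hm x).1 hx with rfl | rfl | rfl | rfl
    · exact (hxs rfl).elim
    · rwa [pr]
    · rwa [pc]
    · rwa [pd]
  · have key : ∀ x y, (x = s ∧ y = r) ∨ (x = s ∧ y = c) ∨ (x = s ∧ y = d) ∨ (x = r ∧ y = c) ∨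
        (x = r ∧ y = d) ∨ (x = c ∧ y = d) → KQ H c d c' d' x y → ψ x ≠ ψ y := by
      rintro x y (⟨rfl, rfl⟩ | ⟨rfl, rfl⟩ | ⟨rfl, rfl⟩ | ⟨rfl, rfl⟩ | ⟨rfl, rfl⟩ | ⟨rfl, rfl⟩) hk
      · rwa [ps, pr]
      · exact (h.sx h.qc (h.kadj h.lv (by omega) hk)).elim
      · exact (h.sx h.qd (h.kadj h.lv (by omega) hk)).elim
      · rwa [pr, pc]
      · rw [pr, pd]; exact h3 (h.kadj h.lv (by omega) hk)
      · rwa [pc, pd]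
    have irr : ∀ x, ¬ KQ H c d c' d' x x := by
      rintro x (hx | ⟨rfl, hx⟩ | ⟨rfl, hx⟩ | ⟨rfl, hx⟩ | ⟨rfl, hx⟩)
      exacts [hx.ne rfl, h.n2 hx, h.n2 hx.symm, h.n5 hx, h.n5 hx.symm]
    intro x hx y hy hk
    have := key x y
    have h7 := fun hh => (key y x hh hk.symm).symm
    rcases (hm x).1 hx with hx' | hx' | hx' | hx' <;>
      rcases (hm y).1 hy with hy' | hy' | hy' | hy'
    case inl.inl => exact (irr x (by rw [hx'] at hk ⊢; rwa [hy'] at hk)).elim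
    case inr.inl.inr.inl => exact (irr x (by rw [hx'] at hk ⊢; rwa [hy'] at hk)).elim
    case inr.inr.inl.inr.inr.inl => exact (irr x (by rw [hx'] at hk ⊢; rwa [hy'] at hk)).elim
    case inr.inr.inr.inr.inr.inr => exact (irr x (by rw [hx'] at hk ⊢; rwa [hy'] at hk)).elim
    all_goals first
      | (refine this ?_ hk; simp only [hx', hy', true_and, and_true, true_or, or_true]; done)
      | (refine h7 ?_; simp only [hx', hy', true_and, and_true, true_or, or_true]; done)
  · intro x hx h5 h6
    rcases (hm x).1 hx with rfl | rfl | rfl | rfl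
    · exact (h5 rfl).elim
    · exact (h6 rfl).elim
    · omega
    · omega
  · intro u hu huS
    rw [hm, not_or, not_or, not_or] at huS
    obtain ⟨a, b, i, j, k, l⟩ := h4 u hu huS.1 huS.2.1 huS.2.2.1 huS.2.2.2
    refine ⟨a, b, fun p hp hk => ?_⟩
    rcases (hm p).1 hp with rfl | rfl | rfl | rfl
    · rw [ps]; exact i (h.kadj h.lv (by omega) hk.symm).symm
    · rw [pr]; exact j (h.kadj h.lv (by omega) hk.symm).symm
    · rw [pc]; exact k hk
    · rw [pd]; exact l hk

/-- version with triple conditions. -/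
theorem EndS.four' (h : EndS H M U L lev s q c d c' d') {r : W} (sr : H.Adj s r) (rc : H.Adj r c)
    (h0 : ∀ u ∈ U, H.Adj u s → H.Adj u r → H.Adj u c → H.Adj u d → False)
    (hh : ∀ σ ρ, σ ≠ ρ → ρ ∈ L r → ∃ γ ∈ L c, ∃ κ ∈ L d, ρ ≠ γ ∧ γ ≠ κ ∧ (H.Adj r d → ρ ≠ κ) ∧
      (∀ u ∈ U, H.Adj u s → H.Adj u r → H.Adj u c → γ ∉ bad (L u) σ ρ) ∧
      (∀ u ∈ U, H.Adj u s → H.Adj u r → H.Adj u d → κ ∉ bad (L u) σ ρ) ∧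
      (∀ u ∈ U, u ≠ r → H.Adj u s → H.Adj u c → H.Adj u d → κ ∉ bad (L u) σ γ) ∧
      (∀ u ∈ U, H.Adj u r → H.Adj u c → H.Adj u d → κ ∉ bad (L u) ρ γ) ∧
      (H.Adj r c' → κ ∉ bad (L c') ρ γ) ∧ (H.Adj r d' → κ ∉ bad (L d') ρ γ)) : False := by
  refine h.four sr rc (fun σ ρ hne hρ => ?_)
  obtain ⟨γ, hγ, κ, hκ, h1, h2, h3, a1, a2, a3, a4, a5, a6⟩ := hh σ ρ hne hρ
  refine ⟨γ, hγ, κ, hκ, h1, h2, h3, fun u hu us ur uc ud => ?_⟩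
  have nus : u = c' ∨ u = d' → ¬ H.Adj u s := by
    rintro (rfl | rfl) hh
    · exact h.sx h.qc' hh.symm
    · exact h.sx h.qd' hh.symm
  by_cases u1 : u = c'
  · have := nus (Or.inl u1)
    exact ok4 (fun h => (this h).elim) (fun h => (this h).elim) (fun h => (this h).elim)
      (fun h => (this h).elim) (fun hh _ _ => by rw [u1] at hh ⊢; exact a5 hh.symm)
  by_cases u2 : u = d'
  · have := nus (Or.inr u2)
    exact ok4 (fun h => (this h).elim) (fun h => (this h).elim) (fun h => (this h).elim)
      (fun h => (this h).elim) (fun hh _ _ => by rw [u2] at hh ⊢; exact a6 hh.symm)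
  have kc : KQ H c d c' d' u c → H.Adj u c := by
    rintro (hh | ⟨hh, _⟩ | ⟨hh, _⟩ | ⟨hh, _⟩ | ⟨hh, _⟩)
    exacts [hh, (uc hh).elim, (u1 hh).elim, (ud hh).elim, (u2 hh).elim]
  have kd : KQ H c d c' d' u d → H.Adj u d := by
    rintro (hh | ⟨hh, _⟩ | ⟨hh, _⟩ | ⟨hh, _⟩ | ⟨hh, _⟩)
    exacts [hh, (uc hh).elim, (u1 hh).elim, (ud hh).elim, (u2 hh).elim]
  exact ok4 (fun i j k l => h0 u hu i j (kc k) (kd l)) (fun i j k => a1 u hu i j (kc k))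
    (fun i j k => a2 u hu i j (kd k)) (fun i j k => a3 u hu ur i (kc j) (kd k))
    (fun i j k => a4 u hu i (kc j) (kd k))

/-- uniqueness of the common neighbour of `s, r, c`. -/
theorem EndS.uniq (h : EndS H M U L lev s q c d c' d') {r : W} (sr : H.Adj s r) (rc : H.Adj r c) :
    ∀ u ∈ U, ∀ u' ∈ U, (H.Adj u s ∧ H.Adj u r ∧ H.Adj u c) →
      (H.Adj u' s ∧ H.Adj u' r ∧ H.Adj u' c) → u = u' := by
  rintro u hu u' hu' ⟨a1, a2, a3⟩ ⟨b1, b2, b3⟩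
  by_contra hn
  have rU := h.rU sr rc h.qc
  obtain ⟨y, hy, y1, y2, y3, y4⟩ := h.dg r rU (h.l2 sr rc h.qc) s u c u'
  exact h.toStar.w4 rU h.sU hu h.cU (Or.inl hu') sr.symm a2.symm rc b2.symm hy a1.symm a3 b3.symm b1
      (h.sne h.qc) hn y1 y2 y3 y4

theorem Env.uniqF (h : Env H M U L q c d c' d') (P : W → Prop) :
    ∀ u ∈ U, ∀ u' ∈ U, (P u ∧ H.Adj u c ∧ H.Adj u d) →
      (P u' ∧ H.Adj u' c ∧ H.Adj u' d) → u = u' := by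
  rintro u hu u' hu' ⟨a1, a2, a3⟩ ⟨b1, b2, b3⟩
  exact h.F1 (fun e => h.qU (e ▸ hu)) (fun e => h.qU (e ▸ hu')) a2 a3 b2 b3

theorem EndS.EA (h : EndS H M U L lev s q c d c' d') {r : W} (sr : H.Adj s r) (rc : H.Adj r c)
    (rd : H.Adj r d) : ∃ w, H.Adj w s ∧ H.Adj w r ∧ H.Adj w d := by
  by_contra hno
  push Not at hno
  have rq := h.rq sr rc h.qc
  have hf : ∀ u ∈ U, H.Adj u c → H.Adj u d → u = r := fun u hu uc ud =>
    h.F1 (fun e => h.qU (e ▸ hu)) rq uc ud rc rd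
  refine h.four' sr rc (fun u hu _ ur uc ud => ur.ne (hf u hu uc ud)) (fun σ ρ hne hρ => ?_)
  obtain ⟨γ, hγ, g1, g2⟩ := pickU (h.L5 c h.cU) h.L5 _ (h.uniq sr rc) ρ σ ρ
  obtain ⟨κ, hκ, k1⟩ := pick1 (A := L d) (B := {γ, ρ}) (by
    have := card2 γ ρ; have := h.L5 d h.dU; omega)
  simp only [Finset.mem_insert, Finset.mem_singleton, not_or] at k1
  refine ⟨γ, hγ, κ, hκ, g1.symm, fun e => k1.1 e.symm, fun _ e => k1.2 e.symm,
    fun u hu i j k => g2 u hu ⟨i, j, k⟩, fun u hu i j k => (hno u i j k).elim,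
    fun u hu n i j k => (n (hf u hu j k)).elim, fun u hu i j k => (i.ne (hf u hu j k)).elim, ?_, ?_⟩
  · intro e; exact (h.toEnv.F0 rq rc rd e).elim
  · intro e; exact (h.toEnv.rot.rot.rot.F0 rq e rc rd).elim

theorem EndS.caseC (h : EndS H M U L lev s q c d c' d') {r : W} (sr : H.Adj s r) (rc : H.Adj r c)
    (rd : ¬ H.Adj r d) (rc' : ¬ H.Adj r c') (rd' : ¬ H.Adj r d')
    (h1 : ∀ u, H.Adj u s → H.Adj u r → ¬ H.Adj u d)
    (h2 : ∀ u, H.Adj u s → H.Adj u c → ¬ H.Adj u d) : False := by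
  refine h.four' sr rc (fun u hu us ur uc ud => h1 u us ur ud) (fun σ ρ hne hρ => ?_)
  obtain ⟨γ, hγ, g1, g2⟩ := pickU (h.L5 c h.cU) h.L5 _ (h.uniq sr rc) ρ σ ρ
  obtain ⟨κ, hκ, k1, k2⟩ := pickU (h.L5 d h.dU) h.L5 _ (h.uniqF (fun u => H.Adj u r)) γ ρ γ
  exact ⟨γ, hγ, κ, hκ, g1.symm, k1.symm, fun e => (rd e).elim,
    fun u hu i j k => g2 u hu ⟨i, j, k⟩, fun u hu i j k => (h1 u i j k).elim,
    fun u hu n i j k => (h2 u i j k).elim, fun u hu i j k => k2 u hu ⟨i, j, k⟩,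
    fun e => (rc' e).elim, fun e => (rd' e).elim⟩

theorem EndS.caseA (h : EndS H M U L lev s q c d c' d') {r : W} (sr : H.Adj s r) (rc : H.Adj r c)
    (rd' : H.Adj r d') (hd : ∀ u, H.Adj u s → ¬ H.Adj u d) : False := by
  obtain ⟨w2, a1, a2, a3⟩ := h.refl.EA sr rc rd'
  obtain ⟨w1, b1, b2, b3⟩ := h.refl.swap.EA sr rd' rc
  have rq := h.rq sr rc h.qc
  have w1q := h.rq b1.symm b3 h.qc
  have w2q := h.rq a1.symm a3 h.qd'
  have rU := h.rU sr rc h.qc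
  have w1U := h.rU b1.symm b3 h.qc
  have w2U := h.rU a1.symm a3 h.qd'
  have hw : w1 ≠ w2 := by
    rintro rfl
    exact b2.ne (h.toEnv.refl.F1 w1q rq b3 a3 rc rd')
  have nr : ∀ y, H.Adj r y → y = s ∨ y = w1 ∨ y = c ∨ y = d' ∨ y = w2 := by
    intro y hy
    by_contra hn
    simp only [not_or] at hn
    obtain ⟨n1, n2, n3, n4, n5⟩ := hn
    exact h.toStar.w5 rU h.sU w1U h.cU h.d'U w2U sr.symm b2.symm rc rd' a2.symm hy b1.symm b3
      h.r4.symm a3.symm a1 (h.sne h.qc) (h.sne h.qd') (h.rne b1.symm b3 h.qc h.qd') hw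
      (h.rne a1.symm a3 h.qd' h.qc).symm n1 n2 n3 n4 n5
  have nf : ∀ u, H.Adj u r → H.Adj u c → ¬ H.Adj u d := by
    intro u ur uc ud
    rcases nr u ur.symm with rfl | rfl | rfl | rfl | rfl
    · exact h.sx h.qc uc
    · exact hd _ b1 ud
    · exact uc.ne rfl
    · exact h.toEnv.rot.ncc ud.symm
    · exact hd _ a1 ud
  refine h.four' sr rc (fun u hu us ur uc ud => hd u us ud) (fun σ ρ hne hρ => ?_)
  obtain ⟨γ, hγ, g1, g2⟩ := pickU (h.L5 c h.cU) h.L5 _ (h.uniq sr rc) ρ σ ρ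
  obtain ⟨κ, hκ, k1, k2⟩ := pickU (h.L5 d h.dU) h.L5 (fun u => u = d')
    (fun u _ u' _ e e' => e.trans e'.symm) γ ρ γ
  exact ⟨γ, hγ, κ, hκ, g1.symm, k1.symm, fun e => (hd r sr.symm e).elim,
    fun u hu i j k => g2 u hu ⟨i, j, k⟩, fun u hu i j k => (hd u i k).elim,
    fun u hu n i j k => (hd u i k).elim, fun u hu i j k => (nf u i j k).elim,
    fun e => (h.toEnv.rot.rot.F0 rq e rd' rc).elim, fun e => k2 d' h.d'U rfl⟩

theorem bad_empty {A : Finset ℕ} {x y : ℕ} (h : y ∉ A) : bad A x y = ∅ := by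
  unfold bad; rw [if_neg]; exact fun h' => h h'.2.1

theorem bad_empty' {A : Finset ℕ} {x y : ℕ} (h : x ∉ A) : bad A x y = ∅ := by
  unfold bad; rw [if_neg]; exact fun h' => h h'.1

theorem bad_self {A : Finset ℕ} {x y : ℕ} : x ∉ bad A x y := by
  unfold bad; split_ifs <;> simp

/-- combinatorial lemma. -/
theorem comb {A D F G : Finset ℕ} (hA : A.card = 5) (hD : D.card = 5) (hF : F.card = 5)
    (hG : G.card = 5) (ρ : ℕ) :
    ∃ γ ∈ A, γ ≠ ρ ∧ ∃ κ ∈ D, κ ≠ γ ∧ κ ∉ bad F ρ γ ∧ κ ∉ bad G ρ γ := by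
  have pk : ∀ γ (B : Finset ℕ), B.card ≤ 3 → ∃ κ ∈ D, κ ≠ γ ∧ κ ∉ B := by
    intro γ B hB
    obtain ⟨κ, h1, h2⟩ := pick1 (A := D) (B := insert γ B) (by
      have := Finset.card_insert_le γ B; omega)
    rw [Finset.mem_insert, not_or] at h2
    exact ⟨κ, h1, h2.1, h2.2⟩
  obtain ⟨γ₀, hγ₀, hn⟩ := pick1 (A := A) (B := {ρ}) (by rw [Finset.card_singleton]; omega)
  simp only [Finset.mem_singleton] at hn
  by_cases h1 : ∃ γ ∈ A, γ ≠ ρ ∧ (bad F ρ γ = ∅ ∨ bad G ρ γ = ∅)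
  · obtain ⟨γ, hγ, hγρ, he | he⟩ := h1
    · obtain ⟨κ, h1, h2, h3⟩ := pk γ _ (bad_card hG ρ γ)
      exact ⟨γ, hγ, hγρ, κ, h1, h2, by simp [he], h3⟩
    · obtain ⟨κ, h1, h2, h3⟩ := pk γ _ (bad_card hF ρ γ)
      exact ⟨γ, hγ, hγρ, κ, h1, h2, h3, by simp [he]⟩
  · push Not at h1
    have key : ∀ F : Finset ℕ, F.card = 5 → (∀ γ ∈ A, γ ≠ ρ → bad F ρ γ ≠ ∅) → F = insert ρ A := by
      intro F hF hh
      symm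
      apply Finset.eq_of_subset_of_card_le
      · intro x hx
        by_cases e : x = ρ
        · by_contra hx'
          exact hh γ₀ hγ₀ hn (bad_empty' (e ▸ hx'))
        · by_contra hx'
          exact hh x ((Finset.mem_insert.1 hx).resolve_left e) e (bad_empty hx')
      · rw [hF, ← hA]; exact Finset.card_le_card (Finset.subset_insert _ _)
    have e1 := key F hF (fun γ a b => (h1 γ a b).1.ne_empty)
    have e2 := key G hG (fun γ a b => (h1 γ a b).2.ne_empty)
    obtain ⟨κ, i, j, k⟩ := pk γ₀ _ (bad_card hF ρ γ₀)
    exact ⟨γ₀, hγ₀, hn, κ, i, j, k, by rw [e2, ← e1]; exact k⟩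

theorem EndS.caseB (h : EndS H M U L lev s q c d c' d') {r : W} (sr : H.Adj s r) (rc : H.Adj r c)
    (rc' : H.Adj r c') (hd : ∀ u, H.Adj u s → ¬ H.Adj u d) : False := by
  have rq := h.rq sr rc h.qc
  by_cases hw : ∃ w, H.Adj w s ∧ H.Adj w r ∧ H.Adj w c
  · obtain ⟨w, w1, w2, w3⟩ := hw
    have wq := h.rq w1.symm w3 h.qc
    have wc' : ¬ H.Adj w c' := fun e => h.F6 rq wq (fun e => h.qU (e ▸ h.sU)) h.sU (h.sne h.qc)
      (h.sne h.qc') w2.symm rc rc' w3 e sr w1.symm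
    by_cases wd' : H.Adj w d'
    · exact h.caseA w1.symm w3 wd' hd
    · exact h.caseC w1.symm w3 (hd w w1) wc' wd' (fun u i _ => hd u i) (fun u i _ => hd u i)
  push Not at hw
  refine h.four' sr rc (fun u hu us ur uc ud => hd u us ud) (fun σ ρ hne hρ => ?_)
  have nrd' : ¬ H.Adj r d' := fun e => h.toEnv.rot.rot.F0 rq rc' e rc
  by_cases hf : ∃ u ∈ U, H.Adj u r ∧ H.Adj u c ∧ H.Adj u d
  · obtain ⟨f, hfU, f1, f2, f3⟩ := hf
    obtain ⟨γ, hγ, g1, κ, hκ, k1, k2, k3⟩ := comb (h.L5 c h.cU) (h.L5 d h.dU) (h.L5 f hfU)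
      (h.L5 c' h.c'U) ρ
    exact ⟨γ, hγ, κ, hκ, g1.symm, k1.symm, fun e => (hd r sr.symm e).elim,
      fun u hu i j k => (hw u i j k).elim, fun u hu i j k => (hd u i k).elim,
      fun u hu n i j k => (hd u i k).elim,
      fun u hu i j k => by
        rw [h.toEnv.uniqF (fun u => H.Adj u r) u hu f hfU ⟨i, j, k⟩ ⟨f1, f2, f3⟩]; exact k2,
      fun e => k3, fun e => (nrd' e).elim⟩
  · obtain ⟨γ, hγ, g1, κ, hκ, k1, k2, k3⟩ := comb (h.L5 c h.cU) (h.L5 d h.dU) (h.L5 c' h.c'U)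
      (h.L5 c' h.c'U) ρ
    exact ⟨γ, hγ, κ, hκ, g1.symm, k1.symm, fun e => (hd r sr.symm e).elim,
      fun u hu i j k => (hw u i j k).elim, fun u hu i j k => (hd u i k).elim,
      fun u hu n i j k => (hd u i k).elim,
      fun u hu i j k => (hf ⟨u, hu, i, j, k⟩).elim,
      fun e => k3, fun e => (nrd' e).elim⟩

theorem EndS.unc (h : EndS H M U L lev s q c d c' d') {r : W} (sr : H.Adj s r) (rc : H.Adj r c)
    (hd : ∀ u, H.Adj u s → ¬ H.Adj u d) : False := by
  by_cases a : H.Adj r c'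
  · exact h.caseB sr rc a hd
  by_cases b : H.Adj r d'
  · exact h.caseA sr rc b hd
  exact h.caseC sr rc (hd r sr.symm) a b (fun u i _ => hd u i) (fun u i _ => hd u i)

/-- every crossing vertex is covered. -/
theorem EndS.cov (h : EndS H M U L lev s q c d c' d') : ∃ u, H.Adj s u ∧ H.Adj u d := by
  by_contra hn
  push Not at hn
  have hd : ∀ u, H.Adj u s → ¬ H.Adj u d := fun u i => hn u i.symm
  have hc : ∀ u, H.Adj u s → ¬ H.Adj u c := fun u i j => h.unc i.symm j hd
  have hc' : ∀ u, H.Adj u s → ¬ H.Adj u c' := fun u i j => h.rot.swap.unc i.symm j hd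
  obtain ⟨r, sr, hr⟩ := h.lv.down s (h.UM _ h.sU) (fun e => h.qU (e ▸ h.sU))
  obtain ⟨x, rx, hx⟩ := h.lv.down r (h.inM _ _ sr) (fun e => by
    have := h.lv.zero; rw [← e] at this; have := h.s3; omega)
  obtain ⟨y, xy, hy⟩ := h.lv.down x (h.inM _ _ rx) (fun e => by
    have := h.lv.zero; rw [← e] at this; have := h.s3; omega)
  have hyq : y = q := h.lv.eq_q (h.inM _ _ xy) (by have := h.s3; omega)
  rw [hyq] at xy
  rcases (h.nq x).1 xy.symm with rfl | rfl | rfl | rfl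
  · exact hc r sr.symm rx
  · exact hd r sr.symm rx
  · exact hc' r sr.symm rx
  · exact h.rot.rot.rot.unc sr rx hc

theorem EndS.noB (h : EndS H M U L lev s q c d c' d') {r : W} (sr : H.Adj s r) (rc : H.Adj r c)
    (rc' : H.Adj r c') : False := by
  obtain ⟨u, su, ud⟩ := h.cov
  obtain ⟨v, sv, vd⟩ := h.rot.rot.cov
  have rq := h.rq sr rc h.qc
  have ur : u ≠ r := by rintro rfl; exact h.F0 rq rc ud rc'
  have vr : v ≠ r := by rintro rfl; exact h.toEnv.rot.rot.F0 rq rc' vd rc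
  refine h.toEnv.five (h.rne sr rc h.qc h.qd) (h.rne sr rc h.qc h.qd') rc rc' (Z := {u, s, v})
    (Conn.insert (Conn.insert (Conn.singleton v) ⟨v, rfl, sv⟩) ⟨s, by simp, su.symm⟩)
    ?_ ?_ ?_ ?_ ?_ ⟨s, by simp, sr.symm⟩ ⟨u, by simp, ud.symm⟩ ⟨v, by simp, vd.symm⟩
  · rintro (e | e | e)
    exacts [h.rne su ud h.qd h.qc e.symm, h.sne h.qc e.symm, h.rne sv vd h.qd' h.qc e.symm]
  · rintro (e | e | e)
    exacts [h.rne su ud h.qd h.qc' e.symm, h.sne h.qc' e.symm, h.rne sv vd h.qd' h.qc' e.symm]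
  · rintro (e | e | e)
    exacts [h.rne su ud h.qd h.qd e.symm, h.sne h.qd e.symm, h.rne sv vd h.qd' h.qd e.symm]
  · rintro (e | e | e)
    exacts [h.rne su ud h.qd h.qd' e.symm, h.sne h.qd' e.symm, h.rne sv vd h.qd' h.qd' e.symm]
  · rintro (e | e | e)
    exacts [ur e.symm, sr.ne e.symm, vr e.symm]

end CN
end PartG

open Set
noncomputable section PartG2
namespace CN
variable {W : Type} {H : SimpleGraph W}
variable {M : Set W} {U : Finset W} {L : W → Finset ℕ} {q c d c' d' : W} {lev : W → ℕ} {s : W}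

theorem comb2 {A D F : Finset ℕ} (hA : A.card = 5) (hD : D.card = 5) (hF : F.card = 5) {σ ρ : ℕ}
    (hne : σ ≠ ρ) : ∃ γ ∈ A, γ ≠ ρ ∧ ∃ κ ∈ D, κ ≠ γ ∧ ∃ a b, (σ ∈ F → σ = a ∨ σ = b) ∧
      (ρ ∈ F → ρ = a ∨ ρ = b) ∧ (γ ∈ F → γ = a ∨ γ = b) ∧ (κ ∈ F → κ = a ∨ κ = b) := by
  have one : ∀ τ, τ ∈ F → (σ ∈ F → σ = τ) → (ρ ∈ F → ρ = τ) → ∃ γ ∈ A, γ ≠ ρ ∧ ∃ κ ∈ D, κ ≠ γ ∧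
      ∃ a b, (σ ∈ F → σ = a ∨ σ = b) ∧
      (ρ ∈ F → ρ = a ∨ ρ = b) ∧ (γ ∈ F → γ = a ∨ γ = b) ∧ (κ ∈ F → κ = a ∨ κ = b) := by
    intro τ hτ h1 h2
    have : ∃ κ ∈ D, κ = τ ∨ κ ∉ F := by
      by_cases hD' : τ ∈ D
      · exact ⟨τ, hD', Or.inl rfl⟩
      · by_contra hn
        push Not at hn
        have : D ⊆ F := fun x hx => (hn x hx).2
        have := Finset.eq_of_subset_of_card_le this (by omega)
        exact hD' (this ▸ hτ)
    obtain ⟨κ, hκ, hk⟩ := this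
    obtain ⟨γ, hγ, hn⟩ := pick1 (A := A) (B := {ρ, κ}) (by have := card2 ρ κ; omega)
    simp only [Finset.mem_insert, Finset.mem_singleton, not_or] at hn
    refine ⟨γ, hγ, hn.1, κ, hκ, fun e => hn.2 e.symm, τ, γ, fun h => Or.inl (h1 h),
      fun h => Or.inl (h2 h), fun _ => Or.inr rfl, fun h => Or.inl (hk.resolve_right (fun e => e h))⟩
  by_cases h1 : σ ∈ F
  · by_cases h2 : ρ ∈ F
    · have hb : (F \ {σ, ρ}).card = 3 := by
        rw [Finset.card_sdiff_of_subset (by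
          intro z hz; simp only [Finset.mem_insert, Finset.mem_singleton] at hz
          rcases hz with rfl | rfl <;> assumption), Finset.card_pair hne]; omega
      have pk : ∀ (A : Finset ℕ), A.card = 5 → ∀ x, ∃ γ ∈ A, γ ≠ x ∧ (γ ∈ F → γ = σ ∨ γ = ρ) := by
        intro A hA x
        obtain ⟨γ, hγ, hn⟩ := pick1 (A := A) (B := insert x (F \ {σ, ρ})) (by
          have := Finset.card_insert_le x (F \ {σ, ρ}); omega)
        simp only [Finset.mem_insert, Finset.mem_sdiff, Finset.mem_singleton, not_or, not_and,
          not_not] at hn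
        exact ⟨γ, hγ, hn.1, fun h => by have := hn.2 h; tauto⟩
      obtain ⟨γ, g1, g2, g3⟩ := pk A hA ρ
      obtain ⟨κ, k1, k2, k3⟩ := pk D hD γ
      exact ⟨γ, g1, g2, κ, k1, k2, σ, ρ, fun _ => Or.inl rfl, fun _ => Or.inr rfl, g3, k3⟩
    · exact one σ h1 (fun _ => rfl) (fun h => (h2 h).elim)
  · by_cases h2 : ρ ∈ F
    · exact one ρ h2 (fun h => (h1 h).elim) (fun _ => rfl)
    · obtain ⟨γ, hγ, hn⟩ := pick1 (A := A) (B := {ρ}) (by rw [Finset.card_singleton]; omega)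
      obtain ⟨κ, hκ, hn'⟩ := pick1 (A := D) (B := {γ}) (by rw [Finset.card_singleton]; omega)
      rw [Finset.mem_singleton] at hn hn'
      exact ⟨γ, hγ, hn, κ, hκ, hn', γ, κ, fun h => (h1 h).elim, fun h => (h2 h).elim,
        fun _ => Or.inl rfl, fun _ => Or.inr rfl⟩

theorem EndS.AC (h : EndS H M U L lev s q c d c' d') {r w : W} (sr : H.Adj s r) (rc : H.Adj r c)
    (rd : H.Adj r d) (ws : H.Adj w s) (wr : H.Adj w r) (wc : H.Adj w c) : H.Adj w d' := by
  by_contra wd'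
  have rq := h.rq sr rc h.qc
  have wq := h.rq ws.symm wc h.qc
  have rU := h.rU sr rc h.qc
  have wd : ¬ H.Adj w d := fun e => wr.ne (h.toEnv.F1 wq rq wc e rc rd)
  have wc' : ¬ H.Adj w c' := fun e => h.noB ws.symm wc e
  obtain ⟨z, sz, zd⟩ := h.rot.rot.cov
  have zq := h.rq sz zd h.qd'
  have hu : ∀ u ∈ U, H.Adj u s → H.Adj u w → H.Adj u d → u = r := by
    intro u hu us uw ud
    by_contra hn
    refine h.hP.k33u (x := s) (y := w) (z := d) (u := r) (v := u) (C := {c, q, d', z})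
      (Conn.insert (Conn.insert (Conn.insert (Conn.singleton z) ⟨z, rfl, zd.symm⟩)
        ⟨d', by simp, h.qd'⟩) ⟨q, by simp, h.qc.symm⟩)
      ws.ne' (h.sne h.qd) (h.rne ws.symm wc h.qc h.qd) (Ne.symm hn) sr wr rd.symm us.symm uw.symm
      ud.symm ?_ ?_ ?_ ?_ ?_ ⟨z, by simp, sz⟩ ⟨c, by simp, wc⟩ ⟨c, by simp, h.r1.symm⟩
    · rintro (e | e | e | e)
      exacts [h.sne h.qc e, h.qU (e ▸ h.sU), h.sne h.qd' e, sz.ne e]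
    · rintro (e | e | e | e)
      exacts [wc.ne e, wq e, h.rne ws.symm wc h.qc h.qd' e, wd' (e ▸ zd)]
    · rintro (e | e | e | e)
      exacts [h.n1 e.symm, h.qd.ne e.symm, h.n5 e, h.rne sz zd h.qd' h.qd e.symm]
    · rintro (e | e | e | e)
      exacts [rc.ne e, rq e, h.rne sr rc h.qc h.qd' e, h.toEnv.rot.rot.rot.F0 rq (e ▸ zd) rc rd]
    · rintro (e | e | e | e)
      exacts [h.sx h.qc (e ▸ us.symm), h.qU (e ▸ hu), h.sx h.qd' (e ▸ us.symm),
        h.rot.noB us.symm ud (e ▸ zd)]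
  refine h.four ws.symm wc (fun σ ρ hne hρ => ?_)
  obtain ⟨γ, hγ, g1, κ, hκ, k1, a, b, h1, h2, h3, h4⟩ :=
    comb2 (h.L5 c h.cU) (h.L5 d h.dU) (h.L5 r rU) hne
  refine ⟨γ, hγ, κ, hκ, g1.symm, k1.symm, fun e => (wd e).elim, fun u huU us uw uc ud => ?_⟩
  by_cases ur : u = r
  · rw [ur]
    exact ⟨a, b, fun _ => h1, fun _ => h2, fun _ => h3, fun _ => h4⟩
  by_cases u1 : u = c'
  · rw [u1]
    exact ⟨γ, κ, fun e => (h.sx h.qc' e.symm).elim, fun e => (wc' e.symm).elim,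
      fun _ _ => Or.inl rfl, fun _ _ => Or.inr rfl⟩
  by_cases u2 : u = d'
  · rw [u2]
    exact ⟨γ, κ, fun e => (h.sx h.qd' e.symm).elim, fun e => (wd' e.symm).elim,
      fun _ _ => Or.inl rfl, fun _ _ => Or.inr rfl⟩
  have kc : KQ H c d c' d' u c → H.Adj u c := by
    rintro (hh | ⟨hh, _⟩ | ⟨hh, _⟩ | ⟨hh, _⟩ | ⟨hh, _⟩)
    exacts [hh, (uc hh).elim, (u1 hh).elim, (ud hh).elim, (u2 hh).elim]
  have kd : KQ H c d c' d' u d → H.Adj u d := by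
    rintro (hh | ⟨hh, _⟩ | ⟨hh, _⟩ | ⟨hh, _⟩ | ⟨hh, _⟩)
    exacts [hh, (uc hh).elim, (u1 hh).elim, (ud hh).elim, (u2 hh).elim]
  have ncd : KQ H c d c' d' u c → KQ H c d c' d' u d → False := fun i j =>
    ur (h.toEnv.F1 (fun e => h.qU (e ▸ huU)) rq (kc i) (kd j) rc rd)
  exact ok4 (fun _ _ i j => (ncd i j).elim)
    (fun i j k => (ur (h.uniq ws.symm wc u huU r rU ⟨i, j, kc k⟩ ⟨sr.symm, wr.symm, rc⟩)).elim)
    (fun i j k => (ur (hu u huU i j (kd k))).elim) (fun _ i j => (ncd i j).elim)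
    (fun _ i j => (ncd i j).elim)

theorem EndS.A1 (h : EndS H M U L lev s q c d c' d') {r : W} (sr : H.Adj s r) (rc : H.Adj r c)
    (rd : H.Adj r d) : ∃ w, H.Adj w s ∧ H.Adj w r ∧ H.Adj w c ∧ H.Adj w d' := by
  obtain ⟨w, w1, w2, w3⟩ := h.swap.EA sr rd rc
  exact ⟨w, w1, w2, w3, h.AC sr rc rd w1 w2 w3⟩

theorem EndS.w4s (h : EndS H M U L lev s q c d c' d') {a v e v' : W} (sa : H.Adj s a)
    (sv : H.Adj s v) (se : H.Adj s e) (sv' : H.Adj s v') (ac : H.Adj a c) (vd : H.Adj v d)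
    (ec : H.Adj e c') (vd' : H.Adj v' d') (av : H.Adj a v) (ve : H.Adj v e)
    (ev' : H.Adj e v') (v'a : H.Adj v' a) : False := by
  obtain ⟨y, sy, y3⟩ := h.hy
  have l1 := h.l2 sa ac h.qc
  have l2 := h.l2 sv vd h.qd
  have l3 := h.l2 se ec h.qc'
  have l4 := h.l2 sv' vd' h.qd'
  exact h.toStar.w4 h.sU (h.rU sa ac h.qc) (h.rU sv vd h.qd) (h.rU se ec h.qc')
    (Or.inl (h.rU sv' vd' h.qd')) sa sv se sv' sy av ve ev' v'a
    (fun e => h.noB sa ac (e ▸ ec)) (fun e => h.rot.noB sv vd (e ▸ vd'))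
    (by rintro rfl; omega) (by rintro rfl; omega) (by rintro rfl; omega) (by rintro rfl; omega)

theorem EndS.noA (h : EndS H M U L lev s q c d c' d') {r : W} (sr : H.Adj s r) (rc : H.Adj r c)
    (rd : H.Adj r d) : False := by
  obtain ⟨w1, a1, a2, a3, a4⟩ := h.A1 sr rc rd
  obtain ⟨w2, b1, b2, b3, b4⟩ := h.swap.A1 sr rd rc
  obtain ⟨w3, e1, e2, e3, e4⟩ := h.rot.rot.rot.A1 a1.symm a4 a3
  obtain ⟨w4, f1, f2, f3, f4⟩ := h.rot.rot.refl.A1 b1.symm b4 b3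
  have : w3 = w4 := h.toEnv.rot.rot.F1 (h.rq e1.symm e3 h.qd') (h.rq f1.symm f3 h.qc') e4 e3 f3 f4
  subst this
  obtain ⟨y, sy, y3⟩ := h.hy
  exact h.w4s (a := w1) (v := r) (e := w2) (v' := w3) a1.symm sr b1.symm e1.symm a3 rd b4 e3 a2
    b2.symm f2.symm e2

theorem EndS.nbd (h : EndS H M U L lev s q c d c' d') {r : W} (sr : H.Adj s r) (rc : H.Adj r c) :
    ∃ e, H.Adj e s ∧ H.Adj e r ∧ H.Adj e d := by
  by_contra hn
  push Not at hn
  exact h.caseC sr rc (fun e => h.noA sr rc e) (fun e => h.noB sr rc e)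
    (fun e => h.refl.noA sr rc e) hn (fun u us uc ud => h.noA us.symm uc ud)

theorem EndS.uniqC (h : EndS H M U L lev s q c d c' d') {r r' : W} (sr : H.Adj s r)
    (rc : H.Adj r c) (sr' : H.Adj s r') (rc' : H.Adj r' c) : r = r' := by
  by_contra hn
  obtain ⟨e, e1, e2, e3⟩ := h.nbd sr rc
  obtain ⟨f, f1, f2, f3⟩ := h.refl.nbd sr rc
  refine h.hP.k33v (x := r) (y := s) (z := q) (A := {e, d}) (B := {f, d'}) (C := {c, r'})
    (Conn.insert (Conn.singleton d) ⟨d, rfl, e3⟩) (Conn.insert (Conn.singleton d') ⟨d', rfl, f3⟩)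
    (Conn.insert (Conn.singleton r') ⟨r', rfl, rc'.symm⟩) sr.ne' (h.rq sr rc h.qc)
    (fun e => h.qU (e ▸ h.sU)) ?_ ?_ ?_ ?_ ?_ ?_ ?_ ?_ ?_ ?_ ?_ ?_ ⟨e, by simp, e2.symm⟩
    ⟨f, by simp, f2.symm⟩ ⟨c, by simp, rc⟩ ⟨e, by simp, e1.symm⟩ ⟨f, by simp, f1.symm⟩
    ⟨r', by simp, sr'⟩ ⟨d, by simp, h.qd⟩ ⟨d', by simp, h.qd'⟩ ⟨c, by simp, h.qc⟩
  · rintro w (rfl | rfl) (i | i)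
    exacts [h.rot.noB e1.symm e3 (i ▸ f3), h.rne e1.symm e3 h.qd h.qd' i,
      h.rne f1.symm f3 h.qd' h.qd i.symm, h.n5 i]
  · rintro w (rfl | rfl) (i | i)
    exacts [h.rne e1.symm e3 h.qd h.qc i, h.noA sr' rc' (i ▸ e3), h.n1 i.symm,
      h.rne sr' rc' h.qc h.qd i.symm]
  · rintro w (rfl | rfl) (i | i)
    exacts [h.rne f1.symm f3 h.qd' h.qc i, h.refl.noA sr' rc' (i ▸ f3), h.n3 i.symm,
      h.rne sr' rc' h.qc h.qd' i.symm]
  · rintro (i | i)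
    exacts [e2.ne i.symm, h.rne sr rc h.qc h.qd i]
  · rintro (i | i)
    exacts [f2.ne i.symm, h.rne sr rc h.qc h.qd' i]
  · rintro (i | i)
    exacts [rc.ne i, hn i]
  · rintro (i | i)
    exacts [e1.ne i.symm, h.sne h.qd i]
  · rintro (i | i)
    exacts [f1.ne i.symm, h.sne h.qd' i]
  · rintro (i | i)
    exacts [h.sne h.qc i, sr'.ne i]
  · rintro (i | i)
    exacts [h.rq e1.symm e3 h.qd i.symm, h.qd.ne i]
  · rintro (i | i)
    exacts [h.rq f1.symm f3 h.qd' i.symm, h.qd'.ne i]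
  · rintro (i | i)
    exacts [h.qc.ne i, h.rq sr' rc' h.qc i.symm]

theorem EndS.false (h : EndS H M U L lev s q c d c' d') : False := by
  obtain ⟨r, sr, rc⟩ := h.rot.rot.rot.cov
  obtain ⟨e, e1, e2, e3⟩ := h.nbd sr rc
  obtain ⟨f, f1, f2, f3⟩ := h.refl.nbd sr rc
  obtain ⟨g, g1, g2, g3⟩ := h.rot.nbd e1.symm e3
  obtain ⟨k, k1, k2, k3⟩ := h.rot.rot.rot.refl.nbd f1.symm f3
  have : g = k := h.rot.rot.uniqC g1.symm g3 k1.symm k3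
  subst this
  exact h.w4s sr e1.symm g1.symm f1.symm rc e3 g3 f3 e2.symm g2.symm k2 f2

/-- chain lemma. -/
theorem Env.chain (h : Env H M U L q c d c' d') (lv : Lev H M q lev) :
    ∀ n, ∀ t ∈ U, lev t = n + 3 →
      (∀ r ∈ M, lev r < n + 3 → r ≠ q → r ∈ U ∧ ∀ a b e f, ∃ y, H.Adj r y ∧ y ≠ a ∧ y ≠ b ∧ y ≠ e ∧ y ≠ f) →
      (∃ y, H.Adj t y ∧ 3 ≤ lev y) →
      ∃ r ∈ U, H.Adj t r ∧ lev t = lev r + 1 ∧ FF H U L lev q c d c' d' t r := by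
  intro n
  induction n with
  | zero =>
    intro t tU t3 hd hy
    by_contra hn
    push Not at hn
    have e : EndS H M U L lev t q c d c' d' :=
      { h with
        lv := lv, sU := tU, s3 := t3, hy := hy
        dg := fun r rU r2 => (hd r (h.UM _ rU) (by omega) (fun e => h.qU (e ▸ rU))).2
        no := fun r rU tr r2 => hn r rU tr (by omega) }
    exact e.false
  | succ n ih =>
    intro t tU t3 hd hy
    have tq : t ≠ q := fun e => h.qU (e ▸ tU)
    obtain ⟨s, ts, hs⟩ := lv.down t (h.UM _ tU) tq
    have sq : s ≠ q := by rintro rfl; have := lv.zero; omega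
    obtain ⟨sU, sd⟩ := hd s (h.inM _ _ ts) (by omega) sq
    obtain ⟨r, rU, sr, hr, hF⟩ := ih s sU (by omega) (fun r rM hr => hd r rM (by omega))
      ⟨t, ts.symm, by omega⟩
    exact ⟨s, sU, ts, hs, hF.ext h lv hr (by omega) sr ts (by omega) tU sU rU sd⟩

end CN
end PartG2

open Set
noncomputable section PartH1
namespace CN
variable {W : Type} {H : SimpleGraph W}

/-- list colouring goal for a relation `K`, with `X` precoloured. -/
def Goal (K : W → W → Prop) (U X : Finset W) (φ : W → ℕ) (L : W → Finset ℕ) : Prop :=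
  ∃ f : W → ℕ, (∀ t ∈ X, f t = φ t) ∧ (∀ v ∈ U, v ∉ X → f v ∈ L v) ∧
    ∀ u ∈ U, ∀ v ∈ U, K u v → ¬ (u ∈ X ∧ v ∈ X) → f u ≠ f v

theorem fin {K : W → W → Prop} (hP : Planar H) (hK : ∀ u v, K u v → K v u)
    (U X Sr T : Finset W) (S : Set W) (hS : Conn H S) (hUS : ∀ u ∈ U, u ∈ S → u ∈ Sr)
    (hTU : T ⊆ U) (hTS : ∀ t ∈ T, t ∉ Sr) (hT2 : T.card ≤ 2) (hTN : ∀ t ∈ T, Nb H S t)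
    (hTcl : ∀ s ∈ T, ∀ t ∈ T, s ≠ t → H.Adj s t) (ψ φ : W → ℕ) (L : W → Finset ℕ)
    (hX : ∀ x ∈ X, x ∈ Sr ∨ x ∈ T) (hφ : ∀ x ∈ X, ψ x = φ x)
    (hL : ∀ u ∈ U, u ∉ Sr → u ∉ T → 5 ≤ (L u).card)
    (hK' : ∀ u ∈ U, ∀ v ∈ U, K u v → H.Adj u v ∨
      (Nb H S u ∧ Nb H S v ∧ (u ∈ Sr ∨ u ∈ T ∨ v ∈ Sr ∨ v ∈ T)))
    (hSU : Sr ⊆ U) (hSS : ∀ x ∈ Sr, x ∈ S)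
    (inL : ∀ p, (p ∈ Sr ∨ p ∈ T) → p ∉ X → ψ p ∈ L p)
    (prp : ∀ p, (p ∈ Sr ∨ p ∈ T) → p ∉ X → ∀ v, (v ∈ Sr ∨ v ∈ T) → K p v → ψ p ≠ ψ v)
    (ok : ∀ u ∈ U, u ∉ Sr → u ∉ T → ∃ a b, ∀ p, (p ∈ Sr ∨ p ∈ T) → K u p →
      ¬ (p ∈ T ∧ H.Adj u p) → ψ p ∈ L u → ψ p = a ∨ ψ p = b) :
    Goal K U X φ L := by
  have hpU : ∀ p, (p ∈ Sr ∨ p ∈ T) → p ∈ U := by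
    rintro p (h | h)
    exacts [hSU h, hTU h]
  obtain ⟨f, f1, f2, f3, f4⟩ := finish hP hK U Sr T S hS hUS hTU hTS hT2 hTN hTcl ψ L hL
    (by
      intro u hu h1 h2 v hv h3 h4 h
      rcases hK' u hu v hv h with h | ⟨-, -, h | h | h | h⟩
      exacts [h, (h1 h).elim, (h2 h).elim, (h3 h).elim, (h4 h).elim])
    (by
      intro u hu h1 h2 p hp h
      rcases hK' u hu p (hpU p hp) h with h | h
      · rcases hp with hp | hp
        · exact Or.inl ⟨p, hSS p hp, h⟩
        · exact Or.inr ⟨hp, h⟩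
      · exact Or.inl h.1) ok
  have hf : ∀ p, (p ∈ Sr ∨ p ∈ T) → f p = ψ p := by
    rintro p (h | h)
    exacts [f1 p h, f2 p h]
  refine ⟨f, fun x hx => (hf x (hX x hx)).trans (hφ x hx), fun v hv hvX => ?_, ?_⟩
  · by_cases h : v ∈ Sr ∨ v ∈ T
    · rw [hf v h]; exact inL v h hvX
    · rw [not_or] at h; exact f3 v hv h.1 h.2
  · intro u hu v hv huv hX2
    by_cases h : u ∈ Sr ∨ u ∈ T
    · by_cases h' : v ∈ Sr ∨ v ∈ T
      · rw [hf u h, hf v h']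
        by_cases hx : u ∈ X
        · exact (prp v h' (fun hh => hX2 ⟨hx, hh⟩) u h (hK _ _ huv)).symm
        · exact prp u h hx v h' huv
      · rw [not_or] at h'
        exact (f4 v hv h'.1 h'.2 u hu (hK _ _ huv)).symm
    · rw [not_or] at h
      exact f4 u hu h.1 h.2 v hv huv

open Classical in
theorem glue {K K1 K2 : W → W → Prop} {U U1 U2 X Y : Finset W} {C : Set W} {φ : W → ℕ}
    {L : W → Finset ℕ} (hU1 : ∀ u, u ∈ U1 ↔ u ∈ U ∧ u ∉ C)
    (hU2 : ∀ u, u ∈ U2 ↔ (u ∈ U ∧ u ∈ C) ∨ u ∈ Y) (hXC : ∀ x ∈ X, x ∉ C) (hYC : ∀ y ∈ Y, y ∉ C)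
    (hK : ∀ u ∈ U, ∀ v ∈ U, K u v → (u ∉ C ∧ v ∉ C ∧ K1 u v) ∨
      (u ∈ U2 ∧ v ∈ U2 ∧ K2 u v ∧ ¬ (u ∈ Y ∧ v ∈ Y)))
    (h1 : Goal K1 U1 X φ L) (h2 : ∀ f, Goal K2 U2 Y f L) : Goal K U X φ L := by
  obtain ⟨f, f1, f2, f3⟩ := h1
  obtain ⟨g, g1, g2, g3⟩ := h2 f
  set k : W → ℕ := fun u => if u ∈ C then g u else f u with hk
  have kf : ∀ u, u ∉ C → k u = f u := fun u hu => by simp [hk, hu]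
  have kg : ∀ u ∈ U2, k u = g u := by
    intro u hu
    by_cases h : u ∈ C
    · simp [hk, h]
    · rw [kf u h]
      exact (g1 u (((hU2 u).1 hu).resolve_left (fun hh => h hh.2))).symm
  clear_value k
  refine ⟨k, fun t ht => (kf t (hXC t ht)).trans (f1 t ht), fun v hv hvX => ?_, ?_⟩
  · by_cases h : v ∈ C
    · have := (hU2 v).2 (Or.inl ⟨hv, h⟩)
      rw [kg v this]
      exact g2 v this (fun hh => hYC v hh h)
    · rw [kf v h]
      exact f2 v ((hU1 v).2 ⟨hv, h⟩) hvX
  · intro u hu v hv huv hx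
    rcases hK u hu v hv huv with ⟨a, b, e⟩ | ⟨a, b, e, e'⟩
    · rw [kf u a, kf v b]
      exact f3 u ((hU1 u).2 ⟨hu, a⟩) v ((hU1 v).2 ⟨hv, b⟩) e hx
    · rw [kg u a, kg v b]
      exact g3 u a v b e e'

open Classical in
/-- colour one further vertex at the end. -/
theorem del {K K' : W → W → Prop} {U X : Finset W} {φ : W → ℕ} {L : W → Finset ℕ}
    (hs : ∀ u v, K u v → K v u) {v : W} (hvX : v ∉ X) (hL : 5 ≤ (L v).card) {a b e f : W}
    (irr : ¬ K v v) (hv : ∀ y ∈ U, K v y → y = a ∨ y = b ∨ y = e ∨ y = f)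
    (hK : ∀ x ∈ U, x ≠ v → ∀ y ∈ U, y ≠ v → K x y → K' x y)
    (h : Goal K' (U.erase v) X φ L) : Goal K U X φ L := by
  obtain ⟨g, g1, g2, g3⟩ := h
  obtain ⟨γ, hγ, hn⟩ := pick1 (A := L v) (B := {g a, g b, g e, g f}) (by
    have := card4 (g a) (g b) (g e) (g f); omega)
  simp only [Finset.mem_insert, Finset.mem_singleton, not_or] at hn
  set k : W → ℕ := fun u => if u = v then γ else g u with hk
  have kv : k v = γ := by simp [hk]
  have kg : ∀ u, u ≠ v → k u = g u := fun u hu => by simp [hk, hu]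
  clear_value k
  have key : ∀ y ∈ U, K v y → k v ≠ k y := by
    intro y hy hvy
    have hne : y ≠ v := by rintro rfl; exact irr hvy
    rw [kv, kg y hne]
    rcases hv y hy hvy with h | h | h | h <;> rw [h]
    exacts [hn.1, hn.2.1, hn.2.2.1, hn.2.2.2]
  refine ⟨k, fun t ht => (kg t (by rintro rfl; exact hvX ht)).trans (g1 t ht), fun u hu huX => ?_, ?_⟩
  · by_cases h : u = v
    · rw [h, kv]; exact hγ
    · rw [kg u h]; exact g2 u (Finset.mem_erase.2 ⟨h, hu⟩) huX
  · intro x hx y hy hxy hX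
    by_cases h1 : x = v
    · rw [h1] at hxy ⊢; exact key y hy hxy
    · by_cases h2 : y = v
      · rw [h2] at hxy ⊢; exact (key x hx (hs _ _ hxy)).symm
      · rw [kg x h1, kg y h2]
        exact g3 x (Finset.mem_erase.2 ⟨h1, hx⟩) y (Finset.mem_erase.2 ⟨h2, hy⟩)
          (hK x hx h1 y hy h2 hxy) hX

theorem Planar.deltaF (hP : Planar H) {A P : Set W} (hA : Conn H A) (hAP : ∀ a ∈ A, a ∉ P)
    {Y : Finset W} (h3 : Y.card ≤ 3) (hY : ∀ y ∈ Y, y ∈ P ∧ Nb H A y) :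
    Planar (cut H P (Y : Set W)) := by
  classical
  rcases Y.eq_empty_or_nonempty with rfl | hne
  · refine hP.mono (fun u v h => ?_)
    rcases h.2 with h | h
    · exact h.1
    · simp at h
  · have : ∃ x y z, Y = {x, y, z} := by
      have := hne.card_pos
      have h : Y.card = 1 ∨ Y.card = 2 ∨ Y.card = 3 := by omega
      rcases h with h | h | h
      · obtain ⟨x, rfl⟩ := Finset.card_eq_one.1 h
        exact ⟨x, x, x, by simp⟩
      · obtain ⟨x, y, -, rfl⟩ := Finset.card_eq_two.1 h
        exact ⟨x, y, y, by simp⟩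
      · obtain ⟨x, y, z, -, -, -, rfl⟩ := Finset.card_eq_three.1 h
        exact ⟨x, y, z, rfl⟩
    obtain ⟨x, y, z, rfl⟩ := this
    have e : (({x, y, z} : Finset W) : Set W) = {x, y, z} := by simp
    rw [e]
    obtain ⟨a1, a2⟩ := hY x (by simp)
    obtain ⟨b1, b2⟩ := hY y (by simp)
    obtain ⟨c1, c2⟩ := hY z (by simp)
    exact hP.delta hA hAP a1 b1 c1 a2 b2 c2

open Classical in
theorem sep {M : Set W} {U : Finset W} (hUM : ∀ u ∈ U, u ∈ M)
    (hno : ¬ ∀ x ∈ U, ∀ y ∈ U, ∀ z ∈ U, Conn H (M \ {x, y, z})) :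
    ∃ Y : Finset W, Y ⊆ U ∧ Y.card ≤ 3 ∧ ∀ v ∈ M \ (Y : Set W),
      (∀ y ∈ Y, Nb H (comp H (M \ (Y : Set W)) v) y) ∧
        ∃ w ∈ M \ (Y : Set W), w ∉ comp H (M \ (Y : Set W)) v := by
  have hex : ∃ n, ∃ Y : Finset W, Y.card = n ∧ Y ⊆ U ∧ Y.card ≤ 3 ∧ ¬ Conn H (M \ (Y : Set W)) := by
    push Not at hno
    obtain ⟨x, hx, y, hy, z, hz, h⟩ := hno
    refine ⟨_, {x, y, z}, rfl, ?_, Finset.card_le_three, ?_⟩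
    · intro w hw
      simp only [Finset.mem_insert, Finset.mem_singleton] at hw
      rcases hw with rfl | rfl | rfl <;> assumption
    · have e : (({x, y, z} : Finset W) : Set W) = {x, y, z} := by simp
      rwa [e]
  obtain ⟨Y, hn, hYU, hY3, hY⟩ := Nat.find_spec hex
  refine ⟨Y, hYU, hY3, fun v hv => ⟨fun y hy => ?_, ?_⟩⟩
  · by_contra hnb
    have hc : ¬ Conn H (M \ ((Y.erase y : Finset W) : Set W)) := by
      intro hC
      have := hC.2 (comp H (M \ (Y : Set W)) v) (fun z hz => by
          have := comp_sub hv hz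
          exact ⟨this.1, fun h => this.2 (Finset.erase_subset _ _ h)⟩) ⟨v, self_mem_comp _ _⟩
        (fun x hx z hz hxz => by
          by_cases e : z = y
          · rw [e] at hxz; exact (hnb ⟨x, hx, hxz.symm⟩).elim
          · exact comp_closed hx ⟨hz.1, fun h => hz.2 (Finset.mem_erase.2 ⟨e, h⟩)⟩ hxz)
      have hy' : y ∈ comp H (M \ (Y : Set W)) v := by
        rw [this]; exact ⟨hUM y (hYU hy), by simp⟩
      exact (comp_sub hv hy').2 hy
    have := Nat.find_min' hex ⟨Y.erase y, rfl, (Finset.erase_subset _ _).trans hYU, by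
      rw [Finset.card_erase_of_mem hy]; omega, hc⟩
    rw [Finset.card_erase_of_mem hy] at this
    have := Finset.card_pos.2 ⟨y, hy⟩
    omega
  · by_contra h
    push Not at h
    refine hY ?_
    have : comp H (M \ (Y : Set W)) v = M \ (Y : Set W) := subset_antisymm (comp_sub hv) h
    rw [← this]
    exact comp_conn _ _

end CN
end PartH1

open Set
noncomputable section PartH2
namespace CN
variable {W : Type} {H : SimpleGraph W}
variable {U X : Finset W} {L : W → Finset ℕ} {φ : W → ℕ} {q c d c' d' : W}

open Classical in
theorem t1fin (hP : Planar H) (hC : Cross H q c d c' d') (qU : q ∉ U) {Sr : Finset W}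
    (hSU : Sr ⊆ U) (hS : Conn H (insert q (Sr : Set W))) (p1 : c ∈ Sr ∨ c' ∈ Sr)
    (p2 : d ∈ Sr ∨ d' ∈ Sr) (hXU : X ⊆ U) (hcl : ∀ s ∈ X, ∀ t ∈ X, s ≠ t → H.Adj s t)
    (hX3 : X.card ≤ 3) {x : W} (hxX : x ∈ X) (hxS : x ∈ Sr) (ψ : W → ℕ)
    (hψ : ∀ x ∈ X, ψ x = φ x) (hL : ∀ u ∈ U, u ∉ X → 5 ≤ (L u).card)
    (inL : ∀ p ∈ Sr, p ∉ X → ψ p ∈ L p)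
    (prp : ∀ p ∈ Sr, p ∉ X → ∀ v, (v ∈ Sr ∨ v ∈ X) → KQ H c d c' d' p v → ψ p ≠ ψ v)
    (ok : ∀ u ∈ U, u ∉ Sr → u ∉ X → ∃ a b, ∀ p ∈ Sr, KQ H c d c' d' u p → ψ p ∈ L u →
      ψ p = a ∨ ψ p = b) :
    Goal (KQ H c d c' d') U X φ L := by
  have ht : ∀ t, t ∈ X \ Sr ↔ t ∈ X ∧ t ∉ Sr := fun t => Finset.mem_sdiff
  have hu : ∀ u, u ∉ Sr → u ∉ X \ Sr → u ∉ X := fun u h1 h2 h3 => h2 ((ht u).2 ⟨h3, h1⟩)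
  have mate : ∀ u v, KQ H c d c' d' u v → H.Adj u v ∨ ((H.Adj u q ∧ H.Adj v q) ∧ (u ∈ Sr ∨ v ∈ Sr)) := by
    rintro u v (h | ⟨rfl, rfl⟩ | ⟨rfl, rfl⟩ | ⟨rfl, rfl⟩ | ⟨rfl, rfl⟩)
    · exact Or.inl h
    · exact Or.inr ⟨⟨hC.qc.symm, hC.qc'.symm⟩, p1⟩
    · exact Or.inr ⟨⟨hC.qc'.symm, hC.qc.symm⟩, p1.symm⟩
    · exact Or.inr ⟨⟨hC.qd.symm, hC.qd'.symm⟩, p2⟩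
    · exact Or.inr ⟨⟨hC.qd'.symm, hC.qd.symm⟩, p2.symm⟩
  refine fin hP (fun u v => KQ.symm) U X Sr (X \ Sr) (insert q (Sr : Set W)) hS ?_
    (Finset.sdiff_subset.trans hXU) (fun t h => ((ht t).1 h).2) ?_ ?_ ?_ ψ φ L ?_ hψ ?_ ?_ hSU
    (fun x hx => Or.inr hx) ?_ ?_ ?_
  · rintro u hu (rfl | h)
    exacts [(qU hu).elim, h]
  · have h1 : X \ Sr ⊆ X.erase x := fun t h => Finset.mem_erase.2
      ⟨by rintro rfl; exact ((ht _).1 h).2 hxS, ((ht _).1 h).1⟩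
    have := Finset.card_le_card h1
    rw [Finset.card_erase_of_mem hxX] at this
    omega
  · intro t h
    obtain ⟨h1, h2⟩ := (ht t).1 h
    exact ⟨x, Or.inr hxS, hcl t h1 x hxX (by rintro rfl; exact h2 hxS)⟩
  · intro s hs t ht' hst
    exact hcl s ((ht s).1 hs).1 t ((ht t).1 ht').1 hst
  · intro x hx
    by_cases h : x ∈ Sr
    · exact Or.inl h
    · exact Or.inr ((ht x).2 ⟨hx, h⟩)
  · intro u h1 h2 h3
    exact hL u h1 (hu u h2 h3)
  · intro u _ v _ h
    rcases mate u v h with h | ⟨⟨h1, h2⟩, h3⟩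
    · exact Or.inl h
    · exact Or.inr ⟨⟨q, Or.inl rfl, h1⟩, ⟨q, Or.inl rfl, h2⟩, by
        rcases h3 with h3 | h3
        · exact Or.inl h3
        · exact Or.inr (Or.inr (Or.inl h3))⟩
  · rintro p (h | h) hp
    · exact inL p h hp
    · exact (hp ((ht p).1 h).1).elim
  · rintro p (h | h) hp v hv
    · exact prp p h hp v (hv.imp id (fun h => ((ht v).1 h).1))
    · exact (hp ((ht p).1 h).1).elim
  · intro u h1 h2 h3
    obtain ⟨a, b, hab⟩ := ok u h1 h2 (hu u h2 h3)
    refine ⟨a, b, fun p hp hk hn => ?_⟩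
    rcases hp with hp | hp
    · exact hab p hp hk
    · exfalso
      rcases mate u p hk with h | ⟨-, h | h⟩
      exacts [hn ⟨hp, h⟩, h2 h, ((ht p).1 hp).2 h]

/-- the precoloured set meets the crossing. -/
theorem k0 (hP : Planar H) (hC : Cross H q c d c' d') (qU : q ∉ U)
    (hin : ∀ u v, H.Adj u v → v ∈ U ∨ v = q) (hXU : X ⊆ U)
    (hcl : ∀ s ∈ X, ∀ t ∈ X, s ≠ t → H.Adj s t)
    (hX3 : X.card ≤ 3) (hL : ∀ u ∈ U, u ∉ X → 5 ≤ (L u).card) (hc : c ∈ X) :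
    Goal (KQ H c d c' d') U X φ L := by
  classical
  have dU : d ∈ U := (hin c d hC.r1).resolve_right hC.qd.ne'
  have : ∃ κ, (d ∈ X → κ = φ d) ∧ (d ∉ X → κ ∈ L d ∧ ∀ x ∈ X, κ ≠ φ x) := by
    by_cases h : d ∈ X
    · exact ⟨φ d, fun _ => rfl, fun h' => (h' h).elim⟩
    · obtain ⟨κ, h1, h2⟩ := pick1 (A := L d) (B := X.image φ) (by
        have := Finset.card_image_le (s := X) (f := φ)
        have := hL d dU h; omega)
      exact ⟨κ, fun h' => (h h').elim, fun _ => ⟨h1, fun x hx e =>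
        h2 (Finset.mem_image.2 ⟨x, hx, e.symm⟩)⟩⟩
  obtain ⟨κ, k1, k2⟩ := this
  have hm : ∀ p, p ∈ ({c, d} : Finset W) ↔ p = c ∨ p = d := by simp
  set ψ : W → ℕ := fun u => if u ∈ X then φ u else κ with hψ
  have pX : ∀ u ∈ X, ψ u = φ u := fun u hu => by simp [hψ, hu]
  have pd : ψ d = κ := by
    by_cases h : d ∈ X
    · rw [pX d h, k1 h]
    · simp [hψ, h]
  clear_value ψ
  refine t1fin hP hC qU (Sr := {c, d}) ?_ ?_ (by simp) (by simp) hXU hcl hX3 hc (by simp) ψ pX hL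
    ?_ ?_ ?_
  · intro p hp
    rcases (hm p).1 hp with rfl | rfl
    exacts [hXU hc, dU]
  · have e : (insert q (({c, d} : Finset W) : Set W)) = insert q (insert c {d}) := by simp
    rw [e]
    exact Conn.insert (Conn.insert (Conn.singleton d) ⟨d, rfl, hC.r1⟩) ⟨d, by simp, hC.qd⟩
  · intro p hp hpX
    rcases (hm p).1 hp with rfl | rfl
    · exact (hpX hc).elim
    · rw [pd]; exact (k2 hpX).1
  · intro p hp hpX v hv hk
    rcases (hm p).1 hp with rfl | rfl
    · exact (hpX hc).elim
    · have hv' : v ∈ X ∨ v = p := by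
        rcases hv with hv | hv
        · rcases (hm v).1 hv with rfl | rfl
          · exact Or.inl hc
          · exact Or.inr rfl
        · exact Or.inl hv
      rcases hv' with hv' | rfl
      · rw [pd, pX v hv']; exact (k2 hpX).2 v hv'
      · rcases hk with hk | ⟨h1, h2⟩ | ⟨h1, h2⟩ | ⟨h1, h2⟩ | ⟨h1, h2⟩
        exacts [(hk.ne rfl).elim, (hC.n1 h1.symm).elim, (hC.n1 h2.symm).elim, (hC.n5 h2).elim,
          (hC.n5 h1).elim]
  · intro u hu h1 h2
    refine ⟨ψ c, ψ d, fun p hp _ _ => ?_⟩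
    rcases (hm p).1 hp with rfl | rfl
    exacts [Or.inl rfl, Or.inr rfl]

/-- main situation for one crossing. -/
structure T1S (H : SimpleGraph W) (U : Finset W) (L : W → Finset ℕ) (X : Finset W) (φ : W → ℕ)
    (q c d c' d' : W) : Prop extends Env H (insert q (U : Set W)) U L q c d c' d' where
  XU : X ⊆ U
  Xq : ∀ x ∈ X, ¬ H.Adj q x
  X3 : X.card ≤ 3
  cl : ∀ s ∈ X, ∀ t ∈ X, s ≠ t → H.Adj s t
  dgr : ∀ v ∈ U, v ∉ X → ∀ a b e f, ∃ y, H.Adj v y ∧ y ≠ a ∧ y ≠ b ∧ y ≠ e ∧ y ≠ f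
  nc : X.card ≤ 2 → ∀ v ∈ U, v ∉ X → ∃ x ∈ X, ¬ H.Adj v x
  no : ¬ Goal (KQ H c d c' d') U X φ L

theorem T1S.rot (h : T1S H U L X φ q c d c' d') : T1S H U L X φ q d c' d' c :=
  { h.toEnv.rot with
    XU := h.XU, Xq := h.Xq, X3 := h.X3, cl := h.cl, dgr := h.dgr, nc := h.nc
    no := by rw [KQ.rot]; exact h.no }

theorem T1S.refl (h : T1S H U L X φ q c d c' d') : T1S H U L X φ q c d' c' d :=
  { h.toEnv.refl with
    XU := h.XU, Xq := h.Xq, X3 := h.X3, cl := h.cl, dgr := h.dgr, nc := h.nc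
    no := by rw [KQ.refl]; exact h.no }

theorem T1S.xk (h : T1S H U L X φ q c d c' d') {x u : W} (hx : x ∈ X) (hk : KQ H c d c' d' u x) :
    H.Adj u x := by
  rcases hk with hk | ⟨-, h2⟩ | ⟨-, h2⟩ | ⟨-, h2⟩ | ⟨-, h2⟩
  exacts [hk, (h.Xq x hx (h2 ▸ h.qc')).elim, (h.Xq x hx (h2 ▸ h.qc)).elim,
    (h.Xq x hx (h2 ▸ h.qd')).elim, (h.Xq x hx (h2 ▸ h.qd)).elim]

theorem T1S.tri (h : T1S H U L X φ q c d c' d') {x : W} (hx : x ∈ X) (xc : H.Adj x c) {γ κ : ℕ}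
    (hγ : γ ∈ L c) (hκ : κ ∈ L d) (hne : κ ≠ γ) (gX : ∀ y ∈ X, H.Adj c y → γ ≠ φ y)
    (kX : ∀ y ∈ X, H.Adj d y → κ ≠ φ y)
    (h1 : ∀ u ∈ U, H.Adj u x → H.Adj u c → H.Adj u d → κ ∉ bad (L u) (φ x) γ)
    (h2 : H.Adj x c' → κ ∉ bad (L c') (φ x) γ) (h3 : H.Adj x d' → κ ∉ bad (L d') (φ x) γ) :
    False := by
  classical
  refine h.no ?_
  have cX : c ∉ X := fun hh => h.Xq c hh h.qc
  have dX : d ∉ X := fun hh => h.Xq d hh h.qd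
  have hm : ∀ p, p ∈ ({x, c, d} : Finset W) ↔ p = x ∨ p = c ∨ p = d := by simp
  set ψ : W → ℕ := fun u => if u = c then γ else if u = d then κ else φ u with hψ
  have pX : ∀ u ∈ X, ψ u = φ u := fun u hu => by
    have a : u ≠ c := by rintro rfl; exact cX hu
    have b : u ≠ d := by rintro rfl; exact dX hu
    simp [hψ, a, b]
  have pc : ψ c = γ := by simp [hψ]
  have pd : ψ d = κ := by simp [hψ, h.n1.symm]
  clear_value ψ
  have irr : ∀ x, ¬ KQ H c d c' d' x x := by
    rintro x (hx | ⟨rfl, hx⟩ | ⟨rfl, hx⟩ | ⟨rfl, hx⟩ | ⟨rfl, hx⟩)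
    exacts [hx.ne rfl, h.n2 hx, h.n2 hx.symm, h.n5 hx, h.n5 hx.symm]
  refine t1fin h.hP h.toCross h.qU (Sr := {x, c, d}) ?_ ?_ (by simp) (by simp) h.XU h.cl h.X3 hx
    (by simp) ψ pX (fun u hu _ => (h.L5 u hu).ge) ?_ ?_ ?_
  · intro p hp
    rcases (hm p).1 hp with rfl | rfl | rfl
    exacts [h.XU hx, h.cU, h.dU]
  · have e : (insert q (({x, c, d} : Finset W) : Set W)) = insert q (insert x (insert c {d})) := by simp
    rw [e]
    exact Conn.insert (Conn.insert (Conn.insert (Conn.singleton d) ⟨d, rfl, h.r1⟩)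
      ⟨c, by simp, xc⟩) ⟨d, by simp, h.qd⟩
  · intro p hp hpX
    rcases (hm p).1 hp with rfl | rfl | rfl
    · exact (hpX hx).elim
    · rwa [pc]
    · rwa [pd]
  · intro p hp hpX v hv hk
    have hv' : v ∈ X ∨ v = c ∨ v = d := by
      rcases hv with hv | hv
      · rcases (hm v).1 hv with rfl | hv
        · exact Or.inl hx
        · exact Or.inr hv
      · exact Or.inl hv
    rcases (hm p).1 hp with rfl | rfl | rfl
    · exact (hpX hx).elim
    · rcases hv' with hv' | rfl | rfl
      · rw [pc, pX v hv']; exact gX v hv' (h.xk hv' hk)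
      · exact (irr _ hk).elim
      · rw [pc, pd]; exact hne.symm
    · rcases hv' with hv' | rfl | rfl
      · rw [pd, pX v hv']; exact kX v hv' (h.xk hv' hk)
      · rw [pc, pd]; exact hne
      · exact (irr _ hk).elim
  · intro u hu uS uX
    rw [hm, not_or, not_or] at uS
    obtain ⟨-, uc, ud⟩ := uS
    have : (H.Adj u x ∧ KQ H c d c' d' u c ∧ KQ H c d c' d' u d) → κ ∉ bad (L u) (φ x) γ := by
      rintro ⟨i, j, k⟩
      by_cases u1 : u = c'
      · rw [u1] at i ⊢; exact h2 i.symm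
      by_cases u2 : u = d'
      · rw [u2] at i ⊢; exact h3 i.symm
      have kc : H.Adj u c := by
        rcases j with hh | ⟨hh, _⟩ | ⟨hh, _⟩ | ⟨hh, _⟩ | ⟨hh, _⟩
        exacts [hh, (uc hh).elim, (u1 hh).elim, (ud hh).elim, (u2 hh).elim]
      have kd : H.Adj u d := by
        rcases k with hh | ⟨hh, _⟩ | ⟨hh, _⟩ | ⟨hh, _⟩ | ⟨hh, _⟩
        exacts [hh, (uc hh).elim, (u1 hh).elim, (ud hh).elim, (u2 hh).elim]
      exact h1 u hu i kc kd
    obtain ⟨a, b, i, j, k⟩ : ∃ a b, (H.Adj u x → φ x ∈ L u → φ x = a ∨ φ x = b) ∧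
        (KQ H c d c' d' u c → γ ∈ L u → γ = a ∨ γ = b) ∧
        (KQ H c d c' d' u d → κ ∈ L u → κ = a ∨ κ = b) := by
      by_cases a1 : H.Adj u x
      · by_cases a2 : KQ H c d c' d' u c
        · by_cases a3 : KQ H c d c' d' u d
          · obtain ⟨a, b, i, j, k⟩ := ok3 (this ⟨a1, a2, a3⟩)
            exact ⟨a, b, fun _ => i, fun _ => j, fun _ => k⟩
          · exact ⟨φ x, γ, fun _ _ => Or.inl rfl, fun _ _ => Or.inr rfl, fun e => (a3 e).elim⟩
        · exact ⟨φ x, κ, fun _ _ => Or.inl rfl, fun e => (a2 e).elim, fun _ _ => Or.inr rfl⟩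
      · exact ⟨γ, κ, fun e => (a1 e).elim, fun _ _ => Or.inl rfl, fun _ _ => Or.inr rfl⟩
    refine ⟨a, b, fun p hp hk => ?_⟩
    rcases (hm p).1 hp with rfl | rfl | rfl
    · rw [pX p hx]; exact i (h.xk hx hk)
    · rw [pc]; exact j hk
    · rw [pd]; exact k hk

theorem T1S.xq (h : T1S H U L X φ q c d c' d') {x : W} (hx : x ∈ X) : x ≠ q :=
  fun e => h.qU (e ▸ h.XU hx)

theorem T1S.pickX (h : T1S H U L X φ q c d c' d') {v : W} (hv : v ∈ U) (γ : ℕ) :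
    ∃ κ ∈ L v, κ ≠ γ ∧ ∀ y ∈ X, κ ≠ φ y := by
  classical
  obtain ⟨κ, h1, h2⟩ := pick1 (A := L v) (B := insert γ (X.image φ)) (by
    have := Finset.card_image_le (s := X) (f := φ)
    have := h.L5 v hv
    have := h.X3
    have := Finset.card_insert_le γ (X.image φ); omega)
  rw [Finset.mem_insert, not_or] at h2
  exact ⟨κ, h1, h2.1, fun y hy e => h2.2 (Finset.mem_image.2 ⟨y, hy, e.symm⟩)⟩

theorem T1S.A (h : T1S H U L X φ q c d c' d') {x : W} (hx : x ∈ X) (xc : H.Adj x c)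
    (xd : H.Adj x d) : False := by
  obtain ⟨γ, g1, -, g2⟩ := h.pickX h.cU 0
  obtain ⟨κ, k1, k2, k3⟩ := h.pickX h.dU γ
  have xq := h.xq hx
  refine h.tri hx xc g1 k1 k2 (fun y hy _ => g2 y hy) (fun y hy _ => k3 y hy)
    (fun u hu i j k => (i.ne (h.toEnv.F1 (fun e => h.qU (e ▸ hu)) xq j k xc xd)).elim)
    (fun e => (h.toEnv.F0 xq xc xd e).elim) (fun e => (h.toEnv.rot.rot.rot.F0 xq e xc xd).elim)

theorem T1S.C (h : T1S H U L X φ q c d c' d') {x : W} (hx : x ∈ X) (xc : H.Adj x c)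
    (xc' : ¬ H.Adj x c') (xd' : ¬ H.Adj x d')
    (hd : ∀ y ∈ X, ¬ H.Adj y d) : False := by
  obtain ⟨γ, g1, -, g2⟩ := h.pickX h.cU 0
  obtain ⟨κ, k1, k2, k3⟩ := pickU (h.L5 d h.dU) h.L5 _ (h.toEnv.uniqF (fun u => H.Adj u x)) γ (φ x) γ
  exact h.tri hx xc g1 k1 k2 (fun y hy _ => g2 y hy) (fun y hy e => (hd y hy e.symm).elim)
    (fun u hu i j k => k3 u hu ⟨i, j, k⟩) (fun e => (xc' e).elim) (fun e => (xd' e).elim)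

theorem T1S.B (h : T1S H U L X φ q c d c' d') {x : W} (hx : x ∈ X) (xc : H.Adj x c)
    (xc' : H.Adj x c') (hd : ∀ y ∈ X, ¬ H.Adj y d) : False := by
  classical
  have xq := h.xq hx
  have xd' : ¬ H.Adj x d' := fun e => h.toEnv.rot.rot.F0 xq xc' e xc
  by_cases hy : ∃ y ∈ X, y ≠ x ∧ H.Adj y c
  · obtain ⟨y, hy, yx, yc⟩ := hy
    by_cases yd' : H.Adj y d'
    · exact h.refl.A hy yc yd'
    by_cases yc' : H.Adj y c'
    · by_cases hX : X.card ≤ 2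
      · obtain ⟨z, hz, hz'⟩ := h.nc hX c h.cU (fun e => h.Xq c e h.qc)
        have hxy : ({x, y} : Finset W) = X := by
          refine Finset.eq_of_subset_of_card_le ?_ ?_
          · intro w hw
            simp only [Finset.mem_insert, Finset.mem_singleton] at hw
            rcases hw with rfl | rfl <;> assumption
          · rw [Finset.card_pair yx.symm]; exact hX
        rw [← hxy] at hz
        simp only [Finset.mem_insert, Finset.mem_singleton] at hz
        rcases hz with rfl | rfl
        exacts [hz' xc.symm, hz' yc.symm]
      · have : ∃ z ∈ X, z ∉ ({x, y} : Finset W) := Finset.exists_mem_notMem_of_card_lt_card (by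
          rw [Finset.card_pair yx.symm]; omega)
        obtain ⟨z, hz, hz'⟩ := this
        simp only [Finset.mem_insert, Finset.mem_singleton, not_or] at hz'
        exact h.toEnv.F6 xq (h.xq hy) (h.xq hz) (h.XU hz) (fun e => h.Xq z hz (e ▸ h.qc))
          (fun e => h.Xq z hz (e ▸ h.qc')) (h.cl x hx y hy yx.symm) xc xc' yc yc'
          (h.cl z hz x hx hz'.1) (h.cl z hz y hy hz'.2)
    · exact h.C hy yc yc' yd' hd
  · have gX : ∀ γ, γ ≠ φ x → ∀ y ∈ X, H.Adj c y → γ ≠ φ y := by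
      intro γ hγ y hyX hc
      by_cases e : y = x
      · rw [e]; exact hγ
      · exact (hy ⟨y, hyX, e, hc.symm⟩).elim
    by_cases hf : ∃ u ∈ U, H.Adj u x ∧ H.Adj u c ∧ H.Adj u d
    · obtain ⟨f, hfU, f1, f2, f3⟩ := hf
      obtain ⟨γ, hγ, g1, κ, hκ, k1, k2, k3⟩ := comb (h.L5 c h.cU) (h.L5 d h.dU) (h.L5 f hfU)
        (h.L5 c' h.c'U) (φ x)
      exact h.tri hx xc hγ hκ k1 (gX γ g1) (fun y hy e => (hd y hy e.symm).elim)
        (fun u hu i j k => by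
          rw [h.toEnv.uniqF (fun u => H.Adj u x) u hu f hfU ⟨i, j, k⟩ ⟨f1, f2, f3⟩]; exact k2)
        (fun _ => k3) (fun e => (xd' e).elim)
    · obtain ⟨γ, hγ, g1, κ, hκ, k1, k2, k3⟩ := comb (h.L5 c h.cU) (h.L5 d h.dU) (h.L5 c' h.c'U)
        (h.L5 c' h.c'U) (φ x)
      exact h.tri hx xc hγ hκ k1 (gX γ g1) (fun y hy e => (hd y hy e.symm).elim)
        (fun u hu i j k => (hf ⟨u, hu, i, j, k⟩).elim)
        (fun _ => k3) (fun e => (xd' e).elim)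

theorem T1S.noB (h : T1S H U L X φ q c d c' d') {x : W} (hx : x ∈ X) (xc : H.Adj x c)
    (xc' : H.Adj x c') : False := by
  by_cases h1 : ∃ y ∈ X, H.Adj y d
  · obtain ⟨y, hy, yd⟩ := h1
    by_cases h2 : ∃ y ∈ X, H.Adj y d'
    · obtain ⟨z, hz, zd'⟩ := h2
      have xq := h.xq hx
      have yx : y ≠ x := by rintro rfl; exact h.toEnv.F0 xq xc yd xc'
      have zx : z ≠ x := by rintro rfl; exact h.toEnv.rot.rot.F0 xq xc' zd' xc
      have nX : ∀ v, H.Adj q v → v ∉ ({y, z} : Set W) := by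
        rintro v qv (rfl | rfl)
        exacts [h.Xq _ hy qv, h.Xq _ hz qv]
      have hZ : Conn H ({y, z} : Set W) := by
        by_cases e : y = z
        · rw [e]; simpa using Conn.singleton z
        · exact Conn.insert (Conn.singleton z) ⟨z, rfl, h.cl y hy z hz e⟩
      refine h.toEnv.five (r := x) (fun e => h.Xq x hx (e ▸ h.qd)) (fun e => h.Xq x hx (e ▸ h.qd')) xc xc'
        hZ (nX _ h.qc) (nX _ h.qc') (nX _ h.qd) (nX _ h.qd') ?_ ⟨y, by simp, h.cl x hx y hy yx.symm⟩
        ⟨y, by simp, yd.symm⟩ ⟨z, by simp, zd'.symm⟩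
      rintro (e | e)
      exacts [yx e.symm, zx e.symm]
    · push Not at h2
      exact h.refl.B hx xc xc' h2
  · push Not at h1
    exact h.B hx xc xc' h1

theorem T1S.other (h : T1S H U L X φ q c d c' d') {x : W} (hx : x ∈ X) (xc : H.Adj x c) :
    ∃ y ∈ X, H.Adj y d := by
  by_contra hn
  push Not at hn
  exact h.C hx xc (fun e => h.noB hx xc e) (fun e => h.refl.A hx xc e) hn

theorem T1S.k1 (h : T1S H U L X φ q c d c' d') {x : W} (hx : x ∈ X) : ¬ H.Adj x c := by
  intro xc
  obtain ⟨y, hy, yd⟩ := h.other hx xc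
  obtain ⟨z, hz, zd'⟩ := h.refl.other hx xc
  obtain ⟨w, hw, wc'⟩ := h.rot.other hy yd
  classical
  have : ({x, y, z, w} : Finset W).card ≤ X.card := Finset.card_le_card (by
    intro v hv
    simp only [Finset.mem_insert, Finset.mem_singleton] at hv
    rcases hv with rfl | rfl | rfl | rfl <;> assumption)
  have n1 : x ≠ y := by rintro rfl; exact h.A hx xc yd
  have n2 : x ≠ z := by rintro rfl; exact h.refl.A hx xc zd'
  have n3 : x ≠ w := by rintro rfl; exact h.noB hx xc wc'
  have n4 : y ≠ z := by rintro rfl; exact h.rot.noB hy yd zd'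
  have n5 : y ≠ w := by rintro rfl; exact h.rot.A hy yd wc'
  have n6 : z ≠ w := by rintro rfl; exact h.rot.rot.A hz wc' zd'
  have h4 : ({x, y, z, w} : Finset W).card = 4 := by
    rw [Finset.card_insert_of_notMem (by simp [n1, n2, n3]),
      Finset.card_insert_of_notMem (by simp [n4, n5]), Finset.card_pair n6]
  have := h.X3
  omega

end CN
end PartH2

open Set
noncomputable section PartH3
namespace CN
variable {W : Type} {H : SimpleGraph W}
variable {U X : Finset W} {L : W → Finset ℕ} {φ : W → ℕ} {q c d c' d' : W}

theorem Goal.mono {K K' : W → W → Prop} (h : Goal K U X φ L) (hK : ∀ u v, K' u v → K u v) :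
    Goal K' U X φ L := by
  obtain ⟨f, f1, f2, f3⟩ := h
  exact ⟨f, f1, f2, fun u hu v hv k => f3 u hu v hv (hK u v k)⟩

theorem comp_disj {S : Set W} {v w u : W} (hv : v ∈ S) (hw : w ∈ S) (h : w ∉ comp H S v)
    (hu : u ∈ comp H S v) : u ∉ comp H S w := fun hu' =>
  h ((comp_conn S w).sub_comp (comp_sub hw) hu' hu (self_mem_comp S w))

theorem comp_symm {S : Set W} {v w : W} (hv : v ∈ S) (hw : w ∈ S) (h : w ∉ comp H S v) :
    v ∉ comp H S w := comp_disj hv hw h (self_mem_comp S v)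

open Classical in
theorem split {m m1 m2 : W → W → Prop} {M : Set W} {Y : Finset W} {z : W}
    (hin : ∀ u v, H.Adj u v → v ∈ M) (hUM : ∀ u ∈ U, u ∈ M) (hz : z ∈ M \ (Y : Set W))
    (hXC : ∀ x ∈ X, x ∉ comp H (M \ (Y : Set W)) z)
    (hm : ∀ u ∈ U, ∀ v ∈ U, m u v → u ≠ v ∧
      ((u ∉ comp H (M \ (Y : Set W)) z ∧ v ∉ comp H (M \ (Y : Set W)) z ∧ m1 u v) ∨
       (m2 u v ∧ (u ∈ comp H (M \ (Y : Set W)) z ∨ u ∈ Y) ∧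
        (v ∈ comp H (M \ (Y : Set W)) z ∨ v ∈ Y))))
    (h1 : Goal (fun u v => (cut H (M \ comp H (M \ (Y : Set W)) z) (Y : Set W)).Adj u v ∨ m1 u v)
      (U.filter (fun u => u ∉ comp H (M \ (Y : Set W)) z)) X φ L)
    (h2 : ∀ f, Goal (fun u v => (cut H (comp H (M \ (Y : Set W)) z ∪ Y) (Y : Set W)).Adj u v ∨ m2 u v)
      (U.filter (fun u => u ∈ comp H (M \ (Y : Set W)) z) ∪ Y) Y f L) :
    Goal (fun u v => H.Adj u v ∨ m u v) U X φ L := by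
  have cY : ∀ y ∈ Y, y ∉ comp H (M \ (Y : Set W)) z := fun y hy h => (comp_sub hz h).2 hy
  have cl : ∀ u v, u ∈ comp H (M \ (Y : Set W)) z → H.Adj u v →
    v ∈ comp H (M \ (Y : Set W)) z ∨ v ∈ (Y : Set W) := fun u v => comp_cl hin
  generalize comp H (M \ (Y : Set W)) z = C at *
  refine glue (C := C) (Y := Y) (by simp) (by simp) hXC cY ?_ h1 h2
  have key : ∀ u ∈ U, ∀ v ∈ U, (u ∈ C ∨ u ∈ Y) → (v ∈ C ∨ v ∈ Y) → u ≠ v →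
      ((cut H (C ∪ Y) Y).Adj u v ∨ m2 u v) →
      (u ∉ C ∧ v ∉ C ∧ ((cut H (M \ C) (Y : Set W)).Adj u v ∨ m1 u v)) ∨
      (u ∈ U.filter (fun u => u ∈ C) ∪ Y ∧ v ∈ U.filter (fun u => u ∈ C) ∪ Y ∧
        ((cut H (C ∪ Y) (Y : Set W)).Adj u v ∨ m2 u v) ∧ ¬ (u ∈ Y ∧ v ∈ Y)) := by
    intro u hu v hv h1 h2 hne h
    by_cases hy : u ∈ Y ∧ v ∈ Y
    · exact Or.inl ⟨cY u hy.1, cY v hy.2, Or.inl ⟨hne, Or.inr hy⟩⟩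
    · refine Or.inr ⟨?_, ?_, h, hy⟩
      · simp only [Finset.mem_union, Finset.mem_filter]; exact h1.imp (fun h => ⟨hu, h⟩) id
      · simp only [Finset.mem_union, Finset.mem_filter]; exact h2.imp (fun h => ⟨hv, h⟩) id
  rintro u hu v hv (h | h)
  · by_cases uC : u ∈ C
    · have := cl u v uC h
      exact key u hu v hv (Or.inl uC) this h.ne (Or.inl ⟨h.ne, Or.inl ⟨h, Or.inl uC, this⟩⟩)
    by_cases vC : v ∈ C
    · have := cl v u vC h.symm
      exact key u hu v hv this (Or.inl vC) h.ne (Or.inl ⟨h.ne, Or.inl ⟨h, this, Or.inl vC⟩⟩)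
    · exact Or.inl ⟨uC, vC, Or.inl ⟨h.ne, Or.inl ⟨h, ⟨hUM u hu, uC⟩, hUM v hv, vC⟩⟩⟩
  · obtain ⟨h1, h2 | ⟨h2, h3, h4⟩⟩ := hm u hu v hv h
    · exact Or.inl ⟨h2.1, h2.2.1, Or.inr h2.2.2⟩
    · exact key u hu v hv h3 h4 h1 (Or.inr h2)

theorem Cross.cut {P Y : Set W} (h : Cross H q c d c' d') (qP : q ∈ P) (qY : q ∉ Y)
    (hP : ∀ v, H.Adj q v → v ∈ P) : Cross (cut H P Y) q c d c' d' where
  nq := by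
    intro v
    rw [cut_adj, ← h.nq v]
    constructor
    · rintro ⟨h1, h2 | h2⟩
      exacts [h2.1, (qY h2.1).elim]
    · intro h1; exact ⟨h1.ne, Or.inl ⟨h1, qP, hP v h1⟩⟩
  n1 := h.n1
  n2 := h.n2
  n3 := h.n3
  n4 := h.n4
  n5 := h.n5
  n6 := h.n6
  r1 := ⟨h.n1, Or.inl ⟨h.r1, hP _ h.qc, hP _ h.qd⟩⟩
  r2 := ⟨h.n4, Or.inl ⟨h.r2, hP _ h.qd, hP _ h.qc'⟩⟩
  r3 := ⟨h.n6, Or.inl ⟨h.r3, hP _ h.qc', hP _ h.qd'⟩⟩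
  r4 := ⟨h.n3.symm, Or.inl ⟨h.r4, hP _ h.qd', hP _ h.qc⟩⟩

/-- mates at a crossing. -/
def mt (c d c' d' u v : W) : Prop :=
  (u = c ∧ v = c') ∨ (u = c' ∧ v = c) ∨ (u = d ∧ v = d') ∨ (u = d' ∧ v = d)

theorem Cross.mt (h : Cross H q c d c' d') {u v : W} (hm : mt c d c' d' u v) :
    H.Adj q u ∧ H.Adj q v ∧ u ≠ v := by
  rcases hm with ⟨rfl, rfl⟩ | ⟨rfl, rfl⟩ | ⟨rfl, rfl⟩ | ⟨rfl, rfl⟩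
  exacts [⟨h.qc, h.qc', h.n2⟩, ⟨h.qc', h.qc, h.n2.symm⟩, ⟨h.qd, h.qd', h.n5⟩,
    ⟨h.qd', h.qd, h.n5.symm⟩]

theorem mt.symm {u v : W} (h : mt c d c' d' u v) : mt c d c' d' v u := by
  rcases h with h | h | h | h
  · exact Or.inr (Or.inl h.symm)
  · exact Or.inl h.symm
  · exact Or.inr (Or.inr (Or.inr h.symm))
  · exact Or.inr (Or.inr (Or.inl h.symm))

/-- the hypotheses of the one-crossing theorem. -/
structure T1H (H : SimpleGraph W) (U : Finset W) (L : W → Finset ℕ) (X : Finset W)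
    (q c d c' d' : W) : Prop where
  hP : Planar H
  cr : Cross H q c d c' d'
  qU : q ∉ U
  hin : ∀ u v, H.Adj u v → v ∈ U ∨ v = q
  XU : X ⊆ U
  X3 : X.card ≤ 3
  cl : ∀ s ∈ X, ∀ t ∈ X, s ≠ t → H.Adj s t
  L5 : ∀ u ∈ U, u ∉ X → 5 ≤ (L u).card

theorem T1H.rot (h : T1H H U L X q c d c' d') : T1H H U L X q d c' d' c :=
  { h with cr := h.cr.rot }

/-- weaken a solution with an additional precoloured vertex. -/
theorem weaken {K : W → W → Prop} (irr : ∀ v, ¬ K v v) {v : W} {γ : ℕ} [DecidableEq W]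
    (hvX : v ∉ X) (hγ : γ ∈ L v)
    (hs : ∀ u v, K u v → K v u)
    (hX : ∀ x ∈ X, γ ≠ φ x)
    (h : Goal K U (insert v X) (fun u => if u = v then γ else φ u) L) : Goal K U X φ L := by
  obtain ⟨f, f1, f2, f3⟩ := h
  have fv : f v = γ := by rw [f1 v (by simp)]; simp
  have fX : ∀ x ∈ X, f x = φ x := by
    intro x hx
    have : x ≠ v := by rintro rfl; exact hvX hx
    rw [f1 x (by simp [hx])]; simp [this]
  refine ⟨f, fX, ?_, ?_⟩
  · intro u hu huX
    by_cases e : u = v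
    · rw [e, fv]; exact hγ
    · exact f2 u hu (by simp [e, huX])
  · intro u hu w hw k hn
    by_cases h2 : u ∈ insert v X ∧ w ∈ insert v X
    · obtain ⟨h3, h4⟩ := h2
      rw [Finset.mem_insert] at h3 h4
      rcases h3 with rfl | h3
      · rcases h4 with rfl | h4
        · exact (irr _ k).elim
        · rw [fv, fX w h4]; exact hX w h4
      · rcases h4 with rfl | h4
        · rw [fv, fX u h3]; exact (hX u h3).symm
        · exact (hn ⟨h3, h4⟩).elim
    · exact f3 u hu w hw k h2

theorem KQ.irr (h : Cross H q c d c' d') (v : W) : ¬ KQ H c d c' d' v v := by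
  rintro (h1 | h1)
  · exact h1.ne rfl
  · exact (h.mt h1).2.2 rfl

theorem T1H.k0 (h : T1H H U L X q c d c' d') (hx : ∃ x ∈ X, H.Adj q x) :
    Goal (KQ H c d c' d') U X φ L := by
  obtain ⟨x, hx, qx⟩ := hx
  have key : ∀ {c d c' d' : W}, T1H H U L X q c d c' d' → c ∈ X →
    Goal (KQ H c d c' d') U X φ L := fun h hc => CN.k0 h.hP h.cr h.qU h.hin h.XU h.cl h.X3 h.L5 hc
  rcases (h.cr.nq x).1 qx with rfl | rfl | rfl | rfl
  · exact key h hx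
  · rw [← KQ.rot]; exact key h.rot hx
  · rw [← KQ.rot, ← KQ.rot]; exact key h.rot.rot hx
  · rw [← KQ.rot, ← KQ.rot, ← KQ.rot]; exact key h.rot.rot.rot hx

theorem lev_ex {M : Set W} (hM : Conn H M) (inM : ∀ u v, H.Adj u v → v ∈ M) (qM : q ∈ M) :
    ∃ lev, Lev H M q lev := by
  have hr : ∀ v ∈ M, H.Reachable q v := by
    have := hM.2 {v | v ∈ M ∧ H.Reachable q v} (fun v h => h.1) ⟨q, qM, SimpleGraph.Reachable.refl q⟩
      (fun x hx y hy hxy => ⟨hy, hx.2.trans hxy.reachable⟩)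
    intro v hv
    rw [← this] at hv
    exact hv.2
  refine ⟨fun v => H.dist q v, by simp, ?_, ?_⟩
  · intro u v huv
    obtain ⟨p, hp⟩ := (hr v (inM u v huv)).exists_walk_length_eq_dist
    have := SimpleGraph.dist_le (p.concat huv.symm)
    rw [SimpleGraph.Walk.length_concat, hp] at this
    exact this
  · intro v hv hne
    obtain ⟨p, hp⟩ := (hr v hv).symm.exists_walk_length_eq_dist
    cases p with
    | nil => exact (hne rfl).elim
    | @cons _ u _ hvu p =>
      refine ⟨u, hvu, ?_⟩
      rw [SimpleGraph.Walk.length_cons, SimpleGraph.dist_comm] at hp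
      have h1 := SimpleGraph.dist_le p
      rw [SimpleGraph.dist_comm] at h1
      obtain ⟨p', hp'⟩ := (hr u (inM v u hvu)).exists_walk_length_eq_dist
      have := SimpleGraph.dist_le (p'.concat hvu.symm)
      rw [SimpleGraph.Walk.length_concat, hp'] at this
      show H.dist q v = H.dist q u + 1
      omega

end CN
end PartH3

open Set
noncomputable section PartH4
namespace CN
variable {W : Type} {H : SimpleGraph W}
variable {U X : Finset W} {L : W → Finset ℕ} {φ : W → ℕ} {q c d c' d' : W}

theorem T1S.k1' (h : T1S H U L X φ q c d c' d') {x y : W} (hx : x ∈ X) (hy : H.Adj q y) :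
    ¬ H.Adj x y := by
  rcases (h.nq y).1 hy with rfl | rfl | rfl | rfl
  exacts [h.k1 hx, h.rot.k1 hx, h.rot.rot.k1 hx, h.rot.rot.rot.k1 hx]

theorem T1S.absurd (h : T1S H U L X φ q c d c' d') : False := by
  classical
  have cX : c ∉ X := fun e => h.Xq c e h.qc
  have hne : X.Nonempty := by
    by_contra hn
    rw [Finset.not_nonempty_iff_eq_empty] at hn
    obtain ⟨x, hx, -⟩ := h.nc (by simp [hn]) c h.cU cX
    simp [hn] at hx
  have hM : Conn H (insert q (U : Set W)) := by
    have h1 := h.conn c h.cU c h.cU c h.cU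
    have h2 := h1.insert (v := c) ⟨q, ⟨Or.inl rfl, by simpa using h.qc.ne⟩, h.qc.symm⟩
    convert h2 using 1
    ext w
    have : c ∈ U := h.cU
    by_cases e : w = c
    · simp [e, this]
    · simp [e]
  obtain ⟨lev, lv⟩ := lev_ex hM h.inM (q := q) (Or.inl rfl)
  obtain ⟨x, hx, hmin⟩ := Finset.exists_min_image X lev hne
  have low : ∀ v, v ∈ X → lev v < 3 → False := by
    intro v hv h3
    have vq := h.xq hv
    obtain ⟨u, vu, e⟩ := lv.down v (Or.inr (h.XU hv)) vq
    by_cases uq : u = q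
    · exact h.Xq v hv (uq ▸ vu.symm)
    obtain ⟨w, uw, e'⟩ := lv.down u (h.inM _ _ vu) uq
    by_cases wq : w = q
    · exact h.k1' hv (wq ▸ uw.symm) vu
    obtain ⟨z, wz, e''⟩ := lv.down w (h.inM _ _ uw) wq
    omega
  have x3 : 3 ≤ lev x := by by_contra hc; exact low x hx (by omega)
  have hx2 : ∃ x2 ∈ X, x2 ≠ x := by
    by_contra hn
    push Not at hn
    obtain ⟨u, xu, e⟩ := lv.down x (Or.inr (h.XU hx)) (h.xq hx)
    have uq : u ≠ q := by rintro rfl; exact h.Xq x hx xu.symm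
    have uU : u ∈ U := (h.inM _ _ xu).resolve_left uq
    have uX : u ∉ X := by intro hu; have := hn u hu; subst this; exact xu.ne rfl
    have hc : X.card ≤ 2 := by
      have : X ⊆ {x} := fun w hw => by simp [hn w hw]
      have := Finset.card_le_card this
      simp at this; omega
    obtain ⟨y, hy, hny⟩ := h.nc hc u uU uX
    rw [hn y hy] at hny
    exact hny xu.symm
  obtain ⟨x2, hx2, hne2⟩ := hx2
  obtain ⟨r, rU, xr, er, hF⟩ := h.toEnv.chain lv (lev x - 3) x (h.XU hx) (by omega) (by
    intro r hr hl hq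
    refine ⟨hr.resolve_left hq, h.dgr r (hr.resolve_left hq) (fun hrX => ?_)⟩
    have := hmin r hrX
    omega) ⟨x2, h.cl x hx x2 hx2 hne2.symm, by have := hmin x2 hx2; omega⟩
  obtain ⟨ρ, hρ, -, ρX⟩ := h.pickX rU 0
  obtain ⟨Sr, ψ, hw⟩ := hF (φ x) ρ (ρX x hx).symm hρ
  have SX : ∀ p ∈ Sr, p ≠ x → p ∉ X := by
    intro p hp hpx hpX
    have := hmin p hpX
    by_cases e : p = r
    · subst e; omega
    · have := hw.low p hp hpx e; omega
  set ψ' : W → ℕ := fun u => if u ∈ X then φ u else ψ u with hψ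
  have p1 : ∀ u ∈ X, ψ' u = φ u := fun u hu => by simp [hψ, hu]
  have p2 : ∀ u ∈ Sr, ψ' u = ψ u := by
    intro u hu
    by_cases e : u = x
    · rw [e, p1 x hx, hw.cs]
    · simp [hψ, SX u hu e]
  clear_value ψ'
  refine h.no (t1fin h.hP h.toCross h.qU hw.sub hw.conn hw.p1 hw.p2 h.XU h.cl h.X3 hx hw.hs ψ' p1
    (fun u hu _ => (h.L5 u hu).ge) ?_ ?_ ?_)
  · intro p hp hpX
    rw [p2 p hp]
    exact hw.inL p hp (by rintro rfl; exact hpX hx)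
  · intro p hp hpX v hv k
    by_cases vS : v ∈ Sr
    · rw [p2 p hp, p2 v vS]; exact hw.prop p hp v vS k
    · have vX := hv.resolve_left vS
      rw [p1 v vX, p2 p hp]
      by_cases e : p = r
      · rw [e, hw.cr]; exact ρX v vX
      · exfalso
        have h1 := hw.low p hp (by rintro rfl; exact hpX hx) e
        have h2 : H.Adj p v := by
          rcases k with k | k
          · exact k
          · exact (h.Xq v vX (h.toCross.mt k).2.1).elim
        have := lv.le v p h2.symm
        have := hmin v vX
        omega
  · intro u hu h1 h2
    obtain ⟨a, b, hab⟩ := hw.ok u hu h1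
    refine ⟨a, b, fun p hp => ?_⟩
    rw [p2 p hp]; exact hab p hp

/-- shrink lists to size five. -/
theorem shrink (hL : ∀ u ∈ U, u ∉ X → 5 ≤ (L u).card) : ∃ L' : W → Finset ℕ,
    (∀ u, (L' u).card = 5) ∧ ∀ u ∈ U, u ∉ X → L' u ⊆ L u := by
  have : ∀ u, ∃ B : Finset ℕ, B.card = 5 ∧ (u ∈ U → u ∉ X → B ⊆ L u) := by
    intro u
    by_cases h : 5 ≤ (L u).card
    · obtain ⟨B, h1, h2⟩ := Finset.exists_subset_card_eq h
      exact ⟨B, h2, fun _ _ => h1⟩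
    · exact ⟨Finset.range 5, by simp, fun h1 h2 => (h (hL u h1 h2)).elim⟩
  choose B hB using this
  exact ⟨B, fun u => (hB u).1, fun u h1 h2 => (hB u).2 h1 h2⟩

theorem Goal.list {K : W → W → Prop} {L' : W → Finset ℕ} (h : Goal K U X φ L')
    (hL : ∀ u ∈ U, u ∉ X → L' u ⊆ L u) : Goal K U X φ L := by
  obtain ⟨f, f1, f2, f3⟩ := h
  exact ⟨f, f1, fun v h1 h2 => hL v h1 h2 (f2 v h1 h2), f3⟩

open Classical in
/-- deletion of a crossing vertex. -/
theorem T1H.delQ (h : T1H H U L X q c d c' d') (hX : ∀ x ∈ X, ¬ H.Adj q x) {a b e f : W}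
    (hd : ∀ y, H.Adj c y → y = a ∨ y = b ∨ y = e ∨ y = f) : Goal (KQ H c d c' d') U X φ L := by
  have cU : c ∈ U := (h.hin _ _ h.cr.r4).resolve_right h.cr.qc.ne'
  have dU : d ∈ U := (h.hin _ _ h.cr.r1).resolve_right h.cr.qd.ne'
  have d'U : d' ∈ U := (h.hin _ _ h.cr.r3).resolve_right h.cr.qd'.ne'
  have cX : c ∉ X := fun e => hX c e h.cr.qc
  have hfour : ∃ a b e : W, ∀ y, H.Adj c y → y ≠ q → y = a ∨ y = b ∨ y = e := by
    rcases hd q h.cr.qc.symm with rfl | rfl | rfl | rfl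
    · exact ⟨b, e, f, fun y hy hq => (hd y hy).resolve_left hq⟩
    · exact ⟨a, e, f, fun y hy hq => by rcases hd y hy with h | h | h | h <;> simp_all⟩
    · exact ⟨a, b, f, fun y hy hq => by rcases hd y hy with h | h | h | h <;> simp_all⟩
    · exact ⟨a, b, e, fun y hy hq => by rcases hd y hy with h | h | h | h <;> simp_all⟩
  obtain ⟨a, b, e, ha⟩ := hfour
  have hPl : Planar (cut H ((U : Set W) \ {c}) (({d, d'} : Finset W) : Set W)) := by
    refine h.hP.deltaF (A := {q}) (Conn.singleton q) ?_ (Finset.card_le_two.trans (by norm_num)) ?_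
    · rintro _ rfl ⟨h1, -⟩; exact h.qU h1
    · intro y hy
      simp only [Finset.mem_insert, Finset.mem_singleton] at hy
      rcases hy with rfl | rfl
      · exact ⟨⟨dU, by simpa using h.cr.n1.symm⟩, q, rfl, h.cr.qd.symm⟩
      · exact ⟨⟨d'U, by simpa using h.cr.n3.symm⟩, q, rfl, h.cr.qd'.symm⟩
  refine del (v := c) (a := a) (b := b) (e := e) (f := c') (fun u v => KQ.symm) cX (h.L5 c cU cX)
    (KQ.irr h.cr c) ?_ ?_ (R2 hPl (U.erase c) X φ L ?_ h.X3 ?_ ?_)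
  · rintro y hy (k | ⟨-, rfl⟩ | k | k | k)
    · rcases ha y k (by rintro rfl; exact h.qU hy) with h | h | h <;> simp [h]
    · simp
    · exact (h.cr.n2 k.1).elim
    · exact (h.cr.n1 k.1).elim
    · exact (h.cr.n3 k.1).elim
  · intro x hx xc y hy yc k
    refine ⟨?_, ?_⟩
    · rintro rfl; exact KQ.irr h.cr _ k
    rcases k with k | k | k | k | k
    · exact Or.inl ⟨k, ⟨hx, by simpa using xc⟩, hy, by simpa using yc⟩
    · exact (xc k.1).elim
    · exact (yc k.2).elim
    · exact Or.inr (by simp [k.1, k.2])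
    · exact Or.inr (by simp [k.1, k.2])
  · intro x hx; exact Finset.mem_erase.2 ⟨by rintro rfl; exact cX hx, h.XU hx⟩
  · intro s hs t ht hne
    have aux : ∀ x ∈ X, x ∈ (U : Set W) \ {c} := fun x hx =>
      ⟨h.XU hx, by rintro rfl; exact cX hx⟩
    exact ⟨hne, Or.inl ⟨h.cl s hs t ht hne, aux s hs, aux t ht⟩⟩
  · intro u hu; exact h.L5 u (Finset.mem_of_mem_erase hu)

end CN
end PartH4

open Set
noncomputable section PartH5
namespace CN
variable {W : Type} {H : SimpleGraph W}
variable {U X : Finset W} {L : W → Finset ℕ} {φ : W → ℕ} {q c d c' d' : W}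

open Classical in
theorem T1 : ∀ (n : ℕ) (H : SimpleGraph W) (U X : Finset W) (φ : W → ℕ) (L : W → Finset ℕ),
    T1H H U L X q c d c' d' → 4 * U.card + 3 - X.card < n → Goal (KQ H c d c' d') U X φ L := by
  intro n
  induction n with
  | zero => intro H U X φ L h hn; omega
  | succ n ih =>
  intro H U X φ L h hn
  have hX3 := h.X3
  by_contra no
  have cU : c ∈ U := (h.hin _ _ h.cr.r4).resolve_right h.cr.qc.ne'
  have Xq : ∀ x ∈ X, ¬ H.Adj q x := fun x hx hq => no (h.k0 ⟨x, hx, hq⟩)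
  have XM : X.card ≤ U.card := Finset.card_le_card h.XU
  -- common neighbours
  have nc : X.card ≤ 2 → ∀ v ∈ U, v ∉ X → ∃ x ∈ X, ¬ H.Adj v x := by
    intro hc v hv hvX
    by_contra hcon
    push Not at hcon
    obtain ⟨γ, g1, g2⟩ := pick1 (A := L v) (B := X.image φ) (by
      have := Finset.card_image_le (s := X) (f := φ)
      have := h.L5 v hv hvX; omega)
    have hcard : (insert v X).card = X.card + 1 := Finset.card_insert_of_notMem hvX
    refine no (weaken (KQ.irr h.cr) hvX g1 (fun u v => KQ.symm)
      (fun x hx e => g2 (Finset.mem_image.2 ⟨x, hx, e.symm⟩)) (ih _ _ _ _ _ { h with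
        XU := Finset.insert_subset hv h.XU
        X3 := by omega
        cl := ?_
        L5 := fun u hu hu' => h.L5 u hu (fun e => hu' (Finset.mem_insert_of_mem e)) } (by omega)))
    intro s hs t ht hne
    rw [Finset.mem_insert] at hs ht
    rcases hs with rfl | hs
    · rcases ht with rfl | ht
      · exact (hne rfl).elim
      · exact hcon t ht
    · rcases ht with rfl | ht
      · exact (hcon s hs).symm
      · exact h.cl s hs t ht hne
  set M : Set W := insert q (U : Set W) with hMdef
  have UM : ∀ u ∈ U, u ∈ M := fun u hu => Or.inr hu
  have inM : ∀ u v, H.Adj u v → v ∈ M := fun u v e => (h.hin u v e).symm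
  -- connectivity
  have conn : ∀ x ∈ U, ∀ y ∈ U, ∀ z ∈ U, Conn H (M \ {x, y, z}) := by
    by_contra hno
    obtain ⟨Y, hYU, hY3, hS⟩ := sep UM hno
    have qY : q ∈ M \ (Y : Set W) := ⟨Or.inl rfl, fun e => h.qU (hYU e)⟩
    obtain ⟨nq, w, hw, wC⟩ := hS q qY
    obtain ⟨nw, -⟩ := hS w hw
    have disj : ∀ u, u ∈ comp H (M \ (Y : Set W)) q → u ∉ comp H (M \ (Y : Set W)) w :=
      fun u => comp_disj qY hw wC
    have wq : w ≠ q := by rintro rfl; exact wC (self_mem_comp _ _)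
    have wU : w ∈ U := hw.1.resolve_left wq
    have wY : w ∉ Y := hw.2
    have nbq : ∀ v, H.Adj q v → v ∈ comp H (M \ (Y : Set W)) q ∨ v ∈ (Y : Set W) := fun v hv =>
      comp_cl inM (self_mem_comp _ _) hv
    have qYn : q ∉ Y := fun e => h.qU (hYU e)
    have hcY : ∀ P : Set W, ∀ s ∈ Y, ∀ t ∈ Y, s ≠ t → (cut H P (Y : Set W)).Adj s t :=
      fun P s hs t ht e => ⟨e, Or.inr ⟨hs, ht⟩⟩
    have pl1 : ∀ z ∈ M \ (Y : Set W), Planar (cut H (M \ comp H (M \ (Y : Set W)) z) (Y : Set W)) := by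
      intro z hz
      refine h.hP.deltaF (comp_conn _ z) (fun a ha hb => hb.2 ha) hY3 (fun y hy => ⟨⟨UM y (hYU hy),
        fun e => (comp_sub hz e).2 hy⟩, (hS z hz).1 y hy⟩)
    have pl2 : ∀ z ∈ M \ (Y : Set W), ∀ w ∈ M \ (Y : Set W),
        (∀ u, u ∈ comp H (M \ (Y : Set W)) z → u ∉ comp H (M \ (Y : Set W)) w) →
        Planar (cut H (comp H (M \ (Y : Set W)) z ∪ Y) (Y : Set W)) := by
      intro z hz w hw hd
      refine h.hP.deltaF (comp_conn _ w) ?_ hY3 (fun y hy => ⟨Or.inr hy, (hS w hw).1 y hy⟩)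
      rintro a ha (hb | hb)
      exacts [hd a hb ha, (comp_sub hw ha).2 hb]
    by_cases hXC : ∀ x ∈ X, x ∉ comp H (M \ (Y : Set W)) q
    · refine no (split (z := q) (m := mt c d c' d') (m1 := fun _ _ => False) (m2 := mt c d c' d')
        inM UM qY hXC ?_ ?_ ?_)
      · intro u _ v _ hm
        obtain ⟨h1, h2, h3⟩ := h.cr.mt hm
        exact ⟨h3, Or.inr ⟨hm, nbq u h1, nbq v h2⟩⟩
      · refine Goal.mono (K := (cut H (M \ comp H (M \ (Y : Set W)) q) (Y : Set W)).Adj)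
          (R2 (pl1 q qY) _ X φ L ?_ h.X3 ?_ ?_) (fun u v k => k.resolve_right id)
        · intro x hx; exact Finset.mem_filter.2 ⟨h.XU hx, hXC x hx⟩
        · intro s hs t ht e
          exact ⟨e, Or.inl ⟨h.cl s hs t ht e, ⟨UM s (h.XU hs), hXC s hs⟩, UM t (h.XU ht), hXC t ht⟩⟩
        · intro u hu; exact h.L5 u (Finset.mem_filter.1 hu).1
      · intro f
        have hlt : (U.filter (fun u => u ∈ comp H (M \ (Y : Set W)) q) ∪ Y).card < U.card := by
          refine Finset.card_lt_card ⟨?_, ?_⟩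
          · exact Finset.union_subset (Finset.filter_subset _ _) hYU
          · intro hs
            have := hs wU
            simp only [Finset.mem_union, Finset.mem_filter] at this
            rcases this with h1 | h1
            exacts [wC h1.2, wY h1]
        refine ih _ _ _ _ _ { 
          hP := pl2 q qY w hw disj
          cr := h.cr.cut (Or.inl (self_mem_comp _ _)) qYn (fun v hv => nbq v hv)
          qU := ?_
          hin := ?_
          XU := Finset.subset_union_right
          X3 := hY3
          cl := hcY _
          L5 := ?_ } (by omega)
        · simp only [Finset.mem_union, Finset.mem_filter]
          rintro (h1 | h1)
          exacts [h.qU h1.1, qYn h1]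
        · rintro u v ⟨-, ⟨h1, h2, h3⟩ | h1⟩
          · by_cases e : v = q
            · exact Or.inr e
            · left
              simp only [Finset.mem_union, Finset.mem_filter]
              exact h3.imp (fun h4 => ⟨(inM _ _ h1).resolve_left e, h4⟩) id
          · exact Or.inl (Finset.mem_union_right _ h1.2)
        · intro u hu huY
          have hu' := (Finset.mem_union.1 hu).resolve_right huY
          rw [Finset.mem_filter] at hu'
          exact h.L5 u hu'.1 (fun e => hXC u e hu'.2)
    · push Not at hXC
      obtain ⟨x0, hx0, x0C⟩ := hXC
      have hXC : ∀ x ∈ X, x ∉ comp H (M \ (Y : Set W)) w := by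
        intro x hx hxw
        by_cases e : x = x0
        · subst e; exact disj x x0C hxw
        · rcases comp_cl inM x0C (h.cl x0 hx0 x hx (Ne.symm e)) with h1 | h1
          · exact disj x h1 hxw
          · exact (comp_sub hw hxw).2 h1
      have qw : q ∉ comp H (M \ (Y : Set W)) w := disj q (self_mem_comp _ _)
      have nbw : ∀ v, H.Adj q v → v ∉ comp H (M \ (Y : Set W)) w := by
        intro v hv h1
        rcases nbq v hv with h2 | h2
        exacts [disj v h2 h1, (comp_sub hw h1).2 h2]
      refine no (split (z := w) (m := mt c d c' d') (m1 := mt c d c' d') (m2 := fun _ _ => False)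
        inM UM hw hXC ?_ ?_ ?_)
      · intro u _ v _ hm
        obtain ⟨h1, h2, h3⟩ := h.cr.mt hm
        exact ⟨h3, Or.inl ⟨nbw u h1, nbw v h2, hm⟩⟩
      · have hlt : (U.filter (fun u => u ∉ comp H (M \ (Y : Set W)) w)).card < U.card := by
          refine Finset.card_lt_card ⟨Finset.filter_subset _ _, ?_⟩
          intro hs
          have := hs wU
          rw [Finset.mem_filter] at this
          exact this.2 (self_mem_comp _ _)
        refine ih _ _ _ _ _ { 
          hP := pl1 w hw
          cr := h.cr.cut ⟨Or.inl rfl, qw⟩ qYn (fun v hv => ⟨inM _ _ hv, nbw v hv⟩)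
          qU := fun e => h.qU (Finset.mem_filter.1 e).1
          hin := ?_
          XU := fun x hx => Finset.mem_filter.2 ⟨h.XU hx, hXC x hx⟩
          X3 := h.X3
          cl := fun s hs t ht e => ⟨e, Or.inl ⟨h.cl s hs t ht e, ⟨UM s (h.XU hs), hXC s hs⟩,
            UM t (h.XU ht), hXC t ht⟩⟩
          L5 := fun u hu => h.L5 u (Finset.mem_filter.1 hu).1 } (by omega)
        rintro u v ⟨-, ⟨h1, h2, h3⟩ | h1⟩
        · by_cases e : v = q
          · exact Or.inr e
          · exact Or.inl (Finset.mem_filter.2 ⟨h3.1.resolve_left e, h3.2⟩)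
        · exact Or.inl (Finset.mem_filter.2 ⟨hYU h1.2, fun e => (comp_sub hw e).2 h1.2⟩)
      · intro f
        refine Goal.mono (K := (cut H (comp H (M \ (Y : Set W)) w ∪ Y) (Y : Set W)).Adj)
          (R2 (pl2 w hw q qY (fun u h1 h2 => disj u h2 h1)) _ Y f L Finset.subset_union_right hY3
            (hcY _) ?_) (fun u v k => k.resolve_right id)
        intro u hu huY
        have hu' := (Finset.mem_union.1 hu).resolve_right huY
        rw [Finset.mem_filter] at hu'
        exact h.L5 u hu'.1 (fun e => hXC u e hu'.2)
  -- degrees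
  have dgr : ∀ v ∈ U, v ∉ X → ∀ a b e f, ∃ y, H.Adj v y ∧ y ≠ a ∧ y ≠ b ∧ y ≠ e ∧ y ≠ f := by
    intro v hv hvX a b e f
    by_contra hcon
    have hd : ∀ y, H.Adj v y → y = a ∨ y = b ∨ y = e ∨ y = f := by
      intro y hy
      by_contra hc
      push Not at hc
      exact hcon ⟨y, hy, hc⟩
    clear hcon
    by_cases hvq : H.Adj q v
    · rcases (h.cr.nq v).1 hvq with rfl | rfl | rfl | rfl
      · exact no (h.delQ Xq hd)
      · refine no ?_
        rw [← KQ.rot]; exact h.rot.delQ Xq hd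
      · refine no ?_
        rw [← KQ.rot, ← KQ.rot]; exact h.rot.rot.delQ Xq hd
      · refine no ?_
        rw [← KQ.rot, ← KQ.rot, ← KQ.rot]; exact h.rot.rot.rot.delQ Xq hd
    · have hlt := Finset.card_erase_lt_of_mem hv
      have vq : v ≠ q := by rintro rfl; exact h.qU hv
      have aux : ∀ u ∈ M, u ≠ v → u ∈ M \ {v} := fun u hu e => ⟨hu, e⟩
      refine no (del (v := v) (fun u v => KQ.symm) hvX (h.L5 v hv hvX) (KQ.irr h.cr v)
        (a := a) (b := b) (e := e) (f := f) ?_ ?_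
        (ih (cut H (M \ {v}) ∅) (U.erase v) X φ L { 
          hP := h.hP.mono ?_
          cr := h.cr.cut (aux q (Or.inl rfl) vq.symm) (by simp)
            (fun u hu => aux u (inM _ _ hu) (by rintro rfl; exact hvq hu))
          qU := fun e => h.qU (Finset.mem_of_mem_erase e)
          hin := ?_
          XU := fun x hx => Finset.mem_erase.2 ⟨by rintro rfl; exact hvX hx, h.XU hx⟩
          X3 := h.X3
          cl := ?_
          L5 := fun u hu => h.L5 u (Finset.mem_of_mem_erase hu) } (by omega)))
      · rintro y hy (k | k)
        · exact hd y k
        · exact (hvq (h.cr.mt k).1).elim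
      · rintro x hx xv y hy yv (k | k)
        · exact Or.inl ⟨k.ne, Or.inl ⟨k, aux x (UM x hx) xv, aux y (UM y hy) yv⟩⟩
        · exact Or.inr k
      · rintro x y ⟨-, k | k⟩
        · exact k.1
        · exact k.1.elim
      · rintro x y ⟨-, k | k⟩
        · rcases h.hin x y k.1 with h1 | h1
          · exact Or.inl (Finset.mem_erase.2 ⟨k.2.2.2, h1⟩)
          · exact Or.inr h1
        · exact k.1.elim
      · intro s hs t ht e
        exact ⟨e, Or.inl ⟨h.cl s hs t ht e, aux s (UM s (h.XU hs)) (by rintro rfl; exact hvX hs),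
          aux t (UM t (h.XU ht)) (by rintro rfl; exact hvX ht)⟩⟩
  obtain ⟨L', hL1, hL2⟩ := shrink h.L5
  have qx : ∀ x, H.Adj q x → x ∈ U := fun x hx => (h.hin _ _ hx).resolve_right hx.ne'
  exact T1S.absurd (H := H) (U := U) (L := L') (X := X) (φ := φ) (q := q) (c := c) (d := d)
    (c' := c') (d' := d') { h.cr with
    hP := h.hP
    inM := inM
    UM := UM
    conn := conn
    qU := h.qU
    nU := fun x _ v hv => h.hin x v hv
    deg := fun x hx => dgr x (qx x hx) (fun e => Xq x e hx)
    L5 := fun u _ => hL1 u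
    XU := h.XU
    Xq := Xq
    X3 := h.X3
    cl := h.cl
    dgr := dgr
    nc := nc
    no := fun hg => no (hg.list hL2) }

theorem T1H.goal (h : T1H H U L X q c d c' d') : Goal (KQ H c d c' d') U X φ L :=
  T1 _ H U X φ L h (Nat.lt_succ_self _)

end CN
end PartH5

open Set
noncomputable section PartI1
namespace CN
variable {W : Type} {H : SimpleGraph W}
variable {M : Set W} {U X : Finset W} {L : W → Finset ℕ} {φ : W → ℕ}
  {p a b a' b' q c d c' d' : W}

/-- adjacency or mates at one of two crossings. -/
def KK (H : SimpleGraph W) (a b a' b' c d c' d' u v : W) : Prop :=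
  H.Adj u v ∨ mt a b a' b' u v ∨ mt c d c' d' u v

theorem mt.rot : mt d c' d' c = mt c d c' d' := by
  funext u v; unfold mt; apply propext; tauto

theorem mt.refl : mt c d' c' d = mt c d c' d' := by
  funext u v; unfold mt; apply propext; tauto

theorem KK.symm {u v : W} (h : KK H a b a' b' c d c' d' u v) : KK H a b a' b' c d c' d' v u := by
  rcases h with h | h | h
  exacts [Or.inl h.symm, Or.inr (Or.inl h.symm), Or.inr (Or.inr h.symm)]

/-- minimal counterexample with two crossings. -/
structure MS (H : SimpleGraph W) (M : Set W) (U : Finset W) (L : W → Finset ℕ)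
    (p a b a' b' q c d c' d' : W) : Prop where
  ep : Env H M U L p a b a' b'
  eq : Env H M U L q c d c' d'
  dj : ∀ v, H.Adj p v → ¬ H.Adj q v
  dgr : ∀ v ∈ U, ∀ a b e f, ∃ y, H.Adj v y ∧ y ≠ a ∧ y ≠ b ∧ y ≠ e ∧ y ≠ f
  mM : ∀ v ∈ M, v ∈ U ∨ v = p ∨ v = q
  no : ¬ Goal (KK H a b a' b' c d c' d') U ∅ (fun _ => 0) L

theorem MS.rotq (h : MS H M U L p a b a' b' q c d c' d') : MS H M U L p a b a' b' q d c' d' c :=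
  { h with
    eq := h.eq.rot
    no := by
      have := h.no
      unfold KK at this ⊢
      rw [mt.rot (c := c) (d := d)]; exact this }

theorem MS.reflq (h : MS H M U L p a b a' b' q c d c' d') : MS H M U L p a b a' b' q c d' c' d :=
  { h with
    eq := h.eq.refl
    no := by
      have := h.no
      unfold KK at this ⊢
      rw [mt.refl (c := c) (d := d)]; exact this }

theorem MS.swap (h : MS H M U L p a b a' b' q c d c' d') : MS H M U L q c d c' d' p a b a' b' :=
  { ep := h.eq
    eq := h.ep
    dj := fun v h1 h2 => h.dj v h2 h1
    dgr := h.dgr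
    mM := fun v hv => (h.mM v hv).imp id Or.symm
    no := fun hg => h.no (hg.mono (fun u v k => k.imp id Or.symm)) }

theorem MS.rotp (h : MS H M U L p a b a' b' q c d c' d') : MS H M U L p b a' b' a q c d c' d' :=
  h.swap.rotq.swap

theorem MS.reflp (h : MS H M U L p a b a' b' q c d c' d') : MS H M U L p a b' a' b q c d c' d' :=
  h.swap.reflq.swap

open Classical in
theorem MS.mfin (h : MS H M U L p a b a' b' q c d c' d') {Sr : Finset W} (hSU : Sr ⊆ U)
    (hS : Conn H (insert q (Sr : Set W))) (aS : a ∈ Sr) (bS : b ∉ Sr)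
    (p1 : c ∈ Sr ∨ c' ∈ Sr) (p2 : d ∈ Sr ∨ d' ∈ Sr) (ψ : W → ℕ) (inL : ∀ s ∈ Sr, ψ s ∈ L s)
    (βL : ψ b ∈ L b)
    (prp : ∀ s ∈ Sr, ∀ t ∈ Sr, KK H a b a' b' c d c' d' s t → ψ s ≠ ψ t)
    (prb : ∀ s ∈ Sr, KK H a b a' b' c d c' d' b s → ψ b ≠ ψ s)
    (ok : ∀ u ∈ U, u ∉ Sr → u ≠ b → ∃ x y,
      (∀ s ∈ Sr, KK H a b a' b' c d c' d' u s → ψ s ∈ L u → ψ s = x ∨ ψ s = y) ∧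
      (u = b' → ψ b ∈ L u → ψ b = x ∨ ψ b = y)) : False := by
  have S' : Conn H (insert p (insert q (Sr : Set W))) := hS.insert ⟨a, Or.inr aS, h.ep.qc⟩
  have irr : ∀ v, ¬ KK H a b a' b' c d c' d' v v := by
    rintro v (k | k | k)
    exacts [k.ne rfl, (h.ep.toCross.mt k).2.2 rfl, (h.eq.toCross.mt k).2.2 rfl]
  refine h.no (fin (H := H) h.ep.hP (fun u v => KK.symm) U ∅ Sr {b} _ S' ?_ ?_ ?_ (by simp) ?_ ?_
    ψ _ L (by simp) (by simp) (fun u hu _ _ => (h.ep.L5 u hu).ge) ?_ hSU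
    (fun x hx => Or.inr (Or.inr hx)) ?_ ?_ ?_)
  · rintro u hu (rfl | rfl | h1)
    exacts [(h.ep.qU hu).elim, (h.eq.qU hu).elim, h1]
  · intro t ht
    rw [Finset.mem_singleton] at ht
    rw [ht]; exact h.ep.dU
  · intro t ht
    rw [Finset.mem_singleton] at ht
    rw [ht]; exact bS
  · intro t ht
    rw [Finset.mem_singleton] at ht
    rw [ht]; exact ⟨p, Or.inl rfl, h.ep.qd.symm⟩
  · intro s hs t ht e
    rw [Finset.mem_singleton] at hs ht
    exact (e (hs.trans ht.symm)).elim
  · have mp : ∀ u v, mt a b a' b' u v → u ∈ Sr ∨ u ∈ ({b} : Finset W) ∨ v ∈ Sr ∨ v ∈ ({b} : Finset W) := by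
      rintro u v (⟨rfl, rfl⟩ | ⟨rfl, rfl⟩ | ⟨rfl, rfl⟩ | ⟨rfl, rfl⟩) <;> simp [aS]
    have mq : ∀ u v, mt c d c' d' u v → u ∈ Sr ∨ u ∈ ({b} : Finset W) ∨ v ∈ Sr ∨ v ∈ ({b} : Finset W) := by
      rintro u v (⟨rfl, rfl⟩ | ⟨rfl, rfl⟩ | ⟨rfl, rfl⟩ | ⟨rfl, rfl⟩)
      · rcases p1 with k | k <;> simp [k]
      · rcases p1 with k | k <;> simp [k]
      · rcases p2 with k | k <;> simp [k]
      · rcases p2 with k | k <;> simp [k]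
    rintro u _ v _ (k | k | k)
    · exact Or.inl k
    · obtain ⟨k1, k2, -⟩ := h.ep.toCross.mt k
      exact Or.inr ⟨⟨p, Or.inl rfl, k1.symm⟩, ⟨p, Or.inl rfl, k2.symm⟩, mp u v k⟩
    · obtain ⟨k1, k2, -⟩ := h.eq.toCross.mt k
      exact Or.inr ⟨⟨q, Or.inr (Or.inl rfl), k1.symm⟩, ⟨q, Or.inr (Or.inl rfl), k2.symm⟩, mq u v k⟩
  · intro s hs _
    rcases hs with hs | hs
    · exact inL s hs
    · rw [Finset.mem_singleton] at hs
      rw [hs]; exact βL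
  · intro s hs _ v hv k
    rw [Finset.mem_singleton] at hs hv
    rcases hs with hs | rfl
    · rcases hv with hv | rfl
      · exact prp s hs v hv k
      · exact (prb s hs k.symm).symm
    · rcases hv with hv | rfl
      · exact prb v hv k
      · exact (irr _ k).elim
  · intro u hu uS uT
    rw [Finset.mem_singleton] at uT
    obtain ⟨x, y, h1, h2⟩ := ok u hu uS uT
    refine ⟨x, y, fun s hs k hn => ?_⟩
    rw [Finset.mem_singleton] at hs hn
    rcases hs with hs | rfl
    · exact h1 s hs k
    · refine h2 ?_
      rcases k with k | k | k
      · exact (hn ⟨rfl, k⟩).elim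
      · rcases k with ⟨-, k⟩ | ⟨-, k⟩ | ⟨-, k⟩ | ⟨k, -⟩
        · exact (h.ep.n4 k).elim
        · exact (h.ep.n1 k.symm).elim
        · exact (h.ep.n5 k).elim
        · exact k
      · exact (h.dj s h.ep.qd (h.eq.toCross.mt k).2.1).elim

open Classical in
theorem MS.tri (h : MS H M U L p a b a' b' q c d c' d') (ac : H.Adj a c) {ρ γ κ β : ℕ}
    (hρ : ρ ∈ L a) (hγ : γ ∈ L c) (hκ : κ ∈ L d) (hβ : β ∈ L b) (gr : γ ≠ ρ) (kg : κ ≠ γ)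
    (ad : H.Adj a d → κ ≠ ρ) (br : β ≠ ρ) (bc : H.Adj b c → β ≠ γ) (bd : H.Adj b d → β ≠ κ)
    (h1 : ∀ u ∈ U, H.Adj u a → H.Adj u c → H.Adj u d → κ ∉ bad (L u) ρ γ)
    (h2 : H.Adj a c' → κ ∉ bad (L c') ρ γ) (h3 : H.Adj a d' → κ ∉ bad (L d') ρ γ)
    (h4 : ¬ (H.Adj a' c ∧ H.Adj a' d))
    (h5 : ∃ x y, (ρ = x ∨ ρ = y) ∧ (β ∈ L b' → β = x ∨ β = y) ∧
      (H.Adj b' c → γ ∈ L b' → γ = x ∨ γ = y) ∧ (H.Adj b' d → κ ∈ L b' → κ = x ∨ κ = y)) :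
    False := by
  have pa := h.ep.qc
  have pb := h.ep.qd
  have pa' := h.ep.qc'
  have pb' := h.ep.qd'
  have qc := h.eq.qc
  have qd := h.eq.qd
  have qc' := h.eq.qc'
  have qd' := h.eq.qd'
  have ne : ∀ {u v}, H.Adj p u → H.Adj q v → u ≠ v := by rintro u v h1 h2 rfl; exact h.dj u h1 h2
  have hm : ∀ s, s ∈ ({a, c, d} : Finset W) ↔ s = a ∨ s = c ∨ s = d := by simp
  set ψ : W → ℕ := fun u => if u = a then ρ else if u = c then γ else if u = d then κ else β with hψ
  have ea : ψ a = ρ := by simp [hψ]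
  have ec : ψ c = γ := by simp [hψ, (ne pa qc).symm]
  have ed : ψ d = κ := by simp [hψ, (ne pa qd).symm, h.eq.n1.symm]
  have eb : ψ b = β := by simp [hψ, ne pb qc, ne pb qd, h.ep.n1.symm]
  clear_value ψ
  -- relation to each of the three
  have Ka : ∀ u, KK H a b a' b' c d c' d' u a → H.Adj u a ∨ u = a' := by
    rintro u (k | k | k)
    · exact Or.inl k
    · rcases k with ⟨-, k⟩ | ⟨k, -⟩ | ⟨-, k⟩ | ⟨-, k⟩
      · exact (h.ep.n2 k).elim
      · exact Or.inr k
      · exact (h.ep.n3 k).elim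
      · exact (h.ep.n1 k).elim
    · exact (h.dj _ pa (h.eq.toCross.mt k).2.1).elim
  have Kc : ∀ u, KK H a b a' b' c d c' d' u c → H.Adj u c ∨ u = c' := by
    rintro u (k | k | k)
    · exact Or.inl k
    · exact (h.dj _ (h.ep.toCross.mt k).2.1 qc).elim
    · rcases k with ⟨-, k⟩ | ⟨k, -⟩ | ⟨-, k⟩ | ⟨-, k⟩
      · exact (h.eq.n2 k).elim
      · exact Or.inr k
      · exact (h.eq.n3 k).elim
      · exact (h.eq.n1 k).elim
  have Kd : ∀ u, KK H a b a' b' c d c' d' u d → H.Adj u d ∨ u = d' := by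
    rintro u (k | k | k)
    · exact Or.inl k
    · exact (h.dj _ (h.ep.toCross.mt k).2.1 qd).elim
    · rcases k with ⟨-, k⟩ | ⟨-, k⟩ | ⟨-, k⟩ | ⟨k, -⟩
      · exact (h.eq.n4 k).elim
      · exact (h.eq.n1 k.symm).elim
      · exact (h.eq.n5 k).elim
      · exact Or.inr k
  have hac : ψ a ≠ ψ c := by rw [ea, ec]; exact gr.symm
  have hcd : ψ c ≠ ψ d := by rw [ec, ed]; exact kg.symm
  have had : KK H a b a' b' c d c' d' a d → ψ a ≠ ψ d := by
    intro k
    rw [ea, ed]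
    exact (ad ((Kd a k).resolve_right (ne pa qd'))).symm
  have irr : ∀ v, ¬ KK H a b a' b' c d c' d' v v := by
    rintro v (k | k | k)
    exacts [k.ne rfl, (h.ep.toCross.mt k).2.2 rfl, (h.eq.toCross.mt k).2.2 rfl]
  refine h.mfin (Sr := {a, c, d}) ?_ ?_ (by simp) ?_ (by simp) (by simp) ψ ?_ (by rwa [eb]) ?_ ?_ ?_
  · intro s hs
    rcases (hm s).1 hs with rfl | rfl | rfl
    exacts [h.ep.cU, h.eq.cU, h.eq.dU]
  · have e : (insert q (({a, c, d} : Finset W) : Set W)) = insert q (insert a (insert c {d})) := by simp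
    rw [e]
    exact Conn.insert (Conn.insert (Conn.insert (Conn.singleton d) ⟨d, rfl, h.eq.r1⟩)
      ⟨c, by simp, ac⟩) ⟨d, by simp, qd⟩
  · rw [hm]
    rintro (k | k | k)
    exacts [h.ep.n1 k.symm, ne pb qc k, ne pb qd k]
  · intro s hs
    rcases (hm s).1 hs with rfl | rfl | rfl
    · rwa [ea]
    · rwa [ec]
    · rwa [ed]
  · intro s hs t ht k
    rcases (hm s).1 hs with rfl | rfl | rfl <;> rcases (hm t).1 ht with rfl | rfl | rfl
    exacts [(irr _ k).elim, hac, had k, hac.symm, (irr _ k).elim, hcd, (had k.symm).symm, hcd.symm,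
      (irr _ k).elim]
  · intro s hs k
    rw [eb]
    rcases (hm s).1 hs with rfl | rfl | rfl
    · rw [ea]; exact br
    · rw [ec]; exact bc ((Kc b k).resolve_right (ne pb qc'))
    · rw [ed]; exact bd ((Kd b k).resolve_right (ne pb qd'))
  · intro u hu uS ub
    rw [hm] at uS
    push Not at uS
    by_cases ub' : u = b'
    · subst ub'
      obtain ⟨x, y, e1, e2, e3, e4⟩ := h5
      refine ⟨x, y, ?_, fun _ => by rw [eb]; exact e2⟩
      intro s hs k
      rcases (hm s).1 hs with rfl | rfl | rfl
      · rw [ea]; exact fun _ => e1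
      · rw [ec]; exact e3 ((Kc _ k).resolve_right (ne pb' qc'))
      · rw [ed]; exact e4 ((Kd _ k).resolve_right (ne pb' qd'))
    by_cases hall : κ ∉ bad (L u) ρ γ
    · obtain ⟨x, y, e1, e2, e3⟩ := ok3 hall
      refine ⟨x, y, ?_, fun e => (ub' e).elim⟩
      intro s hs k
      rcases (hm s).1 hs with rfl | rfl | rfl
      · rw [ea]; exact e1
      · rw [ec]; exact e2
      · rw [ed]; exact e3
    · have : ¬ (KK H a b a' b' c d c' d' u a ∧ KK H a b a' b' c d c' d' u c ∧
          KK H a b a' b' c d c' d' u d) := by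
        rintro ⟨k1, k2, k3⟩
        rcases Kc u k2 with j2 | rfl
        · rcases Kd u k3 with j3 | rfl
          · rcases Ka u k1 with j1 | rfl
            · exact hall (h1 u hu j1 j2 j3)
            · exact h4 ⟨j2, j3⟩
          · exact hall (h3 ((Ka _ k1).resolve_right (ne pa' qd').symm).symm)
        · exact hall (h2 ((Ka _ k1).resolve_right (ne pa' qc').symm).symm)
      by_cases k1 : KK H a b a' b' c d c' d' u a
      · by_cases k2 : KK H a b a' b' c d c' d' u c
        · refine ⟨ρ, γ, ?_, fun e => (ub' e).elim⟩
          intro s hs k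
          rcases (hm s).1 hs with rfl | rfl | rfl
          · simp [ea]
          · simp [ec]
          · exact (this ⟨k1, k2, k⟩).elim
        · refine ⟨ρ, κ, ?_, fun e => (ub' e).elim⟩
          intro s hs k
          rcases (hm s).1 hs with rfl | rfl | rfl
          · simp [ea]
          · exact (k2 k).elim
          · simp [ed]
      · refine ⟨γ, κ, ?_, fun e => (ub' e).elim⟩
        intro s hs k
        rcases (hm s).1 hs with rfl | rfl | rfl
        · exact (k1 k).elim
        · simp [ec]
        · simp [ed]

end CN
end PartI1

open Set
noncomputable section PartI2
namespace CN
variable {W : Type} {H : SimpleGraph W}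
variable {M : Set W} {U X : Finset W} {L : W → Finset ℕ} {φ : W → ℕ}
  {p a b a' b' q c d c' d' : W}

theorem pk3 {A : Finset ℕ} (hA : A.card = 5) (x y z : ℕ) : ∃ κ ∈ A, κ ≠ x ∧ κ ≠ y ∧ κ ≠ z := by
  obtain ⟨κ, h1, h2⟩ := pick1 (A := A) (B := {x, y, z}) (by
    have := card3 x y z; omega)
  simp only [Finset.mem_insert, Finset.mem_singleton, not_or] at h2
  exact ⟨κ, h1, h2⟩

theorem eq5 {A B : Finset ℕ} (hA : A.card = 5) (hB : B.card = 5) : A = B ∨ ∃ x ∈ A, x ∉ B := by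
  by_cases h : A ⊆ B
  · exact Or.inl (Finset.eq_of_subset_of_card_le h (by omega))
  · rw [Finset.not_subset] at h; exact Or.inr h

/-- a vertex adjacent to `a` is not adjacent to both `b` and `b'`. -/
theorem MS.nbb (h : MS H M U L p a b a' b' q c d c' d') {v : W} (hv : v ≠ p) (va : H.Adj v a)
    (vb : H.Adj v b) (vb' : H.Adj v b') : False :=
  h.ep.rot.rot.rot.F0 hv vb' va vb

theorem MS.cp (h : MS H M U L p a b a' b' q c d c' d') : c ≠ p := fun e => h.ep.qU (e ▸ h.eq.cU)
theorem MS.aq (h : MS H M U L p a b a' b' q c d c' d') : a ≠ q := fun e => h.eq.qU (e ▸ h.ep.cU)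

theorem MS.triA (h : MS H M U L p a b a' b' q c d c' d') (ac : H.Adj a c) (ad : H.Adj a d)
    {ρ γ κ β : ℕ} (hρ : ρ ∈ L a) (hγ : γ ∈ L c) (hκ : κ ∈ L d) (hβ : β ∈ L b) (gr : γ ≠ ρ)
    (kg : κ ≠ γ) (kr : κ ≠ ρ) (br : β ≠ ρ) (bc : β ≠ γ) (bd : H.Adj b d → β ≠ κ)
    (h5 : ∃ x y, (ρ = x ∨ ρ = y) ∧ (β ∈ L b' → β = x ∨ β = y) ∧
      (H.Adj b' c → γ ∈ L b' → γ = x ∨ γ = y) ∧ (H.Adj b' d → κ ∈ L b' → κ = x ∨ κ = y)) :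
    False := by
  have uq : ∀ u ∈ U, H.Adj u c → H.Adj u d → u = a := fun u hu h1 h2 =>
    h.eq.F1 (fun e => h.eq.qU (e ▸ hu)) h.aq h1 h2 ac ad
  refine h.tri ac hρ hγ hκ hβ gr kg (fun _ => kr) br (fun _ => bc) bd ?_ ?_ ?_ ?_ h5
  · intro u hu h1 h2 h3
    exact (h1.ne (uq u hu h2 h3)).elim
  · exact fun e => (h.eq.F0 h.aq ac ad e).elim
  · exact fun e => (h.eq.rot.rot.rot.F0 h.aq e ac ad).elim
  · exact fun e => h.ep.n2 (uq a' h.ep.c'U e.1 e.2).symm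

theorem MS.noA (h : MS H M U L p a b a' b' q c d c' d') (ac : H.Adj a c) (ad : H.Adj a d) : False := by
  have key1 : ∀ {b b' : W}, MS H M U L p a b a' b' q c d c' d' → ¬ H.Adj b' c → ¬ H.Adj b' d →
      False := by
    intro b b' h bc bd
    obtain ⟨ρ, hρ, -⟩ := pk3 (h.ep.L5 a h.ep.cU) 0 0 0
    obtain ⟨γ, hγ, g1, -⟩ := pk3 (h.ep.L5 c h.eq.cU) ρ ρ ρ
    obtain ⟨κ, hκ, k1, k2, -⟩ := pk3 (h.ep.L5 d h.eq.dU) ρ γ ρ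
    obtain ⟨β, hβ, b1, b2, b3⟩ := pk3 (h.ep.L5 b h.ep.dU) ρ γ κ
    exact h.triA ac ad hρ hγ hκ hβ g1 k2 k1 b1 b2 (fun _ => b3)
      ⟨ρ, β, Or.inl rfl, fun _ => Or.inr rfl, fun e => (bc e).elim, fun e => (bd e).elim⟩
  have key2 : ∀ {b b' : W}, MS H M U L p a b a' b' q c d c' d' → ¬ H.Adj b' c → ¬ H.Adj b d →
      False := by
    intro b b' h bc bd
    rcases eq5 (h.ep.L5 d h.eq.dU) (h.ep.L5 b' h.ep.d'U) with e1 | ⟨κ, hκ, k1⟩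
    · rcases eq5 (h.ep.L5 b h.ep.dU) (h.ep.L5 b' h.ep.d'U) with e2 | ⟨β, hβ, b1⟩
      · obtain ⟨ρ, hρ, -⟩ := pk3 (h.ep.L5 a h.ep.cU) 0 0 0
        obtain ⟨γ, hγ, g1, -⟩ := pk3 (h.ep.L5 c h.eq.cU) ρ ρ ρ
        obtain ⟨κ, hκ, k1, k2, -⟩ := pk3 (h.ep.L5 d h.eq.dU) ρ γ ρ
        exact h.triA ac ad hρ hγ hκ (by rw [e2, ← e1]; exact hκ) g1 k2 k1 k1 k2 (fun e => (bd e).elim)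
          ⟨ρ, κ, Or.inl rfl, fun _ => Or.inr rfl, fun e => (bc e).elim, fun _ _ => Or.inr rfl⟩
      · obtain ⟨ρ, hρ, r1, -⟩ := pk3 (h.ep.L5 a h.ep.cU) β β β
        obtain ⟨γ, hγ, g1, g2, -⟩ := pk3 (h.ep.L5 c h.eq.cU) ρ β ρ
        obtain ⟨κ, hκ, k1, k2, -⟩ := pk3 (h.ep.L5 d h.eq.dU) ρ γ ρ
        exact h.triA ac ad hρ hγ hκ hβ g1 k2 k1 r1.symm g2.symm (fun e => (bd e).elim)
          ⟨ρ, κ, Or.inl rfl, fun e => (b1 e).elim, fun e => (bc e).elim, fun _ _ => Or.inr rfl⟩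
    · obtain ⟨ρ, hρ, r1, -⟩ := pk3 (h.ep.L5 a h.ep.cU) κ κ κ
      obtain ⟨γ, hγ, g1, g2, -⟩ := pk3 (h.ep.L5 c h.eq.cU) ρ κ ρ
      obtain ⟨β, hβ, b1, b2, -⟩ := pk3 (h.ep.L5 b h.ep.dU) ρ γ ρ
      exact h.triA ac ad hρ hγ hκ hβ g1 g2.symm r1.symm b1 b2 (fun e => (bd e).elim)
        ⟨ρ, β, Or.inl rfl, fun _ => Or.inr rfl, fun e => (bc e).elim, fun _ e => (k1 e).elim⟩
  have nc : ¬ (H.Adj b c ∧ H.Adj b' c) := fun e => h.nbb h.cp ac.symm e.1.symm e.2.symm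
  have nd : ¬ (H.Adj b d ∧ H.Adj b' d) := fun e => h.nbb h.rotq.cp ad.symm e.1.symm e.2.symm
  by_cases b'c : H.Adj b' c
  · have bc : ¬ H.Adj b c := fun e => nc ⟨e, b'c⟩
    by_cases bd : H.Adj b d
    · exact key2 h.reflp bc (fun e => nd ⟨bd, e⟩)
    · exact key1 h.reflp bc bd
  · by_cases b'd : H.Adj b' d
    · exact key2 h b'c (fun e => nd ⟨e, b'd⟩)
    · exact key1 h b'c b'd

theorem MS.noB (h : MS H M U L p a b a' b' q c d c' d') (ac : H.Adj a c) (ac' : H.Adj a c') : False := by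
  have key : ∀ {b b' d d' : W}, MS H M U L p a b a' b' q c d c' d' → ¬ H.Adj b d → ¬ H.Adj a' d →
      ¬ H.Adj b' d → ¬ H.Adj b' c → False := by
    intro b b' d d' h bd a'd b'd b'c
    obtain ⟨ρ, hρ, -⟩ := pk3 (h.ep.L5 a h.ep.cU) 0 0 0
    have ad : ¬ H.Adj a d := fun e => h.eq.F0 h.aq ac e ac'
    have ad' : ¬ H.Adj a d' := fun e => h.eq.refl.F0 h.aq ac e ac'
    have main : ∀ F : Finset ℕ, F.card = 5 → (∀ u ∈ U, H.Adj u a → H.Adj u c → H.Adj u d → L u = F) →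
        False := by
      intro F hF hu
      obtain ⟨γ, hγ, g1, κ, hκ, k1, k2, k3⟩ := comb (h.ep.L5 c h.eq.cU) (h.ep.L5 d h.eq.dU) hF
        (h.ep.L5 c' h.eq.c'U) ρ
      obtain ⟨β, hβ, b1, b2, -⟩ := pk3 (h.ep.L5 b h.ep.dU) ρ γ ρ
      exact h.tri ac hρ hγ hκ hβ g1 k1 (fun e => (ad e).elim) b1 (fun _ => b2) (fun e => (bd e).elim)
        (fun u h1 h2 h3 h4 => by rw [hu u h1 h2 h3 h4]; exact k2) (fun _ => k3)
        (fun e => (ad' e).elim) (fun e => a'd e.2)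
        ⟨ρ, β, Or.inl rfl, fun _ => Or.inr rfl, fun e => (b'c e).elim, fun e => (b'd e).elim⟩
    by_cases hf : ∃ u ∈ U, H.Adj u a ∧ H.Adj u c ∧ H.Adj u d
    · obtain ⟨f, fU, f1, f2, f3⟩ := hf
      exact main (L f) (h.ep.L5 f fU) (fun u hu i j k => by
        rw [h.eq.uniqF (fun u => H.Adj u a) u hu f fU ⟨i, j, k⟩ ⟨f1, f2, f3⟩])
    · exact main (L c) (h.ep.L5 c h.eq.cU) (fun u hu i j k => (hf ⟨u, hu, i, j, k⟩).elim)
  have key' : ∀ {d d' : W}, MS H M U L p a b a' b' q c d c' d' → ¬ H.Adj b d → ¬ H.Adj a' d →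
      ¬ H.Adj b' d → False := by
    intro d d' h bd a'd b'd
    by_cases b'c : H.Adj b' c
    · exact key h.reflp b'd a'd bd (fun e => h.nbb h.cp ac.symm e.symm b'c.symm)
    · exact key h bd a'd b'd b'c
  by_cases hd : ¬ H.Adj b d ∧ ¬ H.Adj a' d ∧ ¬ H.Adj b' d
  · exact key' h hd.1 hd.2.1 hd.2.2
  by_cases hd' : ¬ H.Adj b d' ∧ ¬ H.Adj a' d' ∧ ¬ H.Adj b' d'
  · exact key' h.reflq hd'.1 hd'.2.1 hd'.2.2
  have nZ : ∀ v, H.Adj q v → v ∉ (insert p (insert b (insert a' {b'})) : Set W) := by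
    rintro v qv (rfl | rfl | rfl | rfl)
    · rcases (h.eq.nq v).1 qv with rfl | rfl | rfl | rfl
      exacts [h.ep.qU h.eq.cU, h.ep.qU h.eq.dU, h.ep.qU h.eq.c'U, h.ep.qU h.eq.d'U]
    · exact h.dj _ h.ep.qd qv
    · exact h.dj _ h.ep.qc' qv
    · exact h.dj _ h.ep.qd' qv
  have hZ : Conn H (insert p (insert b (insert a' {b'})) : Set W) := by
    refine Conn.insert (Conn.insert (Conn.insert (Conn.singleton b') ⟨b', rfl, h.ep.r3⟩)
      ⟨a', by simp, h.ep.r2⟩) ⟨b, by simp, h.ep.qd⟩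
  have nb : ∀ v, ¬ (¬ H.Adj b v ∧ ¬ H.Adj a' v ∧ ¬ H.Adj b' v) →
      Nb H (insert p (insert b (insert a' {b'})) : Set W) v := by
    intro v hv
    by_contra hn
    refine hv ⟨fun e => hn ⟨b, by simp, e.symm⟩, fun e => hn ⟨a', by simp, e.symm⟩,
      fun e => hn ⟨b', by simp, e.symm⟩⟩
  refine h.eq.five (r := a) (fun e => h.dj a h.ep.qc (e ▸ h.eq.qd)) (fun e => h.dj a h.ep.qc (e ▸ h.eq.qd'))
    ac ac' hZ (nZ _ h.eq.qc) (nZ _ h.eq.qc') (nZ _ h.eq.qd) (nZ _ h.eq.qd') ?_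
    ⟨p, by simp, h.ep.qc.symm⟩ (nb d hd) (nb d' hd')
  rintro (e | e | e | e)
  exacts [h.ep.qU (e ▸ h.ep.cU), h.ep.n1 e, h.ep.n2 e, h.ep.n3 e]

theorem MS.noC (h : MS H M U L p a b a' b' q c d c' d') : ¬ H.Adj a c := by
  intro ac
  have key : ∀ {b b' : W}, MS H M U L p a b a' b' q c d c' d' → ¬ H.Adj b' d → False := by
    intro b b' h b'd
    have ad : ¬ H.Adj a d := fun e => h.noA ac e
    have ad' : ¬ H.Adj a d' := fun e => h.reflq.noA ac e
    have ac' : ¬ H.Adj a c' := fun e => h.noB ac e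
    have bc : ¬ H.Adj b c := fun e => h.swap.noA ac.symm e.symm
    have b'c : ¬ H.Adj b' c := fun e => h.swap.reflq.noA ac.symm e.symm
    have a'c : ¬ H.Adj a' c := fun e => h.swap.noB ac.symm e.symm
    have main : ∀ F : Finset ℕ, F.card = 5 → (∀ u ∈ U, H.Adj u a → H.Adj u c → H.Adj u d → L u = F) →
        False := by
      intro F hF hu
      obtain ⟨ρ, hρ, -⟩ := pk3 (h.ep.L5 a h.ep.cU) 0 0 0
      obtain ⟨γ, hγ, g1, κ, hκ, k1, k2, k3⟩ := comb (h.ep.L5 c h.eq.cU) (h.ep.L5 d h.eq.dU) hF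
        (h.ep.L5 c' h.eq.c'U) ρ
      obtain ⟨β, hβ, b1, b2, -⟩ := pk3 (h.ep.L5 b h.ep.dU) ρ κ ρ
      exact h.tri ac hρ hγ hκ hβ g1 k1 (fun e => (ad e).elim) b1 (fun e => (bc e).elim) (fun _ => b2)
        (fun u h1 h2 h3 h4 => by rw [hu u h1 h2 h3 h4]; exact k2) (fun _ => k3)
        (fun e => (ad' e).elim) (fun e => a'c e.1)
        ⟨ρ, β, Or.inl rfl, fun _ => Or.inr rfl, fun e => (b'c e).elim, fun e => (b'd e).elim⟩
    by_cases hf : ∃ u ∈ U, H.Adj u a ∧ H.Adj u c ∧ H.Adj u d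
    · obtain ⟨f, fU, f1, f2, f3⟩ := hf
      exact main (L f) (h.ep.L5 f fU) (fun u hu i j k => by
        rw [h.eq.uniqF (fun u => H.Adj u a) u hu f fU ⟨i, j, k⟩ ⟨f1, f2, f3⟩])
    · exact main (L c) (h.ep.L5 c h.eq.cU) (fun u hu i j k => (hf ⟨u, hu, i, j, k⟩).elim)
  by_cases b'd : H.Adj b' d
  · exact key h.reflp (fun e => h.rotp.rotq.swap.noB e.symm b'd.symm)
  · exact key h b'd

theorem MS.noE (h : MS H M U L p a b a' b' q c d c' d') {x y : W} (hx : H.Adj p x) (hy : H.Adj q y) :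
    ¬ H.Adj x y := by
  have key : ∀ {a b a' b' : W}, MS H M U L p a b a' b' q c d c' d' → ¬ H.Adj a y := by
    intro a b a' b' h
    rcases (h.eq.nq y).1 hy with rfl | rfl | rfl | rfl
    exacts [h.noC, h.rotq.noC, h.rotq.rotq.noC, h.rotq.rotq.rotq.noC]
  rcases (h.ep.nq x).1 hx with rfl | rfl | rfl | rfl
  exacts [key h, key h.rotp, key h.rotp.rotp, key h.rotp.rotp.rotp]

end CN
end PartI2

open Set
noncomputable section PartI3
namespace CN
variable {W : Type} {H : SimpleGraph W}
variable {M : Set W} {U X : Finset W} {L : W → Finset ℕ} {φ : W → ℕ}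
  {p a b a' b' q c d c' d' : W}

open Classical in
theorem MS.core (h : MS H M U L p a b a' b' q c d c' d') {lev : W → ℕ} (lv : Lev H M q lev)
    (hmin : ∀ x, H.Adj p x → lev a ≤ lev x) {r : W} (rU : r ∈ U)
    (er : lev a = lev r + 1) (hF : FF H U L lev q c d c' d' a r) (hb : ¬ H.Adj b' r) : False := by
  obtain ⟨ρ, hρ, -⟩ := pk3 (h.ep.L5 r rU) 0 0 0
  obtain ⟨σ, hσ, hσρ, -⟩ := pk3 (h.ep.L5 a h.ep.cU) ρ ρ ρ
  obtain ⟨β, hβ, hβσ, hβρ, -⟩ := pk3 (h.ep.L5 b h.ep.dU) σ ρ ρ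
  obtain ⟨Sr, ψ, hw⟩ := hF σ ρ hσρ hρ
  have SQ : ∀ s ∈ Sr, H.Adj p s → s = a := by
    intro s hs ps
    by_contra hsa
    have h1 := hmin s ps
    by_cases e : s = r
    · subst e; omega
    · have := hw.low s hs hsa e; omega
  have lowQ : ∀ x, H.Adj p x → ∀ s ∈ Sr, KK H a b a' b' c d c' d' x s → s = a ∨ s = r ∧ H.Adj x s := by
    intro x px s hs k
    rcases k with k | k | k
    · by_cases e1 : s = a
      · exact Or.inl e1
      by_cases e2 : s = r
      · exact Or.inr ⟨e2, k⟩
      have h1 := hw.low s hs e1 e2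
      have h2 := hmin x px
      have h3 := lv.le x s k
      omega
    · exact Or.inl (SQ s hs (h.ep.toCross.mt k).2.1)
    · exact (h.dj x px (h.eq.toCross.mt k).1).elim
  have bS : b ∉ Sr := fun e => h.ep.n1 (SQ b e h.ep.qd).symm
  have hψ : ∀ s ∈ Sr, Function.update ψ b β s = ψ s := fun s hs =>
    Function.update_of_ne (by rintro rfl; exact bS hs) _ _
  have hψb : Function.update ψ b β b = β := Function.update_self _ _ _
  set ψ' := Function.update ψ b β
  refine h.mfin hw.sub hw.conn hw.hs bS hw.p1 hw.p2 ψ' ?_ (by rw [hψb]; exact hβ) ?_ ?_ ?_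
  · intro s hs
    rw [hψ s hs]
    by_cases e : s = a
    · rw [e, hw.cs]; exact hσ
    · exact hw.inL s hs e
  · intro s hs t ht k
    rw [hψ s hs, hψ t ht]
    rcases k with k | k | k
    · exact hw.prop s hs t ht (Or.inl k)
    · obtain ⟨k1, k2, k3⟩ := h.ep.toCross.mt k
      exact (k3 ((SQ s hs k1).trans (SQ t ht k2).symm)).elim
    · exact hw.prop s hs t ht (Or.inr k)
  · intro s hs k
    rw [hψb, hψ s hs]
    rcases lowQ b h.ep.qd s hs k with rfl | ⟨rfl, -⟩
    · rw [hw.cs]; exact hβσ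
    · rw [hw.cr]; exact hβρ
  · intro u hu uS ub
    rw [hψb]
    by_cases pu : H.Adj p u
    · by_cases e : u = b'
      · subst e
        refine ⟨σ, β, fun s hs k _ => ?_, fun _ _ => Or.inr rfl⟩
        rw [hψ s hs]
        rcases lowQ u pu s hs k with rfl | ⟨rfl, h1⟩
        · exact Or.inl hw.cs
        · exact (hb h1).elim
      · refine ⟨σ, ρ, fun s hs k _ => ?_, fun e' => (e e').elim⟩
        rw [hψ s hs]
        rcases lowQ u pu s hs k with rfl | ⟨rfl, h1⟩
        · exact Or.inl hw.cs
        · exact Or.inr hw.cr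
    · obtain ⟨x, y, hxy⟩ := hw.ok u hu uS
      refine ⟨x, y, fun s hs k => ?_, fun e' => (pu (e' ▸ h.ep.qd')).elim⟩
      rw [hψ s hs]
      refine hxy s hs ?_
      rcases k with k | k | k
      · exact Or.inl k
      · exact (pu (h.ep.toCross.mt k).1).elim
      · exact Or.inr k

theorem MS.absurd1 (h : MS H M U L p a b a' b' q c d c' d') {lev : W → ℕ} (lv : Lev H M q lev)
    (hmin : ∀ x, H.Adj p x → lev a ≤ lev x) : False := by
  have aq := h.aq
  have aM := h.ep.UM _ h.ep.cU
  have pM : p ∈ M := h.ep.inM _ _ h.ep.qc.symm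
  have pq : p ≠ q := by rintro rfl; exact h.dj _ h.ep.qc h.ep.qc
  have a3 : 3 ≤ lev a := by
    obtain ⟨u, vu, e⟩ := lv.down a aM aq
    by_cases uq : u = q
    · exact (h.dj a h.ep.qc (uq ▸ vu.symm)).elim
    obtain ⟨w, uw, e'⟩ := lv.down u (h.ep.inM _ _ vu) uq
    by_cases wq : w = q
    · exact (h.noE h.ep.qc (wq ▸ uw.symm) vu).elim
    obtain ⟨z, wz, e''⟩ := lv.down w (h.ep.inM _ _ uw) wq
    omega
  have hp : lev a + 1 ≤ lev p := by
    obtain ⟨u, pu, e⟩ := lv.down p pM pq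
    have := hmin u pu
    omega
  obtain ⟨r, rU, ar, er, hF⟩ := h.eq.chain lv (lev a - 3) a h.ep.cU (by omega) (by
    intro r hr hl hq
    have rU : r ∈ U := by
      rcases h.mM r hr with k | k | k
      · exact k
      · rw [k] at hl; omega
      · exact (hq k).elim
    exact ⟨rU, h.dgr r rU⟩) ⟨p, h.ep.qc.symm, by omega⟩
  have rp : r ≠ p := fun e => h.ep.qU (e ▸ rU)
  by_cases hb : H.Adj b' r
  · refine h.reflp.core lv hmin rU er hF (fun hb2 => ?_)
    exact h.nbb rp ar.symm hb2.symm hb.symm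
  · exact h.core lv hmin rU er hF hb

theorem MS.absurd (h : MS H M U L p a b a' b' q c d c' d') : False := by
  have hM : Conn H M := by
    have cM := h.ep.UM _ h.eq.cU
    have cU := h.eq.cU
    have h1 := h.ep.conn c cU c cU c cU
    have h2 := h1.insert (v := c) ⟨q, ⟨h.ep.inM _ _ h.eq.qc.symm, by simpa using h.eq.qc.ne⟩, h.eq.qc.symm⟩
    convert h2 using 1
    ext w
    by_cases e : w = c
    · simp [e, cM]
    · simp [e]
  obtain ⟨lev, lv⟩ := lev_ex hM h.ep.inM (q := q) (h.ep.inM _ _ h.eq.qc.symm)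
  have hmin : ∃ x, H.Adj p x ∧ ∀ y, H.Adj p y → lev x ≤ lev y := by
    obtain ⟨x, h1, h2⟩ := WellFounded.has_min (measure lev).wf {x | H.Adj p x} ⟨a, h.ep.qc⟩
    exact ⟨x, h1, fun y hy => not_lt.1 (h2 y hy)⟩
  obtain ⟨x, px, hx⟩ := hmin
  rcases (h.ep.nq x).1 px with rfl | rfl | rfl | rfl
  · exact h.absurd1 lv hx
  · exact h.rotp.absurd1 lv hx
  · exact h.rotp.rotp.absurd1 lv hx
  · exact h.rotp.rotp.rotp.absurd1 lv hx

end CN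
end PartI3

open Set
noncomputable section PartI4
namespace CN
variable {W : Type} {H : SimpleGraph W}
variable {M : Set W} {U X : Finset W} {L : W → Finset ℕ} {φ : W → ℕ}
  {p a b a' b' q c d c' d' : W}

/-- hypotheses of the theorem with two crossings far apart. -/
structure MH (H : SimpleGraph W) (U : Finset W) (L : W → Finset ℕ)
    (p a b a' b' q c d c' d' : W) : Prop where
  hP : Planar H
  crp : Cross H p a b a' b'
  crq : Cross H q c d c' d'
  pU : p ∉ U
  qU : q ∉ U
  hin : ∀ u v, H.Adj u v → v ∈ U ∨ v = p ∨ v = q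
  dj : ∀ v, H.Adj p v → ¬ H.Adj q v
  npq : ¬ H.Adj p q
  L5 : ∀ u ∈ U, 5 ≤ (L u).card

theorem MH.rot (h : MH H U L p a b a' b' q c d c' d') : MH H U L p b a' b' a q c d c' d' :=
  { h with crp := h.crp.rot }

theorem MH.swap (h : MH H U L p a b a' b' q c d c' d') : MH H U L q c d c' d' p a b a' b' :=
  { h with
    crp := h.crq
    crq := h.crp
    pU := h.qU
    qU := h.pU
    hin := fun u v k => (h.hin u v k).imp id Or.symm
    dj := fun v h1 h2 => h.dj v h2 h1
    npq := fun k => h.npq k.symm }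

theorem KK.rot : KK H b a' b' a c d c' d' = KK H a b a' b' c d c' d' := by
  funext u v; unfold KK; rw [mt.rot]

theorem KK.swap : KK H c d c' d' a b a' b' = KK H a b a' b' c d c' d' := by
  funext u v; unfold KK; apply propext; tauto

theorem KK.irr (hp : Cross H p a b a' b') (hq : Cross H q c d c' d') (v : W) :
    ¬ KK H a b a' b' c d c' d' v v := by
  rintro (k | k | k)
  exacts [k.ne rfl, (hp.mt k).2.2 rfl, (hq.mt k).2.2 rfl]

open Classical in
theorem MH.delP (h : MH H U L p a b a' b' q c d c' d') {x b1 e f : W}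
    (hd : ∀ y, H.Adj a y → y = x ∨ y = b1 ∨ y = e ∨ y = f) :
    Goal (KK H a b a' b' c d c' d') U ∅ φ L := by
  have inU : ∀ v, H.Adj p v → v ∈ U := by
    intro v hv
    rcases h.hin _ _ hv with k | k | k
    exacts [k, (hv.ne' k).elim, (h.npq (k ▸ hv)).elim]
  have inUq : ∀ v, H.Adj q v → v ∈ U := by
    intro v hv
    rcases h.hin _ _ hv with k | k | k
    exacts [k, (h.npq (k ▸ hv.symm)).elim, (hv.ne' k).elim]
  have aU := inU _ h.crp.qc
  have pq : p ≠ q := by rintro rfl; exact h.dj _ h.crp.qc h.crp.qc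
  have aq : a ≠ q := fun k => h.qU (k ▸ aU)
  obtain ⟨x, b1, e, ha⟩ : ∃ a1 b e : W, ∀ y, H.Adj a y → y ≠ p → y = a1 ∨ y = b ∨ y = e := by
    rcases hd p h.crp.qc.symm with rfl | rfl | rfl | rfl
    · exact ⟨b1, e, f, fun y hy hq => (hd y hy).resolve_left hq⟩
    · exact ⟨x, e, f, fun y hy hq => by rcases hd y hy with h | h | h | h <;> simp_all⟩
    · exact ⟨x, b1, f, fun y hy hq => by rcases hd y hy with h | h | h | h <;> simp_all⟩
    · exact ⟨x, b1, e, fun y hy hq => by rcases hd y hy with h | h | h | h <;> simp_all⟩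
  have PU : ∀ u ∈ U, u ≠ a → u ∈ {u : W | u ≠ a ∧ u ≠ p} := fun u hu e =>
    ⟨e, by rintro rfl; exact h.pU hu⟩
  have hPl : Planar (cut H {u : W | u ≠ a ∧ u ≠ p} (({b, b'} : Finset W) : Set W)) := by
    refine h.hP.deltaF (A := {p}) (Conn.singleton p) ?_ (Finset.card_le_two.trans (by norm_num)) ?_
    · rintro _ rfl ⟨-, h1⟩; exact h1 rfl
    · intro y hy
      simp only [Finset.mem_insert, Finset.mem_singleton] at hy
      rcases hy with rfl | rfl
      · exact ⟨PU _ (inU _ h.crp.qd) h.crp.n1.symm, p, rfl, h.crp.qd.symm⟩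
      · exact ⟨PU _ (inU _ h.crp.qd') h.crp.n3.symm, p, rfl, h.crp.qd'.symm⟩
  have T : T1H (cut H {u : W | u ≠ a ∧ u ≠ p} (({b, b'} : Finset W) : Set W)) (U.erase a) L ∅ q c d c' d' :=
    { hP := hPl
      cr := h.crq.cut ⟨aq.symm, pq.symm⟩ (by
          simp only [Finset.coe_insert, Finset.coe_singleton, Set.mem_insert_iff, Set.mem_singleton_iff]
          rintro (k | k)
          · exact h.npq (k ▸ h.crp.qd)
          · exact h.npq (k ▸ h.crp.qd'))
        (fun v hv => PU v (inUq v hv) (by rintro rfl; exact h.dj _ h.crp.qc hv))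
      qU := fun k => h.qU (Finset.mem_of_mem_erase k)
      hin := by
        rintro u v ⟨-, ⟨h1, -, h2⟩ | ⟨-, h2⟩⟩
        · rcases h.hin _ _ h1 with k | k | k
          · exact Or.inl (Finset.mem_erase.2 ⟨h2.1, k⟩)
          · exact (h2.2 k).elim
          · exact Or.inr k
        · simp only [Finset.coe_insert, Finset.coe_singleton, Set.mem_insert_iff, Set.mem_singleton_iff] at h2
          left
          rcases h2 with rfl | rfl
          · exact Finset.mem_erase.2 ⟨h.crp.n1.symm, inU _ h.crp.qd⟩
          · exact Finset.mem_erase.2 ⟨h.crp.n3.symm, inU _ h.crp.qd'⟩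
      XU := by simp
      X3 := by simp
      cl := by simp
      L5 := fun u hu _ => h.L5 u (Finset.mem_of_mem_erase hu) }
  refine del (v := a) (a := x) (b := b1) (e := e) (f := a') (fun u v => KK.symm) (by simp) (h.L5 a aU)
    (KK.irr h.crp h.crq a) ?_ ?_ T.goal
  · rintro y hy (k | k | k)
    · rcases ha y k (by rintro rfl; exact h.pU hy) with h | h | h <;> simp [h]
    · rcases k with k | k | k | k
      · simp [k.2]
      · exact (h.crp.n2 k.1).elim
      · exact (h.crp.n1 k.1).elim
      · exact (h.crp.n3 k.1).elim
    · exact (h.dj a h.crp.qc (h.crq.mt k).1).elim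
  · intro x hx xc y hy yc k
    rcases k with k | k | k
    · exact Or.inl ⟨k.ne, Or.inl ⟨k, PU x hx xc, PU y hy yc⟩⟩
    · refine Or.inl ⟨(h.crp.mt k).2.2, ?_⟩
      rcases k with k | k | k | k
      · exact (xc k.1).elim
      · exact (yc k.2).elim
      · exact Or.inr (by simp [k.1, k.2])
      · exact Or.inr (by simp [k.1, k.2])
    · exact Or.inr k

open Classical in
theorem Main : ∀ (n : ℕ) (H : SimpleGraph W) (U : Finset W) (L : W → Finset ℕ),
    MH H U L p a b a' b' q c d c' d' → U.card < n →
    Goal (KK H a b a' b' c d c' d') U ∅ (fun _ => 0) L := by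
  intro n
  induction n with
  | zero => intro H U L h hn; omega
  | succ n ih =>
  intro H U L h hn
  by_contra no
  set M : Set W := insert p (insert q (U : Set W)) with hMdef
  have UM : ∀ u ∈ U, u ∈ M := fun u hu => Or.inr (Or.inr hu)
  have pM : p ∈ M := Or.inl rfl
  have qM : q ∈ M := Or.inr (Or.inl rfl)
  have inM : ∀ u v, H.Adj u v → v ∈ M := by
    intro u v k
    rcases h.hin u v k with k | k | k
    exacts [UM v k, Or.inl k, Or.inr (Or.inl k)]
  have mM : ∀ v ∈ M, v ∈ U ∨ v = p ∨ v = q := by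
    rintro v (k | k | k)
    exacts [Or.inr (Or.inl k), Or.inr (Or.inr k), Or.inl k]
  have pq : p ≠ q := by rintro rfl; exact h.dj _ h.crp.qc h.crp.qc
  have inU : ∀ v, H.Adj p v → v ∈ U := by
    intro v hv
    rcases h.hin _ _ hv with k | k | k
    exacts [k, (hv.ne' k).elim, (h.npq (k ▸ hv)).elim]
  have inUq : ∀ v, H.Adj q v → v ∈ U := by
    intro v hv
    rcases h.hin _ _ hv with k | k | k
    exacts [k, (h.npq (k ▸ hv.symm)).elim, (hv.ne' k).elim]
  -- connectivity
  have conn : ∀ x ∈ U, ∀ y ∈ U, ∀ z ∈ U, Conn H (M \ {x, y, z}) := by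
    by_contra hno
    obtain ⟨Y, hYU, hY3, hS⟩ := sep UM hno
    have pYn : p ∉ Y := fun e => h.pU (hYU e)
    have qYn : q ∉ Y := fun e => h.qU (hYU e)
    have pY : p ∈ M \ (Y : Set W) := ⟨pM, pYn⟩
    have qY : q ∈ M \ (Y : Set W) := ⟨qM, qYn⟩
    have nbp : ∀ v, H.Adj p v → v ∈ comp H (M \ (Y : Set W)) p ∨ v ∈ (Y : Set W) := fun v hv =>
      comp_cl inM (self_mem_comp _ _) hv
    have nbq : ∀ v, H.Adj q v → v ∈ comp H (M \ (Y : Set W)) q ∨ v ∈ (Y : Set W) := fun v hv =>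
      comp_cl inM (self_mem_comp _ _) hv
    have hcY : ∀ P : Set W, ∀ s ∈ Y, ∀ t ∈ Y, s ≠ t → (cut H P (Y : Set W)).Adj s t :=
      fun P s hs t ht e => ⟨e, Or.inr ⟨hs, ht⟩⟩
    have pl1 : ∀ z ∈ M \ (Y : Set W), Planar (cut H (M \ comp H (M \ (Y : Set W)) z) (Y : Set W)) := by
      intro z hz
      refine h.hP.deltaF (comp_conn _ z) (fun a ha hb => hb.2 ha) hY3 (fun y hy => ⟨⟨UM y (hYU hy),
        fun e => (comp_sub hz e).2 hy⟩, (hS z hz).1 y hy⟩)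
    have pl2 : ∀ z ∈ M \ (Y : Set W), ∀ w ∈ M \ (Y : Set W),
        (∀ u, u ∈ comp H (M \ (Y : Set W)) z → u ∉ comp H (M \ (Y : Set W)) w) →
        Planar (cut H (comp H (M \ (Y : Set W)) z ∪ Y) (Y : Set W)) := by
      intro z hz w hw hd
      refine h.hP.deltaF (comp_conn _ w) ?_ hY3 (fun y hy => ⟨Or.inr hy, (hS w hw).1 y hy⟩)
      rintro a ha (hb | hb)
      exacts [hd a hb ha, (comp_sub hw ha).2 hb]
    by_cases hA : ∃ z ∈ M \ (Y : Set W), p ∉ comp H (M \ (Y : Set W)) z ∧ q ∉ comp H (M \ (Y : Set W)) z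
    · obtain ⟨z, hz, pz, qz⟩ := hA
      have zU : z ∈ U := by
        rcases mM z hz.1 with k | k | k
        · exact k
        · exact (pz (k ▸ self_mem_comp _ _)).elim
        · exact (qz (k ▸ self_mem_comp _ _)).elim
      have dp : ∀ u, u ∈ comp H (M \ (Y : Set W)) z → u ∉ comp H (M \ (Y : Set W)) p :=
        fun u => comp_disj hz pY pz
      have dq : ∀ u, u ∈ comp H (M \ (Y : Set W)) z → u ∉ comp H (M \ (Y : Set W)) q :=
        fun u => comp_disj hz qY qz
      have np : ∀ v, H.Adj p v → v ∉ comp H (M \ (Y : Set W)) z := by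
        intro v hv h1
        rcases nbp v hv with h2 | h2
        exacts [dp v h1 h2, (comp_sub hz h1).2 h2]
      have nq : ∀ v, H.Adj q v → v ∉ comp H (M \ (Y : Set W)) z := by
        intro v hv h1
        rcases nbq v hv with h2 | h2
        exacts [dq v h1 h2, (comp_sub hz h1).2 h2]
      refine no (split (z := z) (m := fun u v => mt a b a' b' u v ∨ mt c d c' d' u v)
        (m1 := fun u v => mt a b a' b' u v ∨ mt c d c' d' u v) (m2 := fun _ _ => False)
        inM UM hz (by simp) ?_ ?_ ?_)
      · rintro u _ v _ (hm | hm)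
        · obtain ⟨h1, h2, h3⟩ := h.crp.mt hm
          exact ⟨h3, Or.inl ⟨np u h1, np v h2, Or.inl hm⟩⟩
        · obtain ⟨h1, h2, h3⟩ := h.crq.mt hm
          exact ⟨h3, Or.inl ⟨nq u h1, nq v h2, Or.inr hm⟩⟩
      · have hlt : (U.filter (fun u => u ∉ comp H (M \ (Y : Set W)) z)).card < U.card := by
          refine Finset.card_lt_card ⟨Finset.filter_subset _ _, ?_⟩
          intro hs
          have := hs zU
          rw [Finset.mem_filter] at this
          exact this.2 (self_mem_comp _ _)
        have sb : ∀ u v, (cut H (M \ comp H (M \ (Y : Set W)) z) (Y : Set W)).Adj u v → u ∉ Y →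
            H.Adj u v := by
          rintro u v ⟨-, k | k⟩ hu
          exacts [k.1, (hu k.1).elim]
        refine ih _ _ _ { 
          hP := pl1 z hz
          crp := h.crp.cut ⟨pM, pz⟩ pYn (fun v hv => ⟨inM _ _ hv, np v hv⟩)
          crq := h.crq.cut ⟨qM, qz⟩ qYn (fun v hv => ⟨inM _ _ hv, nq v hv⟩)
          pU := fun e => h.pU (Finset.mem_filter.1 e).1
          qU := fun e => h.qU (Finset.mem_filter.1 e).1
          hin := ?_
          dj := fun v h1 h2 => h.dj v (sb _ _ h1 pYn) (sb _ _ h2 qYn)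
          npq := fun k => h.npq (sb _ _ k pYn)
          L5 := fun u hu => h.L5 u (Finset.mem_filter.1 hu).1 } (by omega)
        rintro u v ⟨-, ⟨h1, h2, h3⟩ | h1⟩
        · rcases mM v h3.1 with k | k
          · exact Or.inl (Finset.mem_filter.2 ⟨k, h3.2⟩)
          · exact Or.inr k
        · exact Or.inl (Finset.mem_filter.2 ⟨hYU h1.2, fun e => (comp_sub hz e).2 h1.2⟩)
      · intro f
        refine Goal.mono (K := (cut H (comp H (M \ (Y : Set W)) z ∪ Y) (Y : Set W)).Adj)
          (R2 (pl2 z hz p pY dp) _ Y f L Finset.subset_union_right hY3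
            (hcY _) ?_) (fun u v k => k.resolve_right id)
        intro u hu huY
        have hu' := (Finset.mem_union.1 hu).resolve_right huY
        rw [Finset.mem_filter] at hu'
        exact h.L5 u hu'.1
    · push Not at hA
      have qp : q ∉ comp H (M \ (Y : Set W)) p := by
        intro hq
        obtain ⟨-, w, hw, wC⟩ := hS p pY
        have hd : ∀ u, u ∈ comp H (M \ (Y : Set W)) p → u ∉ comp H (M \ (Y : Set W)) w :=
          fun u => comp_disj pY hw wC
        exact hd q hq (hA w hw (hd p (self_mem_comp _ _)))
      have dj : ∀ u, u ∈ comp H (M \ (Y : Set W)) p → u ∉ comp H (M \ (Y : Set W)) q :=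
        fun u => comp_disj pY qY qp
      have nq : ∀ v, H.Adj q v → v ∉ comp H (M \ (Y : Set W)) p := by
        intro v hv h1
        rcases nbq v hv with h2 | h2
        exacts [dj v h1 h2, (comp_sub pY h1).2 h2]
      refine no (split (z := p) (m := fun u v => mt a b a' b' u v ∨ mt c d c' d' u v)
        (m1 := mt c d c' d') (m2 := mt a b a' b')
        inM UM pY (by simp) ?_ ?_ ?_)
      · rintro u _ v _ (hm | hm)
        · obtain ⟨h1, h2, h3⟩ := h.crp.mt hm
          exact ⟨h3, Or.inr ⟨hm, nbp u h1, nbp v h2⟩⟩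
        · obtain ⟨h1, h2, h3⟩ := h.crq.mt hm
          exact ⟨h3, Or.inl ⟨nq u h1, nq v h2, hm⟩⟩
      · refine T1H.goal (q := q) { 
          hP := pl1 p pY
          cr := h.crq.cut ⟨qM, qp⟩ qYn (fun v hv => ⟨inM _ _ hv, nq v hv⟩)
          qU := fun e => h.qU (Finset.mem_filter.1 e).1
          hin := ?_
          XU := by simp
          X3 := by simp
          cl := by simp
          L5 := fun u hu _ => h.L5 u (Finset.mem_filter.1 hu).1 }
        rintro u v ⟨-, ⟨h1, h2, h3⟩ | h1⟩
        · rcases mM v h3.1 with k | k | k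
          · exact Or.inl (Finset.mem_filter.2 ⟨k, h3.2⟩)
          · exact (h3.2 (k ▸ self_mem_comp _ _)).elim
          · exact Or.inr k
        · exact Or.inl (Finset.mem_filter.2 ⟨hYU h1.2, fun e => (comp_sub pY e).2 h1.2⟩)
      · intro f
        refine T1H.goal (q := p) { 
          hP := pl2 p pY q qY dj
          cr := h.crp.cut (Or.inl (self_mem_comp _ _)) pYn (fun v hv => nbp v hv)
          qU := ?_
          hin := ?_
          XU := Finset.subset_union_right
          X3 := hY3
          cl := hcY _
          L5 := ?_ }
        · simp only [Finset.mem_union, Finset.mem_filter]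
          rintro (h1 | h1)
          exacts [h.pU h1.1, pYn h1]
        · rintro u v ⟨-, ⟨h1, h2, h3⟩ | h1⟩
          · rcases mM v (inM _ _ h1) with k | k | k
            · left
              simp only [Finset.mem_union, Finset.mem_filter]
              exact h3.imp (fun h4 => ⟨k, h4⟩) id
            · exact Or.inr k
            · rw [k] at h3
              exact (h3.elim qp qYn).elim
          · exact Or.inl (Finset.mem_union_right _ h1.2)
        · intro u hu huY
          have hu' := (Finset.mem_union.1 hu).resolve_right huY
          rw [Finset.mem_filter] at hu'
          exact h.L5 u hu'.1
  -- degrees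
  have dgr : ∀ v ∈ U, ∀ a b e f, ∃ y, H.Adj v y ∧ y ≠ a ∧ y ≠ b ∧ y ≠ e ∧ y ≠ f := by
    intro v hv x1 x2 x3 x4
    by_contra hcon
    have hd : ∀ y, H.Adj v y → y = x1 ∨ y = x2 ∨ y = x3 ∨ y = x4 := by
      intro y hy
      by_contra hc
      push Not at hc
      exact hcon ⟨y, hy, hc⟩
    clear hcon
    have key : ∀ {p a b a' b' q c d c' d' : W}, MH H U L p a b a' b' q c d c' d' → H.Adj p v →
        Goal (KK H a b a' b' c d c' d') U ∅ (fun _ => 0) L := by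
      intro p a b a' b' q c d c' d' h hvp
      rcases (h.crp.nq v).1 hvp with rfl | rfl | rfl | rfl
      · exact h.delP hd
      · rw [← KK.rot]; exact h.rot.delP hd
      · rw [← KK.rot, ← KK.rot]; exact h.rot.rot.delP hd
      · rw [← KK.rot, ← KK.rot, ← KK.rot]; exact h.rot.rot.rot.delP hd
    by_cases hvp : H.Adj p v
    · exact no (key h hvp)
    by_cases hvq : H.Adj q v
    · refine no ?_
      rw [← KK.swap]; exact key h.swap hvq
    have hlt := Finset.card_erase_lt_of_mem hv
    have vq : v ≠ q := by rintro rfl; exact h.qU hv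
    have vp : v ≠ p := by rintro rfl; exact h.pU hv
    have aux : ∀ u ∈ M, u ≠ v → u ∈ M \ {v} := fun u hu e => ⟨hu, e⟩
    have sb : ∀ u w, (cut H (M \ {v}) ∅).Adj u w → H.Adj u w := by
      rintro x y ⟨-, k | k⟩
      exacts [k.1, k.1.elim]
    refine no (del (v := v) (fun u v => KK.symm) (by simp) (h.L5 v hv) (KK.irr h.crp h.crq v)
      (a := x1) (b := x2) (e := x3) (f := x4) ?_ ?_
      (ih (cut H (M \ {v}) ∅) (U.erase v) L { 
        hP := h.hP.mono sb
        crp := h.crp.cut (aux p pM vp.symm) (by simp)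
          (fun u hu => aux u (inM _ _ hu) (by rintro rfl; exact hvp hu))
        crq := h.crq.cut (aux q qM vq.symm) (by simp)
          (fun u hu => aux u (inM _ _ hu) (by rintro rfl; exact hvq hu))
        pU := fun e => h.pU (Finset.mem_of_mem_erase e)
        qU := fun e => h.qU (Finset.mem_of_mem_erase e)
        hin := ?_
        dj := fun v h1 h2 => h.dj v (sb _ _ h1) (sb _ _ h2)
        npq := fun k => h.npq (sb _ _ k)
        L5 := fun u hu => h.L5 u (Finset.mem_of_mem_erase hu) } (by omega)))
    · rintro y hy (k | k | k)
      · exact hd y k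
      · exact (hvp (h.crp.mt k).1).elim
      · exact (hvq (h.crq.mt k).1).elim
    · rintro x hx xv y hy yv (k | k)
      · exact Or.inl ⟨k.ne, Or.inl ⟨k, aux x (UM x hx) xv, aux y (UM y hy) yv⟩⟩
      · exact Or.inr k
    · rintro x y ⟨-, k | k⟩
      · rcases h.hin x y k.1 with h1 | h1
        · exact Or.inl (Finset.mem_erase.2 ⟨k.2.2.2, h1⟩)
        · exact Or.inr h1
      · exact k.1.elim
  obtain ⟨L', hL1, hL2⟩ := shrink (X := ∅) (fun u hu _ => h.L5 u hu)
  refine MS.absurd (H := H) (M := M) (U := U) (L := L') (p := p) (a := a) (b := b) (a' := a')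
    (b' := b') (q := q) (c := c) (d := d) (c' := c') (d' := d') { 
    ep := { h.crp with
      hP := h.hP
      inM := inM
      UM := UM
      conn := conn
      qU := h.pU
      nU := ?_
      deg := fun x hx => dgr x (inU x hx)
      L5 := fun u _ => hL1 u }
    eq := { h.crq with
      hP := h.hP
      inM := inM
      UM := UM
      conn := conn
      qU := h.qU
      nU := ?_
      deg := fun x hx => dgr x (inUq x hx)
      L5 := fun u _ => hL1 u }
    dj := h.dj
    dgr := dgr
    mM := mM
    no := fun hg => no (hg.list hL2) }
  · intro x hx v hv
    rcases h.hin x v hv with k | k | k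
    exacts [Or.inl k, Or.inr k, (h.dj x hx (k ▸ hv.symm)).elim]
  · intro x hx v hv
    rcases h.hin x v hv with k | k | k
    exacts [Or.inl k, (h.dj x (k ▸ hv.symm) hx).elim, Or.inr k]

theorem MH.goal (h : MH H U L p a b a' b' q c d c' d') :
    Goal (KK H a b a' b' c d c' d') U ∅ (fun _ => 0) L :=
  Main _ H U L h (Nat.lt_succ_self _)

end CN
end PartI4

open Set
noncomputable section PartJ
namespace CN
variable {W : Type} {H : SimpleGraph W}
variable {M : Set W} {U X : Finset W} {L : W → Finset ℕ} {φ : W → ℕ}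
  {p a b a' b' q c d c' d' : W}

/-- two crossings sharing the endpoint `a`. -/
structure SH (H : SimpleGraph W) (U : Finset W) (L : W → Finset ℕ)
    (p q a b a' b' d c' d' : W) : Prop where
  hP : Planar H
  pq : p ≠ q
  pU : p ∉ U
  qU : q ∉ U
  aU : a ∈ U
  bU : b ∈ U
  b'U : b' ∈ U
  dU : d ∈ U
  d'U : d' ∈ U
  L5 : ∀ u ∈ U, 5 ≤ (L u).card
  pb : H.Adj p b
  pb' : H.Adj p b'
  qd : H.Adj q d
  qd' : H.Adj q d'
  na : Nb H {p, q} a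
  na' : Nb H {p, q} a'
  nc' : Nb H {p, q} c'
  cn : Conn H {a, p, q}
  k3 : a' ≠ c' → H.Adj p a ∧ H.Adj p a'
  hQ : ∃ Q : Set W, Q ⊆ {p, q} ∧ q ∈ Q ∧ Conn H Q ∧ Nb H Q a
  n1 : a ≠ a'
  n2 : a ≠ b
  n3 : a ≠ b'
  n4 : a ≠ c'
  n5 : a ≠ d
  n6 : a ≠ d'
  n7 : b ≠ b'
  n8 : d ≠ d'
  n9 : a' ≠ b
  n10 : a' ≠ b'
  n11 : c' ≠ d
  n12 : c' ≠ d'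

theorem SH.sb (h : SH H U L p q a b a' b' d c' d') : SH H U L p q a b' a' b d c' d' :=
  { h with
    bU := h.b'U, b'U := h.bU, pb := h.pb', pb' := h.pb, n2 := h.n3, n3 := h.n2, n7 := h.n7.symm
    n9 := h.n10, n10 := h.n9 }

theorem SH.sd (h : SH H U L p q a b a' b' d c' d') : SH H U L p q a b a' b' d' c' d :=
  { h with
    dU := h.d'U, d'U := h.dU, qd := h.qd', qd' := h.qd, n5 := h.n6, n6 := h.n5, n8 := h.n8.symm
    n11 := h.n12, n12 := h.n11 }

theorem KK.sb : KK H a b' a' b c d c' d' = KK H a b a' b' c d c' d' := by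
  funext u v; unfold KK; rw [mt.refl]

theorem KK.sd : KK H a b a' b' c d' c' d = KK H a b a' b' c d c' d' := by
  funext u v; unfold KK; rw [mt.refl (c := c)]

theorem Nb.mono {A B : Set W} {v : W} (h : Nb H A v) (hAB : A ⊆ B) : Nb H B v := by
  obtain ⟨s, h1, h2⟩ := h
  exact ⟨s, hAB h1, h2⟩

theorem SH.irr (h : SH H U L p q a b a' b' d c' d') (v : W) : ¬ KK H a b a' b' a d c' d' v v := by
  have := h.n1; have := h.n7; have := h.n4; have := h.n8
  rintro (k | k | k)
  · exact k.ne rfl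
  · unfold mt at k; grind
  · unfold mt at k; grind

theorem SH.nbs (h : SH H U L p q a b a' b' d c' d') {S : Set W} (hp : p ∈ S) (hq : q ∈ S) {u v : W}
    (k : mt a b a' b' u v ∨ mt a d c' d' u v) : Nb H S u := by
  have hs : ({p, q} : Set W) ⊆ S := by
    rintro x (rfl | rfl)
    exacts [hp, hq]
  have nb : Nb H S b := ⟨p, hp, h.pb.symm⟩
  have nb' : Nb H S b' := ⟨p, hp, h.pb'.symm⟩
  have nd : Nb H S d := ⟨q, hq, h.qd.symm⟩
  have nd' : Nb H S d' := ⟨q, hq, h.qd'.symm⟩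
  have na := h.na.mono hs
  have na' := h.na'.mono hs
  have nc' := h.nc'.mono hs
  rcases k with k | k <;> rcases k with ⟨rfl, -⟩ | ⟨rfl, -⟩ | ⟨rfl, -⟩ | ⟨rfl, -⟩ <;> assumption

theorem mt.symm' {u v : W} (k : mt a b a' b' u v ∨ mt a d c' d' u v) :
    mt a b a' b' v u ∨ mt a d c' d' v u := k.imp mt.symm mt.symm

open Classical in
theorem SH.c2 (h : SH H U L p q a b a' b' d c' d') (e : b = d) :
    Goal (KK H a b a' b' a d c' d') U ∅ (fun _ => 0) L := by
  subst e
  obtain ⟨ρ, hρ⟩ : (L a).Nonempty := Finset.card_pos.1 (by have := h.L5 a h.aU; omega)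
  obtain ⟨κ, hκ, hne⟩ := pick1 (A := L b) (B := {ρ}) (by have := h.L5 b h.bU; simp; omega)
  rw [Finset.mem_singleton] at hne
  have hab := h.n2
  have irr := h.irr
  refine fin (H := H) h.hP (fun u v => KK.symm) U ∅ {a, b} ∅ (insert b {a, p, q})
    (h.cn.insert ⟨p, by simp, h.pb.symm⟩) ?_ (by simp) (by simp) (by simp) (by simp) (by simp)
    (fun u => if u = a then ρ else κ) _ L (by simp) (by simp) (fun u hu _ _ => h.L5 u hu) ?_ ?_ ?_ ?_ ?_ ?_
  · intro u hu hs
    simp only [Set.mem_insert_iff, Set.mem_singleton_iff] at hs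
    rcases hs with rfl | rfl | rfl | rfl
    · simp
    · simp
    · exact (h.pU hu).elim
    · exact (h.qU hu).elim
  · rintro u hu v hv (k | k)
    · exact Or.inl k
    · refine Or.inr ⟨h.nbs (by simp) (by simp) k, h.nbs (by simp) (by simp) (mt.symm' k), ?_⟩
      unfold mt at k
      simp only [Finset.mem_insert, Finset.mem_singleton]
      grind
  · intro x hx
    simp only [Finset.mem_insert, Finset.mem_singleton] at hx
    rcases hx with rfl | rfl
    exacts [h.aU, h.bU]
  · intro x hx
    simp only [Finset.mem_insert, Finset.mem_singleton] at hx
    rcases hx with rfl | rfl <;> simp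
  · intro x hx _
    simp only [Finset.mem_insert, Finset.mem_singleton] at hx
    rcases hx with (rfl | rfl) | hx
    · simpa using hρ
    · simpa [hab.symm] using hκ
    · simp at hx
  · intro x hx _ y hy k
    simp only [Finset.mem_insert, Finset.mem_singleton, Finset.notMem_empty, or_false] at hx hy
    rcases hx with rfl | rfl <;> rcases hy with rfl | rfl
    · exact (irr _ k).elim
    · simpa [hab.symm] using Ne.symm hne
    · simpa [hab.symm] using hne
    · exact (irr _ k).elim
  · intro u hu _ _
    refine ⟨ρ, κ, fun s hs _ _ _ => ?_⟩
    simp only [Finset.mem_insert, Finset.mem_singleton, Finset.notMem_empty, or_false] at hs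
    rcases hs with rfl | rfl
    · simp
    · simp [hab.symm]

open Classical in
theorem SH.c3 (h : SH H U L p q a b a' b' d c' d') (e : b = c') (e2 : b' ≠ d) (e3 : b' ≠ d') :
    Goal (KK H a b a' b' a d c' d') U ∅ (fun _ => 0) L := by
  subst e
  obtain ⟨pa, pa'⟩ := h.k3 h.n9
  obtain ⟨ρ, hρ⟩ : (L a).Nonempty := Finset.card_pos.1 (by have := h.L5 a h.aU; omega)
  obtain ⟨κ, hκ, hne⟩ := pick1 (A := L b) (B := {ρ}) (by have := h.L5 b h.bU; simp; omega)
  rw [Finset.mem_singleton] at hne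
  have hab := h.n2
  have irr := h.irr
  have pq := h.pq
  have PU : ∀ u ∈ U, u ∈ {u : W | u ≠ q} := fun u hu => by rintro rfl; exact h.qU hu
  have hPl : Planar (cut H {u : W | u ≠ q} (({d, d'} : Finset W) : Set W)) := by
    refine h.hP.deltaF (A := {q}) (Conn.singleton q) ?_ (Finset.card_le_two.trans (by norm_num)) ?_
    · rintro _ rfl h1; exact h1 rfl
    · intro y hy
      simp only [Finset.mem_insert, Finset.mem_singleton] at hy
      rcases hy with rfl | rfl
      · exact ⟨PU _ h.dU, q, rfl, h.qd.symm⟩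
      · exact ⟨PU _ h.d'U, q, rfl, h.qd'.symm⟩
  have ad : ∀ u v, H.Adj u v → u ≠ q → v ≠ q → (cut H {u : W | u ≠ q} (({d, d'} : Finset W) : Set W)).Adj u v :=
    fun u v k h1 h2 => ⟨k.ne, Or.inl ⟨k, h1, h2⟩⟩
  have uq : ∀ u ∈ U, u ≠ q := fun u hu => PU u hu
  have pa2 := ad _ _ pa pq (uq _ h.aU)
  have pb2 := ad _ _ h.pb pq (uq _ h.bU)
  have pb'2 := ad _ _ h.pb' pq (uq _ h.b'U)
  have dd2 : (cut H {u : W | u ≠ q} (({d, d'} : Finset W) : Set W)).Adj d d' :=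
    ⟨h.n8, Or.inr (by simp)⟩
  generalize cut H {u : W | u ≠ q} (({d, d'} : Finset W) : Set W) = H2 at *
  have hc : Conn H2 {b, a, p} := ((Conn.singleton p).insert ⟨p, rfl, pa2.symm⟩).insert
    ⟨p, by simp, pb2.symm⟩
  refine fin (H := H2) hPl (fun u v => KK.symm) U ∅ {a, b} ∅ {b, a, p}
    hc ?_ (by simp) (by simp) (by simp) (by simp) (by simp)
    (fun u => if u = a then ρ else κ) _ L (by simp) (by simp) (fun u hu _ _ => h.L5 u hu) ?_ ?_ ?_ ?_ ?_ ?_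
  · intro u hu hs
    simp only [Set.mem_insert_iff, Set.mem_singleton_iff] at hs
    rcases hs with rfl | rfl | rfl
    · simp
    · simp
    · exact (h.pU hu).elim
  · have na : Nb H2 {b, a, p} a := ⟨p, by simp, pa2.symm⟩
    have nb : Nb H2 {b, a, p} b := ⟨p, by simp, pb2.symm⟩
    have nb' : Nb H2 {b, a, p} b' := ⟨p, by simp, pb'2.symm⟩
    rintro u hu v hv (k | k | k)
    · exact Or.inl (ad _ _ k (uq _ hu) (uq _ hv))
    · have na' : a' ∈ U → Nb H2 {b, a, p} a' := fun hu => ⟨p, by simp, (ad _ _ pa' pq (uq _ hu)).symm⟩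
      rcases k with ⟨rfl, rfl⟩ | ⟨rfl, rfl⟩ | ⟨rfl, rfl⟩ | ⟨rfl, rfl⟩
      · exact Or.inr ⟨na, na' hv, by simp⟩
      · exact Or.inr ⟨na' hu, na, by simp⟩
      · exact Or.inr ⟨nb, nb', by simp⟩
      · exact Or.inr ⟨nb', nb, by simp⟩
    · rcases k with ⟨rfl, rfl⟩ | ⟨rfl, rfl⟩ | ⟨rfl, rfl⟩ | ⟨rfl, rfl⟩
      · exact Or.inr ⟨na, nb, by simp⟩
      · exact Or.inr ⟨nb, na, by simp⟩
      · exact Or.inl dd2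
      · exact Or.inl dd2.symm
  · intro x hx
    simp only [Finset.mem_insert, Finset.mem_singleton] at hx
    rcases hx with rfl | rfl
    exacts [h.aU, h.bU]
  · intro x hx
    simp only [Finset.mem_insert, Finset.mem_singleton] at hx
    rcases hx with rfl | rfl <;> simp
  · intro x hx _
    simp only [Finset.mem_insert, Finset.mem_singleton] at hx
    rcases hx with (rfl | rfl) | hx
    · simpa using hρ
    · simpa [hab.symm] using hκ
    · simp at hx
  · intro x hx _ y hy k
    simp only [Finset.mem_insert, Finset.mem_singleton, Finset.notMem_empty, or_false] at hx hy
    rcases hx with rfl | rfl <;> rcases hy with rfl | rfl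
    · exact (irr _ k).elim
    · simpa [hab.symm] using Ne.symm hne
    · simpa [hab.symm] using hne
    · exact (irr _ k).elim
  · intro u hu _ _
    refine ⟨ρ, κ, fun s hs _ _ _ => ?_⟩
    simp only [Finset.mem_insert, Finset.mem_singleton, Finset.notMem_empty, or_false] at hs
    rcases hs with rfl | rfl
    · simp
    · simp [hab.symm]

open Classical in
theorem SH.c1 (h : SH H U L p q a b a' b' d c' d') (f1 : b ≠ d) (f2 : b ≠ d') (f3 : b' ≠ d)
    (f4 : b' ≠ d') (f5 : b ≠ c') (f6 : b' ≠ c') (hb : ¬ (H.Adj b' a ∧ H.Adj b' d)) :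
    Goal (KK H a b a' b' a d c' d') U ∅ (fun _ => 0) L := by
  obtain ⟨ρ, hρ⟩ : (L a).Nonempty := Finset.card_pos.1 (by have := h.L5 a h.aU; omega)
  obtain ⟨κ, hκ, kne⟩ := pick1 (A := L d) (B := {ρ}) (by have := h.L5 d h.dU; simp; omega)
  obtain ⟨β, hβ, bne⟩ := pick1 (A := L b) (B := {ρ, κ}) (by
    have := h.L5 b h.bU; have := Finset.card_le_two (a := ρ) (b := κ); omega)
  simp only [Finset.mem_insert, Finset.mem_singleton, not_or] at kne bne
  have irr := h.irr
  have := h.n1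
  have n2 := h.n2
  have := h.n3
  have := h.n4
  have n5 := h.n5
  have := h.n6
  have := h.n7
  have := h.n8
  have := h.n9
  have := h.n10
  have := h.n11
  have := h.n12
  have ψa : (fun u => if u = a then ρ else if u = d then κ else β) a = ρ := by simp
  have ψd : (fun u => if u = a then ρ else if u = d then κ else β) d = κ := by simp [n5.symm]
  have ψb : (fun u => if u = a then ρ else if u = d then κ else β) b = β := by simp [n2.symm, f1]
  generalize (fun u => if u = a then ρ else if u = d then κ else β) = ψ at *
  refine fin (H := H) h.hP (fun u v => KK.symm) U ∅ {a, d} {b} (insert d {a, p, q})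
    (h.cn.insert ⟨q, by simp, h.qd.symm⟩) ?_ (by simpa using h.bU) (by simpa using ⟨n2.symm, f1⟩) (by simp)
    (by simpa using ⟨p, by simp, h.pb.symm⟩) (by simp)
    ψ _ L (by simp) (by simp) (fun u hu _ _ => h.L5 u hu) ?_ ?_ ?_ ?_ ?_ ?_
  · intro u hu hs
    simp only [Set.mem_insert_iff, Set.mem_singleton_iff] at hs
    rcases hs with rfl | rfl | rfl | rfl
    · simp
    · simp
    · exact (h.pU hu).elim
    · exact (h.qU hu).elim
  · rintro u hu v hv (k | k)
    · exact Or.inl k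
    · refine Or.inr ⟨h.nbs (by simp) (by simp) k, h.nbs (by simp) (by simp) (mt.symm' k), ?_⟩
      unfold mt at k
      simp only [Finset.mem_insert, Finset.mem_singleton]
      grind
  · intro x hx
    simp only [Finset.mem_insert, Finset.mem_singleton] at hx
    rcases hx with rfl | rfl
    exacts [h.aU, h.dU]
  · intro x hx
    simp only [Finset.mem_insert, Finset.mem_singleton] at hx
    rcases hx with rfl | rfl <;> simp
  · intro x hx _
    simp only [Finset.mem_insert, Finset.mem_singleton] at hx
    rcases hx with (rfl | rfl) | rfl
    · rw [ψa]; exact hρ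
    · rw [ψd]; exact hκ
    · rw [ψb]; exact hβ
  · intro x hx _ y hy k
    have kn : x ≠ y := by rintro rfl; exact irr _ k
    simp only [Finset.mem_insert, Finset.mem_singleton] at hx hy
    clear k irr hb
    grind
  · intro u hu h1 h2
    simp only [Finset.mem_insert, Finset.mem_singleton, not_or] at h1 h2 ⊢
    have nb : ∀ s, u ≠ b' → s = b → KK H a b a' b' a d c' d' u s → ¬ (s = b ∧ H.Adj u s) → False := by
      rintro s ub rfl (k | k | k) hn
      · exact hn ⟨rfl, k⟩
      · unfold mt at k; grind
      · unfold mt at k; grind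
    by_cases ub : u = b'
    · subst ub
      by_cases ua : H.Adj u a
      · have ud : ¬ H.Adj u d := fun k => hb ⟨ua, k⟩
        refine ⟨ρ, β, ?_⟩
        rintro s ((rfl | rfl) | rfl) k - -
        · exact Or.inl ψa
        · exfalso
          rcases k with k | k | k
          · exact ud k
          · unfold mt at k; grind
          · unfold mt at k; grind
        · exact Or.inr ψb
      · refine ⟨κ, β, ?_⟩
        rintro s ((rfl | rfl) | rfl) k - -
        · exfalso
          rcases k with k | k | k
          · exact ua k
          · unfold mt at k; grind
          · unfold mt at k; grind
        · exact Or.inl ψd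
        · exact Or.inr ψb
    · refine ⟨ρ, κ, ?_⟩
      rintro s ((hs | hs) | hs) k hn -
      · rw [hs]; exact Or.inl ψa
      · rw [hs]; exact Or.inr ψd
      · exact (nb s ub hs k hn).elim

theorem SH.goal (h : SH H U L p q a b a' b' d c' d') :
    Goal (KK H a b a' b' a d c' d') U ∅ (fun _ => 0) L := by
  have key : ∀ {b b' d d'}, SH H U L p q a b a' b' d c' d' →
     (b = d ∨ (b = c' ∧ b' ≠ d ∧ b' ≠ d') ∨ (b ≠ d ∧ b ≠ d' ∧ b' ≠ d ∧ b' ≠ d' ∧ b ≠ c' ∧ b' ≠ c' ∧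
      ¬ (H.Adj b' a ∧ H.Adj b' d))) → Goal (KK H a b a' b' a d c' d') U ∅ (fun _ => 0) L := by
    rintro b b' d d' h (k | ⟨k1, k2, k3⟩ | ⟨k1, k2, k3, k4, k5, k6, k7⟩)
    exacts [h.c2 k, h.c3 k1 k2 k3, h.c1 k1 k2 k3 k4 k5 k6 k7]
  by_contra hn
  have h1 := fun k => hn (key h k)
  have h2 := fun k => hn (by have := key h.sb k; rwa [KK.sb] at this)
  have h3 := fun k => hn (by have := key h.sd k; rwa [KK.sd] at this)
  have h4 := fun k => hn (by have := key h.sb.sd k; rwa [KK.sd, KK.sb] at this)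
  have f1 : b ≠ d := fun e => h1 (Or.inl e)
  have f2 : b' ≠ d := fun e => h2 (Or.inl e)
  have f3 : b ≠ d' := fun e => h3 (Or.inl e)
  have f4 : b' ≠ d' := fun e => h4 (Or.inl e)
  have f5 : b ≠ c' := fun e => h1 (Or.inr (Or.inl ⟨e, f2, f4⟩))
  have f6 : b' ≠ c' := fun e => h2 (Or.inr (Or.inl ⟨e, f1, f3⟩))
  obtain ⟨k1, k2⟩ : H.Adj b' a ∧ H.Adj b' d := by
    by_contra k; exact h1 (Or.inr (Or.inr ⟨f1, f3, f2, f4, f5, f6, k⟩))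
  obtain ⟨k3, k4⟩ : H.Adj b a ∧ H.Adj b d := by
    by_contra k; exact h2 (Or.inr (Or.inr ⟨f2, f4, f1, f3, f6, f5, k⟩))
  obtain ⟨-, k5⟩ : H.Adj b' a ∧ H.Adj b' d' := by
    by_contra k; exact h3 (Or.inr (Or.inr ⟨f3, f1, f4, f2, f5, f6, k⟩))
  obtain ⟨-, k6⟩ : H.Adj b a ∧ H.Adj b d' := by
    by_contra k; exact h4 (Or.inr (Or.inr ⟨f4, f2, f3, f1, f6, f5, k⟩))
  obtain ⟨Q, q1, q2, q3, q4⟩ := h.hQ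
  have nQ : ∀ u ∈ U, u ∉ Q := by
    intro u hu k
    rcases q1 k with rfl | rfl
    exacts [h.pU hu, h.qU hu]
  exact h.hP.k33u q3 h.n5 h.n6 h.n8 h.n7 k3.symm k4.symm k6.symm k1.symm k2.symm k5.symm
    (nQ _ h.aU) (nQ _ h.dU) (nQ _ h.d'U) (nQ _ h.bU) (nQ _ h.b'U) q4 ⟨q, q2, h.qd.symm⟩
    ⟨q, q2, h.qd'.symm⟩

end CN
end PartJ

open Set
noncomputable section PartK1
namespace CN

lemma exLog {X : Type} [TopologicalSpace X] [SimplyConnectedSpace X] [LocallyPathConnectedSpace X]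
    (x₀ : X) (f : X → ℂ) (hf : Continuous f) (h0 : ∀ x, f x ≠ 0) :
    ∃ g : X → ℂ, Continuous g ∧ ∀ x, Complex.exp (g x) = f x := by
  rcases Complex.isCoveringMapOn_exp.existsUnique_continuousMap_lifts
    ⟨f, hf⟩ (Complex.exp_log (h0 x₀)) (fun x ↦ h0 x) with ⟨g, ⟨-, hg⟩, -⟩
  exact ⟨g, g.continuous, fun x ↦ congrFun hg x⟩

/-- `w` is the logarithmic increment of `γ - z` along `[0,1]`. -/
def Dl (γ : ℝ → ℂ) (z w : ℂ) : Prop :=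
  ∃ g : ℝ → ℂ, Continuous g ∧ (∃ c : ℂ, c ≠ 0 ∧ ∀ t, Complex.exp (g t) = c * (γ t - z)) ∧
    w = g 1 - g 0

lemma Dl.exists {γ : ℝ → ℂ} (hγ : Continuous γ) {z : ℂ} (hz : ∀ t, γ t ≠ z) : ∃ w, Dl γ z w := by
  obtain ⟨g, hg, h⟩ := exLog (0 : ℝ) (fun t ↦ γ t - z) (by fun_prop)
    (fun t ↦ sub_ne_zero.2 (hz t))
  exact ⟨_, g, hg, ⟨1, one_ne_zero, by simpa using h⟩, rfl⟩

lemma Dl.unique {γ : ℝ → ℂ} {z w w' : ℂ} (h : Dl γ z w) (h' : Dl γ z w') : w = w' := by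
  obtain ⟨g, hg, ⟨c, hc, e⟩, rfl⟩ := h
  obtain ⟨g', hg', ⟨c', hc', e'⟩, rfl⟩ := h'
  have key : g = fun t ↦ g' t + (g 0 - g' 0) := by
    refine Complex.isCoveringMap_exp.eq_of_comp_eq hg (by fun_prop) ?_ 0 (by simp)
    funext t
    apply Subtype.ext
    simp only [Function.comp]
    rw [Complex.exp_add, Complex.exp_sub, e, e', e, e']
    have h1 : γ 0 - z ≠ 0 := by
      intro h0
      have := e 0
      rw [h0, mul_zero] at this
      exact Complex.exp_ne_zero _ this
    field_simp
  have := congrFun key 1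
  rw [this]; ring

lemma Dl.exp {γ : ℝ → ℂ} {z w : ℂ} (h : Dl γ z w) :
    Complex.exp w = (γ 1 - z) / (γ 0 - z) := by
  obtain ⟨g, hg, ⟨c, hc, e⟩, rfl⟩ := h
  rw [Complex.exp_sub, e, e]
  field_simp

lemma Dl.square {γ δ : ℝ → ℂ} (hγ : Continuous γ) (hδ : Continuous δ) (hd : ∀ s t, γ s ≠ δ t)
    {w1 w2 w3 w4 : ℂ} (h1 : Dl γ (δ 0) w1) (h2 : Dl γ (δ 1) w2) (h3 : Dl δ (γ 1) w3)
    (h4 : Dl δ (γ 0) w4) : w1 - w2 + w3 - w4 = 0 := by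
  obtain ⟨g, hg, h⟩ := exLog ((0, 0) : ℝ × ℝ) (fun t ↦ γ t.1 - δ t.2) (by fun_prop)
    (fun t ↦ sub_ne_zero.2 (hd _ _))
  have e1 := h1.unique ⟨fun s ↦ g (s, 0), by fun_prop, ⟨1, one_ne_zero, fun t ↦ by simp [h]⟩, rfl⟩
  have e2 := h2.unique ⟨fun s ↦ g (s, 1), by fun_prop, ⟨1, one_ne_zero, fun t ↦ by simp [h]⟩, rfl⟩
  have e3 := h3.unique ⟨fun s ↦ g (1, s), by fun_prop, ⟨-1, by simp, fun t ↦ by simp [h]⟩, rfl⟩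
  have e4 := h4.unique ⟨fun s ↦ g (0, s), by fun_prop, ⟨-1, by simp, fun t ↦ by simp [h]⟩, rfl⟩
  rw [e1, e2, e3, e4]; ring

/-- A chosen logarithm of `f x - f y`. -/
def lg {m : ℕ} (f : Fin m → ℂ) (x y : Fin m) : ℂ :=
  if x < y then Complex.log (f x - f y) else Complex.log (f y - f x) + Real.pi * Complex.I

lemma exp_lg {m : ℕ} {f : Fin m → ℂ} (hf : Function.Injective f) {x y : Fin m} (h : x ≠ y) :
    Complex.exp (lg f x y) = f x - f y := by
  unfold lg
  split_ifs
  · rw [Complex.exp_log (sub_ne_zero.2 (hf.ne h))]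
  · rw [Complex.exp_add, Complex.exp_log (sub_ne_zero.2 (hf.ne h.symm)), Complex.exp_pi_mul_I]
    ring

lemma lg_sub {m : ℕ} (f : Fin m → ℂ) {x y : Fin m} (h : x ≠ y) :
    lg f x y - lg f y x = Real.pi * Complex.I * ((1 - 2 * (if x < y then 1 else 0) : ℤ) : ℂ) := by
  unfold lg
  rcases lt_or_gt_of_ne h with h | h
  · simp [h, h.not_gt]
  · simp [h, h.not_gt]

lemma vanKampen {m : ℕ} (f : Fin m → ℂ) (hf : Function.Injective f)
    (Ed : Fin m → Fin m → Prop) (S : Fin m → Fin m → Set ℂ)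
    (hJ : ∀ i j, Ed i j → JoinedIn (S i j) (f i) (f j))
    (hd : ∀ i j k l, Ed i j → Ed k l → i ≠ k → i ≠ l → j ≠ k → j ≠ l → Disjoint (S i j) (S k l))
    (hv : ∀ i j k, Ed i j → k ≠ i → k ≠ j → f k ∉ S i j) :
    ∃ n : Fin m → Fin m → Fin m → ℤ, ∀ a b c d, Ed a b → Ed c d → a ≠ c → a ≠ d → b ≠ c → b ≠ d →
      n a b c - n a b d + n c d b - n c d a - (if b < c then 1 else 0) + (if a < c then 1 else 0)
        + (if b < d then 1 else 0) - (if a < d then 1 else 0) = 0 := by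
  have hp : ∀ i j, ∃ γ : ℝ → ℂ, Ed i j → Continuous γ ∧ γ 0 = f i ∧ γ 1 = f j ∧
      ∀ t, γ t ∈ S i j := by
    intro i j
    by_cases h : Ed i j
    · obtain ⟨p, hp⟩ := hJ i j h
      exact ⟨p.extend, fun _ ↦ ⟨p.continuous_extend, by simp, by simp, fun t ↦ hp _⟩⟩
    · exact ⟨0, fun h' ↦ absurd h' h⟩
  choose γ hγ using hp
  have hn : ∀ i j k, ∃ n : ℤ, Ed i j → k ≠ i → k ≠ j →
      Dl (γ i j) (f k) (lg f j k - lg f i k + n * (2 * Real.pi * Complex.I)) := by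
    intro i j k
    by_cases h : Ed i j ∧ k ≠ i ∧ k ≠ j
    · obtain ⟨h, hi, hj⟩ := h
      obtain ⟨hc, h0, h1, hs⟩ := hγ i j h
      obtain ⟨w, hw⟩ := Dl.exists hc (z := f k) (fun t e ↦ hv i j k h hi hj (e ▸ hs t))
      have := hw.exp
      rw [h0, h1, ← exp_lg hf hi.symm, ← exp_lg hf hj.symm, ← Complex.exp_sub,
        Complex.exp_eq_exp_iff_exists_int] at this
      obtain ⟨n, hn⟩ := this
      exact ⟨n, fun _ _ _ ↦ hn ▸ hw⟩
    · exact ⟨0, fun a b c ↦ absurd ⟨a, b, c⟩ h⟩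
  choose n hn using hn
  refine ⟨n, fun a b c d h1 h2 hac had hbc hbd ↦ ?_⟩
  obtain ⟨c1, z1, o1, s1⟩ := hγ a b h1
  obtain ⟨c2, z2, o2, s2⟩ := hγ c d h2
  have sq := Dl.square c1 c2 (fun s t e ↦ Set.disjoint_left.1 (hd a b c d h1 h2 hac had hbc hbd)
    (s1 s) (e ▸ s2 t)) (by rw [z2]; exact hn a b c h1 hac.symm hbc.symm)
    (by rw [o2]; exact hn a b d h1 had.symm hbd.symm)
    (by rw [o1]; exact hn c d b h2 hbc hbd) (by rw [z1]; exact hn c d a h2 hac had)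
  have e1 := lg_sub f hbc
  have e2 := lg_sub f hac
  have e3 := lg_sub f hbd
  have e4 := lg_sub f had
  have hpi : (Real.pi : ℂ) * Complex.I ≠ 0 :=
    mul_ne_zero (Complex.ofReal_ne_zero.2 Real.pi_ne_zero) Complex.I_ne_zero
  generalize (if b < c then (1 : ℤ) else 0) = x1 at *
  generalize (if a < c then (1 : ℤ) else 0) = x2 at *
  generalize (if b < d then (1 : ℤ) else 0) = x3 at *
  generalize (if a < d then (1 : ℤ) else 0) = x4 at *
  have : (Real.pi : ℂ) * Complex.I * (2 * ((n a b c - n a b d + n c d b - n c d a - x1 + x2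
        + x3 - x4 : ℤ) : ℂ)) = 0 := by
    push_cast at *
    linear_combination sq - e1 + e2 + e3 - e4
  rcases mul_eq_zero.1 this with h | h
  · exact absurd h hpi
  · rcases mul_eq_zero.1 h with h | h
    · norm_num at h
    · exact_mod_cast h

lemma noK5 (f : Fin 5 → ℂ) (hf : Function.Injective f) (S : Fin 5 → Fin 5 → Set ℂ)
    (hJ : ∀ i j, i < j → JoinedIn (S i j) (f i) (f j))
    (hd : ∀ i j k l, i ≠ k → i ≠ l → j ≠ k → j ≠ l → Disjoint (S i j) (S k l))
    (hv : ∀ i j k, k ≠ i → k ≠ j → f k ∉ S i j) : False := by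
  obtain ⟨n, hn⟩ := vanKampen f hf (fun i j ↦ i < j) S hJ (fun i j k l _ _ ↦ hd i j k l)
    (fun i j k _ ↦ hv i j k)
  have h1 := hn 0 1 2 3 (by decide) (by decide) (by decide) (by decide) (by decide) (by decide)
  have h2 := hn 0 2 1 3 (by decide) (by decide) (by decide) (by decide) (by decide) (by decide)
  have h3 := hn 0 3 1 2 (by decide) (by decide) (by decide) (by decide) (by decide) (by decide)
  have h4 := hn 0 1 2 4 (by decide) (by decide) (by decide) (by decide) (by decide) (by decide)
  have h5 := hn 0 2 1 4 (by decide) (by decide) (by decide) (by decide) (by decide) (by decide)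
  have h6 := hn 0 4 1 2 (by decide) (by decide) (by decide) (by decide) (by decide) (by decide)
  have h7 := hn 0 1 3 4 (by decide) (by decide) (by decide) (by decide) (by decide) (by decide)
  have h8 := hn 0 3 1 4 (by decide) (by decide) (by decide) (by decide) (by decide) (by decide)
  have h9 := hn 0 4 1 3 (by decide) (by decide) (by decide) (by decide) (by decide) (by decide)
  have h10 := hn 0 2 3 4 (by decide) (by decide) (by decide) (by decide) (by decide) (by decide)
  have h11 := hn 0 3 2 4 (by decide) (by decide) (by decide) (by decide) (by decide) (by decide)
  have h12 := hn 0 4 2 3 (by decide) (by decide) (by decide) (by decide) (by decide) (by decide)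
  have h13 := hn 1 2 3 4 (by decide) (by decide) (by decide) (by decide) (by decide) (by decide)
  have h14 := hn 1 3 2 4 (by decide) (by decide) (by decide) (by decide) (by decide) (by decide)
  have h15 := hn 1 4 2 3 (by decide) (by decide) (by decide) (by decide) (by decide) (by decide)
  simp (decide := true) only [if_true, if_false] at *
  omega

lemma noK33 (f : Fin 6 → ℂ) (hf : Function.Injective f) (S : Fin 6 → Fin 6 → Set ℂ)
    (hJ : ∀ i j, (i < 3 ∧ 3 ≤ j) → JoinedIn (S i j) (f i) (f j))
    (hd : ∀ i j k l, i ≠ k → i ≠ l → j ≠ k → j ≠ l → Disjoint (S i j) (S k l))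
    (hv : ∀ i j k, k ≠ i → k ≠ j → f k ∉ S i j) : False := by
  obtain ⟨n, hn⟩ := vanKampen f hf (fun i j ↦ i < 3 ∧ 3 ≤ j) S hJ (fun i j k l _ _ ↦ hd i j k l)
    (fun i j k _ ↦ hv i j k)
  have key : ∀ a b c d : Fin 6, a < 3 → c < 3 → a ≠ c → 3 ≤ b → 3 ≤ d → b ≠ d →
      n a b c - n a b d + n c d b - n c d a + (if a < c then 1 else 0)
        + (if b < d then 1 else 0) - 1 = 0 := by
    intro a b c d ha hc hac hb hd hbd
    have h1 : ¬ b < c := (hc.trans_le hb).not_gt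
    have h2 : a < d := ha.trans_le hd
    have := hn a b c d ⟨ha, hb⟩ ⟨hc, hd⟩ hac h2.ne (hc.trans_le hb).ne' hbd
    rw [if_neg h1, if_pos h2] at this
    linarith
  have K : ∀ b d : Fin 6, 3 ≤ b → 3 ≤ d → b ≠ d → _ := fun b d h1 h2 h3 ↦
    And.intro (key 0 b 1 d (by decide) (by decide) (by decide) h1 h2 h3)
     (And.intro (key 0 b 2 d (by decide) (by decide) (by decide) h1 h2 h3)
      (key 1 b 2 d (by decide) (by decide) (by decide) h1 h2 h3))
  obtain ⟨a1, a2, a3⟩ := K 3 4 (by decide) (by decide) (by decide)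
  obtain ⟨b1, b2, b3⟩ := K 4 3 (by decide) (by decide) (by decide)
  obtain ⟨c1, c2, c3⟩ := K 3 5 (by decide) (by decide) (by decide)
  obtain ⟨d1, d2, d3⟩ := K 5 3 (by decide) (by decide) (by decide)
  obtain ⟨e1, e2, e3⟩ := K 4 5 (by decide) (by decide) (by decide)
  obtain ⟨f1, f2, f3⟩ := K 5 4 (by decide) (by decide) (by decide)
  simp (decide := true) only [if_true, if_false] at *
  omega

end CN
end PartK1

open Set
noncomputable section PartK2
namespace CN
variable {W : Type}

/-- A system of drawn edges on the point set `pos`: independent edges are disjoint. -/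
structure Drw (E : W → W → Set ℂ → Prop) (pos : W → ℂ) : Prop where
  inj : Function.Injective pos
  sym : ∀ u v S, E u v S → E v u S
  jn : ∀ u v S, E u v S → JoinedIn S (pos u) (pos v)
  cpt : ∀ u v S, E u v S → IsCompact S
  dj : ∀ u v S x y T, E u v S → E x y T → u ≠ x → u ≠ y → v ≠ x → v ≠ y → Disjoint S T
  pt : ∀ u v S w, E u v S → pos w ∈ S → w = u ∨ w = v
  fin : {S | ∃ u v, E u v S}.Finite

/-- The graph of a drawing. -/
def gr (E : W → W → Set ℂ → Prop) : SimpleGraph W where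
  Adj u v := u ≠ v ∧ ∃ S, E u v S ∨ E v u S
  symm := ⟨fun _ _ h => ⟨h.1.symm, h.2.imp fun _ h => h.symm⟩⟩
  loopless := ⟨fun _ h => h.1 rfl⟩

variable {E : W → W → Set ℂ → Prop} {pos : W → ℂ}

/-- The part of the drawing spanned by a vertex set. -/
def img (E : W → W → Set ℂ → Prop) (pos : W → ℂ) (A : Set W) : Set ℂ :=
  {z | (∃ u ∈ A, z = pos u) ∨ ∃ u ∈ A, ∃ v ∈ A, ∃ T, E u v T ∧ z ∈ T}

lemma Drw.adj (h : Drw E pos) {u v : W} : (gr E).Adj u v ↔ u ≠ v ∧ ∃ S, E u v S :=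
  ⟨fun ⟨a, S, b⟩ => ⟨a, S, b.elim id (h.sym _ _ _)⟩, fun ⟨a, S, b⟩ => ⟨a, S, Or.inl b⟩⟩

lemma Drw.img_disj (h : Drw E pos) {A B : Set W} (hAB : Disjoint A B) :
    Disjoint (img E pos A) (img E pos B) := by
  have ne : ∀ x ∈ A, ∀ y ∈ B, x ≠ y := fun x hx y hy e => Set.disjoint_left.1 hAB hx (e ▸ hy)
  rw [Set.disjoint_left]
  rintro z (⟨u, hu, rfl⟩ | ⟨u, hu, v, hv, T, hT, hz⟩) (⟨x, hx, hz'⟩ | ⟨x, hx, y, hy, T', hT', hz'⟩)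
  · exact ne u hu x hx (h.inj hz')
  · rcases h.pt _ _ _ _ hT' hz' with rfl | rfl
    · exact ne _ hu _ hx rfl
    · exact ne _ hu _ hy rfl
  · subst hz'
    rcases h.pt _ _ _ _ hT hz with rfl | rfl
    · exact ne _ hu _ hx rfl
    · exact ne _ hv _ hx rfl
  · exact Set.disjoint_left.1 (h.dj _ _ _ _ _ _ hT hT' (ne u hu x hx) (ne u hu y hy)
      (ne v hv x hx) (ne v hv y hy)) hz hz'

lemma Drw.img_joined (h : Drw E pos) {A : Set W} (hA : Conn (gr E) A) {x y : W} (hx : x ∈ A)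
    (hy : y ∈ A) : JoinedIn (img E pos A) (pos x) (pos y) := by
  have := hA.2 {y | y ∈ A ∧ JoinedIn (img E pos A) (pos x) (pos y)} (fun y hy => hy.1)
    ⟨x, hx, JoinedIn.refl (Or.inl ⟨x, hx, rfl⟩)⟩ (by
      rintro u ⟨hu, hj⟩ v hv huv
      obtain ⟨-, S, hS⟩ := h.adj.1 huv
      exact ⟨hv, hj.trans ((h.jn _ _ _ hS).mono
        (fun z hz => Or.inr ⟨u, hu, v, hv, S, hS, hz⟩))⟩)
  rw [← this] at hy
  exact hy.2

lemma Drw.planar (h : Drw E pos) : Planar (gr E) := by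
  constructor
  · intro B hB hd ht
    choose b hb using fun i => (hB i).1
    have hU : ∀ i j k l, i ≠ k → i ≠ l → j ≠ k → j ≠ l → Disjoint (B i ∪ B j) (B k ∪ B l) := by
      intro i j k l h1 h2 h3 h4
      simp [*]
    refine noK5 (fun i => pos (b i)) ?_ (fun i j => img E pos (B i ∪ B j)) ?_ ?_ ?_
    · intro i j e
      by_contra hij
      exact Set.disjoint_left.1 (hd i j hij) (hb i) (h.inj e ▸ hb j)
    · intro i j hij
      exact h.img_joined ((hB i).union (hB j) (ht i j hij.ne)) (Or.inl (hb i)) (Or.inr (hb j))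
    · intro i j k l h1 h2 h3 h4
      exact h.img_disj (hU _ _ _ _ h1 h2 h3 h4)
    · intro i j k h1 h2 hm
      exact Set.disjoint_left.1 (h.img_disj (hU k k i j h1 h2 h1 h2))
        (Or.inl ⟨b k, Or.inl (hb k), rfl⟩) hm
  · intro A A' hA hA' dA dA' dAA' ht
    let B : Fin 6 → Set W := Fin.append A A'
    have ind : ∀ P : Fin 6 → Prop, (∀ i : Fin 3, P (Fin.castAdd 3 i)) →
        (∀ i : Fin 3, P (Fin.natAdd 3 i)) → ∀ i, P i := fun P h1 h2 i => Fin.addCases (m := 3) (n := 3) (motive := P) h1 h2 i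
    have bl : ∀ i : Fin 3, B (Fin.castAdd 3 i) = A i := fun i => Fin.append_left _ _ _
    have br : ∀ i : Fin 3, B (Fin.natAdd 3 i) = A' i := fun i => Fin.append_right _ _ _
    have hB : ∀ i, Conn (gr E) (B i) := by
      refine ind _ ?_ ?_
      · intro i; rw [bl]; exact hA i
      · intro i; rw [br]; exact hA' i
    have hd : ∀ i j, i ≠ j → Disjoint (B i) (B j) := by
      refine ind _ ?_ ?_
      · intro i
        refine ind _ ?_ ?_
        · intro j hij; rw [bl, bl]; exact dA i j (fun e => hij (by rw [e]))
        · intro j hij; rw [bl, br]; exact dAA' i j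
      · intro i
        refine ind _ ?_ ?_
        · intro j hij; rw [bl, br]; exact (dAA' j i).symm
        · intro j hij; rw [br, br]; exact dA' i j (fun e => hij (by rw [e]))
    have ht' : ∀ i j : Fin 6, i < 3 ∧ 3 ≤ j → Tch (gr E) (B i) (B j) := by
      refine ind _ ?_ ?_
      · intro i
        refine ind _ ?_ ?_
        · rintro j ⟨-, h2⟩
          rw [Fin.le_def] at h2
          exact absurd h2 (by simp)
        · intro j _; rw [bl, br]; exact ht i j
      · rintro i j ⟨h1, -⟩
        rw [Fin.lt_def] at h1
        exact absurd h1 (by simp)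
    choose b hb using fun i => (hB i).1
    have hU : ∀ i j k l, i ≠ k → i ≠ l → j ≠ k → j ≠ l → Disjoint (B i ∪ B j) (B k ∪ B l) := by
      intro i j k l h1 h2 h3 h4
      simp [*]
    refine noK33 (fun i => pos (b i)) ?_ (fun i j => img E pos (B i ∪ B j)) ?_ ?_ ?_
    · intro i j e
      by_contra hij
      exact Set.disjoint_left.1 (hd i j hij) (hb i) (h.inj e ▸ hb j)
    · intro i j hij
      exact h.img_joined ((hB i).union (hB j) (ht' i j hij)) (Or.inl (hb i)) (Or.inr (hb j))
    · intro i j k l h1 h2 h3 h4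
      exact h.img_disj (hU _ _ _ _ h1 h2 h3 h4)
    · intro i j k h1 h2 hm
      exact Set.disjoint_left.1 (h.img_disj (hU k k i j h1 h2 h1 h2))
        (Or.inl ⟨b k, Or.inl (hb k), rfl⟩) hm

end CN
end PartK2

open Set
noncomputable section PartK3
namespace CN
variable {W : Type}

/-- Orientation form of a triple of points. -/
def ori (A B z : ℂ) : ℝ := (B.re - A.re) * (z.im - A.im) - (B.im - A.im) * (z.re - A.re)

lemma ori_ne {P A B C : ℂ} {r : ℝ} (hA : dist A P = r) (hB : dist B P = r) (hC : dist C P = r)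
    (h1 : A ≠ B) (h2 : A ≠ C) (h3 : B ≠ C) : ori A B C ≠ 0 := by
  intro h0
  have sq : ∀ z : ℂ, dist z P = r → (z.re - P.re) ^ 2 + (z.im - P.im) ^ 2 = r ^ 2 := by
    intro z hz
    rw [← hz, Complex.dist_eq_re_im, Real.sq_sqrt (by positivity)]
  have eA := sq A hA
  have eB := sq B hB
  have eC := sq C hC
  have pos : ∀ z w : ℂ, z ≠ w → 0 < (w.re - z.re) ^ 2 + (w.im - z.im) ^ 2 := by
    intro z w hzw
    by_contra hn
    exact hzw (Complex.ext (by nlinarith [sq_nonneg (w.re - z.re), sq_nonneg (w.im - z.im)])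
      (by nlinarith [sq_nonneg (w.re - z.re), sq_nonneg (w.im - z.im)]))
  have pu := pos A B h1
  have pv := pos A C h2
  have pw := pos B C h3
  unfold ori at h0
  obtain ⟨a1, ha1⟩ : ∃ x, x = A.re - P.re := ⟨_, rfl⟩
  obtain ⟨a2, ha2⟩ : ∃ x, x = A.im - P.im := ⟨_, rfl⟩
  obtain ⟨u1, hu1⟩ : ∃ x, x = B.re - A.re := ⟨_, rfl⟩
  obtain ⟨u2, hu2⟩ : ∃ x, x = B.im - A.im := ⟨_, rfl⟩
  obtain ⟨v1, hv1⟩ : ∃ x, x = C.re - A.re := ⟨_, rfl⟩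
  obtain ⟨v2, hv2⟩ : ∃ x, x = C.im - A.im := ⟨_, rfl⟩
  have q1 : u1 ^ 2 + u2 ^ 2 + 2 * (u1 * a1 + u2 * a2) = 0 := by
    subst_vars; linear_combination eB - eA
  have q2 : v1 ^ 2 + v2 ^ 2 + 2 * (v1 * a1 + v2 * a2) = 0 := by
    subst_vars; linear_combination eC - eA
  rw [← hu1, ← hu2, ← hv1, ← hv2] at h0
  rw [← hu1, ← hu2] at pu
  rw [← hv1, ← hv2] at pv
  have k1 : (u1 ^ 2 + u2 ^ 2) * ((v1 ^ 2 + v2 ^ 2) - (u1 * v1 + u2 * v2)) = 0 := by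
    linear_combination (u1 ^ 2 + u2 ^ 2) * q2 - (u1 * v1 + u2 * v2) * q1 +
      2 * (u2 * a1 - u1 * a2) * h0
  have k2 : (v1 ^ 2 + v2 ^ 2) * ((u1 ^ 2 + u2 ^ 2) - (u1 * v1 + u2 * v2)) = 0 := by
    linear_combination (v1 ^ 2 + v2 ^ 2) * q1 - (u1 * v1 + u2 * v2) * q2 -
      2 * (v2 * a1 - v1 * a2) * h0
  have k1 := (mul_eq_zero.1 k1).resolve_left pu.ne'
  have k2 := (mul_eq_zero.1 k2).resolve_left pv.ne'
  have : (C.re - B.re) ^ 2 + (C.im - B.im) ^ 2 = 0 := by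
    subst_vars; linear_combination k1 + k2
  exact pw.ne' this

lemma ori_seg {A B x y z : ℂ} (hz : z ∈ segment ℝ x y) :
    ∃ s t : ℝ, 0 ≤ s ∧ 0 ≤ t ∧ s + t = 1 ∧ ori A B z = s * ori A B x + t * ori A B y ∧
      z = s • x + t • y := by
  obtain ⟨s, t, hs, ht, hst, rfl⟩ := hz
  refine ⟨s, t, hs, ht, hst, ?_, rfl⟩
  have : s = 1 - t := by linarith
  subst this
  simp [ori]; ring

lemma ori_left (A B : ℂ) : ori A B A = 0 := by simp [ori]
lemma ori_right (A B : ℂ) : ori A B B = 0 := by simp [ori]; ring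

lemma ori_seg0 {A B z : ℂ} (hz : z ∈ segment ℝ A B) : ori A B z = 0 := by
  obtain ⟨s, t, -, -, -, h, -⟩ := ori_seg (A := A) (B := B) hz
  rw [h, ori_left, ori_right]; ring

/-- Points of a circle are not inside chords. -/
lemma not_chord {P A B C : ℂ} {r : ℝ} (hA : dist A P = r) (hB : dist B P = r) (hC : dist C P = r)
    (h1 : A ≠ B) (h2 : A ≠ C) (h3 : B ≠ C) : C ∉ segment ℝ A B :=
  fun h => ori_ne hA hB hC h1 h2 h3 (ori_seg0 h)

/-- Two crossing chords: the sides are disjoint from the opposite parts. -/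
lemma chords {P A B A' B' O : ℂ} {r : ℝ} (hA : dist A P = r) (hB : dist B P = r)
    (hA' : dist A' P = r) (hB' : dist B' P = r) (n1 : A ≠ B) (n2 : A ≠ A') (n3 : A ≠ B')
    (n4 : B ≠ A') (n5 : B ≠ B') (h1 : O ∈ segment ℝ A A') (h2 : O ∈ segment ℝ B B') :
    Disjoint (segment ℝ A B) (segment ℝ A' B') ∧ Disjoint (segment ℝ A B) (segment ℝ O A') ∧
      Disjoint (segment ℝ A B) (segment ℝ O B') := by
  have fa := ori_ne hA hB hA' n1 n2 n4
  have fb := ori_ne hA hB hB' n1 n3 n5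
  have OA : O ≠ A := fun e => not_chord hB hB' hA n5 n1.symm n3.symm (e ▸ h2)
  have OB : O ≠ B := fun e => not_chord hA hA' hB n2 n1 n4.symm (e ▸ h1)
  obtain ⟨s, t, s0, t0, st, e, eO⟩ := ori_seg (A := A) (B := B) h1
  obtain ⟨s', t', s0', t0', st', e', eO'⟩ := ori_seg (A := A) (B := B) h2
  rw [ori_left, mul_zero, zero_add] at e
  rw [ori_right, mul_zero, zero_add] at e'
  have tp : 0 < t := by
    refine lt_of_le_of_ne t0 fun h => OA ?_
    have : s = 1 := by linarith
    rw [eO, ← h, this]; simp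
  have tp' : 0 < t' := by
    refine lt_of_le_of_ne t0' fun h => OB ?_
    have : s' = 1 := by linarith
    rw [eO', ← h, this]; simp
  have key : ∀ x y, 0 < ori A B x * ori A B y → Disjoint (segment ℝ A B) (segment ℝ x y) := by
    intro x y hxy
    rw [Set.disjoint_left]
    intro z hz hz'
    have z0 := ori_seg0 hz
    obtain ⟨α, β, a0, b0, ab, e, -⟩ := ori_seg (A := A) (B := B) hz'
    rw [z0] at e
    have hx : ori A B x ≠ 0 := fun h => by rw [h] at hxy; simp at hxy
    have hx2 : 0 < ori A B x ^ 2 := by positivity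
    have : α * ori A B x ^ 2 + β * (ori A B x * ori A B y) = 0 := by
      linear_combination (-ori A B x) * e
    have i1 := mul_nonneg a0 hx2.le
    have i2 := mul_nonneg b0 hxy.le
    have j1 : α = 0 := (mul_eq_zero.1 (by linarith : α * ori A B x ^ 2 = 0)).resolve_right hx2.ne'
    have j2 : β = 0 :=
      (mul_eq_zero.1 (by linarith : β * (ori A B x * ori A B y) = 0)).resolve_right hxy.ne'
    linarith
  have pa : 0 < ori A B A' ^ 2 := by positivity
  have pb : 0 < ori A B B' ^ 2 := by positivity
  refine ⟨key _ _ ?_, key _ _ ?_, key _ _ ?_⟩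
  · have : t * (ori A B A' * ori A B B') = t' * ori A B B' ^ 2 := by
      linear_combination (-ori A B B') * e + ori A B B' * e'
    exact pos_of_mul_pos_right (this ▸ mul_pos tp' pb) tp.le
  · rw [e, mul_assoc, ← sq]; exact mul_pos tp pa
  · rw [e', mul_assoc, ← sq]; exact mul_pos tp' pb

/-- The tail of a path after its last visit of a closed disc. -/
lemma tail {S : Set ℂ} {P Q : ℂ} {r : ℝ} (hS : JoinedIn S P Q) (hr : 0 < r) (hQ : r < dist Q P) :
    ∃ (T : Set ℂ) (A : ℂ), T ⊆ S ∧ IsCompact T ∧ dist A P = r ∧ JoinedIn T A Q ∧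
      ∀ z ∈ T, dist z P ≤ r → z = A := by
  obtain ⟨γ, hγ⟩ := hS
  let g : ℝ → ℂ := γ.extend
  have hg : Continuous g := γ.continuous_extend
  have g0 : g 0 = P := by simp [g]
  have g1 : g 1 = Q := by simp [g]
  have gS : ∀ t, g t ∈ S := fun t => hγ _
  let K : Set ℝ := Icc 0 1 ∩ {t | dist (g t) P ≤ r}
  have hK : IsCompact K := isCompact_Icc.inter_right
    (isClosed_le (by fun_prop) continuous_const)
  obtain ⟨t₀, ht₀, hmax⟩ := hK.exists_isGreatest ⟨0, by simp, by simp [g0, hr.le]⟩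
  have hmax' : ∀ t, t ∈ K → t ≤ t₀ := fun t ht => hmax ht
  have e : dist (g t₀) P = r := by
    obtain ⟨t, ht, e⟩ := intermediate_value_Icc ht₀.1.2
      (f := fun t => dist (g t) P) (by fun_prop) (show r ∈ Icc _ _ from
        ⟨ht₀.2, by rw [g1]; exact hQ.le⟩)
    have : t ≤ t₀ := hmax' t ⟨⟨ht₀.1.1.trans ht.1, ht.2⟩, le_of_eq e⟩
    rw [le_antisymm ht.1 this]; exact e
  refine ⟨g '' Icc t₀ 1, g t₀, ?_, isCompact_Icc.image hg, e, ?_, ?_⟩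
  · rintro _ ⟨t, -, rfl⟩; exact gS t
  · rw [← g1]
    have hc : IsPathConnected (g '' Icc t₀ 1) :=
      ((convex_Icc t₀ 1).isPathConnected ⟨t₀, by simp [ht₀.1.2]⟩).image hg
    exact hc.joinedIn _ ⟨t₀, by simp [ht₀.1.2], rfl⟩ _ ⟨1, by simp [ht₀.1.2], rfl⟩
  · rintro _ ⟨t, ht, rfl⟩ hd
    rw [le_antisymm (hmax' t ⟨⟨ht₀.1.1.trans ht.1, ht.2⟩, hd⟩) ht.1]

end CN
end PartK3

open Set
noncomputable section PartK4
namespace CN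
variable {W : Type} {E : W → W → Set ℂ → Prop} {pos : W → ℂ}

/-- Local picture around a vertex `p` of degree four. -/
structure Loc (E : W → W → Set ℂ → Prop) (pos : W → ℂ) (p : W) (n : Fin 4 → W)
    (S : Fin 4 → Set ℂ) (ε : ℝ) (T : Fin 4 → Set ℂ) (A : Fin 4 → ℂ) : Prop where
  h : Drw E pos
  ninj : Function.Injective n
  np : ∀ i, n i ≠ p
  ES : ∀ i, E p (n i) (S i)
  e0 : 0 < ε
  TS : ∀ i, T i ⊆ S i
  Tc : ∀ i, IsCompact (T i)
  Ad : ∀ i, dist (A i) (pos p) = ε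
  TJ : ∀ i, JoinedIn (T i) (A i) (pos (n i))
  Tb : ∀ i, ∀ z ∈ T i, dist z (pos p) ≤ ε → z = A i
  Td : ∀ i j, i ≠ j → Disjoint (T i) (T j)
  far : ∀ w, w ≠ p → ε < dist (pos w) (pos p)
  farE : ∀ u v X z, E u v X → u ≠ p → v ≠ p → z ∈ X → ε < dist z (pos p)

lemma Drw.exists_loc [Finite W] (h : Drw E pos) {p : W} {n : Fin 4 → W} {S : Fin 4 → Set ℂ}
    (ninj : Function.Injective n) (np : ∀ i, n i ≠ p) (ES : ∀ i, E p (n i) (S i))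
    (hS : ∀ i j, i ≠ j → ∀ z ∈ S i, z ∈ S j → z = pos p) :
    ∃ ε T A, Loc E pos p n S ε T A := by
  have hF : ({X | ∃ u v, E u v X ∧ u ≠ p ∧ v ≠ p} : Set (Set ℂ)).Finite :=
    h.fin.subset (by rintro X ⟨u, v, hE, -⟩; exact ⟨u, v, hE⟩)
  have c1 : IsClosed (⋃ X ∈ {X | ∃ u v, E u v X ∧ u ≠ p ∧ v ≠ p}, X) :=
    hF.isClosed_biUnion (by rintro X ⟨u, v, hE, -⟩; exact (h.cpt _ _ _ hE).isClosed)
  have c2 : IsClosed (pos '' {w | w ≠ p}) := (Set.toFinite _).isClosed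
  have hU := (c1.union c2).isOpen_compl.mem_nhds (x := pos p) (by
    rintro (hm | ⟨w, hw, e⟩)
    · simp only [Set.mem_iUnion] at hm
      obtain ⟨X, ⟨u, v, hE, hu, hv⟩, hm⟩ := hm
      rcases h.pt _ _ _ _ hE hm with rfl | rfl
      · exact hu rfl
      · exact hv rfl
    · exact hw (h.inj e))
  obtain ⟨ε, e0, hε⟩ := Metric.nhds_basis_closedBall.mem_iff.1 hU
  have far : ∀ w, w ≠ p → ε < dist (pos w) (pos p) := by
    intro w hw
    by_contra hn
    exact hε (Metric.mem_closedBall.2 (not_lt.1 hn)) (Or.inr ⟨w, hw, rfl⟩)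
  have farE : ∀ u v X z, E u v X → u ≠ p → v ≠ p → z ∈ X → ε < dist z (pos p) := by
    intro u v X z hE hu hv hz
    by_contra hn
    refine hε (Metric.mem_closedBall.2 (not_lt.1 hn)) (Or.inl ?_)
    simp only [Set.mem_iUnion]
    exact ⟨X, ⟨u, v, hE, hu, hv⟩, hz⟩
  choose T A TS Tc Ad TJ Tb using fun i => tail (h.jn _ _ _ (ES i)) e0 (far _ (np i))
  refine ⟨ε, T, A, h, ninj, np, ES, e0, TS, Tc, Ad, TJ, Tb, ?_, far, farE⟩
  intro i j hij
  rw [Set.disjoint_left]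
  intro z hi hj
  have e := hS i j hij z (TS i hi) (TS j hj)
  have := Tb i z hi (by rw [e, dist_self]; exact e0.le)
  have h2 := Ad i
  rw [← this, e, dist_self] at h2
  exact e0.ne h2

/-- Replacing the star at `p` by another drawing inside the disc. -/
def RE (E : W → W → Set ℂ → Prop) (p : W) {κ : Type} (e1 e2 : κ → W) (X : κ → Set ℂ)
    (u v : W) (Y : Set ℂ) : Prop :=
  (E u v Y ∧ u ≠ p ∧ v ≠ p) ∨ ∃ k, Y = X k ∧ (u = e1 k ∧ v = e2 k ∨ u = e2 k ∧ v = e1 k)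

lemma Loc.gadget {p : W} {n : Fin 4 → W} {S : Fin 4 → Set ℂ} {ε : ℝ} {T : Fin 4 → Set ℂ}
    {A : Fin 4 → ℂ} (l : Loc E pos p n S ε T A) [DecidableEq W] {κ : Type} [Finite κ]
    (e1 e2 : κ → W)
    (C : κ → Set ℂ) (I : κ → Set (Fin 4)) (O : ℂ) (hO : dist O (pos p) ≤ ε)
    (hI : ∀ k, ∀ i ∈ I k, n i = e1 k ∨ n i = e2 k) (hA : ∀ k, ∀ i ∈ I k, A i ∈ C k)
    (hC : ∀ k, ∀ z ∈ C k, dist z (pos p) ≤ ε) (hCc : ∀ k, IsCompact (C k))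
    (hJ : ∀ k, JoinedIn (C k ∪ ⋃ i ∈ I k, T i) (Function.update pos p O (e1 k))
      (Function.update pos p O (e2 k)))
    (hd : ∀ k j, e1 k ≠ e1 j → e1 k ≠ e2 j → e2 k ≠ e1 j → e2 k ≠ e2 j → Disjoint (C k) (C j))
    (hOC : ∀ k, O ∈ C k → p = e1 k ∨ p = e2 k) (hOA : ∀ i, O ≠ A i) :
    Drw (RE E p e1 e2 (fun k => C k ∪ ⋃ i ∈ I k, T i)) (Function.update pos p O) := by
  have up : Function.update pos p O p = O := Function.update_self ..
  have un : ∀ w, w ≠ p → Function.update pos p O w = pos w := fun w hw =>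
    Function.update_of_ne hw ..
  have mem : ∀ k z, z ∈ (C k ∪ ⋃ i ∈ I k, T i) → z ∈ C k ∨ ∃ i ∈ I k, z ∈ T i := by
    intro k z hz
    simpa only [Set.mem_union, Set.mem_iUnion, exists_prop] using hz
  -- old against new
  have on : ∀ u v Y, E u v Y → u ≠ p → v ≠ p → ∀ k, u ≠ e1 k → u ≠ e2 k → v ≠ e1 k → v ≠ e2 k →
      Disjoint Y (C k ∪ ⋃ i ∈ I k, T i) := by
    intro u v Y hE hu hv k h1 h2 h3 h4
    rw [Set.disjoint_left]
    intro z hz hz'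
    rcases mem k z hz' with hz' | ⟨i, hi, hz'⟩
    · exact absurd (hC k z hz') (not_le.2 (l.farE u v Y z hE hu hv hz))
    · refine Set.disjoint_left.1 (l.h.dj _ _ _ _ _ _ hE (l.ES i) hu ?_ hv ?_) hz (l.TS i hz')
      · rcases hI k i hi with e | e <;> rw [e] <;> assumption
      · rcases hI k i hi with e | e <;> rw [e] <;> assumption
  have CT : ∀ k j, Disjoint (C k) (C j) → ∀ z ∈ C k, ∀ i ∈ I j, z ∉ T i := by
    intro k j hkj z hz i hi hz'
    have := l.Tb i z hz' (hC k z hz)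
    exact Set.disjoint_left.1 hkj hz (this ▸ hA j i hi)
  have nn : ∀ k j, e1 k ≠ e1 j → e1 k ≠ e2 j → e2 k ≠ e1 j → e2 k ≠ e2 j →
      Disjoint (C k ∪ ⋃ i ∈ I k, T i) (C j ∪ ⋃ i ∈ I j, T i) := by
    intro k j h1 h2 h3 h4
    have hkj := hd k j h1 h2 h3 h4
    rw [Set.disjoint_left]
    intro z hz hz'
    rcases mem k z hz with hz | ⟨i, hi, hz⟩ <;> rcases mem j z hz' with hz' | ⟨i', hi', hz'⟩
    · exact Set.disjoint_left.1 hkj hz hz'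
    · exact CT k j hkj z hz i' hi' hz'
    · exact CT j k hkj.symm z hz' i hi hz
    · refine Set.disjoint_left.1 (l.Td i i' ?_) hz hz'
      rintro rfl
      rcases hI k i hi with e | e <;> rcases hI j i hi' with e' | e'
      · exact h1 (e.symm.trans e')
      · exact h2 (e.symm.trans e')
      · exact h3 (e.symm.trans e')
      · exact h4 (e.symm.trans e')
  refine ⟨?_, ?_, ?_, ?_, ?_, ?_, ?_⟩
  · intro u v e
    by_cases hu : u = p <;> by_cases hv : v = p
    · rw [hu, hv]
    · rw [hu, up, un v hv] at e
      exact absurd hO (not_le.2 (e ▸ l.far v hv))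
    · rw [hv, up, un u hu] at e
      exact absurd hO (not_le.2 (e ▸ l.far u hu))
    · rw [un u hu, un v hv] at e
      exact l.h.inj e
  · rintro u v Y (⟨hE, hu, hv⟩ | ⟨k, rfl, h⟩)
    · exact Or.inl ⟨l.h.sym _ _ _ hE, hv, hu⟩
    · exact Or.inr ⟨k, rfl, by tauto⟩
  · rintro u v Y (⟨hE, hu, hv⟩ | ⟨k, rfl, ⟨rfl, rfl⟩ | ⟨rfl, rfl⟩⟩)
    · rw [un u hu, un v hv]; exact l.h.jn _ _ _ hE
    · exact hJ k
    · exact (hJ k).symm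
  · rintro u v Y (⟨hE, hu, hv⟩ | ⟨k, rfl, -⟩)
    · exact l.h.cpt _ _ _ hE
    · exact (hCc k).union ((Set.toFinite _).isCompact_biUnion fun i _ => l.Tc i)
  · rintro u v Y x y Z (⟨hE, hu, hv⟩ | ⟨k, rfl, hk⟩) (⟨hE', hx, hy⟩ | ⟨j, rfl, hj⟩) h1 h2 h3 h4
    · exact l.h.dj _ _ _ _ _ _ hE hE' h1 h2 h3 h4
    · rcases hj with ⟨rfl, rfl⟩ | ⟨rfl, rfl⟩
      · exact on _ _ _ hE hu hv j h1 h2 h3 h4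
      · exact on _ _ _ hE hu hv j h2 h1 h4 h3
    · rcases hk with ⟨rfl, rfl⟩ | ⟨rfl, rfl⟩
      · exact (on _ _ _ hE' hx hy k h1.symm h3.symm h2.symm h4.symm).symm
      · exact (on _ _ _ hE' hx hy k h3.symm h1.symm h4.symm h2.symm).symm
    · rcases hk with ⟨rfl, rfl⟩ | ⟨rfl, rfl⟩ <;> rcases hj with ⟨rfl, rfl⟩ | ⟨rfl, rfl⟩
      · exact nn k j h1 h2 h3 h4
      · exact nn k j h2 h1 h4 h3
      · exact nn k j h3 h4 h1 h2
      · exact nn k j h4 h3 h2 h1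
  · rintro u v Y w (⟨hE, hu, hv⟩ | ⟨k, rfl, hk⟩) hw
    · by_cases hwp : w = p
      · rw [hwp, up] at hw
        exact absurd hO (not_le.2 (l.farE _ _ _ _ hE hu hv hw))
      · rw [un w hwp] at hw
        exact l.h.pt _ _ _ _ hE hw
    · have : w = e1 k ∨ w = e2 k := by
        by_cases hwp : w = p
        · rw [hwp, up] at hw
          rcases mem k _ hw with hw | ⟨i, hi, hw⟩
          · rw [hwp]; exact hOC k hw
          · exact absurd (l.Tb i _ hw hO) (hOA i)
        · rw [un w hwp] at hw
          rcases mem k _ hw with hw | ⟨i, hi, hw⟩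
          · exact absurd (hC k _ hw) (not_le.2 (l.far w hwp))
          · rw [(l.h.pt _ _ _ _ (l.ES i) (l.TS i hw)).resolve_left hwp]
            exact hI k i hi
      rcases hk with ⟨rfl, rfl⟩ | ⟨rfl, rfl⟩
      · exact this
      · exact this.symm
  · refine (l.h.fin.union (Set.finite_range fun k => C k ∪ ⋃ i ∈ I k, T i)).subset ?_
    rintro Y ⟨u, v, ⟨hE, -⟩ | ⟨k, rfl, -⟩⟩
    · exact Or.inl ⟨u, v, hE⟩
    · exact Or.inr ⟨k, rfl⟩

end CN
end PartK4

open Set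
noncomputable section PartK5
namespace CN
variable {W : Type} {E : W → W → Set ℂ → Prop} {pos : W → ℂ}

lemma seg_compact (x y : ℂ) : IsCompact (segment ℝ x y) := by
  rw [segment_eq_image_lineMap]
  exact isCompact_Icc.image (by fun_prop)

lemma seg_joined {X : Set ℂ} {x y : ℂ} (h : segment ℝ x y ⊆ X) : JoinedIn X x y :=
  (JoinedIn.of_segment_subset h)

/-- Result of resolving the vertex `p`. -/
structure Resd (E E' : W → W → Set ℂ → Prop) (pos pos' : W → ℂ) (p : W) (n : Fin 4 → W) :
    Prop where
  h : Drw E' pos'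
  hpos : ∀ w, w ≠ p → pos' w = pos w
  keep : ∀ u v X, u ≠ p → v ≠ p → E u v X → E' u v X
  new : ∀ u v X, E' u v X → (E u v X ∧ u ≠ p ∧ v ≠ p) ∨
    ((u = p ∨ ∃ i, u = n i) ∧ (v = p ∨ ∃ i, v = n i))
  res : ((∃ X, E' (n 0) (n 2) X) ∧ (∃ X, E' (n 1) (n 3) X) ∧ ∀ v X, ¬ E' p v X) ∨
    Cross (gr E') p (n 0) (n 1) (n 2) (n 3)

lemma Loc.Ainj {p : W} {n : Fin 4 → W} {S : Fin 4 → Set ℂ} {ε : ℝ} {T : Fin 4 → Set ℂ}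
    {A : Fin 4 → ℂ} (l : Loc E pos p n S ε T A) : Function.Injective A := by
  intro i j e
  by_contra hij
  exact Set.disjoint_left.1 (l.Td i j hij) (l.TJ i).source_mem (e ▸ (l.TJ j).source_mem)

lemma Loc.segball {p : W} {n : Fin 4 → W} {S : Fin 4 → Set ℂ} {ε : ℝ} {T : Fin 4 → Set ℂ}
    {A : Fin 4 → ℂ} (_ : Loc E pos p n S ε T A) {x y z : ℂ} (hx : dist x (pos p) ≤ ε)
    (hy : dist y (pos p) ≤ ε) (hz : z ∈ segment ℝ x y) : dist z (pos p) ≤ ε :=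
  (convex_closedBall (pos p) ε).segment_subset hx hy hz

lemma Loc.Jn {p : W} {n : Fin 4 → W} {S : Fin 4 → Set ℂ} {ε : ℝ} {T : Fin 4 → Set ℂ}
    {A : Fin 4 → ℂ} (l : Loc E pos p n S ε T A) (i j : Fin 4) (I : Set (Fin 4)) (hi : i ∈ I)
    (hj : j ∈ I) :
    JoinedIn (segment ℝ (A i) (A j) ∪ ⋃ i ∈ I, T i) (pos (n i)) (pos (n j)) := by
  have t : ∀ k ∈ I, T k ⊆ segment ℝ (A i) (A j) ∪ ⋃ i ∈ I, T i := fun k hk =>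
    (Set.subset_biUnion_of_mem hk).trans subset_union_right
  exact (((l.TJ i).mono (t i hi)).symm.trans (seg_joined subset_union_left)).trans
    ((l.TJ j).mono (t j hj))

lemma Loc.non {p : W} {n : Fin 4 → W} {S : Fin 4 → Set ℂ} {ε : ℝ} {T : Fin 4 → Set ℂ}
    {A : Fin 4 → ℂ} (l : Loc E pos p n S ε T A)
    (hd : Disjoint (segment ℝ (A 0) (A 2)) (segment ℝ (A 1) (A 3))) :
    ∃ E' pos', Resd E E' pos pos' p n := by
  classical
  have Ai := l.Ainj
  obtain ⟨O, hO, hOA⟩ : ∃ O, dist O (pos p) = ε ∧ ∀ i, O ≠ A i := by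
    have : (Metric.sphere (pos p) ε).Infinite := by
      refine (isPreconnected_sphere (by rw [Complex.rank_real_complex]; norm_num)
        (pos p) ε).infinite_of_nontrivial ⟨A 0, l.Ad 0, A 1, l.Ad 1, Ai.ne (by decide)⟩
    obtain ⟨O, hO, hn⟩ := (this.sdiff (Set.finite_range A)).nonempty
    exact ⟨O, hO, fun i e => hn ⟨i, e.symm⟩⟩
  let e1 : Fin 2 → W := ![n 0, n 1]
  let e2 : Fin 2 → W := ![n 2, n 3]
  let C : Fin 2 → Set ℂ := ![segment ℝ (A 0) (A 2), segment ℝ (A 1) (A 3)]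
  let I : Fin 2 → Set (Fin 4) := ![{0, 2}, {1, 3}]
  have un : ∀ i, Function.update pos p O (n i) = pos (n i) := fun i =>
    Function.update_of_ne (l.np i) ..
  have D : Drw (RE E p e1 e2 (fun k => C k ∪ ⋃ i ∈ I k, T i)) (Function.update pos p O) := by
    refine l.gadget e1 e2 C I O hO.le ?_ ?_ ?_ ?_ ?_ ?_ ?_ hOA
    · rw [Fin.forall_fin_two]
      simp [e1, e2, I]
    · rw [Fin.forall_fin_two]
      simp [C, I, left_mem_segment, right_mem_segment]
    · rw [Fin.forall_fin_two]
      exact ⟨fun z hz => l.segball (l.Ad _).le (l.Ad _).le hz,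
        fun z hz => l.segball (l.Ad _).le (l.Ad _).le hz⟩
    · rw [Fin.forall_fin_two]
      exact ⟨seg_compact _ _, seg_compact _ _⟩
    · rw [Fin.forall_fin_two]
      refine ⟨?_, ?_⟩
      · change JoinedIn _ (Function.update pos p O (n 0)) (Function.update pos p O (n 2))
        rw [un, un]; exact l.Jn 0 2 _ (by simp [I]) (by simp [I])
      · change JoinedIn _ (Function.update pos p O (n 1)) (Function.update pos p O (n 3))
        rw [un, un]; exact l.Jn 1 3 _ (by simp [I]) (by simp [I])
    · rw [Fin.forall_fin_two]
      refine ⟨?_, ?_⟩ <;> rw [Fin.forall_fin_two] <;> refine ⟨?_, ?_⟩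
      · intro h; exact absurd rfl h
      · intros; exact hd
      · intros; exact hd.symm
      · intro h; exact absurd rfl h
    · rw [Fin.forall_fin_two]
      exact ⟨fun h => absurd h (not_chord (l.Ad _) (l.Ad _) hO (Ai.ne (by decide)) (hOA _).symm
        (hOA _).symm), fun h => absurd h (not_chord (l.Ad _) (l.Ad _) hO (Ai.ne (by decide))
        (hOA _).symm (hOA _).symm)⟩
  refine ⟨_, _, D, fun w hw => Function.update_of_ne hw .., ?_, ?_, Or.inl ⟨?_, ?_, ?_⟩⟩
  · intro u v X hu hv hE; exact Or.inl ⟨hE, hu, hv⟩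
  · rintro u v X (h | ⟨k, -, h⟩)
    · exact Or.inl h
    · have h1 : ∀ k, ∃ i, e1 k = n i := by rw [Fin.forall_fin_two]; exact ⟨⟨0, rfl⟩, ⟨1, rfl⟩⟩
      have h2 : ∀ k, ∃ i, e2 k = n i := by rw [Fin.forall_fin_two]; exact ⟨⟨2, rfl⟩, ⟨3, rfl⟩⟩
      rcases h with ⟨rfl, rfl⟩ | ⟨rfl, rfl⟩
      · exact Or.inr ⟨Or.inr (h1 k), Or.inr (h2 k)⟩
      · exact Or.inr ⟨Or.inr (h2 k), Or.inr (h1 k)⟩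
  · exact ⟨_, Or.inr ⟨0, rfl, Or.inl ⟨rfl, rfl⟩⟩⟩
  · exact ⟨_, Or.inr ⟨1, rfl, Or.inl ⟨rfl, rfl⟩⟩⟩
  · rintro v X (⟨-, h, -⟩ | ⟨k, -, h⟩)
    · exact h rfl
    · have h1 : ∀ k, p ≠ e1 k := by
        rw [Fin.forall_fin_two]; exact ⟨(l.np 0).symm, (l.np 1).symm⟩
      have h2 : ∀ k, p ≠ e2 k := by
        rw [Fin.forall_fin_two]; exact ⟨(l.np 2).symm, (l.np 3).symm⟩
      rcases h with ⟨h, -⟩ | ⟨h, -⟩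
      · exact h1 k h
      · exact h2 k h

lemma Loc.alt {p : W} {n : Fin 4 → W} {S : Fin 4 → Set ℂ} {ε : ℝ} {T : Fin 4 → Set ℂ}
    {A : Fin 4 → ℂ} (l : Loc E pos p n S ε T A) {O : ℂ}
    (hO1 : O ∈ segment ℝ (A 0) (A 2)) (hO2 : O ∈ segment ℝ (A 1) (A 3)) :
    ∃ E' pos', Resd E E' pos pos' p n := by
  classical
  have Ai := l.Ainj
  have hO : dist O (pos p) ≤ ε := l.segball (l.Ad _).le (l.Ad _).le hO1
  have hm : ∀ j : Fin 4, O ∈ segment ℝ (A j) (A (j + 2)) := by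
    intro j
    fin_cases j
    · exact hO1
    · exact hO2
    · rw [segment_symm]; exact hO1
    · rw [segment_symm]; exact hO2
  have ch : ∀ j, Disjoint (segment ℝ (A j) (A (j + 1))) (segment ℝ (A (j + 2)) (A (j + 3))) ∧
      Disjoint (segment ℝ (A j) (A (j + 1))) (segment ℝ O (A (j + 2))) ∧
      Disjoint (segment ℝ (A j) (A (j + 1))) (segment ℝ O (A (j + 3))) := by
    intro j
    have h1 := hm (j + 1)
    have e : j + 1 + 2 = j + 3 := by rw [add_assoc]; rfl
    rw [e] at h1
    exact chords (l.Ad _) (l.Ad _) (l.Ad _) (l.Ad _) (Ai.ne (by clear h1; revert j; decide))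
      (Ai.ne (by clear h1; revert j; decide)) (Ai.ne (by clear h1; revert j; decide)) (Ai.ne (by clear h1; revert j; decide))
      (Ai.ne (by clear h1; revert j; decide)) (hm j) h1
  have hOA : ∀ i, O ≠ A i := by
    intro i e
    have := (ch i).2.1
    exact Set.disjoint_left.1 this (e ▸ left_mem_segment ℝ _ _) (left_mem_segment ℝ _ _)
  have sr : ∀ i j : Fin 4, i ≠ j → i ≠ j + 1 →
      Disjoint (segment ℝ (A j) (A (j + 1))) (segment ℝ O (A i)) := by
    intro i j h1 h2
    have : i = j + 2 ∨ i = j + 3 := by revert i j; decide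
    rcases this with rfl | rfl
    · exact (ch j).2.1
    · exact (ch j).2.2
  let e1 : Fin 4 ⊕ Fin 4 → W := Sum.elim (fun _ => p) n
  let e2 : Fin 4 ⊕ Fin 4 → W := Sum.elim n (fun i => n (i + 1))
  let C : Fin 4 ⊕ Fin 4 → Set ℂ := Sum.elim (fun i => segment ℝ O (A i))
    (fun i => segment ℝ (A i) (A (i + 1)))
  let I : Fin 4 ⊕ Fin 4 → Set (Fin 4) := Sum.elim (fun i => {i}) (fun i => {i, i + 1})
  have un : ∀ i, Function.update pos p O (n i) = pos (n i) := fun i =>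
    Function.update_of_ne (l.np i) ..
  have up : Function.update pos p O p = O := Function.update_self ..
  have D : Drw (RE E p e1 e2 (fun k => C k ∪ ⋃ i ∈ I k, T i)) (Function.update pos p O) := by
    refine l.gadget e1 e2 C I O hO ?_ ?_ ?_ ?_ ?_ ?_ ?_ hOA
    · rintro (k | k)
      · rintro i rfl; exact Or.inr rfl
      · rintro i (rfl | rfl)
        · exact Or.inl rfl
        · exact Or.inr rfl
    · rintro (k | k)
      · rintro i rfl; exact right_mem_segment ℝ _ _
      · rintro i (rfl | rfl)
        · exact left_mem_segment ℝ _ _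
        · exact right_mem_segment ℝ _ _
    · rintro (k | k) z hz
      · exact l.segball hO (l.Ad _).le hz
      · exact l.segball (l.Ad _).le (l.Ad _).le hz
    · rintro (k | k)
      · exact seg_compact _ _
      · exact seg_compact _ _
    · rintro (k | k)
      · change JoinedIn _ (Function.update pos p O p) (Function.update pos p O (n k))
        rw [un, up]
        refine (seg_joined subset_union_left).trans ((l.TJ k).mono ?_)
        exact (Set.subset_biUnion_of_mem (u := T) (show k ∈ I (Sum.inl k) from rfl)).trans
          subset_union_right
      · change JoinedIn _ (Function.update pos p O (n k)) (Function.update pos p O (n (k + 1)))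
        rw [un, un]
        exact l.Jn k (k + 1) _ (Or.inl rfl) (Or.inr rfl)
    · rintro (k | k) (j | j) h1 h2 h3 h4
      · exact absurd rfl h1
      · exact (sr k j (fun e => h3 (congrArg n e)) (fun e => h4 (congrArg n e))).symm
      · exact sr j k (fun e => h2 (congrArg n e.symm)) (fun e => h4 (congrArg n e.symm))
      · have a1 : k ≠ j := fun e => h1 (congrArg n e)
        have a2 : k ≠ j + 1 := fun e => h2 (congrArg n e)
        have a3 : k + 1 ≠ j := fun e => h3 (congrArg n e)
        have : j = k + 2 ∧ j + 1 = k + 3 := by clear h1 h2 h3 h4; revert k j; decide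
        have hc := (ch k).1
        rw [← this.1, ← this.2] at hc
        exact hc
    · rintro (k | k) h
      · exact Or.inl rfl
      · exact absurd (left_mem_segment ℝ _ _) (Set.disjoint_left.1 (ch k).2.1 h)
  have ad : ∀ k, e1 k ≠ e2 k →
      (gr (RE E p e1 e2 (fun k => C k ∪ ⋃ i ∈ I k, T i))).Adj (e1 k) (e2 k) := fun k hk =>
    ⟨hk, _, Or.inl (Or.inr ⟨k, rfl, Or.inl ⟨rfl, rfl⟩⟩)⟩
  refine ⟨_, _, D, fun w hw => Function.update_of_ne hw .., ?_, ?_, Or.inr ⟨?_, ?_, ?_, ?_, ?_, ?_,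
    ?_, ?_, ?_, ?_, ?_⟩⟩
  · intro u v X hu hv hE; exact Or.inl ⟨hE, hu, hv⟩
  · have h1 : ∀ k, e1 k = p ∨ ∃ i, e1 k = n i := by
      rintro (k | k)
      · exact Or.inl rfl
      · exact Or.inr ⟨k, rfl⟩
    have h2 : ∀ k, e2 k = p ∨ ∃ i, e2 k = n i := by
      rintro (k | k)
      · exact Or.inr ⟨k, rfl⟩
      · exact Or.inr ⟨k + 1, rfl⟩
    rintro u v X (h | ⟨k, -, ⟨rfl, rfl⟩ | ⟨rfl, rfl⟩⟩)
    · exact Or.inl h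
    · exact Or.inr ⟨h1 k, h2 k⟩
    · exact Or.inr ⟨h2 k, h1 k⟩
  · intro v
    constructor
    · intro h
      obtain ⟨-, X, ⟨-, h, -⟩ | ⟨k | k, -, ⟨h1, h2⟩ | ⟨h1, h2⟩⟩⟩ := D.adj.1 h
      · exact absurd rfl h
      · have h2 : v = n k := h2
        subst h2
        fin_cases k <;> simp
      · exact absurd h1.symm (l.np k)
      · exact absurd h1.symm (l.np k)
      · exact absurd h1.symm (l.np _)
    · rintro (rfl | rfl | rfl | rfl)
      · exact ad (Sum.inl 0) (l.np 0).symm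
      · exact ad (Sum.inl 1) (l.np 1).symm
      · exact ad (Sum.inl 2) (l.np 2).symm
      · exact ad (Sum.inl 3) (l.np 3).symm
  · exact l.ninj.ne (by decide)
  · exact l.ninj.ne (by decide)
  · exact l.ninj.ne (by decide)
  · exact l.ninj.ne (by decide)
  · exact l.ninj.ne (by decide)
  · exact l.ninj.ne (by decide)
  · exact ad (Sum.inr 0) (l.ninj.ne (by decide))
  · exact ad (Sum.inr 1) (l.ninj.ne (by decide))
  · exact ad (Sum.inr 2) (l.ninj.ne (by decide))
  · exact ad (Sum.inr 3) (l.ninj.ne (by decide))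

theorem Drw.resolve [Finite W] (h : Drw E pos) {p : W} {n : Fin 4 → W} {S : Fin 4 → Set ℂ}
    (ninj : Function.Injective n) (np : ∀ i, n i ≠ p) (ES : ∀ i, E p (n i) (S i))
    (hS : ∀ i j, i ≠ j → ∀ z ∈ S i, z ∈ S j → z = pos p) :
    ∃ E' pos', Resd E E' pos pos' p n := by
  obtain ⟨ε, T, A, l⟩ := h.exists_loc ninj np ES hS
  by_cases hd : Disjoint (segment ℝ (A 0) (A 2)) (segment ℝ (A 1) (A 3))
  · exact l.non hd
  · obtain ⟨O, h1, h2⟩ := Set.not_disjoint_iff.1 hd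
    exact l.alt h1 h2

end CN
end PartK5

open Set
noncomputable section PartK6
namespace CN
variable {V : Type} {G : SimpleGraph V} (D : Drawing G)

/-- the plane as the complex plane -/
def cx (z : ℝ × ℝ) : ℂ := Complex.equivRealProdCLM.symm z

lemma cx_cont : Continuous cx := Complex.equivRealProdCLM.symm.continuous
lemma cx_inj : Function.Injective cx := Complex.equivRealProdCLM.symm.injective

/-- arcs in the complex plane -/
def gm {x y : V} (h : G.Adj x y) (t : unitInterval) : ℂ := cx (D.arc h t)

/-- vertices in the complex plane -/
def ps (v : V) : ℂ := cx (D.pos v)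

variable {u v x y : V}

lemma ps_inj : Function.Injective (ps D) := fun _ _ e => D.pos_inj (cx_inj e)
lemma gm_cont (h : G.Adj x y) : Continuous (gm D h) := cx_cont.comp (D.arc h).continuous
lemma gm_inj (h : G.Adj x y) : Function.Injective (gm D h) := fun _ _ e => D.arc_inj h (cx_inj e)
lemma gm_symm (h : G.Adj x y) (t : unitInterval) :
    gm D h.symm t = gm D h (unitInterval.symm t) := by
  unfold gm; rw [D.arc_symm]; rfl
lemma gm_zero (h : G.Adj x y) : gm D h 0 = ps D x := by simp [gm, ps]
lemma gm_one (h : G.Adj x y) : gm D h 1 = ps D y := by simp [gm, ps]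
lemma gm_vertex (h : G.Adj x y) {t : unitInterval} {w : V} (e : gm D h t = ps D w) :
    t = 0 ∨ t = 1 := D.arc_vertex h t w (cx_inj e)
lemma gm_once (h : G.Adj x y) (h' : G.Adj u v) (hne : s(x, y) ≠ s(u, v))
    {s s' t t' : unitInterval} (e : gm D h s = gm D h' s') (e' : gm D h t = gm D h' t') :
    gm D h s = gm D h t := by
  have := D.arc_meet_once h h' hne ⟨⟨s, rfl⟩, ⟨s', (cx_inj e).symm⟩⟩
    ⟨⟨t, rfl⟩, ⟨t', (cx_inj e').symm⟩⟩
  unfold gm; rw [this]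

lemma gm_triple {a b : V} (h : G.Adj x y) (h' : G.Adj u v) (h'' : G.Adj a b)
    (n1 : s(x, y) ≠ s(u, v)) (n2 : s(x, y) ≠ s(a, b)) (n3 : s(u, v) ≠ s(a, b))
    {s s' s'' : unitInterval} (e : gm D h s = gm D h' s') (e' : gm D h s = gm D h'' s'') :
    s = 0 ∨ s = 1 := by
  obtain ⟨w, hw⟩ := D.arc_no_triple h h' h'' n1 n2 n3 (D.arc h s)
    ⟨⟨⟨s, rfl⟩, ⟨s', (cx_inj e).symm⟩⟩, ⟨s'', (cx_inj e').symm⟩⟩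
  exact D.arc_vertex h s w hw

/-- crossing points -/
def Cr : Set ℂ := {z | ∃ (u v x y : V) (h₁ : G.Adj u v) (h₂ : G.Adj x y) (s t : unitInterval),
  s(u, v) ≠ s(x, y) ∧ gm D h₁ s = z ∧ gm D h₂ t = z ∧ s ≠ 0 ∧ s ≠ 1 ∧ t ≠ 0 ∧ t ≠ 1}

lemma Cr_sub {p q : ℝ × ℝ} (h : ∀ r, D.IsCrossing r → r = p ∨ r = q) {z : ℂ} (hz : z ∈ Cr D) :
    z = cx p ∨ z = cx q := by
  obtain ⟨u, v, x, y, h₁, h₂, s, t, hne, e1, e2, s0, s1, t0, t1⟩ := hz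
  have e : D.arc h₂ t = D.arc h₁ s := cx_inj (e2.trans e1.symm)
  have := h (D.arc h₁ s) ⟨u, v, x, y, h₁, h₂, hne, ⟨s, ⟨s0, s1⟩, rfl⟩, ⟨t, ⟨t0, t1⟩, e⟩⟩
  rw [← e1]
  unfold gm
  rcases this with h | h <;> rw [h] <;> simp

/-- positions of the vertices of the host -/
def hpos : V ⊕ Cr D → ℂ := Sum.elim (ps D) Subtype.val

lemma Cr_not_vertex (w : V) : ps D w ∉ Cr D := by
  rintro ⟨u, v, x, y, h₁, h₂, s, t, hne, e1, e2, s0, s1, t0, t1⟩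
  rcases gm_vertex D h₁ e1 with h | h
  · exact s0 h
  · exact s1 h

lemma hpos_inj : Function.Injective (hpos D) := by
  rintro (u | u) (v | v) e
  · exact congrArg _ (ps_inj D e)
  · exact absurd v.2 (by have : ps D u = v := e; rw [← this]; exact Cr_not_vertex D u)
  · exact absurd u.2 (by have : u = ps D v := e; rw [this]; exact Cr_not_vertex D v)
  · exact congrArg _ (Subtype.ext e)

/-- a segment of an edge between consecutive points of the host -/
def Sg (h : G.Adj x y) (u v : V ⊕ Cr D) (S : Set ℂ) : Prop :=
  ∃ s t, s < t ∧ gm D h s = hpos D u ∧ gm D h t = hpos D v ∧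
    (∀ r, s < r → r < t → gm D h r ∉ range (hpos D)) ∧ S = gm D h '' Icc s t

variable {D}

lemma Sg.flip {h : G.Adj x y} {u v : V ⊕ Cr D} {S : Set ℂ} (k : Sg D h u v S) :
    Sg D h.symm v u S := by
  obtain ⟨s, t, st, e1, e2, hr, rfl⟩ := k
  refine ⟨unitInterval.symm t, unitInterval.symm s, ?_, ?_, ?_, ?_, ?_⟩
  · simpa using st
  · rw [gm_symm]; simpa using e2
  · rw [gm_symm]; simpa using e1
  · intro r h1 h2
    rw [gm_symm]
    exact hr _ (by rw [← unitInterval.symm_lt_symm]; simpa using h2)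
      (by rw [← unitInterval.symm_lt_symm]; simpa using h1)
  · ext z
    constructor
    · rintro ⟨r, ⟨h1, h2⟩, rfl⟩
      exact ⟨unitInterval.symm r, ⟨by simpa using h2, by simpa using h1⟩,
        (gm_symm D h _).trans (by simp)⟩
    · rintro ⟨r, ⟨h1, h2⟩, rfl⟩
      refine ⟨unitInterval.symm r, ⟨?_, ?_⟩, (gm_symm D h r).symm⟩
      · rw [← unitInterval.symm_le_symm]; simpa using h2
      · rw [← unitInterval.symm_le_symm]; simpa using h1

lemma Sg.pt {h : G.Adj x y} {u v w : V ⊕ Cr D} {S : Set ℂ} (k : Sg D h u v S)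
    (hw : hpos D w ∈ S) : w = u ∨ w = v := by
  obtain ⟨s, t, st, e1, e2, hr, rfl⟩ := k
  obtain ⟨r, ⟨h1, h2⟩, e⟩ := hw
  rcases h1.eq_or_lt with rfl | h1
  · exact Or.inl (hpos_inj D (e.symm.trans e1))
  · rcases h2.eq_or_lt with rfl | h2
    · exact Or.inr (hpos_inj D (e.symm.trans e2))
    · exact absurd ⟨w, e.symm⟩ (hr r h1 h2)

lemma Sg.same {h : G.Adj x y} {u v u' v' : V ⊕ Cr D} {S T : Set ℂ} (k : Sg D h u v S)
    (k' : Sg D h u' v' T) (n1 : u ≠ u') (n2 : u ≠ v') (n3 : v ≠ u') (n4 : v ≠ v') :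
    Disjoint S T := by
  rw [Set.disjoint_left]
  intro z hz hz'
  have hN : z ∉ range (hpos D) := by
    rintro ⟨w, rfl⟩
    rcases k.pt hz with rfl | rfl <;> rcases k'.pt hz' with rfl | rfl <;> simp_all
  obtain ⟨s, t, st, e1, e2, hr, rfl⟩ := k
  obtain ⟨s', t', st', e1', e2', hr', rfl⟩ := k'
  obtain ⟨r, ⟨h1, h2⟩, rfl⟩ := hz
  obtain ⟨r', ⟨h1', h2'⟩, e⟩ := hz'
  obtain rfl := gm_inj D h e
  have h2 : r' < t := lt_of_le_of_ne h2 (by rintro rfl; exact hN ⟨_, e2.symm⟩)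
  have h2' : r' < t' := lt_of_le_of_ne h2' (by rintro rfl; exact hN ⟨_, e2'.symm⟩)
  have h1 : s < r' := lt_of_le_of_ne h1 (by rintro rfl; exact hN ⟨_, e1.symm⟩)
  have h1' : s' < r' := lt_of_le_of_ne h1' (by rintro rfl; exact hN ⟨_, e1'.symm⟩)
  rcases lt_trichotomy s s' with l | rfl | l
  · exact hr s' l (h1'.trans h2) ⟨_, e1'.symm⟩
  · exact n1 (hpos_inj D (e1.symm.trans e1'))
  · exact hr' s l (h1.trans h2') ⟨_, e1.symm⟩

/-- common points of different edges are points of the host -/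
lemma common {h : G.Adj x y} {h' : G.Adj u v} (hne : s(x, y) ≠ s(u, v)) {s t : unitInterval}
    (e : gm D h s = gm D h' t) : gm D h s ∈ range (hpos D) := by
  by_cases s0 : s = 0
  · rw [s0, gm_zero]; exact ⟨Sum.inl x, rfl⟩
  by_cases s1 : s = 1
  · rw [s1, gm_one]; exact ⟨Sum.inl y, rfl⟩
  by_cases t0 : t = 0
  · rw [e, t0, gm_zero]; exact ⟨Sum.inl u, rfl⟩
  by_cases t1 : t = 1
  · rw [e, t1, gm_one]; exact ⟨Sum.inl v, rfl⟩
  exact ⟨Sum.inr ⟨gm D h s, x, y, u, v, h, h', s, t, hne, rfl, e.symm, s0, s1, t0, t1⟩, rfl⟩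

variable (D) in
/-- drawn edges of the host -/
def HE (u v : V ⊕ Cr D) (S : Set ℂ) : Prop := ∃ (x y : V) (h : G.Adj x y), Sg D h u v S

theorem HE.drw [Finite V] (hC : (Cr D).Finite) : Drw (HE D) (hpos D) := by
  have := hC.to_subtype
  refine ⟨hpos_inj D, ?_, ?_, ?_, ?_, ?_, ?_⟩
  · rintro u v S ⟨x, y, h, k⟩; exact ⟨y, x, h.symm, k.flip⟩
  · rintro u v S ⟨x, y, h, s, t, st, e1, e2, hr, rfl⟩
    have := ((D.arc h).subpath s t).map cx_cont
    rw [← e1, ← e2]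
    refine ⟨((D.arc h).subpath s t).map cx_cont, fun r => ?_⟩
    have : (D.arc h).subpath s t r ∈ D.arc h '' Icc s t := by
      rw [← Path.range_subpath_of_le _ _ _ st.le]; exact ⟨r, rfl⟩
    obtain ⟨r', hr', e⟩ := this
    exact ⟨r', hr', congrArg cx e⟩
  · rintro u v S ⟨x, y, h, s, t, st, e1, e2, hr, rfl⟩
    exact isCompact_Icc.image (gm_cont D h)
  · rintro u v S u' v' T ⟨x, y, h, k⟩ ⟨x', y', h', k'⟩ n1 n2 n3 n4
    by_cases hne : s(x, y) = s(x', y')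
    · rcases Sym2.eq_iff.1 hne with ⟨rfl, rfl⟩ | ⟨rfl, rfl⟩
      · exact k.same k' n1 n2 n3 n4
      · exact k.same k'.flip n2 n1 n4 n3
    · rw [Set.disjoint_left]
      intro z hz hz'
      have : z ∈ range (hpos D) := by
        obtain ⟨s, t, st, e1, e2, hr, rfl⟩ := k
        obtain ⟨s', t', st', e1', e2', hr', rfl⟩ := k'
        obtain ⟨r, -, rfl⟩ := hz
        obtain ⟨r', -, e⟩ := hz'
        exact common hne e.symm
      obtain ⟨w, rfl⟩ := this
      rcases k.pt hz with rfl | rfl <;> rcases k'.pt hz' with rfl | rfl <;> simp_all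
  · rintro u v S w ⟨x, y, h, k⟩ hw; exact k.pt hw
  · have : {S | ∃ u v, HE D u v S} ⊆ ⋃ i : (V ⊕ Cr D) × (V ⊕ Cr D) × V × V,
        {S | ∃ h : G.Adj i.2.2.1 i.2.2.2, Sg D h i.1 i.2.1 S} := by
      rintro S ⟨u, v, x, y, h, k⟩
      exact Set.mem_iUnion.2 ⟨(u, v, x, y), h, k⟩
    refine (Set.finite_iUnion fun i => Set.Subsingleton.finite ?_).subset this
    rintro S ⟨h, s, t, st, e1, e2, hr, rfl⟩ T ⟨h', s', t', st', e1', e2', hr', rfl⟩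
    obtain rfl := gm_inj D h (e1.trans e1'.symm)
    obtain rfl := gm_inj D h (e2.trans e2'.symm)
    rfl

end CN
end PartK6

open Set
noncomputable section PartK7
namespace CN
variable {V : Type} {G : SimpleGraph V} {D : Drawing G}
variable {u v x y a a' b b' : V}

variable (D) in
/-- the crossing point `c` lies on the edge `xy` -/
def On (x y : V) (c : Cr D) : Prop := ∃ (h : G.Adj x y) (s : unitInterval), gm D h s = c

variable {c e : Cr D}

lemma On.symm (h : On D x y c) : On D y x c := by
  obtain ⟨h, s, k⟩ := h
  exact ⟨h.symm, unitInterval.symm s, by rw [gm_symm]; simpa using k⟩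

lemma Cr_int (h : G.Adj x y) {s : unitInterval} (k : gm D h s = c) : 0 < s ∧ s < 1 := by
  constructor
  · refine lt_of_le_of_ne unitInterval.nonneg' fun e => ?_
    rw [← e, gm_zero] at k
    exact Cr_not_vertex D x (k ▸ c.2)
  · refine lt_of_le_of_ne unitInterval.le_one' fun e => ?_
    rw [e, gm_one] at k
    exact Cr_not_vertex D y (k ▸ c.2)

lemma Cr_data (c : Cr D) : ∃ a a' b b', On D a a' c ∧ On D b b' c ∧ s(a, a') ≠ s(b, b') := by
  obtain ⟨z, u, v, x, y, h₁, h₂, s, t, hne, e1, e2, -⟩ := c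
  exact ⟨u, v, x, y, ⟨h₁, s, e1⟩, ⟨h₂, t, e2⟩, hne⟩

lemma On.ne (h : On D a a' c) (k : On D b b' c) (n : s(a, a') ≠ s(b, b')) : a ≠ b := by
  rintro rfl
  obtain ⟨h, s, e⟩ := h
  obtain ⟨k, t, e'⟩ := k
  have := gm_once D h k n (e.trans e'.symm) ((gm_zero D h).trans (gm_zero D k).symm)
  rw [e, gm_zero] at this
  exact Cr_not_vertex D a (this ▸ c.2)

lemma On.once (h : On D a a' c) (k : On D b b' c) (h' : On D a a' e) (k' : On D b b' e)
    (n : s(a, a') ≠ s(b, b')) : c = e := by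
  obtain ⟨h, s, i⟩ := h
  obtain ⟨k, t, j⟩ := k
  obtain ⟨_, s', i'⟩ := h'
  obtain ⟨_, t', j'⟩ := k'
  have := gm_once D h k n (i.trans j.symm) (i'.trans j'.symm)
  exact Subtype.ext (i.symm.trans (this.trans i'))

lemma On.triple (h : On D a a' c) (k : On D b b' c) (l : On D x y c)
    (n : s(a, a') ≠ s(b, b')) : s(a, a') = s(x, y) ∨ s(b, b') = s(x, y) := by
  by_contra! hn
  obtain ⟨h, s, i⟩ := h
  obtain ⟨k, t, j⟩ := k
  obtain ⟨l, r, m⟩ := l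
  have h1 := Cr_int h i
  rcases gm_triple D h k l n hn.1 hn.2 (i.trans j.symm) (i.trans m.symm) with e | e
  · exact h1.1.ne' e
  · exact h1.2.ne e

lemma On.cases (h : On D a a' c) (e : s(a, a') = s(x, y)) : On D x y c := by
  rcases Sym2.eq_iff.1 e with ⟨rfl, rfl⟩ | ⟨rfl, rfl⟩
  exacts [h, h.symm]

lemma seg {h : G.Adj x y} {s t : unitInterval} (st : s < t) {u v : V ⊕ Cr D}
    (hu : gm D h s = hpos D u) (hv : gm D h t = hpos D v)
    (hr : ∀ r, s < r → r < t → ∀ e : Cr D, gm D h r ≠ e) : HE D u v (gm D h '' Icc s t) := by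
  refine ⟨x, y, h, s, t, st, hu, hv, fun r r1 r2 => ?_, rfl⟩
  rintro ⟨w | w, hw⟩
  · rcases gm_vertex D h (w := w) hw.symm with e | e
    · exact absurd (e ▸ r1) (not_lt.2 unitInterval.nonneg')
    · exact absurd (e ▸ r2) (not_lt.2 unitInterval.le_one')
  · exact hr r r1 r2 w hw.symm

lemma free (h : G.Adj x y) (hn : ∀ c, ¬ On D x y c) : ∃ S, HE D (.inl x) (.inl y) S :=
  ⟨_, seg (h := h) (s := 0) (t := 1) zero_lt_one (gm_zero D h) (gm_one D h)
    fun r _ _ e k => hn e ⟨h, r, k⟩⟩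

lemma half (h : G.Adj x y) {s : unitInterval} (k : gm D h s = c) (hn : ∀ e, On D x y e → e = c) :
    HE D (.inr c) (.inl x) (gm D h '' Icc 0 s) ∧ HE D (.inr c) (.inl y) (gm D h '' Icc s 1) := by
  have hs := Cr_int h k
  have key : ∀ (r : unitInterval) (e : Cr D), gm D h r = e → r = s := by
    intro r e i
    have := hn e ⟨h, r, i⟩
    subst this
    exact gm_inj D h (i.trans k.symm)
  constructor
  · obtain ⟨x', y', h', l⟩ := seg (h := h) (u := .inl x) (v := .inr c) hs.1 (gm_zero D h) k
      fun r _ r2 e i => r2.ne (key r e i)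
    exact ⟨_, _, _, l.flip⟩
  · exact seg hs.2 k (gm_one D h) fun r r1 _ e i => r1.ne' (key r e i)

lemma Drw_adj [Finite V] (hC : (Cr D).Finite) {u v : V ⊕ Cr D} (k : ∃ S, HE D u v S) :
    u ≠ v → (gr (HE D)).Adj u v := fun n => (HE.drw hC).adj.2 ⟨n, k⟩

/-- four half edges at a crossing point -/
lemma four (h1 : On D a a' c) (h2 : On D b b' c) (n : s(a, a') ≠ s(b, b'))
    (u1 : ∀ e, On D a a' e → e = c) (u2 : ∀ e, On D b b' e → e = c) :
    ∃ S : Fin 4 → Set ℂ,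
      (∀ i, HE D (.inr c) ((![.inl a, .inl b, .inl a', .inl b'] : Fin 4 → V ⊕ Cr D) i) (S i)) ∧
      ∀ i j, i ≠ j → ∀ z ∈ S i, z ∈ S j → z = c := by
  obtain ⟨h1, s, k1⟩ := h1
  obtain ⟨h2, t, k2⟩ := h2
  have H1 := half h1 k1 u1
  have H2 := half h2 k2 u2
  have A : ∀ {x y : V} (h : G.Adj x y) (s : unitInterval), gm D h s = c →
      ∀ z ∈ gm D h '' Icc 0 s, z ∈ gm D h '' Icc s 1 → z = c := by
    rintro x y h s k _ ⟨r, hr, rfl⟩ ⟨r', hr', e⟩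
    obtain rfl := gm_inj D h e
    rw [← k, le_antisymm hr.2 hr'.1]
  have B : ∀ (I J : Set unitInterval), ∀ z ∈ gm D h1 '' I, z ∈ gm D h2 '' J → z = c := by
    rintro I J _ ⟨r, hr, rfl⟩ ⟨r', hr', e⟩
    rw [← k1]
    exact gm_once D h1 h2 n e.symm (k1.trans k2.symm)
  refine ⟨![gm D h1 '' Icc 0 s, gm D h2 '' Icc 0 t, gm D h1 '' Icc s 1, gm D h2 '' Icc t 1],
    ?_, ?_⟩
  · intro i
    fin_cases i
    exacts [H1.1, H2.1, H1.2, H2.2]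
  · intro i j hij z hz hz'
    fin_cases i <;> fin_cases j <;> first
      | exact absurd rfl hij
      | exact A h1 s k1 z hz hz'
      | exact A h1 s k1 z hz' hz
      | exact A h2 t k2 z hz hz'
      | exact A h2 t k2 z hz' hz
      | exact B _ _ z hz hz'
      | exact B _ _ z hz' hz

/-- vertices to be coloured -/
def UU (D : Drawing G) [Fintype V] : Finset (V ⊕ Cr D) :=
  Finset.univ.map ⟨Sum.inl, Sum.inl_injective⟩

/-- lists of the host -/
def LL (D : Drawing G) (L : V → Finset ℕ) : V ⊕ Cr D → Finset ℕ := Sum.elim L fun _ => ∅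

lemma mem_UU [Fintype V] (v : V) : Sum.inl v ∈ UU D := by simp [UU]
lemma not_mem_UU [Fintype V] (c : Cr D) : Sum.inr c ∉ UU D := by simp [UU]

lemma LL5 [Fintype V] {L : V → Finset ℕ} (hL : ∀ v, 5 ≤ (L v).card) :
    ∀ u ∈ UU D, 5 ≤ (LL D L u).card := by
  rintro (u | u) hu
  · exact hL u
  · exact absurd hu (not_mem_UU u)

lemma done [Fintype V] {L : V → Finset ℕ} {K : V ⊕ Cr D → V ⊕ Cr D → Prop} {φ : V ⊕ Cr D → ℕ}
    (g : Goal K (UU D) ∅ φ (LL D L)) (hK : ∀ u v, G.Adj u v → K (.inl u) (.inl v)) :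
    ListColorable G L := by
  obtain ⟨f, -, f1, f2⟩ := g
  exact ⟨fun v => f (.inl v), fun v => f1 _ (mem_UU v) (by simp), fun u v h =>
    f2 _ (mem_UU u) _ (mem_UU v) (hK u v h) (by simp)⟩

/-- mates -/
lemma mt_of {W : Type} {a b a' b' : V} {i : V → W} (e : s(a, a') = s(x, y) ∨ s(b, b') = s(x, y)) :
    mt (i a) (i b) (i a') (i b') (i x) (i y) := by
  unfold mt
  rcases e with e | e <;> rcases Sym2.eq_iff.1 e with ⟨rfl, rfl⟩ | ⟨rfl, rfl⟩ <;> simp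

end CN
end PartK7

open Set
noncomputable section PartK8
namespace CN
variable {V : Type} {G : SimpleGraph V} {D : Drawing G}
variable {u v x y a a' b b' d d' c' : V}
variable {c e : Cr D}

lemma other (c : Cr D) (x y : V) : ∃ b b', On D b b' c ∧ s(x, y) ≠ s(b, b') := by
  obtain ⟨a, a', b, b', h, k, n⟩ := Cr_data c
  by_cases i : s(x, y) = s(a, a')
  · exact ⟨b, b', k, fun j => n (i.symm.trans j)⟩
  · exact ⟨a, a', h, i⟩

/-- the four endpoints -/
def nn (D : Drawing G) (a b a' b' : V) : Fin 4 → V ⊕ Cr D := ![.inl a, .inl b, .inl a', .inl b']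

lemma nn_inl (i : Fin 4) : ∃ v, nn D a b a' b' i = .inl v ∧ (v = a ∨ v = b ∨ v = a' ∨ v = b') := by
  fin_cases i
  exacts [⟨a, rfl, by simp⟩, ⟨b, rfl, by simp⟩, ⟨a', rfl, by simp⟩, ⟨b', rfl, by simp⟩]

lemma nn_ne (i : Fin 4) (c : Cr D) : nn D a b a' b' i ≠ .inr c := by
  obtain ⟨v, e, -⟩ := nn_inl (D := D) (a := a) (b := b) (a' := a') (b' := b') i
  rw [e]; simp

lemma six (h1 : On D a a' c) (h2 : On D b b' c) (n : s(a, a') ≠ s(b, b')) :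
    a ≠ a' ∧ a ≠ b ∧ a ≠ b' ∧ b ≠ b' ∧ a' ≠ b ∧ a' ≠ b' := by
  have e1 : s(a, a') = s(a', a) := Sym2.eq_swap
  have e2 : s(b, b') = s(b', b) := Sym2.eq_swap
  exact ⟨h1.1.ne, h1.ne h2 n, h1.ne h2.symm (e2 ▸ n), h2.1.ne, h1.symm.ne h2 (e1 ▸ n),
    h1.symm.ne h2.symm (e1 ▸ e2 ▸ n)⟩

lemma nn_inj (h1 : On D a a' c) (h2 : On D b b' c) (n : s(a, a') ≠ s(b, b')) :
    Function.Injective (nn D a b a' b') := by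
  obtain ⟨m1, m2, m3, m4, m5, m6⟩ := six h1 h2 n
  intro i j hij
  fin_cases i <;> fin_cases j <;> first
    | rfl
    | (exfalso
       have := Sum.inl_injective hij
       simp_all)

/-- the result of resolving -/
def St (E : V ⊕ Cr D → V ⊕ Cr D → Set ℂ → Prop) (p : V ⊕ Cr D) (n : Fin 4 → V ⊕ Cr D) : Prop :=
  ((∃ X, E (n 0) (n 2) X) ∧ (∃ X, E (n 1) (n 3) X) ∧ ∀ v X, ¬ E p v X) ∨
    Cross (gr E) p (n 0) (n 1) (n 2) (n 3)

lemma mt_adj {E : V ⊕ Cr D → V ⊕ Cr D → Set ℂ → Prop} {pos : V ⊕ Cr D → ℂ} (h : Drw E pos)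
    {p q r s u v : V ⊕ Cr D} (n1 : p ≠ r) (n2 : q ≠ s) (h1 : ∃ X, E p r X) (h2 : ∃ X, E q s X)
    (k : mt p q r s u v) : (gr E).Adj u v := by
  have A := h.adj.2 ⟨n1, h1⟩
  have B := h.adj.2 ⟨n2, h2⟩
  rcases k with ⟨rfl, rfl⟩ | ⟨rfl, rfl⟩ | ⟨rfl, rfl⟩ | ⟨rfl, rfl⟩
  exacts [A, A.symm, B, B.symm]

/-- plane -/
theorem zero [Fintype V] {L : V → Finset ℕ} (hL : ∀ v, 5 ≤ (L v).card) (hC : Cr D = ∅) :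
    ListColorable G L := by
  have hf : (Cr D).Finite := by rw [hC]; exact Set.finite_empty
  have g : Goal (gr (HE D)).Adj (UU D) ∅ (fun _ => 0) (LL D L) :=
    R2 (HE.drw hf).planar (UU D) ∅ _ _ (by simp) (by simp) (by simp) (fun u hu _ => LL5 hL u hu)
  refine done g fun u v h => Drw_adj hf (free h ?_) (by simpa using h.ne)
  rintro ⟨c, hc⟩
  rw [hC] at hc
  exact absurd hc (Set.notMem_empty _)

/-- one crossing -/
theorem one [Fintype V] {L : V → Finset ℕ} (hL : ∀ v, 5 ≤ (L v).card) (c : Cr D)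
    (hC : ∀ e : Cr D, e = c) : ListColorable G L := by
  have : Finite (Cr D) := by
    have : Subsingleton (Cr D) := ⟨fun x y => (hC x).trans (hC y).symm⟩
    infer_instance
  have hf : (Cr D).Finite := Set.toFinite _
  obtain ⟨a, a', b, b', h1, h2, n⟩ := Cr_data c
  obtain ⟨S, ES, hS⟩ := four h1 h2 n (fun e _ => hC e) (fun e _ => hC e)
  obtain ⟨E, pos, R⟩ := (HE.drw hf).resolve (p := .inr c) (n := nn D a b a' b') (nn_inj h1 h2 n)
    (fun i => nn_ne i c) ES hS
  have fr : ∀ u v, G.Adj u v → ¬ On D u v c → (gr E).Adj (.inl u) (.inl v) := by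
    intro u v h hn
    obtain ⟨X, k⟩ := free h (fun e => hC e ▸ hn)
    exact R.h.adj.2 ⟨by simpa using h.ne, X, R.keep _ _ _ (by simp) (by simp) k⟩
  have six := six h1 h2 n
  rcases R.res with ⟨r1, r2, r3⟩ | r
  · have g : Goal (gr E).Adj (UU D) ∅ (fun _ => 0) (LL D L) :=
      R2 R.h.planar (UU D) ∅ _ _ (by simp) (by simp) (by simp) (fun u hu _ => LL5 hL u hu)
    refine done g fun u v h => ?_
    by_cases k : On D u v c
    · exact mt_adj R.h (by simpa [nn] using six.1) (by simpa [nn] using six.2.2.2.1) r1 r2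
        (mt_of (i := Sum.inl) (h1.triple h2 k n))
    · exact fr u v h k
  · have T : T1H (gr E) (UU D) (LL D L) ∅ (.inr c) (.inl a) (.inl b) (.inl a') (.inl b') :=
      ⟨R.h.planar, r, not_mem_UU c, by
        rintro u (v | v) -
        · exact Or.inl (mem_UU v)
        · exact Or.inr (by rw [hC v]), by simp, by simp, by simp, fun u hu _ => LL5 hL u hu⟩
    refine done (T.goal (φ := fun _ => 0)) fun u v h => ?_
    by_cases k : On D u v c
    · exact Or.inr (mt_of (i := Sum.inl) (h1.triple h2 k n))
    · exact Or.inl (fr u v h k)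

section two
variable [Fintype V] {L : V → Finset ℕ}

/-- shared vertex, all four edges different or one common edge -/
theorem shared_aux (hL : ∀ v, 5 ≤ (L v).card) (hne : c ≠ e)
    (hC : ∀ f : Cr D, f = c ∨ f = e)
    (hf : (Cr D).Finite)
    (p1 : On D a a' c) (p2 : On D b b' c) (q1 : On D a c' e) (q2 : On D d d' e)
    (np : s(a, a') ≠ s(b, b')) (nq : s(a, c') ≠ s(d, d'))
    (ub : ¬ On D b b' e) (ud : ¬ On D d d' c)
    (k : (a' ≠ c' ∧ ¬ On D a a' e ∧ ¬ On D a c' c) ∨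
      (a' = c' ∧ (gr (HE D)).Adj (.inl a) (.inr c) ∧ (gr (HE D)).Adj (.inr c) (.inr e) ∧
        (gr (HE D)).Adj (.inl a') (.inr e))) : ListColorable G L := by
  obtain ⟨m1, m2, m3, m4, m5, m6⟩ := six p1 p2 np
  obtain ⟨o1, o2, o3, o4, o5, o6⟩ := six q1 q2 nq
  have hfc : ∀ {x y : V}, On D x y c → ¬ On D x y e →
      (gr (HE D)).Adj (.inr c) (.inl x) ∧ (gr (HE D)).Adj (.inr c) (.inl y) := by
    rintro x y ⟨h, s, i⟩ hn
    have := half h i fun f hf => (hC f).resolve_right (by rintro rfl; exact hn hf)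
    exact ⟨Drw_adj hf ⟨_, this.1⟩ (by simp), Drw_adj hf ⟨_, this.2⟩ (by simp)⟩
  have hfe : ∀ {x y : V}, On D x y e → ¬ On D x y c →
      (gr (HE D)).Adj (.inr e) (.inl x) ∧ (gr (HE D)).Adj (.inr e) (.inl y) := by
    rintro x y ⟨h, s, i⟩ hn
    have := half h i fun f hf => (hC f).resolve_left (by rintro rfl; exact hn hf)
    exact ⟨Drw_adj hf ⟨_, this.1⟩ (by simp), Drw_adj hf ⟨_, this.2⟩ (by simp)⟩
  have hnA : (gr (HE D)).Adj (.inl a) (.inr c) := by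
    rcases k with ⟨_, k, _⟩ | ⟨_, k, _⟩
    · exact (hfc p1 k).1.symm
    · exact k
  have hQ : ∃ Q : Set (V ⊕ Cr D), Q ⊆ {.inr c, .inr e} ∧ .inr e ∈ Q ∧ Conn (gr (HE D)) Q ∧
      Nb (gr (HE D)) Q (.inl a) := by
    rcases k with ⟨_, _, k⟩ | ⟨_, k1, k2, _⟩
    · exact ⟨{.inr e}, by simp, rfl, Conn.singleton _, _, rfl, (hfe q1 k).1.symm⟩
    · exact ⟨_, subset_rfl, by simp, (Conn.singleton _).insert ⟨_, rfl, k2⟩, _, by simp, k1⟩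
  have T : SH (gr (HE D)) (UU D) (LL D L) (.inr c) (.inr e) (.inl a) (.inl b) (.inl a') (.inl b')
      (.inl d) (.inl c') (.inl d') :=
    { hP := (HE.drw hf).planar
      pq := by simpa using hne
      pU := not_mem_UU c
      qU := not_mem_UU e
      aU := mem_UU _
      bU := mem_UU _
      b'U := mem_UU _
      dU := mem_UU _
      d'U := mem_UU _
      L5 := LL5 hL
      pb := (hfc p2 ub).1
      pb' := (hfc p2 ub).2
      qd := (hfe q2 ud).1
      qd' := (hfe q2 ud).2
      na := ⟨_, by simp, hnA⟩
      na' := by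
        rcases k with ⟨_, k, _⟩ | ⟨_, _, _, k⟩
        · exact ⟨.inr c, by simp, (hfc p1 k).2.symm⟩
        · exact ⟨.inr e, by simp, k⟩
      nc' := by
        rcases k with ⟨_, _, k⟩ | ⟨rfl, _, _, k⟩
        · exact ⟨.inr e, by simp, (hfe q1 k).2.symm⟩
        · exact ⟨.inr e, by simp, k⟩
      cn := by
        rcases k with ⟨_, _, k⟩ | ⟨_, k1, k2, _⟩
        · have := ((Conn.singleton (H := gr (HE D)) (Sum.inr e)).insert
            ⟨_, rfl, (hfe q1 k).1.symm⟩).insert ⟨_, by simp, hnA.symm⟩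
          rwa [Set.insert_comm] at this
        · exact ((Conn.singleton _).insert ⟨_, rfl, k2⟩).insert ⟨_, by simp, k1⟩
      k3 := by
        rcases k with ⟨_, k, _⟩ | ⟨rfl, _, _, k⟩
        · exact fun _ => hfc p1 k
        · simp
      hQ := hQ
      n1 := by simpa using m1
      n2 := by simpa using m2
      n3 := by simpa using m3
      n4 := by simpa using o1
      n5 := by simpa using o2
      n6 := by simpa using o3
      n7 := by simpa using m4
      n8 := by simpa using o4
      n9 := by simpa using m5
      n10 := by simpa using m6
      n11 := by simpa using o5
      n12 := by simpa using o6 }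
  refine done T.goal fun u v h => ?_
  by_cases k1 : On D u v c
  · exact Or.inr (Or.inl (mt_of (i := Sum.inl) (p1.triple p2 k1 np)))
  by_cases k2 : On D u v e
  · exact Or.inr (Or.inr (mt_of (i := Sum.inl) (q1.triple q2 k2 nq)))
  refine Or.inl (Drw_adj hf (free h ?_) (by simpa using h.ne))
  intro f
  rcases hC f with rfl | rfl <;> assumption

/-- an edge with two crossings -/
theorem common_edge (hL : ∀ v, 5 ≤ (L v).card) (hne : c ≠ e)
    (hC : ∀ f : Cr D, f = c ∨ f = e)
    (hf : (Cr D).Finite) (h : G.Adj x y) {s t : unitInterval} (st : s < t)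
    (hs : gm D h s = c) (ht : gm D h t = e) : ListColorable G L := by
  obtain ⟨b, b', p2, np⟩ := other c x y
  obtain ⟨d, d', q2, nq⟩ := other e x y
  have p1 : On D x y c := ⟨h, s, hs⟩
  have q1 : On D x y e := ⟨h, t, ht⟩
  have key : ∀ (r : unitInterval) (f : Cr D), gm D h r = f → r = s ∨ r = t := by
    intro r f i
    rcases hC f with rfl | rfl
    · exact Or.inl (gm_inj D h (i.trans hs.symm))
    · exact Or.inr (gm_inj D h (i.trans ht.symm))
  have s0 := Cr_int h hs
  have t0 := Cr_int h ht
  refine shared_aux hL hne hC hf p1 p2 q1 q2 np nq (fun k => hne (p1.once p2 q1 k np))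
    (fun k => hne (p1.once k q1 q2 nq)) (Or.inr ⟨rfl, ?_, ?_, ?_⟩)
  · refine Drw_adj hf ⟨_, seg (h := h) s0.1 (gm_zero D h) hs fun r _ r2 f i => ?_⟩ (by simp)
    rcases key r f i with rfl | rfl
    · exact lt_irrefl _ r2
    · exact lt_irrefl _ (r2.trans st)
  · refine Drw_adj hf ⟨_, seg (h := h) st hs ht fun r r1 r2 f i => ?_⟩ (by simpa using hne)
    rcases key r f i with rfl | rfl
    · exact lt_irrefl _ r1
    · exact lt_irrefl _ r2
  · refine (Drw_adj hf ⟨_, seg (h := h) (u := .inr e) (v := .inl y) t0.2 ht (gm_one D h) fun r r1 _ f i => ?_⟩ (by simp)).symm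
    rcases key r f i with rfl | rfl
    · exact lt_irrefl _ (r1.trans st)
    · exact lt_irrefl _ r1

/-- the two crossings have disjoint ends -/
theorem apart (hL : ∀ v, 5 ≤ (L v).card) (hne : c ≠ e)
    (hC : ∀ f : Cr D, f = c ∨ f = e)
    (hf : (Cr D).Finite)
    (p1 : On D a a' c) (p2 : On D b b' c) (q1 : On D x y e) (q2 : On D d d' e)
    (np : s(a, a') ≠ s(b, b')) (nq : s(x, y) ≠ s(d, d'))
    (hn : ∀ x y, On D x y c → ¬ On D x y e)
    (hv : ∀ i j, nn D a b a' b' i ≠ nn D x d y d' j) : ListColorable G L := by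
  have := hf.to_subtype
  have hne' : (Sum.inr c : V ⊕ Cr D) ≠ .inr e := by simpa using hne
  have U1 : ∀ {x y}, On D x y c → ∀ f, On D x y f → f = c := fun k f k' =>
    (hC f).resolve_right (by rintro rfl; exact hn _ _ k k')
  have U2 : ∀ {x y}, On D x y e → ∀ f, On D x y f → f = e := fun k f k' =>
    (hC f).resolve_left (by rintro rfl; exact hn _ _ k' k)
  obtain ⟨S, ES, hS⟩ := four p1 p2 np (U1 p1) (U1 p2)
  obtain ⟨S', ES', hS'⟩ := four q1 q2 nq (U2 q1) (U2 q2)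
  obtain ⟨E1, pos1, R1⟩ := (HE.drw hf).resolve (p := .inr c) (n := nn D a b a' b')
    (nn_inj p1 p2 np) (fun i => nn_ne i c) ES hS
  obtain ⟨E, pos, R⟩ := R1.h.resolve (p := .inr e) (n := nn D x d y d')
    (nn_inj q1 q2 nq) (fun i => nn_ne i e)
    (fun i => R1.keep _ _ _ hne'.symm (nn_ne i c) (ES' i))
    (by rw [R1.hpos _ hne'.symm]; exact hS')
  have old : ∀ v X, E (.inr c) v X → E1 (.inr c) v X := by
    intro v X k
    rcases R.new _ _ _ k with k | ⟨k, -⟩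
    · exact k.1
    · rcases k with k | ⟨i, k⟩
      · exact absurd k hne'
      · exact absurd k.symm (nn_ne i c)
  have kp : ∀ {u v}, u ≠ .inr e → v ≠ .inr e → (gr E1).Adj u v → (gr E).Adj u v := by
    intro u v hu hv k
    obtain ⟨k1, X, k2⟩ := R1.h.adj.1 k
    exact R.h.adj.2 ⟨k1, X, R.keep _ _ _ hu hv k2⟩
  have ST1 : St E (.inr c) (nn D a b a' b') := by
    rcases R1.res with ⟨⟨X, r1⟩, ⟨Y, r2⟩, r3⟩ | r
    · exact Or.inl ⟨⟨X, R.keep _ _ _ (nn_ne _ _) (nn_ne _ _) r1⟩, ⟨Y, R.keep _ _ _ (nn_ne _ _) (nn_ne _ _) r2⟩,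
        fun v X k => r3 v X (old v X k)⟩
    · refine Or.inr { r with
        nq := fun v => ?_
        r1 := kp (nn_ne _ _) (nn_ne _ _) r.r1
        r2 := kp (nn_ne _ _) (nn_ne _ _) r.r2
        r3 := kp (nn_ne _ _) (nn_ne _ _) r.r3
        r4 := kp (nn_ne _ _) (nn_ne _ _) r.r4 }
      rw [← r.nq]
      constructor
      · intro k
        obtain ⟨k1, X, k2⟩ := R.h.adj.1 k
        exact R1.h.adj.2 ⟨k1, X, old v X k2⟩
      · intro k
        refine kp hne' ?_ k
        rintro rfl
        rcases (r.nq _).1 k with k | k | k | k <;> exact nn_ne _ _ k.symm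
  have ST2 : St E (.inr e) (nn D x d y d') := R.res
  have fr : ∀ u v, G.Adj u v → ¬ On D u v c → ¬ On D u v e → (gr E).Adj (.inl u) (.inl v) := by
    intro u v h h1 h2
    obtain ⟨X, k⟩ := free h (fun f => by rcases hC f with rfl | rfl <;> assumption)
    exact R.h.adj.2 ⟨by simpa using h.ne, X,
      R.keep _ _ _ (by simp) (by simp) (R1.keep _ _ _ (by simp) (by simp) k)⟩
  have P6 := six p1 p2 np
  have Q6 := six q1 q2 nq
  have M1 : ∀ u v, On D u v c → mt (W := V ⊕ Cr D) (.inl a) (.inl b) (.inl a') (.inl b')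
    (.inl u) (.inl v) := fun u v k => mt_of (i := Sum.inl) (p1.triple p2 k np)
  have M2 : ∀ u v, On D u v e → mt (W := V ⊕ Cr D) (.inl x) (.inl d) (.inl y) (.inl d')
    (.inl u) (.inl v) := fun u v k => mt_of (i := Sum.inl) (q1.triple q2 k nq)
  have L5 := LL5 (D := D) hL
  have hin : ∀ u v, (gr E).Adj u v → v ∈ UU D ∨ v = .inr c ∨ v = .inr e := by
    rintro u (v | v) -
    · exact Or.inl (mem_UU v)
    · rcases hC v with rfl | rfl <;> simp
  have iso : ∀ p, (∀ v X, ¬ E p v X) → ∀ u, ¬ (gr E).Adj u p := by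
    intro p hp u k
    obtain ⟨-, X, k⟩ := R.h.adj.1 k.symm
    exact hp _ _ k
  rcases ST1 with ⟨r1, r2, r3⟩ | r <;> rcases ST2 with ⟨t1, t2, t3⟩ | t
  · have g : Goal (gr E).Adj (UU D) ∅ (fun _ => 0) (LL D L) :=
      R2 R.h.planar (UU D) ∅ _ _ (by simp) (by simp) (by simp) (fun u hu _ => L5 u hu)
    refine done g fun u v h => ?_
    by_cases k : On D u v c
    · exact mt_adj R.h (by simpa [nn] using P6.1) (by simpa [nn] using P6.2.2.2.1) r1 r2 (M1 u v k)
    by_cases k' : On D u v e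
    · exact mt_adj R.h (by simpa [nn] using Q6.1) (by simpa [nn] using Q6.2.2.2.1) t1 t2
        (M2 u v k')
    exact fr u v h k k'
  · have T : T1H (gr E) (UU D) (LL D L) ∅ (.inr e) (.inl x) (.inl d) (.inl y) (.inl d') :=
      ⟨R.h.planar, t, not_mem_UU e, fun u v k => (hin u v k).imp_right fun j =>
        j.resolve_left (by rintro rfl; exact iso _ r3 _ k), by simp, by simp, by simp,
        fun u hu _ => L5 u hu⟩
    refine done (T.goal (φ := fun _ => 0)) fun u v h => ?_
    by_cases k : On D u v c
    · exact Or.inl (mt_adj R.h (by simpa [nn] using P6.1) (by simpa [nn] using P6.2.2.2.1) r1 r2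
        (M1 u v k))
    by_cases k' : On D u v e
    · exact Or.inr (M2 u v k')
    exact Or.inl (fr u v h k k')
  · have T : T1H (gr E) (UU D) (LL D L) ∅ (.inr c) (.inl a) (.inl b) (.inl a') (.inl b') :=
      ⟨R.h.planar, r, not_mem_UU c, fun u v k => (hin u v k).imp_right fun j =>
        j.resolve_right (by rintro rfl; exact iso _ t3 _ k), by simp, by simp, by simp,
        fun u hu _ => L5 u hu⟩
    refine done (T.goal (φ := fun _ => 0)) fun u v h => ?_
    by_cases k : On D u v c
    · exact Or.inr (M1 u v k)
    by_cases k' : On D u v e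
    · exact Or.inl (mt_adj R.h (by simpa [nn] using Q6.1) (by simpa [nn] using Q6.2.2.2.1) t1 t2
        (M2 u v k'))
    exact Or.inl (fr u v h k k')
  · have T : MH (gr E) (UU D) (LL D L) (.inr c) (.inl a) (.inl b) (.inl a') (.inl b')
        (.inr e) (.inl x) (.inl d) (.inl y) (.inl d') :=
      { hP := R.h.planar
        crp := r
        crq := t
        pU := not_mem_UU c
        qU := not_mem_UU e
        hin := hin
        dj := by
          intro v k1 k2
          rcases (r.nq v).1 k1 with i | i | i | i <;> rcases (t.nq v).1 k2 with j | j | j | j <;>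
            exact hv _ _ (i.symm.trans j)
        npq := by
          intro k
          rcases (r.nq _).1 k with i | i | i | i <;> exact nn_ne _ _ i.symm
        L5 := L5 }
    refine done T.goal fun u v h => ?_
    by_cases k : On D u v c
    · exact Or.inr (Or.inl (M1 u v k))
    by_cases k' : On D u v e
    · exact Or.inr (Or.inr (M2 u v k'))
    exact Or.inl (fr u v h k k')

theorem two (hL : ∀ v, 5 ≤ (L v).card) (hne : c ≠ e)
    (hC : ∀ f : Cr D, f = c ∨ f = e) : ListColorable G L := by
  have hf : (Cr D).Finite := by
    refine (Set.toFinite {(c : ℂ), (e : ℂ)}).subset fun z hz => ?_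
    rcases hC ⟨z, hz⟩ with h | h
    · exact Or.inl (congrArg Subtype.val h)
    · exact Or.inr (congrArg Subtype.val h)
  by_cases hn : ∀ x y, On D x y c → ¬ On D x y e
  swap
  · push Not at hn
    obtain ⟨x, y, ⟨h, s, hs⟩, ⟨_, t, ht⟩⟩ := hn
    rcases lt_trichotomy s t with l | rfl | l
    · exact common_edge hL hne hC hf h l hs ht
    · exact absurd (Subtype.ext (hs.symm.trans ht)) hne
    · exact common_edge hL hne.symm (fun f => (hC f).symm) hf h l ht hs
  by_cases hs : ∃ a a' c', On D a a' c ∧ On D a c' e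
  · obtain ⟨a, a', c', p1, q1⟩ := hs
    obtain ⟨b, b', p2, np⟩ := other c a a'
    obtain ⟨d, d', q2, nq⟩ := other e a c'
    exact shared_aux hL hne hC hf p1 p2 q1 q2 np nq (hn _ _ p2) (fun k => hn _ _ k q2)
      (Or.inl ⟨by rintro rfl; exact hn _ _ p1 q1, hn _ _ p1, fun k => hn _ _ k q1⟩)
  · push Not at hs
    obtain ⟨a, a', b, b', p1, p2, np⟩ := Cr_data c
    obtain ⟨x, y, d, d', q1, q2, nq⟩ := Cr_data e
    refine apart hL hne hC hf p1 p2 q1 q2 np nq hn ?_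
    intro i j hij
    have A : ∃ v w, nn D a b a' b' i = .inl v ∧ On D v w c := by
      fin_cases i
      exacts [⟨_, _, rfl, p1⟩, ⟨_, _, rfl, p2⟩, ⟨_, _, rfl, p1.symm⟩, ⟨_, _, rfl, p2.symm⟩]
    have B : ∃ v w, nn D x d y d' j = .inl v ∧ On D v w e := by
      fin_cases j
      exacts [⟨_, _, rfl, q1⟩, ⟨_, _, rfl, q2⟩, ⟨_, _, rfl, q1.symm⟩, ⟨_, _, rfl, q2.symm⟩]
    obtain ⟨v, w, e1, A⟩ := A
    obtain ⟨v', w', e2, B⟩ := B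
    rw [e1, e2] at hij
    obtain rfl := Sum.inl_injective hij
    exact hs _ _ _ A B

end two

theorem final [Fintype V] {L : V → Finset ℕ} (hL : ∀ v, 5 ≤ (L v).card) {p q : ℝ × ℝ}
    (h : ∀ r, D.IsCrossing r → r = p ∨ r = q) : ListColorable G L := by
  by_cases h0 : Cr D = ∅
  · exact zero hL h0
  obtain ⟨z, hz⟩ := Set.nonempty_iff_ne_empty.2 h0
  by_cases h1 : ∀ f : Cr D, f = ⟨z, hz⟩
  · exact one hL _ h1
  push Not at h1
  obtain ⟨e, he⟩ := h1
  refine two hL (c := ⟨z, hz⟩) (e := e) he.symm fun f => ?_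
  have he' : (e : ℂ) ≠ z := fun k => he (Subtype.ext k)
  rw [Subtype.ext_iff, Subtype.ext_iff]
  rcases Cr_sub D h hz with a | a <;> rcases Cr_sub D h e.2 with b | b <;>
    rcases Cr_sub D h f.2 with d | d <;> simp_all

end CN
end PartK8

/-- Every graph whose crossing number is at most two is 5-choosable.  (Crossing number
at most two: `G` admits a drawing in the plane with at most two crossing points.) -/
theorem crossing_number_le_two_5_choosable
    {V : Type} [Fintype V] (G : SimpleGraph V)
    (hcr : ∃ (D : Drawing G) (p q : ℝ × ℝ), ∀ r : ℝ × ℝ, D.IsCrossing r → r = p ∨ r = q)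
    (L : V → Finset ℕ) (hL : ∀ v : V, 5 ≤ (L v).card) :
    ListColorable G L := by
  obtain ⟨D, p, q, h⟩ := hcr
  exact CN.final hL h
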